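/- Let n ≥ 1, let Ω ⊂ ℝ^n be open, and let f ∈ L^1_loc(Ω). Then there exists a family {f_ε}_{ε>0} with f_ε − f ∈ L^∞_loc(Ω), f_ε − f → 0 in L^∞_loc(Ω) as ε → 0, and limsup_{ε→0} κ_ε(f_ε, Ω) ≤ (1/4)·|D^a f|(Ω) + (1/4)·|D^c f|(Ω) + (1/2)·|D^j f|(Ω). -/

import Mathlib

open MeasureTheory Filter Topology Metric
open scoped ENNReal RealInnerProductSpace Classical

noncomputable section

/-- An open cube in `ℝⁿ` with side length `ε` and arbitrary orientation. -/
def IsCube (n : ℕ) (ε : ℝ) (Q : Set (EuclideanSpace ℝ (Fin n))) : Prop :=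
  ∃ (T : EuclideanSpace ℝ (Fin n) ≃ₗᵢ[ℝ] EuclideanSpace ℝ (Fin n))
    (x : EuclideanSpace ℝ (Fin n)),
    Q = (fun y => x + T y) '' {y : EuclideanSpace ℝ (Fin n) | ∀ i, |y i| < ε / 2}

/-- The BMO-type functional `κ_ε(f, Ω)`. -/
def kappa (n : ℕ) (ε : ℝ) (f : EuclideanSpace ℝ (Fin n) → ℝ)
    (Ω : Set (EuclideanSpace ℝ (Fin n))) : ℝ≥0∞ :=
  ENNReal.ofReal (ε ^ (n - 1)) *
    ⨆ (F : Set (Set (EuclideanSpace ℝ (Fin n))))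
      (_ : ∀ Q ∈ F, IsCube n ε Q ∧ Q ⊆ Ω) (_ : F.Pairwise Disjoint),
      ∑' Q : F, ENNReal.ofReal
        (⨍ x in (Q : Set (EuclideanSpace ℝ (Fin n))),
          |f x - ⨍ y in (Q : Set (EuclideanSpace ℝ (Fin n))), f y ∂volume| ∂volume)

/-- The divergence of a vector field on `ℝⁿ`. -/
def vdiv (n : ℕ) (Φ : EuclideanSpace ℝ (Fin n) → EuclideanSpace ℝ (Fin n))
    (x : EuclideanSpace ℝ (Fin n)) : ℝ :=
  ∑ i : Fin n, fderiv ℝ Φ x (EuclideanSpace.single i 1) i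

/-- The variation `Var(f, Ω)`. -/
def variation (n : ℕ) (f : EuclideanSpace ℝ (Fin n) → ℝ)
    (Ω : Set (EuclideanSpace ℝ (Fin n))) : ℝ≥0∞ :=
  ⨆ (Φ : EuclideanSpace ℝ (Fin n) → EuclideanSpace ℝ (Fin n))
    (_ : ContDiff ℝ 1 Φ) (_ : HasCompactSupport Φ) (_ : tsupport Φ ⊆ Ω)
    (_ : ∀ x, ‖Φ x‖ ≤ 1),
    ENNReal.ofReal (∫ x in Ω, f x * vdiv n Φ x)

/-- The approximate jump set `J_f`. -/
def jumpSet (n : ℕ) (f : EuclideanSpace ℝ (Fin n) → ℝ) : Set (EuclideanSpace ℝ (Fin n)) :=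
  {x | ∃ ν : EuclideanSpace ℝ (Fin n), ‖ν‖ = 1 ∧ ∃ a b : ℝ, a ≠ b ∧
    Tendsto (fun r : ℝ =>
        ⨍ y in {y ∈ ball x r | 0 < ⟪y - x, ν⟫}, |f y - a| ∂volume)
      (𝓝[>] 0) (𝓝 0) ∧
    Tendsto (fun r : ℝ =>
        ⨍ y in {y ∈ ball x r | ⟪y - x, ν⟫ < 0}, |f y - b| ∂volume)
      (𝓝[>] 0) (𝓝 0)}

/-- The approximate discontinuity set `S_f` (the set of non-Lebesgue points). -/
def approxDiscontSet (n : ℕ) (f : EuclideanSpace ℝ (Fin n) → ℝ) :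
    Set (EuclideanSpace ℝ (Fin n)) :=
  {x | ¬ ∃ c : ℝ,
    Tendsto (fun r : ℝ => ⨍ y in ball x r, |f y - c| ∂volume) (𝓝[>] 0) (𝓝 0)}

/-- `(μ, σ)` is the polar decomposition `Df = σ |Df|` of the gradient measure of `f` on `Ω`:
`μ` plays the role of the total variation measure `|Df|` and `σ` of the polar vector field. -/
def IsVariationPair (n : ℕ) (f : EuclideanSpace ℝ (Fin n) → ℝ)
    (Ω : Set (EuclideanSpace ℝ (Fin n))) (μ : Measure (EuclideanSpace ℝ (Fin n)))
    (σ : EuclideanSpace ℝ (Fin n) → EuclideanSpace ℝ (Fin n)) : Prop :=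
  IsFiniteMeasure μ ∧ μ Ωᶜ = 0 ∧ AEStronglyMeasurable σ μ ∧ (∀ᵐ x ∂μ, ‖σ x‖ = 1) ∧
  ∀ Φ : EuclideanSpace ℝ (Fin n) → EuclideanSpace ℝ (Fin n),
    ContDiff ℝ 1 Φ → HasCompactSupport Φ → tsupport Φ ⊆ Ω →
    ∫ x in Ω, f x * vdiv n Φ x = - ∫ x, ⟪Φ x, σ x⟫ ∂μ

/-- `|D^a f|(Ω)`, the total variation of the absolutely continuous part of `Df`,
with the convention that it is `∞` if `f` is not of bounded variation in `Ω`. -/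
def absVar (n : ℕ) (f : EuclideanSpace ℝ (Fin n) → ℝ)
    (Ω : Set (EuclideanSpace ℝ (Fin n))) : ℝ≥0∞ :=
  if h : ∃ p : Measure (EuclideanSpace ℝ (Fin n)) ×
      (EuclideanSpace ℝ (Fin n) → EuclideanSpace ℝ (Fin n)),
      IsVariationPair n f Ω p.1 p.2 then
    volume.withDensity ((h.choose.1).rnDeriv volume) Ω
  else ⊤

/-- `|D^c f|(Ω)`, the total variation of the Cantor part of `Df`,
with the convention that it is `∞` if `f` is not of bounded variation in `Ω`. -/
def cantorVar (n : ℕ) (f : EuclideanSpace ℝ (Fin n) → ℝ)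
    (Ω : Set (EuclideanSpace ℝ (Fin n))) : ℝ≥0∞ :=
  if h : ∃ p : Measure (EuclideanSpace ℝ (Fin n)) ×
      (EuclideanSpace ℝ (Fin n) → EuclideanSpace ℝ (Fin n)),
      IsVariationPair n f Ω p.1 p.2 then
    (h.choose.1.singularPart volume) (Ω \ approxDiscontSet n f)
  else ⊤

/-- `|D^j f|(Ω)`, the total variation of the jump part of `Df`,
with the convention that it is `∞` if `f` is not of bounded variation in `Ω`. -/
def jumpVar (n : ℕ) (f : EuclideanSpace ℝ (Fin n) → ℝ)
    (Ω : Set (EuclideanSpace ℝ (Fin n))) : ℝ≥0∞ :=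
  if h : ∃ p : Measure (EuclideanSpace ℝ (Fin n)) ×
      (EuclideanSpace ℝ (Fin n) → EuclideanSpace ℝ (Fin n)),
      IsVariationPair n f Ω p.1 p.2 then
    (h.choose.1.singularPart volume) (jumpSet n f ∩ Ω)
  else ⊤

/-- `g` is the weak (distributional) gradient of `u` on `Ω`. -/
def HasWeakGradientOn (n : ℕ) (u : EuclideanSpace ℝ (Fin n) → ℝ)
    (g : EuclideanSpace ℝ (Fin n) → EuclideanSpace ℝ (Fin n))
    (Ω : Set (EuclideanSpace ℝ (Fin n))) : Prop :=
  ∀ φ : EuclideanSpace ℝ (Fin n) → ℝ,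
    ContDiff ℝ 1 φ → HasCompactSupport φ → tsupport φ ⊆ Ω →
    ∀ k : Fin n,
      ∫ x in Ω, u x * fderiv ℝ φ x (EuclideanSpace.single k 1) =
        - ∫ x in Ω, φ x * g x k

/-- `f ∈ BV(Ω)`: `f` is integrable on `Ω` and has finite variation in `Ω`. -/
def IsBVOn (n : ℕ) (f : EuclideanSpace ℝ (Fin n) → ℝ)
    (Ω : Set (EuclideanSpace ℝ (Fin n))) : Prop :=
  IntegrableOn f Ω volume ∧ variation n f Ω < ⊤

/-- `f ∈ SBV(Ω)`: `f ∈ BV(Ω)` and the Cantor part of `Df` vanishes. -/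
def IsSBVOn (n : ℕ) (f : EuclideanSpace ℝ (Fin n) → ℝ)
    (Ω : Set (EuclideanSpace ℝ (Fin n))) : Prop :=
  IsBVOn n f Ω ∧ cantorVar n f Ω = 0

section

/-- The calibration `cos α` used in the one-dimensional isoperimetric inequality on `[w₀, w₁]`. -/
def calib (a b w : ℝ) : ℝ := (1 + a * b - (a + b) * w) / (1 - w ^ 2)

theorem calib_one_sub {a b w : ℝ} (hw : w ∈ Set.Ioo (-1 : ℝ) 1) :
    (1 - w ^ 2) * (1 - calib a b w) = (w - a) * (b - w) := by
  have : (1 - w ^ 2) ≠ 0 := by nlinarith [hw.1, hw.2]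
  unfold calib
  field_simp
  ring

theorem calib_le_one {a b w : ℝ} (hw : w ∈ Set.Ioo (-1 : ℝ) 1) (h : w ∈ Set.Icc a b) :
    calib a b w ≤ 1 := by
  have h1 := calib_one_sub (a := a) (b := b) hw
  have : 0 < (1 - w ^ 2) := by nlinarith [hw.1, hw.2]
  have h2 : 0 ≤ (w - a) * (b - w) := mul_nonneg (by linarith [h.1]) (by linarith [h.2])
  nlinarith

theorem calib_nonneg {a b w : ℝ} (ha : a ∈ Set.Ioo (-1 : ℝ) 1) (hb : b ∈ Set.Ioo (-1 : ℝ) 1)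
    (hw : w ∈ Set.Ioo (-1 : ℝ) 1) (h : w ∈ Set.Icc a b) : 0 ≤ calib a b w := by
  unfold calib
  have h0 : 0 < (1 - w ^ 2) := by nlinarith [hw.1, hw.2]
  apply div_nonneg _ h0.le
  obtain ⟨ha1, ha2⟩ := ha
  obtain ⟨hb1, hb2⟩ := hb
  obtain ⟨h1, h2⟩ := h
  rcases le_total 0 (a + b) with hs | hs
  · nlinarith [mul_nonneg hs (sub_nonneg.2 h2), mul_nonneg (sub_nonneg.2 hb2.le) (by linarith : (0:ℝ) ≤ 1 + b)]
  · nlinarith [mul_nonneg (neg_nonneg.2 hs) (sub_nonneg.2 h1),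
      mul_nonneg (sub_nonneg.2 ha2.le) (by linarith : (0:ℝ) ≤ 1 + a)]

theorem continuousOn_calib {a b : ℝ} : ContinuousOn (calib a b) (Set.Ioo (-1 : ℝ) 1) := by
  unfold calib
  apply ContinuousOn.div (by fun_prop) (by fun_prop)
  intro w hw
  nlinarith [hw.1, hw.2]

/-- The primitive `√(1 - r²)` with `r = 1 - E z²`. -/
theorem hasDerivAt_profile {E z : ℝ} (hE : 0 < E) (hE1 : E ≤ 1) (hz : z ∈ Set.Icc (0 : ℝ) 1) :
    HasDerivAt (fun z => z * √(E * (2 - E * z ^ 2)))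
      (2 * √E * (1 - E * z ^ 2) / √(2 - E * z ^ 2)) z := by
  have h1 : z ^ 2 ≤ 1 := by nlinarith [hz.1, hz.2]
  have h2 : 0 < 2 - E * z ^ 2 := by nlinarith [sq_nonneg z]
  have h3 : HasDerivAt (fun z => E * (2 - E * z ^ 2)) (E * (-(E * (2 * z)))) z := by
    have := (((hasDerivAt_id' z).fun_pow 2).const_mul E).const_sub 2 |>.const_mul E
    exact this.congr_deriv (by norm_num)
  have h4 := (hasDerivAt_id' z).fun_mul (h3.sqrt (by positivity))
  refine h4.congr_deriv ?_
  rw [Real.sqrt_mul hE.le]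
  have hs1 : √E ≠ 0 := by positivity
  have hs2 : √(2 - E * z ^ 2) ≠ 0 := by positivity
  field_simp
  rw [Real.sq_sqrt h2.le, Real.sq_sqrt hE.le]
  ring

theorem integral_profile {E z : ℝ} (hE : 0 < E) (hE1 : E ≤ 1) (hz : z ∈ Set.Icc (0 : ℝ) 1) :
    ∫ t in (0:ℝ)..z, 2 * √E * (1 - E * t ^ 2) / √(2 - E * t ^ 2) = z * √(E * (2 - E * z ^ 2)) := by
  have hsub : Set.uIcc 0 z ⊆ Set.Icc (0:ℝ) 1 := by
    rw [Set.uIcc_of_le hz.1]; exact Set.Icc_subset_Icc_right hz.2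
  rw [intervalIntegral.integral_eq_sub_of_hasDerivAt
    (fun t ht => hasDerivAt_profile hE hE1 (hsub ht))]
  · simp
  · apply ContinuousOn.intervalIntegrable
    apply ContinuousOn.div (by fun_prop) (by fun_prop)
    intro t ht
    have ht := hsub ht
    have h1 : t ^ 2 ≤ 1 := by nlinarith [ht.1, ht.2]
    have h2 : 0 < 2 - E * t ^ 2 := by nlinarith [sq_nonneg t]
    positivity

theorem poly_ineq {E G y : ℝ} (h0 : 0 ≤ E) (h1 : E ≤ G) (h2 : G ≤ 1) (hy : 0 ≤ y) (hy1 : y ≤ 1) :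
    G ^ 2 * (1 - y) * (2 - E * y) ≤ (G - E * y) * (2 - y) := by
  rcases eq_or_lt_of_le (h0.trans h1) with hG | hG
  · have : E = 0 := le_antisymm (by linarith) h0
    subst this; rw [← hG]; simp
  have k0 : 0 ≤ G * (2 - y) - 2 * G ^ 2 * (1 - y) := by
    have : 0 ≤ G * ((2 - y) - 2 * G * (1 - y)) := by
      apply mul_nonneg hG.le
      nlinarith [mul_nonneg (sub_nonneg.2 h2) (sub_nonneg.2 hy1)]
    nlinarith
  have k1 : 0 ≤ G * (1 - y) * ((1 - G) * (2 - y * (1 + G))) := by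
    apply mul_nonneg (mul_nonneg hG.le (by linarith))
    apply mul_nonneg (by linarith)
    nlinarith [mul_nonneg hy (sub_nonneg.2 h2)]
  have key : G * ((G - E * y) * (2 - y) - G ^ 2 * (1 - y) * (2 - E * y)) =
      (G - E) * (G * (2 - y) - 2 * G ^ 2 * (1 - y)) + E * (G * (1 - y) * ((1 - G) * (2 - y * (1 + G)))) := by
    ring
  have : 0 ≤ G * ((G - E * y) * (2 - y) - G ^ 2 * (1 - y) * (2 - E * y)) := by
    rw [key]
    exact add_nonneg (mul_nonneg (by linarith) k0) (mul_nonneg h0 k1)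
  have := nonneg_of_mul_nonneg_right this hG
  linarith

theorem hasDerivAt_half_sqrt {z : ℝ} (hz : z ∈ Set.Icc (0 : ℝ) 1) :
    HasDerivAt (fun z => z * √(2 - z ^ 2) / 2) ((1 - z ^ 2) / √(2 - z ^ 2)) z := by
  have h2 : 0 < 2 - z ^ 2 := by nlinarith [hz.1, hz.2]
  have h3 : HasDerivAt (fun z : ℝ => (2 - z ^ 2)) (-(2 * z)) z := by
    have := ((hasDerivAt_id' z).fun_pow 2).const_sub 2
    exact this.congr_deriv (by norm_num)
  have h4 := ((hasDerivAt_id' z).fun_mul (h3.sqrt (by positivity))).div_const 2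
  refine h4.congr_deriv ?_
  have hs2 : √(2 - z ^ 2) ≠ 0 := by positivity
  field_simp
  rw [Real.sq_sqrt h2.le]
  ring

theorem integral_half_sqrt : ∫ t in (0:ℝ)..1, (1 - t ^ 2) / √(2 - t ^ 2) = 1 / 2 := by
  have hsub : Set.uIcc (0:ℝ) 1 ⊆ Set.Icc (0:ℝ) 1 := by
    rw [Set.uIcc_of_le zero_le_one]
  rw [intervalIntegral.integral_eq_sub_of_hasDerivAt (fun t ht => hasDerivAt_half_sqrt (hsub ht))]
  · norm_num
  · apply ContinuousOn.intervalIntegrable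
    apply ContinuousOn.div (by fun_prop) (by fun_prop)
    intro t ht
    have ht := hsub ht
    have h2 : 0 < 2 - t ^ 2 := by nlinarith [ht.1, ht.2]
    positivity

end

section

theorem calib_lt_of_root {a b c ρ Δ w : ℝ} (ha : -1 < a) (hab : a < b) (hb : b < 1)
    (hc : c = (a + b) / 2) (hcρ : |c| ≤ ρ) (hρ0 : 0 < ρ) (hρ1 : ρ ≤ 1)
    (hΔ2 : Δ ^ 2 = ρ ^ 2 - (1 + a * b) * ρ + c ^ 2) (hw1 : c - Δ < w * ρ) (hw2 : w * ρ < c + Δ) :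
    w ∈ Set.Icc a b ∧ calib a b w < ρ := by
  have hq : ρ * (ρ * w ^ 2 - 2 * c * w + (1 + a * b) - ρ) < 0 := by
    have : (w * ρ - c) ^ 2 < Δ ^ 2 := sq_lt_sq' (by linarith) (by linarith)
    have e : ρ * (ρ * w ^ 2 - 2 * c * w + (1 + a * b) - ρ) = (w * ρ - c) ^ 2 - Δ ^ 2 := by
      rw [hΔ2]; ring
    linarith
  have hq' : ρ * w ^ 2 - 2 * c * w + (1 + a * b) - ρ < 0 := by
    by_contra hcon
    push Not at hcon
    linarith [mul_nonneg hρ0.le hcon]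
  have hcc := abs_le.1 hcρ
  have hΔa : Δ ≤ ρ - c := by
    apply le_of_sq_le_sq _ (by linarith)
    have e : (ρ - c) ^ 2 - Δ ^ 2 = ρ * ((1 - a) * (1 - b)) := by rw [hΔ2, hc]; ring
    have : 0 ≤ ρ * ((1 - a) * (1 - b)) :=
      mul_nonneg hρ0.le (mul_nonneg (by linarith) (by linarith))
    linarith
  have hΔb : Δ ≤ ρ + c := by
    apply le_of_sq_le_sq _ (by linarith)
    have e : (ρ + c) ^ 2 - Δ ^ 2 = ρ * ((1 + a) * (1 + b)) := by rw [hΔ2, hc]; ring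
    have : 0 ≤ ρ * ((1 + a) * (1 + b)) :=
      mul_nonneg hρ0.le (mul_nonneg (by linarith) (by linarith))
    linarith
  have hw3 : w < 1 := lt_of_mul_lt_mul_right (by linarith : w * ρ < 1 * ρ) hρ0.le
  have hw4 : -1 < w := lt_of_mul_lt_mul_right (by linarith : -1 * ρ < w * ρ) hρ0.le
  have hww : 0 < 1 - w ^ 2 := by nlinarith only [hw3, hw4]
  have hfin : (w - a) * (w - b) < 0 := by
    have : (w - a) * (w - b) =
        (ρ * w ^ 2 - 2 * c * w + (1 + a * b) - ρ) + -((1 - ρ) * (1 - w ^ 2)) := by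
      rw [hc]; ring
    rw [this]
    linarith [mul_nonneg (sub_nonneg.2 hρ1) hww.le]
  refine ⟨⟨?_, ?_⟩, ?_⟩
  · by_contra h; push Not at h
    exact absurd (mul_nonneg_of_nonpos_of_nonpos (by linarith : w - a ≤ 0) (by linarith : w - b ≤ 0))
      hfin.not_ge
  · by_contra h; push Not at h
    exact absurd (mul_nonneg (by linarith : 0 ≤ w - a) (by linarith : 0 ≤ w - b)) hfin.not_ge
  · unfold calib
    rw [div_lt_iff₀ hww]
    rw [hc] at hq'
    linarith

theorem exists_roots {a b : ℝ} (ha : -1 < a) (hab : a < b) (hb : b < 1) :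
    ∃ E G : ℝ, 0 < E ∧ E ≤ G ∧ G ≤ 1 ∧ E < 1 ∧ E + G = 2 - (1 + a * b) ∧
      E * G = (b - a) ^ 2 / 4 := by
  obtain ⟨B, hB⟩ : ∃ B, B = 1 + a * b := ⟨_, rfl⟩
  have ha2 : 0 < 1 - a ^ 2 := by nlinarith only [ha, hab, hb]
  have hb2 : 0 < 1 - b ^ 2 := by nlinarith only [ha, hab, hb]
  obtain ⟨s, hs⟩ : ∃ s, s = √((1 - a ^ 2) * (1 - b ^ 2)) := ⟨_, rfl⟩
  have hs0 : 0 < s := by rw [hs]; positivity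
  have hs2 : s ^ 2 = (1 - a ^ 2) * (1 - b ^ 2) := by rw [hs]; exact Real.sq_sqrt (by positivity)
  have hB0 : 0 < B := by nlinarith only [ha2, hb2, hB, sq_nonneg (a + b)]
  have hB2 : B < 2 := by nlinarith only [ha2, hb2, hB, sq_nonneg (a - b)]
  have hsB : s ≤ B := by
    apply le_of_sq_le_sq _ hB0.le
    rw [hs2, hB]; nlinarith only [sq_nonneg (a + b)]
  have hsB' : s < 2 - B := by
    apply lt_of_pow_lt_pow_left₀ 2 (by linarith)
    rw [hs2, hB]; nlinarith only [sq_pos_of_pos (sub_pos.2 hab)]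
  refine ⟨(2 - B - s) / 2, (2 - B + s) / 2, by linarith, by linarith, by linarith, by linarith,
    by rw [hB]; ring, ?_⟩
  linear_combination (-1/4 : ℝ) * hs2 + (B + 1 + a * b - 4) / 4 * hB

set_option maxHeartbeats 4000000 in
theorem calib_integral {a b : ℝ} (ha : -1 < a) (hab : a < b) (hb : b < 1) :
    (b - a) ^ 2 ≤ 2 * ∫ w in a..b, √(1 - calib a b w ^ 2) := by
  obtain ⟨c, hc⟩ : ∃ c, c = (a + b) / 2 := ⟨_, rfl⟩
  obtain ⟨B, hB⟩ : ∃ B, B = 1 + a * b := ⟨_, rfl⟩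
  obtain ⟨E, G, hE0, hEG, hG1, hE1, hsum, hprod⟩ := exists_roots ha hab hb
  rw [← hB] at hsum
  have hc2 : c ^ 2 = (1 - E) * (1 - G) := by
    rw [hc]; linear_combination (-1 : ℝ) * hprod + hsum - hB
  have hcE : |c| ≤ 1 - E := by
    apply abs_le_of_sq_le_sq _ (by linarith)
    rw [hc2, sq]
    exact mul_le_mul_of_nonneg_left (by linarith) (by linarith)
  set k : ℝ → ℝ := fun t => 2 * √E * (1 - E * t ^ 2) / √(2 - E * t ^ 2) with hk
  have hk0 : ∀ t ∈ Set.Icc (0:ℝ) 1, 0 ≤ k t := by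
    intro t ht
    have : t ^ 2 ≤ 1 := by nlinarith [ht.1, ht.2]
    have : 0 ≤ 1 - E * t ^ 2 := by nlinarith [sq_nonneg t]
    simp only [hk]; positivity
  have hkcont : ContinuousOn k (Set.Icc 0 1) := by
    apply ContinuousOn.div (by fun_prop) (by fun_prop)
    intro t ht
    have h1 : t ^ 2 ≤ 1 := by nlinarith [ht.1, ht.2]
    have h2 : 0 < 2 - E * t ^ 2 := by nlinarith [sq_nonneg t]
    positivity
  have hkmeas : Measurable k := by fun_prop
  have hrmeas : Measurable (calib a b) := by unfold calib; fun_prop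
  obtain ⟨C, hC⟩ := isCompact_Icc.exists_bound_of_continuousOn hkcont
  set H : ℝ → ℝ → ℝ := fun w z => if calib a b w < 1 - E * z ^ 2 then k z else 0 with hH
  have hHmeas : Measurable (Function.uncurry H) := by
    apply Measurable.ite
    · exact measurableSet_lt (hrmeas.comp measurable_fst) (by fun_prop)
    · exact hkmeas.comp measurable_snd
    · exact measurable_const
  have hHint : Integrable (Function.uncurry H)
      ((volume.restrict (Set.Icc a b)).prod (volume.restrict (Set.Icc 0 1))) := by
    apply Integrable.of_bound hHmeas.aestronglyMeasurable C
    rw [Measure.prod_restrict]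
    apply (ae_restrict_mem (measurableSet_Icc.prod measurableSet_Icc)).mono
    rintro ⟨w, z⟩ ⟨_, hz⟩
    simp only [Function.uncurry, hH]
    split_ifs
    · exact hC z hz
    · simpa using (norm_nonneg _).trans (hC z hz)
  have hmem : ∀ w ∈ Set.Icc a b, w ∈ Set.Ioo (-1 : ℝ) 1 := fun w hw =>
    ⟨by linarith [hw.1], by linarith [hw.2]⟩
  -- inner integral in `z`
  have hin1 : ∀ w ∈ Set.Icc a b, ∫ z in Set.Icc (0:ℝ) 1, H w z = √(1 - calib a b w ^ 2) := by
    intro w hw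
    have hr1 := calib_le_one (hmem w hw) hw
    have hre : 1 - E ≤ calib a b w := by
      have h1 := calib_one_sub (a := a) (b := b) (hmem w hw)
      have h2 : 0 < 1 - w ^ 2 := by nlinarith [(hmem w hw).1, (hmem w hw).2]
      have h3 : 0 ≤ (1 - E) * ((1 - E) * w ^ 2 - 2 * c * w + B - (1 - E)) := by
        have : (1 - E) * ((1 - E) * w ^ 2 - 2 * c * w + B - (1 - E)) = ((1 - E) * w - c) ^ 2 := by
          linear_combination (-1 : ℝ) * hc2 + (1 - E) * hsum
        rw [this]; positivity
      have h4 := nonneg_of_mul_nonneg_right h3 (by linarith)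
      have h6 : (1 - w ^ 2) * (calib a b w - (1 - E)) =
          (1 - E) * w ^ 2 - 2 * c * w + B - (1 - E) := by
        rw [hc]; linear_combination (-1 : ℝ) * h1 - hB
      have h5 : 0 ≤ (1 - w ^ 2) * (calib a b w - (1 - E)) := h4.trans_eq h6.symm
      linarith [nonneg_of_mul_nonneg_right h5 h2]
    set z0 := √((1 - calib a b w) / E) with hz0
    have hz00 : 0 ≤ z0 := Real.sqrt_nonneg _
    have hz02 : E * z0 ^ 2 = 1 - calib a b w := by
      rw [hz0, Real.sq_sqrt (div_nonneg (by linarith) hE0.le)]; field_simp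
    have hz01 : z0 ≤ 1 := by
      rw [hz0, Real.sqrt_le_one, div_le_one hE0]; linarith
    have : ∀ z ∈ Set.Icc (0:ℝ) 1, H w z = (Set.Ico 0 z0).indicator k z := by
      intro z hz
      have : calib a b w < 1 - E * z ^ 2 ↔ z ∈ Set.Ico 0 z0 := by
        rw [Set.mem_Ico]
        constructor
        · intro h
          refine ⟨hz.1, ?_⟩
          apply lt_of_pow_lt_pow_left₀ 2 hz00
          exact lt_of_mul_lt_mul_left (by linarith) hE0.le
        · intro h
          have := mul_lt_mul_of_pos_left (pow_lt_pow_left₀ h.2 hz.1 two_ne_zero) hE0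
          linarith
      simp only [hH, Set.indicator, this]
      congr
    have hIco : Set.Ico 0 z0 ⊆ Set.Icc 0 1 := fun z hz => ⟨hz.1, hz.2.le.trans hz01⟩
    rw [setIntegral_congr_fun measurableSet_Icc this, setIntegral_indicator measurableSet_Ico,
      Set.inter_eq_right.2 hIco, integral_Ico_eq_integral_Ioc,
      ← intervalIntegral.integral_of_le hz00, integral_profile hE0 hE1.le ⟨hz00, hz01⟩]
    rw [← Real.sqrt_sq hz00, ← Real.sqrt_mul (by positivity), Real.sqrt_sq hz00]
    congr 1
    calc z0 ^ 2 * (E * (2 - E * z0 ^ 2)) = (E * z0 ^ 2) * (2 - E * z0 ^ 2) := by ring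
      _ = _ := by rw [hz02]; ring
  -- inner integral in `w`
  have hin2 : ∀ z ∈ Set.Icc (0:ℝ) 1, 4 * E * G * ((1 - z ^ 2) / √(2 - z ^ 2)) ≤
      ∫ w in Set.Icc a b, H w z := by
    intro z hz
    have hz2 : z ^ 2 ≤ 1 := by nlinarith [hz.1, hz.2]
    have hz20 := sq_nonneg z
    set ρ := 1 - E * z ^ 2 with hρ
    have hρE : 1 - E ≤ ρ := by nlinarith
    have hρ0 : 0 < ρ := by linarith
    have hρ1 : ρ ≤ 1 := by nlinarith
    have hEz : E * z ^ 2 ≤ E := by nlinarith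
    set Δ := √(E * (1 - z ^ 2) * (G - E * z ^ 2)) with hΔ
    have hΔ0 : 0 ≤ Δ := Real.sqrt_nonneg _
    have hΔnn : 0 ≤ E * (1 - z ^ 2) * (G - E * z ^ 2) :=
      mul_nonneg (mul_nonneg hE0.le (by linarith)) (by linarith)
    have hΔ2 : Δ ^ 2 = ρ ^ 2 - B * ρ + c ^ 2 := by
      rw [hΔ, Real.sq_sqrt hΔnn]
      have e1 : B = 2 - E - G := by linarith
      rw [e1, hc2, hρ]; ring
    have hsub : Set.Ioo ((c - Δ) / ρ) ((c + Δ) / ρ) ⊆ {w | w ∈ Set.Icc a b ∧ calib a b w < ρ} :=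
      fun w hw => calib_lt_of_root ha hab hb hc (hcE.trans hρE) hρ0 hρ1 (hB ▸ hΔ2)
        ((div_lt_iff₀ hρ0).1 hw.1) ((lt_div_iff₀ hρ0).1 hw.2)
    have hle : (c - Δ) / ρ ≤ (c + Δ) / ρ := by gcongr; linarith
    have hval : 2 * Δ / ρ * k z ≤ ∫ w in Set.Icc a b, H w z := by
      have e : ∀ w, H w z = ({w | calib a b w < ρ}).indicator (fun _ => k z) w := by
        intro w; simp only [hH, Set.indicator, Set.mem_ofPred_eq]; rfl
      have hm : MeasurableSet {w | calib a b w < ρ} := measurableSet_lt hrmeas measurable_const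
      simp only [e]
      rw [setIntegral_indicator hm, setIntegral_const, smul_eq_mul]
      apply mul_le_mul_of_nonneg_right _ (hk0 z hz)
      have : volume.real (Set.Ioo ((c - Δ) / ρ) ((c + Δ) / ρ)) ≤
          volume.real (Set.Icc a b ∩ {w | calib a b w < ρ}) := by
        exact measureReal_mono hsub
          ((measure_mono (Set.inter_subset_left : Set.Icc a b ∩ _ ⊆ _)).trans_lt (by simp)).ne
      rw [Real.volume_real_Ioo_of_le hle] at this
      calc 2 * Δ / ρ = (c + Δ) / ρ - (c - Δ) / ρ := by ring
        _ ≤ _ := this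
    refine le_trans ?_ hval
    have h2E : 0 < 2 - E * z ^ 2 := by nlinarith
    have h2z : 0 < 2 - z ^ 2 := by linarith
    have e1 : 2 * Δ / ρ * k z = 4 * E * √((1 - z ^ 2) * (G - E * z ^ 2) / (2 - E * z ^ 2)) := by
      simp only [hk]
      rw [hΔ, mul_assoc E, Real.sqrt_mul hE0.le, Real.sqrt_div' _ h2E.le, ← hρ]
      have : √(2 - E * z ^ 2) ≠ 0 := by positivity
      field_simp
      rw [Real.sq_sqrt hE0.le]
      ring
    rw [e1]
    have e2 : G * ((1 - z ^ 2) / √(2 - z ^ 2)) ≤ √((1 - z ^ 2) * (G - E * z ^ 2) / (2 - E * z ^ 2)) := by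
      apply Real.le_sqrt_of_sq_le
      rw [mul_pow, div_pow, Real.sq_sqrt h2z.le, mul_div_assoc', div_le_div_iff₀ h2z h2E]
      have := mul_le_mul_of_nonneg_left (poly_ineq hE0.le hEG hG1 hz20 hz2)
        (by linarith : 0 ≤ 1 - z ^ 2)
      linarith
    calc 4 * E * G * ((1 - z ^ 2) / √(2 - z ^ 2)) = 4 * E * (G * ((1 - z ^ 2) / √(2 - z ^ 2))) := by ring
      _ ≤ _ := by gcongr
  have hswap := integral_integral_swap hHint
  rw [setIntegral_congr_fun measurableSet_Icc hin1] at hswap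
  have hlow : ∫ z in Set.Icc (0:ℝ) 1, 4 * E * G * ((1 - z ^ 2) / √(2 - z ^ 2)) ≤
      ∫ z in Set.Icc (0:ℝ) 1, ∫ w in Set.Icc a b, H w z := by
    apply setIntegral_mono_on _ hHint.integral_prod_right measurableSet_Icc hin2
    apply ContinuousOn.integrableOn_Icc
    apply ContinuousOn.mul (by fun_prop)
    apply ContinuousOn.div (by fun_prop) (by fun_prop)
    intro t ht
    have h2 : 0 < 2 - t ^ 2 := by nlinarith [ht.1, ht.2]
    positivity
  rw [integral_const_mul, integral_Icc_eq_integral_Ioc,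
    ← intervalIntegral.integral_of_le zero_le_one, integral_half_sqrt, ← hswap,
    integral_Icc_eq_integral_Ioc, ← intervalIntegral.integral_of_le hab.le] at hlow
  rw [mul_assoc 4, hprod] at hlow
  linarith

end

section

theorem mul_add_mul_le_sqrt {A p r : ℝ} (hr : r ^ 2 ≤ 1) :
    A * r + |p| * √(1 - r ^ 2) ≤ √(A ^ 2 + p ^ 2) := by
  apply Real.le_sqrt_of_sq_le
  have h1 : √(1 - r ^ 2) ^ 2 = 1 - r ^ 2 := Real.sq_sqrt (by linarith)
  have h2 : |p| ^ 2 = p ^ 2 := sq_abs p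
  have h3 := sq_nonneg (A * √(1 - r ^ 2) - |p| * r)
  have : A ^ 2 + p ^ 2 - (A * r + |p| * √(1 - r ^ 2)) ^ 2 = (A * √(1 - r ^ 2) - |p| * r) ^ 2 := by
    linear_combination (-A^2 - |p| ^ 2) * h1 - h2
  linarith

/-- One-dimensional functional isoperimetric inequality of Bobkov type for `J(w) = 1 - w²`. -/
theorem bobkov_one_dim {w : ℝ → ℝ} (hw : ContDiff ℝ 1 w) (hlt : ∀ x, |w x| < 1) :
    1 - (∫ x in (0:ℝ)..1, w x) ^ 2 ≤
      ∫ x in (0:ℝ)..1, √((1 - w x ^ 2) ^ 2 + (deriv w x / 2) ^ 2) := by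
  have hwc : Continuous w := hw.continuous
  have hdc : Continuous (deriv w) := hw.continuous_deriv le_rfl
  obtain ⟨x0, hx0, hmin⟩ := isCompact_Icc.exists_isMinOn (s := Set.Icc (0:ℝ) 1) ⟨0, by simp⟩ hwc.continuousOn
  obtain ⟨x1, hx1, hmax⟩ := isCompact_Icc.exists_isMaxOn (s := Set.Icc (0:ℝ) 1) ⟨0, by simp⟩ hwc.continuousOn
  set a := w x0 with ha
  set b := w x1 with hb
  have hIcc : ∀ x ∈ Set.Icc (0:ℝ) 1, w x ∈ Set.Icc a b := fun x hx => ⟨hmin hx, hmax hx⟩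
  have hIoo : ∀ x, w x ∈ Set.Ioo (-1:ℝ) 1 := fun x => abs_lt.1 (hlt x)
  have hrhs : Continuous fun x => √((1 - w x ^ 2) ^ 2 + (deriv w x / 2) ^ 2) := by fun_prop
  rcases (hIcc x0 hx0).2.eq_or_lt with hab | hab
  · have hwa : ∀ x ∈ Set.Icc (0:ℝ) 1, w x = a := fun x hx =>
      le_antisymm ((hIcc x hx).2.trans hab.ge) (hIcc x hx).1
    have e : ∫ x in (0:ℝ)..1, w x = a := by
      rw [intervalIntegral.integral_congr (g := fun _ => a)]
      · simp
      · intro x hx; rw [Set.uIcc_of_le zero_le_one] at hx; exact hwa x hx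
    rw [e]
    calc 1 - a ^ 2 = ∫ x in (0:ℝ)..1, (1 - a ^ 2) := by simp
      _ ≤ _ := by
        apply intervalIntegral.integral_mono_on zero_le_one (by simp) (hrhs.intervalIntegrable _ _)
        intro x hx
        rw [hwa x hx]
        apply Real.le_sqrt_of_sq_le
        nlinarith [sq_nonneg (deriv w x / 2)]
  · obtain ⟨s, hs⟩ : ∃ s : ℝ → ℝ, s = fun t => √(1 - calib a b t ^ 2) := ⟨_, rfl⟩
    have hscont : ContinuousOn s (Set.Ioo (-1) 1) := by
      have := continuousOn_calib (a := a) (b := b)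
      rw [hs]
      fun_prop
    have hsw : Continuous fun x => s (w x) := by
      rw [← continuousOn_univ]
      exact hscont.comp hwc.continuousOn (fun x _ => hIoo x)
    have hs0 : ∀ t, 0 ≤ s t := fun t => by rw [hs]; exact Real.sqrt_nonneg _
    have hq : Continuous fun x => |deriv w x| * s (w x) := hdc.abs.mul hsw
    set c := (a + b) / 2 with hc
    set D := (b - a) / 2 with hD
    have hpt : ∀ x ∈ Set.Icc (0:ℝ) 1, (1 - 2 * c * w x + c ^ 2 - D ^ 2) + |deriv w x| * s (w x) / 2 ≤
        √((1 - w x ^ 2) ^ 2 + (deriv w x / 2) ^ 2) := by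
      intro x hx
      have h1 := calib_le_one (hIoo x) (hIcc x hx)
      have h2 := calib_nonneg (hIoo x0) (hIoo x1) (hIoo x) (hIcc x hx)
      have h3 := calib_one_sub (a := a) (b := b) (hIoo x)
      have h4 : calib a b (w x) ^ 2 ≤ 1 := pow_le_one₀ h2 h1
      have h5 := mul_add_mul_le_sqrt (A := 1 - w x ^ 2) (p := deriv w x / 2) h4
      refine le_trans (le_of_eq ?_) h5
      rw [abs_div, abs_two]
      simp only [hs, hc, hD]
      linear_combination h3
    have hInt : ∫ x in (0:ℝ)..1, ((1 - 2 * c * w x + c ^ 2 - D ^ 2) + |deriv w x| * s (w x) / 2) ≤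
        ∫ x in (0:ℝ)..1, √((1 - w x ^ 2) ^ 2 + (deriv w x / 2) ^ 2) := by
      apply intervalIntegral.integral_mono_on zero_le_one _ (hrhs.intervalIntegrable _ _) hpt
      apply Continuous.intervalIntegrable
      exact Continuous.add (by fun_prop) (hq.div_const 2)
    refine le_trans ?_ hInt
    have hS : ∫ t in a..b, s t ≤ ∫ x in (0:ℝ)..1, |deriv w x| * s (w x) := by
      have hcv : ∫ x in x0..x1, s (w x) * deriv w x = ∫ t in a..b, s t := by
        refine intervalIntegral.integral_comp_mul_deriv' (f := w) (g := s) ?_ ?_ ?_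
        · intro x _; exact (hw.differentiable one_ne_zero x).hasDerivAt
        · exact hdc.continuousOn
        · apply hscont.mono
          rintro _ ⟨x, _, rfl⟩; exact hIoo x
      rw [← hcv]
      refine (le_abs_self _).trans ?_
      rw [← Real.norm_eq_abs]
      refine intervalIntegral.norm_integral_le_integral_norm_uIoc.trans ?_
      rw [intervalIntegral.integral_of_le zero_le_one]
      have : ∀ x, ‖s (w x) * deriv w x‖ = |deriv w x| * s (w x) := by
        intro x; rw [norm_mul, Real.norm_eq_abs, Real.norm_eq_abs, abs_of_nonneg (hs0 _), mul_comm]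
      simp only [this]
      apply setIntegral_mono_set
      · exact hq.integrableOn_Ioc
      · exact ae_of_all _ fun x => mul_nonneg (abs_nonneg _) (hs0 _)
      · apply LE.le.eventuallyLE
        intro x hx
        rw [Set.uIoc, Set.mem_Ioc] at hx
        exact ⟨(le_min hx0.1 hx1.1).trans_lt hx.1, hx.2.trans (max_le hx0.2 hx1.2)⟩
    have hA : (b - a) ^ 2 ≤ 2 * ∫ t in a..b, s t := by
      rw [hs]; exact calib_integral (hIoo x0).1 hab (hIoo x1).2
    rw [intervalIntegral.integral_add (Continuous.intervalIntegrable (by fun_prop) _ _)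
      ((hq.div_const 2).intervalIntegrable _ _), intervalIntegral.integral_div]
    have e : ∫ x in (0:ℝ)..1, (1 - 2 * c * w x + c ^ 2 - D ^ 2) =
        1 - 2 * c * (∫ x in (0:ℝ)..1, w x) + c ^ 2 - D ^ 2 := by
      have : ∀ x, 1 - 2 * c * w x + c ^ 2 - D ^ 2 = (1 + c ^ 2 - D ^ 2) - 2 * c * w x := by intro x; ring
      simp only [this]
      rw [intervalIntegral.integral_sub (by simp) (Continuous.intervalIntegrable (by fun_prop) _ _),
        intervalIntegral.integral_const_mul]
      simp; ring
    rw [e]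
    have : D ^ 2 ≤ (∫ x in (0:ℝ)..1, |deriv w x| * s (w x)) / 2 := by
      have : D ^ 2 = (b - a) ^ 2 / 4 := by rw [hD]; ring
      linarith
    nlinarith [sq_nonneg ((∫ x in (0:ℝ)..1, w x) - c)]

end

section

/-- Lebesgue measure on the unit interval. -/
abbrev unitMeas : Measure ℝ := volume.restrict (Set.Icc 0 1)

instance : IsProbabilityMeasure unitMeas := ⟨by simp⟩

/-- Lebesgue measure on the unit cube. -/
abbrev cubeMeas (n : ℕ) : Measure (Fin n → ℝ) := Measure.pi fun _ => unitMeas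

theorem cubeMeas_eq (n : ℕ) : cubeMeas n = volume.restrict (Set.Icc 0 1) := by
  rw [volume_pi, ← Set.pi_univ_Icc, Measure.restrict_pi_pi]
  rfl

theorem Continuous.integrable_cubeMeas {n : ℕ} {f : (Fin n → ℝ) → ℝ} (hf : Continuous f) :
    Integrable f (cubeMeas n) := by
  rw [cubeMeas_eq]; exact hf.continuousOn.integrableOn_compact isCompact_Icc

theorem sqrt_sum_sq_integral_le {ι α : Type*} [Fintype ι] [MeasurableSpace α] {μ : Measure α}
    {p : ι → α → ℝ} (hp : ∀ i, Integrable (p i) μ) :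
    √(∑ i, (∫ t, p i t ∂μ) ^ 2) ≤ ∫ t, √(∑ i, p i t ^ 2) ∂μ := by
  have hV : Integrable (fun t => (WithLp.toLp 2 (fun i => p i t) : EuclideanSpace ℝ ι)) μ := by
    have h1 : Integrable (fun t => (fun i => p i t : ι → ℝ)) μ := Integrable.of_eval hp
    exact (PiLp.continuousLinearEquiv 2 ℝ (fun _ : ι => ℝ)).symm.toContinuousLinearMap.integrable_comp h1
  have h := norm_integral_le_integral_norm (μ := μ)
    (fun t => (WithLp.toLp 2 (fun i => p i t) : EuclideanSpace ℝ ι))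
  rw [EuclideanSpace.norm_eq] at h
  simp only [EuclideanSpace.norm_eq, Real.norm_eq_abs, sq_abs] at h
  convert h using 4 with i
  exact ((EuclideanSpace.proj (𝕜 := ℝ) i).integral_comp_comm hV)

theorem integrable_of_continuous_unit {f : ℝ → ℝ} (hf : Continuous f) : Integrable f unitMeas :=
  hf.continuousOn.integrableOn_compact isCompact_Icc

theorem hasFDerivAt_integral_unit {m : ℕ} {U : (Fin m → ℝ) → ℝ → ℝ}
    (hU : ContDiff ℝ 1 (Function.uncurry U)) (y : Fin m → ℝ) :
    HasFDerivAt (fun y => ∫ t, U y t ∂unitMeas)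
      (∫ t, (fderiv ℝ (Function.uncurry U) (y, t)).comp (.inl ℝ _ _) ∂unitMeas) y := by
  have hd : Continuous fun q : (Fin m → ℝ) × ℝ =>
      (fderiv ℝ (Function.uncurry U) q).comp (.inl ℝ (Fin m → ℝ) ℝ) :=
    (hU.continuous_fderiv one_ne_zero).clm_comp continuous_const
  obtain ⟨C, hC⟩ := ((isCompact_closedBall y 1).prod (isCompact_Icc (a := (0:ℝ)) (b := 1))).exists_bound_of_continuousOn
    hd.continuousOn
  refine hasFDerivAt_integral_of_dominated_of_fderiv_le
    (F' := fun y t => (fderiv ℝ (Function.uncurry U) (y, t)).comp (.inl ℝ _ _))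
    (bound := fun _ => C) (closedBall_mem_nhds y one_pos) ?_ ?_ ?_ ?_ ?_ ?_
  · refine Eventually.of_forall fun z => ?_
    exact (hU.continuous.comp (by fun_prop : Continuous fun t : ℝ => (z, t))).aestronglyMeasurable
  · exact integrable_of_continuous_unit (hU.continuous.comp (by fun_prop : Continuous fun t : ℝ => (y, t)))
  · exact (hd.comp (by fun_prop : Continuous fun t : ℝ => (y, t))).aestronglyMeasurable
  · refine (ae_restrict_mem measurableSet_Icc).mono fun t ht z hz => hC (z, t) ⟨hz, ht⟩
  · exact integrable_const _
  · refine ae_of_all _ fun t z _ => ?_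
    have h1 := (hU.differentiable one_ne_zero (z, t)).hasFDerivAt
    exact HasFDerivAt.comp (g := Function.uncurry U) (f := fun z => (z, t)) z h1
      (hasFDerivAt_prodMk_left (𝕜 := ℝ) z t)

theorem contDiff_integral_unit {m : ℕ} {U : (Fin m → ℝ) → ℝ → ℝ}
    (hU : ContDiff ℝ 1 (Function.uncurry U)) : ContDiff ℝ 1 (fun y => ∫ t, U y t ∂unitMeas) := by
  rw [contDiff_one_iff_fderiv]
  refine ⟨fun y => (hasFDerivAt_integral_unit hU y).differentiableAt, ?_⟩
  have : fderiv ℝ (fun y => ∫ t, U y t ∂unitMeas) = fun y =>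
      ∫ t, (fderiv ℝ (Function.uncurry U) (y, t)).comp (.inl ℝ _ _) ∂unitMeas :=
    funext fun y => (hasFDerivAt_integral_unit hU y).fderiv
  rw [this]
  apply continuous_parametric_integral_of_continuous (s := Set.Icc (0:ℝ) 1) (μ := volume) _ isCompact_Icc
  exact (hU.continuous_fderiv one_ne_zero).clm_comp continuous_const

theorem continuous_partial {n : ℕ} {u : (Fin n → ℝ) → ℝ} (hu : ContDiff ℝ 1 u) (v : Fin n → ℝ) :
    Continuous fun x => fderiv ℝ u x v :=
  (hu.continuous_fderiv one_ne_zero).clm_apply continuous_const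

theorem integral_cubeMeas_succ {m : ℕ} {f : (Fin (m + 1) → ℝ) → ℝ} (hf : Continuous f) :
    ∫ x, f x ∂cubeMeas (m + 1) = ∫ y, ∫ t, f (Fin.cons t y) ∂unitMeas ∂cubeMeas m := by
  have hmp := (measurePreserving_piFinSuccAbove (fun _ : Fin (m + 1) => unitMeas) 0).symm
  rw [← hmp.integral_comp' f]
  have hc : Continuous fun q : ℝ × (Fin m → ℝ) => f (Fin.cons q.1 q.2) := by fun_prop
  have e : ∀ q : ℝ × (Fin m → ℝ), (MeasurableEquiv.piFinSuccAbove (fun _ : Fin (m + 1) => ℝ) 0).symm q =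
      Fin.cons q.1 q.2 := by
    intro q
    exact Fin.insertNth_zero' q.1 q.2
  simp only [e]
  refine (integral_prod_symm (μ := unitMeas) (ν := cubeMeas m) (fun q : ℝ × (Fin m → ℝ) => f (Fin.cons q.1 q.2)) ?_)
  rw [cubeMeas_eq, Measure.prod_restrict]
  exact hc.continuousOn.integrableOn_compact (isCompact_Icc.prod isCompact_Icc)

theorem bobkov_cube {n : ℕ} {u : (Fin n → ℝ) → ℝ} (hu : ContDiff ℝ 1 u) (hlt : ∀ x, |u x| < 1) :
    1 - (∫ x, u x ∂cubeMeas n) ^ 2 ≤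
      ∫ x, √((1 - u x ^ 2) ^ 2 + ∑ i, (fderiv ℝ u x (Pi.single i 1) / 2) ^ 2) ∂cubeMeas n := by
  induction n with
  | zero =>
    have e1 : ∀ x : Fin 0 → ℝ, x = 0 := fun x => Subsingleton.elim _ _
    have e2 : ∫ x, u x ∂cubeMeas 0 = u 0 := by
      have : u = fun _ => u 0 := funext fun x => by rw [e1 x]
      rw [this]; simp
    rw [e2, integral_congr_ae (g := fun _ => √((1 - u 0 ^ 2) ^ 2)) (ae_of_all _ fun x => by simp [e1 x])]
    rw [integral_const, probReal_univ, one_smul, Real.sqrt_sq_eq_abs]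
    exact le_abs_self _
  | succ m ih =>
    obtain ⟨U, hUdef⟩ : ∃ U : (Fin m → ℝ) → ℝ → ℝ, U = fun y t => u (Fin.cons t y) := ⟨_, rfl⟩
    have hcons : ContDiff ℝ 1 (fun q : (Fin m → ℝ) × ℝ => (Fin.cons q.2 q.1 : Fin (m + 1) → ℝ)) := by
      rw [contDiff_pi]
      intro i
      refine Fin.cases ?_ (fun j => ?_) i
      · simpa using contDiff_snd
      · simp only [Fin.cons_succ]
        exact (contDiff_apply ℝ ℝ j).comp contDiff_fst
    have hU : ContDiff ℝ 1 (Function.uncurry U) := by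
      rw [hUdef]; exact hu.comp hcons
    have hUd : ∀ y t, HasFDerivAt (fun z => U z t) ((fderiv ℝ (Function.uncurry U) (y, t)).comp (.inl ℝ _ _)) y :=
      fun y t => HasFDerivAt.comp (g := Function.uncurry U) (f := fun z => (z, t)) y
        (hU.differentiable one_ne_zero (y, t)).hasFDerivAt (hasFDerivAt_prodMk_left (𝕜 := ℝ) y t)
    set v : (Fin m → ℝ) → ℝ := fun y => ∫ t, U y t ∂unitMeas with hv
    have hvC : ContDiff ℝ 1 v := contDiff_integral_unit hU
    have hlt' : ∀ y t, |U y t| < 1 := fun y t => by rw [hUdef]; exact hlt _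
    have hUy : ∀ y, Continuous fun t => U y t := fun y => hU.continuous.comp (by fun_prop : Continuous fun t : ℝ => (y, t))
    have hvlt : ∀ y, |v y| < 1 := by
      intro y
      obtain ⟨t0, ht0, hmax⟩ := isCompact_Icc.exists_isMaxOn (s := Set.Icc (0:ℝ) 1) ⟨0, by simp⟩
        (hUy y).abs.continuousOn
      have : ‖v y‖ ≤ |U y t0| * unitMeas.real Set.univ := by
        apply norm_integral_le_of_norm_le_const
        exact (ae_restrict_mem measurableSet_Icc).mono fun t ht => hmax ht
      simp only [probReal_univ, mul_one] at this
      exact this.trans_lt (hlt' y t0)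
    have h0 : ∀ y t, HasDerivAt (U y) (fderiv ℝ u (Fin.cons t y) (Pi.single 0 1)) t := by
      intro y t
      rw [hUdef]
      have h1 : HasDerivAt (fun t : ℝ => (Fin.cons t y : Fin (m + 1) → ℝ)) (Pi.single 0 1) t := by
        rw [hasDerivAt_pi]
        intro i
        refine Fin.cases ?_ (fun j => ?_) i
        · simpa using hasDerivAt_id' t
        · simpa using hasDerivAt_const t (y j)
      exact (hu.differentiable one_ne_zero _).hasFDerivAt.comp_hasDerivAt t h1
    have hj : ∀ y t j, (fderiv ℝ (Function.uncurry U) (y, t)).comp (.inl ℝ _ _) (Pi.single j 1) =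
        fderiv ℝ u (Fin.cons t y) (Pi.single j.succ 1) := by
      intro y t j
      have h1 : HasDerivAt (fun s : ℝ => (Fin.cons t (y + s • (Pi.single j 1 : Fin m → ℝ)) : Fin (m + 1) → ℝ))
          (Pi.single j.succ 1) 0 := by
        rw [hasDerivAt_pi]
        intro i
        refine Fin.cases ?_ (fun k => ?_) i
        · simpa using hasDerivAt_const (0:ℝ) t
        · have := ((hasDerivAt_id' (0:ℝ)).mul_const ((Pi.single j 1 : Fin m → ℝ) k)).const_add (y k)
          simpa [Pi.single_apply] using this
      have h2 : HasDerivAt (fun s : ℝ => U (y + s • (Pi.single j 1 : Fin m → ℝ)) t)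
          (fderiv ℝ u (Fin.cons t y) (Pi.single j.succ 1)) 0 := by
        rw [hUdef]
        refine HasFDerivAt.comp_hasDerivAt (f := fun s : ℝ => (Fin.cons t (y + s • (Pi.single j 1 : Fin m → ℝ)) : Fin (m + 1) → ℝ)) 0 ?_ h1
        simpa using (hu.differentiable one_ne_zero (Fin.cons t y)).hasFDerivAt
      have h3 : HasDerivAt (fun s : ℝ => y + s • (Pi.single j 1 : Fin m → ℝ)) (Pi.single j 1) 0 := by
        simpa using ((hasDerivAt_id' (0:ℝ)).smul_const (Pi.single j 1 : Fin m → ℝ)).const_add y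
      have h4 : HasDerivAt (fun s : ℝ => U (y + s • (Pi.single j 1 : Fin m → ℝ)) t)
          ((fderiv ℝ (Function.uncurry U) (y, t)).comp (.inl ℝ _ _) (Pi.single j 1)) 0 := by
        refine HasFDerivAt.comp_hasDerivAt (l := fun z => U z t)
          (f := fun s : ℝ => y + s • (Pi.single j 1 : Fin m → ℝ)) 0 ?_ h3
        simpa using hUd y t
      exact h4.unique h2
    have hcc : ∀ v : Fin (m + 1) → ℝ, Continuous fun q : (Fin m → ℝ) × ℝ => fderiv ℝ u (Fin.cons q.2 q.1 : Fin (m + 1) → ℝ) v := fun w =>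
      (continuous_partial hu w).comp hcons.continuous
    have hvd : ∀ y j, fderiv ℝ v y (Pi.single j 1) =
        ∫ t, fderiv ℝ u (Fin.cons t y) (Pi.single j.succ 1) ∂unitMeas := by
      intro y j
      rw [(hasFDerivAt_integral_unit hU y).fderiv, ContinuousLinearMap.integral_apply]
      · exact integral_congr_ae (ae_of_all _ fun t => hj y t j)
      · have hd : Continuous fun q : (Fin m → ℝ) × ℝ =>
            (fderiv ℝ (Function.uncurry U) q).comp (.inl ℝ (Fin m → ℝ) ℝ) :=
          (hU.continuous_fderiv one_ne_zero).clm_comp continuous_const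
        exact (hd.comp (by fun_prop : Continuous fun t : ℝ => (y, t))).continuousOn.integrableOn_compact
          isCompact_Icc
    have hF : Continuous fun x => √((1 - u x ^ 2) ^ 2 + ∑ i, (fderiv ℝ u x (Pi.single i 1) / 2) ^ 2) := by
      have := hu.continuous
      have h2 := fun i : Fin (m + 1) => continuous_partial hu (Pi.single i 1)
      fun_prop
    rw [integral_cubeMeas_succ hu.continuous, integral_cubeMeas_succ hF]
    have hstep := ih hvC hvlt
    have e : ∀ y, ∫ t, u (Fin.cons t y) ∂unitMeas = v y := fun y => by rw [hv, hUdef]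
    simp only [e]
    refine hstep.trans ?_
    have hvcont := hvC.continuous
    have hvp := fun i : Fin m => continuous_partial hvC (Pi.single i 1)
    apply integral_mono
    · apply Continuous.integrable_cubeMeas
      fun_prop
    · apply Continuous.integrable_cubeMeas
      apply continuous_parametric_integral_of_continuous (s := Set.Icc (0:ℝ) 1) (μ := volume) _ isCompact_Icc
      exact hF.comp hcons.continuous
    intro y
    simp only
    set A : ℝ → ℝ := fun t => √((1 - U y t ^ 2) ^ 2 + (fderiv ℝ u (Fin.cons t y) (Pi.single 0 1) / 2) ^ 2) with hA
    have hUyC : ContDiff ℝ 1 (U y) := hU.comp (by fun_prop : ContDiff ℝ 1 fun t : ℝ => (y, t))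
    have hpc : ∀ i, Continuous fun t : ℝ => fderiv ℝ u (Fin.cons t y) (Pi.single i 1) := fun i =>
      (hcc (Pi.single i 1)).comp (by fun_prop : Continuous fun t : ℝ => (y, t))
    have hAc : Continuous A := by
      have := hpc 0
      have := hUy y
      fun_prop
    have h1d : 1 - v y ^ 2 ≤ ∫ t, A t ∂unitMeas := by
      have := bobkov_one_dim hUyC (hlt' y)
      simp only [(h0 y _).deriv] at this
      rwa [intervalIntegral.integral_of_le zero_le_one, intervalIntegral.integral_of_le zero_le_one,
        ← integral_Icc_eq_integral_Ioc, ← integral_Icc_eq_integral_Ioc] at this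
    have hnn : 0 ≤ 1 - v y ^ 2 := by
      have := (sq_lt_one_iff_abs_lt_one _).2 (hvlt y)
      linarith
    let p : Option (Fin m) → ℝ → ℝ := fun o t => o.elim (A t)
      (fun j => fderiv ℝ u (Fin.cons t y) (Pi.single j.succ 1) / 2)
    have hp : ∀ i, Integrable (p i) unitMeas := by
      rintro (_ | j)
      · exact integrable_of_continuous_unit hAc
      · exact integrable_of_continuous_unit ((hpc j.succ).div_const 2)
    have hmink := sqrt_sum_sq_integral_le hp
    simp only [Fintype.sum_option] at hmink
    simp only [p, Option.elim_none, Option.elim_some, integral_div] at hmink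
    refine le_trans (Real.sqrt_le_sqrt ?_) (hmink.trans (le_of_eq ?_))
    · simp only [hvd]
      gcongr
    · congr 1
      ext t
      congr 1
      rw [hA]
      simp only
      rw [Real.sq_sqrt (by positivity), Fin.sum_univ_succ, ← add_assoc, hUdef]

end

section

/-- A smooth sigmoid. -/
def sigm (s : ℝ) : ℝ := s / √(1 + s ^ 2)

theorem one_add_sq_pos (s : ℝ) : 0 < 1 + s ^ 2 := by positivity

theorem contDiff_sigm : ContDiff ℝ 1 sigm := by
  unfold sigm
  apply ContDiff.div contDiff_id
  · exact ContDiff.sqrt (by fun_prop) fun s => (one_add_sq_pos s).ne'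
  · intro s; have := one_add_sq_pos s; positivity

theorem sigm_sq (s : ℝ) : sigm s ^ 2 = 1 - 1 / (1 + s ^ 2) := by
  have := one_add_sq_pos s
  unfold sigm
  rw [div_pow, Real.sq_sqrt this.le]
  field_simp
  ring

theorem abs_sigm_lt (s : ℝ) : |sigm s| < 1 := by
  rw [← sq_lt_one_iff_abs_lt_one, sigm_sq]
  have : 0 < 1 / (1 + s ^ 2) := one_div_pos.2 (one_add_sq_pos s)
  linarith

/-- The derivative of `sigm`. -/
def dsigm (s : ℝ) : ℝ := 1 / ((1 + s ^ 2) * √(1 + s ^ 2))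

theorem hasDerivAt_sigm (s : ℝ) : HasDerivAt sigm (dsigm s) s := by
  have h := one_add_sq_pos s
  have h1 : HasDerivAt (fun s : ℝ => 1 + s ^ 2) (2 * s) s := by
    simpa using (hasDerivAt_pow 2 s).const_add 1
  have h2 := (hasDerivAt_id' s).fun_div (h1.sqrt h.ne') (by positivity)
  refine h2.congr_deriv ?_
  unfold dsigm
  have h3 : √(1 + s ^ 2) ≠ 0 := by positivity
  field_simp
  rw [Real.sq_sqrt h.le]
  ring

theorem dsigm_nonneg (s : ℝ) : 0 ≤ dsigm s := by
  unfold dsigm; positivity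

theorem continuous_dsigm : Continuous dsigm := by
  unfold dsigm
  apply Continuous.div continuous_const (by fun_prop)
  intro s; have := one_add_sq_pos s; positivity

theorem monotone_sigm : Monotone sigm :=
  monotone_of_deriv_nonneg (contDiff_sigm.differentiable one_ne_zero) fun s => by
    rw [(hasDerivAt_sigm s).deriv]; exact dsigm_nonneg s

theorem sigm_neg (s : ℝ) : sigm (-s) = -sigm s := by
  unfold sigm; rw [neg_sq, neg_div]

theorem abs_sub_le_one_sub_mul {P Q : ℝ} (hP : |P| < 1) (hQ : |Q| < 1) : |P - Q| ≤ 1 - P * Q := by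
  rw [abs_lt] at hP hQ
  rw [abs_le]
  constructor <;> nlinarith

theorem sqrt_sq_add_le {A S : ℝ} (hA : 0 ≤ A) (hS : 0 ≤ S) : √(A ^ 2 + S) ≤ A + √S := by
  rw [Real.sqrt_le_left (by positivity)]
  nlinarith [Real.sq_sqrt hS, Real.sqrt_nonneg S, mul_nonneg hA (Real.sqrt_nonneg S)]

theorem integral_abs_sigm_ge {k a b R : ℝ} (hk : 0 < k) (ha : a ∈ Set.Icc (-R) R) (hb : b ∈ Set.Icc (-R) R) :
    2 * sigm (1 / k) * (|a - b| - 2 * k) ≤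
      ∫ t in Set.Icc (-R) R, |sigm ((a - t) / k ^ 2) - sigm ((b - t) / k ^ 2)| := by
  wlog hab : a ≤ b generalizing a b
  · rw [abs_sub_comm]
    refine (this hb ha (le_of_not_ge hab)).trans_eq ?_
    simp only [abs_sub_comm]
  have hs0 : 0 ≤ sigm (1 / k) := by unfold sigm; positivity
  have hcont : Continuous fun t => |sigm ((a - t) / k ^ 2) - sigm ((b - t) / k ^ 2)| := by
    have := contDiff_sigm.continuous
    fun_prop
  rw [abs_sub_comm, abs_of_nonneg (sub_nonneg.2 hab)]
  rcases le_total (b - a) (2 * k) with h | h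
  · refine le_trans (mul_nonpos_of_nonneg_of_nonpos (by positivity) (by linarith)) ?_
    exact integral_nonneg fun t => abs_nonneg _
  · calc 2 * sigm (1 / k) * (b - a - 2 * k) = ∫ t in Set.Icc (a + k) (b - k), 2 * sigm (1 / k) := by
          rw [setIntegral_const, Real.volume_real_Icc_of_le (by linarith), smul_eq_mul]; ring
      _ ≤ ∫ t in Set.Icc (a + k) (b - k), |sigm ((a - t) / k ^ 2) - sigm ((b - t) / k ^ 2)| := by
          apply setIntegral_mono_on continuous_const.integrableOn_Icc hcont.integrableOn_Icc measurableSet_Icc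
          intro t ht
          have e : 1 / k = k / k ^ 2 := by field_simp
          have h1 : sigm (1 / k) ≤ sigm ((b - t) / k ^ 2) := by
            apply monotone_sigm; rw [e]; gcongr; linarith [ht.2]
          have h2 : sigm ((a - t) / k ^ 2) ≤ -sigm (1 / k) := by
            rw [← sigm_neg]; apply monotone_sigm; rw [e, ← neg_div]; gcongr; linarith [ht.1]
          rw [abs_sub_comm]
          exact le_trans (by linarith) (le_abs_self _)
      _ ≤ _ := by
          apply setIntegral_mono_set hcont.integrableOn_Icc (ae_of_all _ fun t => abs_nonneg _)
          exact (Set.Icc_subset_Icc (by linarith [ha.1]) (by linarith [hb.2])).eventuallyLE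

theorem integral_one_div_le {k a R : ℝ} (hk : 0 < k) (hR : 0 ≤ R) :
    ∫ t in Set.Icc (-R) R, 1 / (1 + ((a - t) / k ^ 2) ^ 2) ≤ k ^ 2 * Real.pi := by
  rw [integral_Icc_eq_integral_Ioc, ← intervalIntegral.integral_of_le (by linarith)]
  have hd : ∀ t : ℝ, HasDerivAt (fun t => -(k ^ 2) * Real.arctan ((a - t) / k ^ 2))
      (1 / (1 + ((a - t) / k ^ 2) ^ 2)) t := by
    intro t
    have h1 : HasDerivAt (fun t => (a - t) / k ^ 2) (-1 / k ^ 2) t :=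
      ((hasDerivAt_id' t).const_sub a).div_const _
    refine (h1.arctan.const_mul _).congr_deriv ?_
    field_simp
  rw [intervalIntegral.integral_eq_sub_of_hasDerivAt (fun t _ => hd t)]
  · have h1 := Real.arctan_lt_pi_div_two ((a - -R) / k ^ 2)
    have h2 := Real.neg_pi_div_two_lt_arctan ((a - R) / k ^ 2)
    have : 0 < k ^ 2 := by positivity
    nlinarith
  · apply Continuous.intervalIntegrable
    apply Continuous.div continuous_const (by fun_prop)
    intro t; exact (one_add_sq_pos _).ne'

theorem integral_dsigm_le {k a R : ℝ} (hR : 0 ≤ R) :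
    ∫ t in Set.Icc (-R) R, dsigm ((a - t) / k ^ 2) / k ^ 2 ≤ 2 := by
  rw [integral_Icc_eq_integral_Ioc, ← intervalIntegral.integral_of_le (by linarith)]
  have hd : ∀ t : ℝ, HasDerivAt (fun t => -sigm ((a - t) / k ^ 2))
      (dsigm ((a - t) / k ^ 2) / k ^ 2) t := by
    intro t
    have h1 : HasDerivAt (fun t => (a - t) / k ^ 2) (-1 / k ^ 2) t :=
      ((hasDerivAt_id' t).const_sub a).div_const _
    refine ((hasDerivAt_sigm _).comp t h1).neg.congr_deriv ?_
    ring
  rw [intervalIntegral.integral_eq_sub_of_hasDerivAt (fun t _ => hd t)]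
  · have h1 := (abs_lt.1 (abs_sigm_lt ((a - -R) / k ^ 2))).2
    have h2 := (abs_lt.1 (abs_sigm_lt ((a - R) / k ^ 2))).1
    linarith
  · apply Continuous.intervalIntegrable
    have := continuous_dsigm
    fun_prop

theorem integrable_prod_cubeMeas {n : ℕ} {R : ℝ} {f : ℝ → (Fin n → ℝ) → ℝ} (hf : Continuous (Function.uncurry f)) :
    Integrable (Function.uncurry f) ((volume.restrict (Set.Icc (-R) R)).prod (cubeMeas n)) := by
  rw [cubeMeas_eq, Measure.prod_restrict]
  exact hf.continuousOn.integrableOn_compact (isCompact_Icc.prod isCompact_Icc)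

theorem continuous_integral_cubeMeas {n : ℕ} {X : Type*} [TopologicalSpace X] [FirstCountableTopology X]
    [LocallyCompactSpace X] {f : X → (Fin n → ℝ) → ℝ} (hf : Continuous (Function.uncurry f)) :
    Continuous fun t => ∫ x, f t x ∂cubeMeas n := by
  rw [cubeMeas_eq]
  exact continuous_parametric_integral_of_continuous hf isCompact_Icc

theorem poincare_cubeMeas {n : ℕ} {w : (Fin n → ℝ) → ℝ} (hw : ContDiff ℝ 1 w) :
    ∫ x, ∫ y, |w x - w y| ∂cubeMeas n ∂cubeMeas n ≤
      (∫ x, √(∑ i, (fderiv ℝ w x (Pi.single i 1)) ^ 2) ∂cubeMeas n) / 2 := by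
  obtain ⟨N, hN⟩ : ∃ N : (Fin n → ℝ) → ℝ, N = fun x => √(∑ i, (fderiv ℝ w x (Pi.single i 1)) ^ 2) := ⟨_, rfl⟩
  have hwc := hw.continuous
  have hpc := fun v : Fin n → ℝ => continuous_partial hw v
  have hNc : Continuous N := by rw [hN]; fun_prop
  have hN0 : ∀ x, 0 ≤ N x := fun x => by rw [hN]; exact Real.sqrt_nonneg _
  have hsc := contDiff_sigm.continuous
  have hdc := continuous_dsigm
  rw [← hN]
  obtain ⟨R, hR⟩ := isCompact_Icc.exists_bound_of_continuousOn (s := Set.Icc (0 : Fin n → ℝ) 1) hwc.continuousOn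
  have hR0 : 0 ≤ R := (norm_nonneg _).trans (hR 0 ⟨le_rfl, zero_le_one⟩)
  have hmem : ∀ᵐ x ∂cubeMeas n, w x ∈ Set.Icc (-R) R := by
    rw [cubeMeas_eq]
    exact (ae_restrict_mem measurableSet_Icc).mono fun x hx => abs_le.1 (hR x hx)
  set I := ∫ x, ∫ y, |w x - w y| ∂cubeMeas n ∂cubeMeas n with hI
  have main : ∀ k : ℝ, 0 < k → 2 * sigm (1 / k) * (I - 2 * k) ≤ k ^ 2 * Real.pi + ∫ x, N x ∂cubeMeas n := by
    intro k hk
    have hpt : ∀ t, ∫ x, ∫ y, |sigm ((w x - t) / k ^ 2) - sigm ((w y - t) / k ^ 2)| ∂cubeMeas n ∂cubeMeas n ≤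
        ∫ x, (1 / (1 + ((w x - t) / k ^ 2) ^ 2) + dsigm ((w x - t) / k ^ 2) / k ^ 2 * (N x / 2)) ∂cubeMeas n := by
      intro t
      set u : (Fin n → ℝ) → ℝ := fun x => sigm ((w x - t) / k ^ 2) with hu
      have huC : ContDiff ℝ 1 u := contDiff_sigm.comp ((hw.sub contDiff_const).div_const _)
      have huc := huC.continuous
      have hlt : ∀ x, |u x| < 1 := fun x => abs_sigm_lt _
      have hb := bobkov_cube huC hlt
      have hL : ∫ x, ∫ y, |u x - u y| ∂cubeMeas n ∂cubeMeas n ≤ 1 - (∫ x, u x ∂cubeMeas n) ^ 2 := by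
        have h1 : ∫ x, ∫ y, |u x - u y| ∂cubeMeas n ∂cubeMeas n ≤
            ∫ x, ∫ y, (1 - u x * u y) ∂cubeMeas n ∂cubeMeas n := by
          apply integral_mono
          · exact (continuous_integral_cubeMeas (by fun_prop)).integrable_cubeMeas
          · exact (continuous_integral_cubeMeas (by fun_prop)).integrable_cubeMeas
          intro x
          apply integral_mono
          · exact Continuous.integrable_cubeMeas (by fun_prop)
          · exact Continuous.integrable_cubeMeas (by fun_prop)
          intro y
          exact abs_sub_le_one_sub_mul (hlt x) (hlt y)
        refine h1.trans_eq ?_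
        have h2 : ∀ x, ∫ y, (1 - u x * u y) ∂cubeMeas n = 1 - u x * ∫ y, u y ∂cubeMeas n := by
          intro x
          rw [integral_sub (integrable_const _) (Continuous.integrable_cubeMeas (by fun_prop)), integral_const_mul]
          simp
        simp only [h2]
        rw [integral_sub (integrable_const _) (Continuous.integrable_cubeMeas (by fun_prop)), integral_mul_const]
        simp [sq]
      refine hL.trans (hb.trans ?_)
      have hup := fun v : Fin n → ℝ => continuous_partial huC v
      apply integral_mono
      · exact Continuous.integrable_cubeMeas (by fun_prop)
      · apply Continuous.integrable_cubeMeas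
        apply Continuous.add
        · apply Continuous.div continuous_const (by fun_prop)
          intro x; exact (one_add_sq_pos _).ne'
        · fun_prop
      intro x
      simp only
      have hder : ∀ i, fderiv ℝ u x (Pi.single i 1) = dsigm ((w x - t) / k ^ 2) / k ^ 2 * fderiv ℝ w x (Pi.single i 1) := by
        intro i
        have h1 : HasFDerivAt (fun x => (w x - t) / k ^ 2) ((k ^ 2)⁻¹ • fderiv ℝ w x) x := by
          have := (((hw.differentiable one_ne_zero x).hasFDerivAt).sub_const t).const_smul ((k ^ 2)⁻¹)
          refine this.congr_of_eventuallyEq (Eventually.of_forall fun z => ?_)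
          simp [div_eq_inv_mul]
        have h2 := (hasDerivAt_sigm ((w x - t) / k ^ 2)).comp_hasFDerivAt x h1
        have h3 : fderiv ℝ u x = dsigm ((w x - t) / k ^ 2) • (k ^ 2)⁻¹ • fderiv ℝ w x := h2.fderiv
        rw [h3]
        simp only [smul_apply, smul_eq_mul]
        ring
      have hd0 : 0 ≤ dsigm ((w x - t) / k ^ 2) / k ^ 2 := div_nonneg (dsigm_nonneg _) (by positivity)
      have e1 : ∑ i, (fderiv ℝ u x (Pi.single i 1) / 2) ^ 2 =
          (dsigm ((w x - t) / k ^ 2) / k ^ 2 / 2) ^ 2 * ∑ i, (fderiv ℝ w x (Pi.single i 1)) ^ 2 := by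
        rw [Finset.mul_sum]
        exact Finset.sum_congr rfl fun i _ => by rw [hder]; ring
      have e2 : 1 - u x ^ 2 = 1 / (1 + ((w x - t) / k ^ 2) ^ 2) := by rw [hu]; simp only [sigm_sq]; ring
      refine (sqrt_sq_add_le (by rw [e2]; positivity) (Finset.sum_nonneg fun i _ => sq_nonneg _)).trans_eq ?_
      rw [e2, e1, Real.sqrt_mul (sq_nonneg _), Real.sqrt_sq (by linarith), hN]
      ring
    have hA : Continuous (Function.uncurry fun (t : ℝ) (x : Fin n → ℝ) =>
        ∫ y, |sigm ((w x - t) / k ^ 2) - sigm ((w y - t) / k ^ 2)| ∂cubeMeas n) := by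
      refine continuous_integral_cubeMeas (X := ℝ × (Fin n → ℝ)) (f := fun q y => |sigm ((w q.2 - q.1) / k ^ 2) - sigm ((w y - q.1) / k ^ 2)|) ?_
      unfold Function.uncurry
      fun_prop
    have hB : Continuous (Function.uncurry fun (t : ℝ) (x : Fin n → ℝ) =>
        (1 / (1 + ((w x - t) / k ^ 2) ^ 2) + dsigm ((w x - t) / k ^ 2) / k ^ 2 * (N x / 2))) := by
      unfold Function.uncurry
      apply Continuous.add
      · apply Continuous.div continuous_const (by fun_prop)
        intro x; exact (one_add_sq_pos _).ne'
      · fun_prop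
    have hInt : ∫ t in Set.Icc (-R) R, ∫ x, ∫ y, |sigm ((w x - t) / k ^ 2) - sigm ((w y - t) / k ^ 2)| ∂cubeMeas n ∂cubeMeas n ≤
        ∫ t in Set.Icc (-R) R, ∫ x, (1 / (1 + ((w x - t) / k ^ 2) ^ 2) + dsigm ((w x - t) / k ^ 2) / k ^ 2 * (N x / 2)) ∂cubeMeas n :=
      integral_mono (integrable_prod_cubeMeas hA).integral_prod_left (integrable_prod_cubeMeas hB).integral_prod_left hpt
    rw [integral_integral_swap (integrable_prod_cubeMeas hA), integral_integral_swap (integrable_prod_cubeMeas hB)] at hInt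
    have hlow : 2 * sigm (1 / k) * (I - 2 * k) ≤ ∫ x, (∫ t in Set.Icc (-R) R, ∫ y, |sigm ((w x - t) / k ^ 2) - sigm ((w y - t) / k ^ 2)| ∂cubeMeas n) ∂cubeMeas n := by
      have e1 : 2 * sigm (1 / k) * (I - 2 * k) = ∫ x, ∫ y, 2 * sigm (1 / k) * (|w x - w y| - 2 * k) ∂cubeMeas n ∂cubeMeas n := by
        have h2 : ∀ x, ∫ y, 2 * sigm (1 / k) * (|w x - w y| - 2 * k) ∂cubeMeas n =
            2 * sigm (1 / k) * (∫ y, |w x - w y| ∂cubeMeas n - 2 * k) := by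
          intro x
          rw [integral_const_mul, integral_sub (Continuous.integrable_cubeMeas (by fun_prop)) (integrable_const _)]
          simp
        simp only [h2]
        rw [integral_const_mul, integral_sub (continuous_integral_cubeMeas (by fun_prop)).integrable_cubeMeas (integrable_const _)]
        simp [hI]
      rw [e1]
      apply integral_mono_ae
      · exact (continuous_integral_cubeMeas (by fun_prop)).integrable_cubeMeas
      · exact (integrable_prod_cubeMeas hA).integral_prod_right
      filter_upwards [hmem] with x hx
      have hC : Continuous (Function.uncurry fun (t : ℝ) (y : Fin n → ℝ) =>
        |sigm ((w x - t) / k ^ 2) - sigm ((w y - t) / k ^ 2)|) := by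
        unfold Function.uncurry
        fun_prop
      rw [integral_integral_swap (integrable_prod_cubeMeas hC)]
      apply integral_mono_ae
      · exact Continuous.integrable_cubeMeas (by fun_prop)
      · exact (integrable_prod_cubeMeas hC).integral_prod_right
      filter_upwards [hmem] with y hy
      exact integral_abs_sigm_ge hk hx hy
    have hup : ∫ x, (∫ t in Set.Icc (-R) R, (1 / (1 + ((w x - t) / k ^ 2) ^ 2) + dsigm ((w x - t) / k ^ 2) / k ^ 2 * (N x / 2))) ∂cubeMeas n ≤
        k ^ 2 * Real.pi + ∫ x, N x ∂cubeMeas n := by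
      have e1 : k ^ 2 * Real.pi + ∫ x, N x ∂cubeMeas n = ∫ x, (k ^ 2 * Real.pi + N x) ∂cubeMeas n := by
        rw [integral_add (integrable_const _) hNc.integrable_cubeMeas]; simp
      rw [e1]
      apply integral_mono (integrable_prod_cubeMeas hB).integral_prod_right
      · exact Continuous.integrable_cubeMeas (by fun_prop)
      intro x
      simp only [Function.uncurry_apply_pair]
      rw [integral_add, integral_mul_const]
      · have h1 := integral_one_div_le (a := w x) hk hR0
        have h2 := integral_dsigm_le (k := k) (a := w x) hR0
        have h3 := mul_le_mul_of_nonneg_right h2 (by linarith [hN0 x] : 0 ≤ N x / 2)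
        linarith
      · apply Continuous.integrableOn_Icc
        apply Continuous.div continuous_const (by fun_prop)
        intro x; exact (one_add_sq_pos _).ne'
      · apply Continuous.integrableOn_Icc
        fun_prop
    exact hlow.trans (hInt.trans hup)
  have hsk : ∀ k : ℝ, 0 < k → sigm (1 / k) = 1 / √(k ^ 2 + 1) := by
    intro k hk
    unfold sigm
    have : 1 + (1 / k) ^ 2 = (k ^ 2 + 1) / k ^ 2 := by field_simp
    rw [this, Real.sqrt_div (by positivity), Real.sqrt_sq hk.le]
    field_simp
  have hlim1 : Tendsto (fun k : ℝ => 2 * (1 / √(k ^ 2 + 1)) * (I - 2 * k)) (𝓝[>] 0) (𝓝 (2 * (1 / √(0 ^ 2 + 1)) * (I - 2 * 0))) := by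
    apply tendsto_nhdsWithin_of_tendsto_nhds
    apply Continuous.tendsto (f := fun k : ℝ => 2 * (1 / √(k ^ 2 + 1)) * (I - 2 * k))
    have : ∀ k : ℝ, √(k ^ 2 + 1) ≠ 0 := fun k => by positivity
    fun_prop (disch := assumption)
  have hlim2 : Tendsto (fun k : ℝ => k ^ 2 * Real.pi + ∫ x, N x ∂cubeMeas n) (𝓝[>] 0) (𝓝 (0 ^ 2 * Real.pi + ∫ x, N x ∂cubeMeas n)) := by
    apply tendsto_nhdsWithin_of_tendsto_nhds
    exact Continuous.tendsto (by fun_prop) _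
  have := le_of_tendsto_of_tendsto hlim1 hlim2 (by
    filter_upwards [self_mem_nhdsWithin] with k hk
    rw [← hsk k hk]; exact main k hk)
  norm_num at this
  linarith

end

section

/-- Affine parametrization of a cube by the unit cube. -/
def cubeMap {n : ℕ} (T : EuclideanSpace ℝ (Fin n) ≃ₗᵢ[ℝ] EuclideanSpace ℝ (Fin n))
    (x₀ : EuclideanSpace ℝ (Fin n)) (ε : ℝ) (z : Fin n → ℝ) : EuclideanSpace ℝ (Fin n) :=
  x₀ + T (WithLp.toLp 2 (ε • (z - fun _ => 1 / 2)))

theorem measurePreserving_affine {n : ℕ} (T : EuclideanSpace ℝ (Fin n) ≃ₗᵢ[ℝ] EuclideanSpace ℝ (Fin n))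
    (x₀ : EuclideanSpace ℝ (Fin n)) :
    MeasurePreserving (fun z : Fin n → ℝ => x₀ + T (WithLp.toLp 2 z)) volume volume :=
  (measurePreserving_add_left volume x₀).comp
    (T.measurePreserving.comp (PiLp.volume_preserving_toLp (Fin n)))

theorem map_cubeMap_volume {n : ℕ} (T : EuclideanSpace ℝ (Fin n) ≃ₗᵢ[ℝ] EuclideanSpace ℝ (Fin n))
    (x₀ : EuclideanSpace ℝ (Fin n)) {ε : ℝ} (hε : 0 < ε) :
    Measure.map (cubeMap T x₀ ε) volume = ENNReal.ofReal ((ε ^ n)⁻¹) • volume := by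
  have h1 : Measure.map (fun z : Fin n → ℝ => ε • (z - fun _ => 1 / 2)) volume =
      ENNReal.ofReal ((ε ^ n)⁻¹) • (volume : Measure (Fin n → ℝ)) := by
    have := Measure.map_addHaar_smul (volume : Measure (Fin n → ℝ)) hε.ne'
    rw [← (measurePreserving_sub_right (volume : Measure (Fin n → ℝ)) (fun _ => 1 / 2)).map_eq,
      Measure.map_map (by fun_prop) (by fun_prop)] at this
    rw [(measurePreserving_sub_right (volume : Measure (Fin n → ℝ)) (fun _ => 1 / 2)).map_eq] at this
    simp only [Function.comp_def] at this
    rw [this]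
    simp [abs_of_pos hε]
  have h2 := measurePreserving_affine T x₀
  have h3 : cubeMap T x₀ ε = (fun z : Fin n → ℝ => x₀ + T (WithLp.toLp 2 z)) ∘
      (fun z : Fin n → ℝ => ε • (z - fun _ => 1 / 2)) := rfl
  rw [h3, ← Measure.map_map h2.measurable (by fun_prop), h1, Measure.map_smul, h2.map_eq]

theorem measurableEmbedding_cubeMap {n : ℕ}
    (T : EuclideanSpace ℝ (Fin n) ≃ₗᵢ[ℝ] EuclideanSpace ℝ (Fin n))
    (x₀ : EuclideanSpace ℝ (Fin n)) {ε : ℝ} (hε : 0 < ε) :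
    MeasurableEmbedding (cubeMap T x₀ ε) := by
  have h1 : MeasurableEmbedding (fun z : Fin n → ℝ => ε • (z - fun _ => 1 / 2)) :=
    (MeasurableEquiv.smul₀ ε hε.ne').measurableEmbedding.comp
      (MeasurableEquiv.subRight _).measurableEmbedding
  exact (MeasurableEquiv.addLeft x₀).measurableEmbedding.comp
    (T.toHomeomorph.toMeasurableEquiv.measurableEmbedding.comp
      ((MeasurableEquiv.toLp 2 (Fin n → ℝ)).measurableEmbedding.comp h1))

/-- The standard cube. -/
def stdCube {n : ℕ} (T : EuclideanSpace ℝ (Fin n) ≃ₗᵢ[ℝ] EuclideanSpace ℝ (Fin n))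
    (x₀ : EuclideanSpace ℝ (Fin n)) (ε : ℝ) : Set (EuclideanSpace ℝ (Fin n)) :=
  (fun y => x₀ + T y) '' {y : EuclideanSpace ℝ (Fin n) | ∀ i, |y i| < ε / 2}

theorem cubeMap_preimage {n : ℕ}
    (T : EuclideanSpace ℝ (Fin n) ≃ₗᵢ[ℝ] EuclideanSpace ℝ (Fin n))
    (x₀ : EuclideanSpace ℝ (Fin n)) {ε : ℝ} (hε : 0 < ε) :
    cubeMap T x₀ ε ⁻¹' stdCube T x₀ ε = Set.pi Set.univ fun _ => Set.Ioo 0 1 := by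
  ext z
  simp only [cubeMap, stdCube, Set.mem_preimage, Set.mem_image, add_right_inj,
    EmbeddingLike.apply_eq_iff_eq, exists_eq_right, Set.mem_ofPred_eq, Set.mem_univ_pi, Set.mem_Ioo]
  refine forall_congr' fun i => ?_
  simp only [Pi.smul_apply, Pi.sub_apply, smul_eq_mul]
  rw [abs_mul, abs_of_pos hε, show ε / 2 = ε * (1 / 2) by ring, mul_lt_mul_iff_right₀ hε, abs_lt]
  constructor <;> rintro ⟨h1, h2⟩ <;> constructor <;> linarith

theorem map_cubeMeas {n : ℕ} (T : EuclideanSpace ℝ (Fin n) ≃ₗᵢ[ℝ] EuclideanSpace ℝ (Fin n))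
    (x₀ : EuclideanSpace ℝ (Fin n)) {ε : ℝ} (hε : 0 < ε) :
    Measure.map (cubeMap T x₀ ε) (cubeMeas n) =
      ENNReal.ofReal ((ε ^ n)⁻¹) • volume.restrict (stdCube T x₀ ε) := by
  have h0 : (volume : Measure (Fin n → ℝ)).restrict (Set.Icc 0 1) =
      volume.restrict (Set.pi Set.univ fun _ => Set.Ioo 0 1) :=
    (Measure.restrict_congr_set
      (Measure.univ_pi_Ioo_ae_eq_Icc (f := (0 : Fin n → ℝ)) (g := 1))).symm
  rw [cubeMeas_eq, h0]
  have := (measurableEmbedding_cubeMap T x₀ hε).restrict_map volume (stdCube T x₀ ε)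
  rw [cubeMap_preimage T x₀ hε, map_cubeMap_volume T x₀ hε, Measure.restrict_smul] at this
  exact this.symm

theorem volume_stdCube {n : ℕ} (T : EuclideanSpace ℝ (Fin n) ≃ₗᵢ[ℝ] EuclideanSpace ℝ (Fin n))
    (x₀ : EuclideanSpace ℝ (Fin n)) {ε : ℝ} (hε : 0 < ε) :
    volume (stdCube T x₀ ε) = ENNReal.ofReal (ε ^ n) := by
  have h := congrArg (fun m => m Set.univ) (map_cubeMeas T x₀ hε)
  simp only [(measurableEmbedding_cubeMap T x₀ hε).map_apply, Set.preimage_univ, measure_univ,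
    Measure.smul_apply, Measure.restrict_apply_univ, smul_eq_mul] at h
  have h0 : 0 < ε ^ n := by positivity
  rw [ENNReal.ofReal_inv_of_pos h0] at h
  have := ENNReal.eq_inv_of_mul_eq_one_left h.symm
  exact (inv_inj.1 this).symm

theorem average_stdCube {n : ℕ} (T : EuclideanSpace ℝ (Fin n) ≃ₗᵢ[ℝ] EuclideanSpace ℝ (Fin n))
    (x₀ : EuclideanSpace ℝ (Fin n)) {ε : ℝ} (hε : 0 < ε) (g : EuclideanSpace ℝ (Fin n) → ℝ) :
    ⨍ x in stdCube T x₀ ε, g x = ∫ z, g (cubeMap T x₀ ε z) ∂cubeMeas n := by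
  rw [← (measurableEmbedding_cubeMap T x₀ hε).integral_map, map_cubeMeas T x₀ hε,
    integral_smul_measure, setAverage_eq, Measure.real, volume_stdCube T x₀ hε]
  have h0 : 0 < ε ^ n := by positivity
  rw [ENNReal.toReal_ofReal h0.le, ENNReal.toReal_ofReal (by positivity)]

theorem hasFDerivAt_cubeMap {n : ℕ} (T : EuclideanSpace ℝ (Fin n) ≃ₗᵢ[ℝ] EuclideanSpace ℝ (Fin n))
    (x₀ : EuclideanSpace ℝ (Fin n)) (ε : ℝ) :
    ∃ L : (Fin n → ℝ) →L[ℝ] EuclideanSpace ℝ (Fin n),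
      (∀ i, L (Pi.single i 1) = ε • T (EuclideanSpace.single i 1)) ∧
      ∀ z, HasFDerivAt (cubeMap T x₀ ε) L z := by
  refine ⟨ε • (T.toContinuousLinearEquiv.toContinuousLinearMap.comp
    (EuclideanSpace.equiv (Fin n) ℝ).symm.toContinuousLinearMap), ?_, ?_⟩
  · intro i
    simp only [smul_apply, ContinuousLinearMap.comp_apply]
    rfl
  · intro z
    have h1 : HasFDerivAt (fun z : Fin n → ℝ => z - fun _ => (1 / 2 : ℝ)) (ContinuousLinearMap.id ℝ _) z :=
      (hasFDerivAt_id z).sub_const _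
    have h2 := ((T.toContinuousLinearEquiv.toContinuousLinearMap.comp
      (EuclideanSpace.equiv (Fin n) ℝ).symm.toContinuousLinearMap).hasFDerivAt.comp z h1).const_smul ε
    refine (h2.const_add x₀).congr_of_eventuallyEq (Eventually.of_forall fun z => ?_) |>.congr_fderiv ?_
    · simp only [cubeMap, WithLp.toLp_smul, map_smul]
      rfl
    · ext; simp

theorem contDiff_cubeMap {n : ℕ} (T : EuclideanSpace ℝ (Fin n) ≃ₗᵢ[ℝ] EuclideanSpace ℝ (Fin n))
    (x₀ : EuclideanSpace ℝ (Fin n)) (ε : ℝ) : ContDiff ℝ 1 (cubeMap T x₀ ε) := by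
  obtain ⟨L, -, hL⟩ := hasFDerivAt_cubeMap T x₀ ε
  rw [contDiff_one_iff_fderiv]
  refine ⟨fun z => (hL z).differentiableAt, ?_⟩
  have : fderiv ℝ (cubeMap T x₀ ε) = fun _ => L := funext fun z => (hL z).fderiv
  rw [this]; exact continuous_const

theorem sum_sq_fderiv_cubeMap {n : ℕ} (T : EuclideanSpace ℝ (Fin n) ≃ₗᵢ[ℝ] EuclideanSpace ℝ (Fin n))
    (x₀ : EuclideanSpace ℝ (Fin n)) {ε : ℝ} (hε : 0 < ε) {w : EuclideanSpace ℝ (Fin n) → ℝ}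
    (hw : ContDiff ℝ 1 w) (z : Fin n → ℝ) :
    √(∑ i, (fderiv ℝ (fun z => w (cubeMap T x₀ ε z)) z (Pi.single i 1)) ^ 2) =
      ε * ‖gradient w (cubeMap T x₀ ε z)‖ := by
  obtain ⟨L, hL1, hL⟩ := hasFDerivAt_cubeMap T x₀ ε
  have h1 : HasFDerivAt (fun z => w (cubeMap T x₀ ε z)) ((fderiv ℝ w (cubeMap T x₀ ε z)).comp L) z :=
    HasFDerivAt.comp (g := w) (f := cubeMap T x₀ ε) z
      (hw.differentiable one_ne_zero _).hasFDerivAt (hL z)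
  rw [h1.fderiv]
  have h2 : ∀ v, fderiv ℝ w (cubeMap T x₀ ε z) v = ⟪gradient w (cubeMap T x₀ ε z), v⟫ := fun v => by
    simp [gradient]
  have h3 := ((EuclideanSpace.basisFun (Fin n) ℝ).map T).sum_sq_norm_inner_right
    (gradient w (cubeMap T x₀ ε z))
  have h4 : ∑ i, (((fderiv ℝ w (cubeMap T x₀ ε z)).comp L) (Pi.single i 1)) ^ 2 =
      (ε * ‖gradient w (cubeMap T x₀ ε z)‖) ^ 2 := by
    rw [mul_pow, ← h3, Finset.mul_sum]
    refine Finset.sum_congr rfl fun i _ => ?_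
    simp only [ContinuousLinearMap.comp_apply, hL1, h2, inner_smul_right, OrthonormalBasis.map_apply,
      EuclideanSpace.basisFun_apply, Real.norm_eq_abs, sq_abs, mul_pow]
    rw [real_inner_comm]
  rw [h4, Real.sqrt_sq (by positivity)]

theorem poincare_stdCube {n : ℕ} (T : EuclideanSpace ℝ (Fin n) ≃ₗᵢ[ℝ] EuclideanSpace ℝ (Fin n))
    (x₀ : EuclideanSpace ℝ (Fin n)) {ε : ℝ} (hε : 0 < ε) {w : EuclideanSpace ℝ (Fin n) → ℝ}
    (hw : ContDiff ℝ 1 w) :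
    ⨍ x in stdCube T x₀ ε, ⨍ y in stdCube T x₀ ε, |w x - w y| ≤
      ε / 2 * ⨍ x in stdCube T x₀ ε, ‖gradient w x‖ := by
  simp only [average_stdCube T x₀ hε]
  have h := poincare_cubeMeas (hw.comp (contDiff_cubeMap T x₀ ε))
  refine h.trans_eq ?_
  simp only [Function.comp_def, sum_sq_fderiv_cubeMap T x₀ hε hw]
  rw [integral_const_mul]
  ring

end

section

theorem integral_unit_of_hasDerivAt {F F' : ℝ → ℝ} (hF : Continuous F) (hF' : Continuous F')
    (hd : ∀ t ∈ Set.Ioo (0 : ℝ) 1, HasDerivAt F (F' t) t) :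
    ∫ t, F' t ∂unitMeas = F 1 - F 0 := by
  rw [unitMeas, integral_Icc_eq_integral_Ioc, ← intervalIntegral.integral_of_le zero_le_one]
  exact intervalIntegral.integral_eq_sub_of_hasDerivAt_of_le zero_le_one hF.continuousOn hd
    (hF'.intervalIntegrable _ _)

theorem hasDerivAt_mul_abs (t : ℝ) : HasDerivAt (fun t : ℝ => t * |t| / 2) |t| t := by
  have h : ∀ y : ℝ, y ≠ 0 → HasDerivAt (fun t : ℝ => t * |t| / 2) |y| y := by
    intro y hy
    refine (((hasDerivAt_id' y).fun_mul (hasDerivAt_abs hy)).div_const 2).congr_deriv ?_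
    rcases lt_or_gt_of_ne hy with h | h
    · rw [abs_of_neg h, sign_neg h]; simp
    · rw [abs_of_pos h, sign_pos h]; simp
  rcases eq_or_ne t 0 with rfl | ht
  · exact hasDerivAt_of_hasDerivAt_of_ne h (by fun_prop) (by fun_prop)
  · exact h t ht

theorem hasDerivAt_abs_cube (t : ℝ) : HasDerivAt (fun t : ℝ => |t| ^ 3 / 6) (t * |t| / 2) t := by
  have e : (fun t : ℝ => |t| ^ 3 / 6) = fun t => t * (t * |t| / 2) / 3 := by
    ext t
    rw [pow_succ, sq_abs]; ring
  rw [e]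
  refine (((hasDerivAt_id' t).fun_mul (hasDerivAt_mul_abs t)).div_const 3).congr_deriv ?_
  ring

/-- The mean of `|s + R X|` for `X` uniform on `[-1, 1]`. -/
def unifAbs (s R : ℝ) : ℝ := ∫ t, |s + R * (2 * t - 1)| ∂unitMeas

theorem continuous_unifAbs : Continuous fun p : ℝ × ℝ => unifAbs p.1 p.2 := by
  unfold unifAbs unitMeas
  exact continuous_parametric_integral_of_continuous (by unfold Function.uncurry; fun_prop) isCompact_Icc

theorem unifAbs_eq {s R : ℝ} (hR : R ≠ 0) :
    unifAbs s R = ((s + R) * |s + R| / 2 - (s - R) * |s - R| / 2) / (2 * R) := by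
  have := integral_unit_of_hasDerivAt (F := fun t => (s + R * (2 * t - 1)) * |s + R * (2 * t - 1)| / 2 / (2 * R))
    (F' := fun t => |s + R * (2 * t - 1)|) (by fun_prop) (by fun_prop) (by
      intro t _
      have h1 : HasDerivAt (fun t : ℝ => s + R * (2 * t - 1)) (R * (2 * 1)) t :=
        ((((hasDerivAt_id' t).const_mul 2).sub_const 1).const_mul R).const_add s
      refine (((hasDerivAt_mul_abs _).comp t h1).div_const (2 * R)).congr_deriv ?_
      field_simp)
  rw [unifAbs, this]
  ring_nf

theorem integral_unifAbs {s R b : ℝ} (hR : R ≠ 0) (hb : b ≠ 0) :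
    ∫ y, unifAbs (s + b * (2 * y - 1)) R ∂unitMeas =
      ∫ u, unifAbs s (√(R ^ 2 + b ^ 2 + 2 * R * b * (2 * u - 1))) ∂unitMeas := by
  have hc := continuous_unifAbs
  have h1 : ∫ y, unifAbs (s + b * (2 * y - 1)) R ∂unitMeas =
      (|s + b + R| ^ 3 / 6 - |s + b - R| ^ 3 / 6) / (4 * R * b) -
      (|s - b + R| ^ 3 / 6 - |s - b - R| ^ 3 / 6) / (4 * R * b) := by
    have := integral_unit_of_hasDerivAt
      (F := fun y => (|s + b * (2 * y - 1) + R| ^ 3 / 6 - |s + b * (2 * y - 1) - R| ^ 3 / 6) / (4 * R * b))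
      (F' := fun y => unifAbs (s + b * (2 * y - 1)) R) (by fun_prop)
      (hc.comp (by fun_prop : Continuous fun y : ℝ => (s + b * (2 * y - 1), R))) (by
        intro t _
        have h0 : HasDerivAt (fun t : ℝ => s + b * (2 * t - 1)) (b * (2 * 1)) t :=
          ((((hasDerivAt_id' t).const_mul 2).sub_const 1).const_mul b).const_add s
        refine ((((hasDerivAt_abs_cube _).comp t (h0.add_const R)).fun_sub
          ((hasDerivAt_abs_cube _).comp t (h0.sub_const R))).div_const (4 * R * b)).congr_deriv ?_
        rw [unifAbs_eq hR]
        field_simp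
        ring)
    rw [this]
    ring_nf
  rw [h1]
  have hq : ∀ u ∈ Set.Ioo (0 : ℝ) 1, 0 < R ^ 2 + b ^ 2 + 2 * R * b * (2 * u - 1) := by
    intro u hu
    have e : R ^ 2 + b ^ 2 + 2 * R * b * (2 * u - 1) = u * (R + b) ^ 2 + (1 - u) * (R - b) ^ 2 := by ring
    rw [e]
    by_cases h : R + b = 0
    · have : R - b ≠ 0 := by
        intro h2; apply hR; linarith
      have : 0 < 1 - u := by linarith [hu.2]
      have := hu.1
      positivity
    · have h3 : 0 < 1 - u := by linarith [hu.2]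
      have := hu.1
      have h4 : 0 < u * (R + b) ^ 2 := by positivity
      have h5 : 0 ≤ (1 - u) * (R - b) ^ 2 := by positivity
      linarith
  have := integral_unit_of_hasDerivAt
      (F := fun u => (|s + √(R ^ 2 + b ^ 2 + 2 * R * b * (2 * u - 1))| ^ 3 / 6 +
        |s - √(R ^ 2 + b ^ 2 + 2 * R * b * (2 * u - 1))| ^ 3 / 6) / (4 * R * b))
      (F' := fun u => unifAbs s (√(R ^ 2 + b ^ 2 + 2 * R * b * (2 * u - 1)))) (by fun_prop)
      (hc.comp (by fun_prop : Continuous fun u : ℝ => (s, √(R ^ 2 + b ^ 2 + 2 * R * b * (2 * u - 1))))) (by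
        intro t ht
        have h0 : HasDerivAt (fun t : ℝ => R ^ 2 + b ^ 2 + 2 * R * b * (2 * t - 1)) (2 * R * b * (2 * 1)) t :=
          ((((hasDerivAt_id' t).const_mul 2).sub_const 1).const_mul _).const_add _
        have h2 := h0.sqrt (hq t ht).ne'
        have hr := Real.sqrt_pos.2 (hq t ht)
        refine ((((hasDerivAt_abs_cube _).comp t (h2.const_add s)).fun_add
          ((hasDerivAt_abs_cube _).comp t (h2.const_sub s))).div_const (4 * R * b)).congr_deriv ?_
        rw [unifAbs_eq hr.ne']
        field_simp
        ring)
  rw [this]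
  have e1 : √(R ^ 2 + b ^ 2 + 2 * R * b * (2 * 1 - 1)) = |R + b| := by
    rw [← Real.sqrt_sq_eq_abs]; ring_nf
  have e0 : √(R ^ 2 + b ^ 2 + 2 * R * b * (2 * 0 - 1)) = |R - b| := by
    rw [← Real.sqrt_sq_eq_abs]; ring_nf
  rw [e1, e0]
  have hs : ∀ x : ℝ, |s + abs x| ^ 3 / 6 + |s - abs x| ^ 3 / 6 = |s + x| ^ 3 / 6 + |s - x| ^ 3 / 6 := by
    intro x
    rcases abs_cases x with ⟨h, -⟩ | ⟨h, -⟩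
    · rw [h]
    · rw [h, sub_neg_eq_add, ← sub_eq_add_neg, add_comm]
  rw [hs, hs]
  ring_nf

theorem integral_unit_affine : ∫ u, (2 * u - 1) ∂unitMeas = 0 := by
  rw [integral_unit_of_hasDerivAt (F := fun u => u ^ 2 - u) (F' := fun u => 2 * u - 1) (by fun_prop)
    (by fun_prop)]
  · norm_num
  · intro t _
    refine ((hasDerivAt_pow 2 t).fun_sub (hasDerivAt_id' t)).congr_deriv ?_
    norm_num

theorem integral_sqrt_affine_le {A B : ℝ} (h : |B| ≤ A) :
    ∫ u, √(A + B * (2 * u - 1)) ∂unitMeas ≤ √A := by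
  have hA : 0 ≤ A := (abs_nonneg B).trans h
  rcases hA.eq_or_lt with rfl | hA
  · have : B = 0 := by simpa using h
    simp [this]
  have hp := Real.sqrt_pos.2 hA
  have hpt : ∀ u ∈ Set.Icc (0 : ℝ) 1, √(A + B * (2 * u - 1)) ≤ √A + B / (2 * √A) * (2 * u - 1) := by
    intro u hu
    have h2 : 0 ≤ A + B * (2 * u - 1) := by
      obtain ⟨h3, h4⟩ := abs_le.1 h
      nlinarith only [h3, h4, mul_nonneg hu.1 (by linarith : 0 ≤ A + B),
        mul_nonneg (sub_nonneg.2 hu.2) (by linarith : 0 ≤ A - B)]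
    have e : √A + B / (2 * √A) * (2 * u - 1) = (√A ^ 2 + (A + B * (2 * u - 1))) / (2 * √A) := by
      rw [Real.sq_sqrt hA.le]
      field_simp
      rw [Real.sq_sqrt hA.le]; ring
    rw [e, le_div_iff₀ (by positivity)]
    nlinarith only [Real.sq_sqrt h2, sq_nonneg (√A - √(A + B * (2 * u - 1)))]
  calc _ ≤ ∫ u, (√A + B / (2 * √A) * (2 * u - 1)) ∂unitMeas := by
        apply integral_mono_ae (integrable_of_continuous_unit (by fun_prop)) (integrable_of_continuous_unit (by fun_prop))
        filter_upwards [ae_restrict_mem measurableSet_Icc] with u hu using hpt u hu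
    _ = √A := by
        rw [integral_add (integrable_const _) (integrable_of_continuous_unit (by fun_prop)), integral_const_mul,
          integral_unit_affine]
        simp

theorem integral_unifAbs_sum_le {n : ℕ} (a : Fin n → ℝ) (R : ℝ) :
    ∫ z, unifAbs (∑ i, a i * (2 * z i - 1)) R ∂cubeMeas n ≤ √(R ^ 2 + ∑ i, a i ^ 2) / 2 := by
  have hc := continuous_unifAbs
  induction n generalizing R with
  | zero =>
    simp only [Finset.univ_eq_empty, Finset.sum_empty, integral_const, probReal_univ, one_smul, add_zero]
    rcases eq_or_ne R 0 with rfl | hR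
    · simp [unifAbs]
    · rw [unifAbs_eq hR, Real.sqrt_sq_eq_abs]
      simp only [zero_add, zero_sub, abs_neg]
      apply le_of_eq
      field_simp
      ring
  | succ m ih =>
    have hcont : ∀ R : ℝ, Continuous fun z : Fin (m + 1) → ℝ => unifAbs (∑ i, a i * (2 * z i - 1)) R := fun R =>
      hc.comp (by fun_prop : Continuous fun z : Fin (m + 1) → ℝ => ((∑ i, a i * (2 * z i - 1) : ℝ), R))
    rw [integral_cubeMeas_succ (hcont R)]
    simp only [Fin.sum_univ_succ, Fin.cons_zero, Fin.cons_succ]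
    obtain ⟨b, hb⟩ : ∃ b, b = a 0 := ⟨_, rfl⟩
    obtain ⟨a', ha'⟩ : ∃ a' : Fin m → ℝ, a' = fun i => a i.succ := ⟨_, rfl⟩
    have ea : ∀ i : Fin m, a i.succ = a' i := fun i => by rw [ha']
    simp only [ea, ← hb]
    clear hb ha' ea hcont
    obtain ⟨S, hS⟩ : ∃ S : (Fin m → ℝ) → ℝ, S = fun z => ∑ i, a' i * (2 * z i - 1) := ⟨_, rfl⟩
    have hSc : Continuous S := by rw [hS]; fun_prop
    have ih' : ∀ R, ∫ z, unifAbs (S z) R ∂cubeMeas m ≤ √(R ^ 2 + ∑ i, a' i ^ 2) / 2 := by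
      intro R; rw [hS]; exact ih a' R
    have e : ∀ z : Fin m → ℝ, ∑ i, a' i * (2 * z i - 1) = S z := fun z => by rw [hS]
    simp only [e, add_comm _ (S _)]
    by_cases hb0 : b = 0
    · subst hb0
      simpa using ih' R
    by_cases hR0 : R = 0
    · subst hR0
      have : ∀ s : ℝ, ∫ t, unifAbs (s + b * (2 * t - 1)) 0 ∂unitMeas = unifAbs s b := by
        intro s; simp [unifAbs]
      simp only [this]
      simpa using ih' b
    simp only [integral_unifAbs hR0 hb0]
    have hq : ∀ u : ℝ, u ∈ Set.Icc (0:ℝ) 1 → 0 ≤ R ^ 2 + b ^ 2 + 2 * R * b * (2 * u - 1) := by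
      intro u hu
      have e : R ^ 2 + b ^ 2 + 2 * R * b * (2 * u - 1) = u * (R + b) ^ 2 + (1 - u) * (R - b) ^ 2 := by ring
      have h1 := hu.1
      have h2 : 0 ≤ 1 - u := by linarith [hu.2]
      rw [e]; positivity
    have hUc : Continuous (Function.uncurry fun (z : Fin m → ℝ) (u : ℝ) =>
        unifAbs (S z) (√(R ^ 2 + b ^ 2 + 2 * R * b * (2 * u - 1)))) := by
      exact hc.comp (by fun_prop : Continuous fun p : (Fin m → ℝ) × ℝ =>
        (S p.1, √(R ^ 2 + b ^ 2 + 2 * R * b * (2 * p.2 - 1))))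
    have hInt : Integrable (Function.uncurry fun (z : Fin m → ℝ) (u : ℝ) =>
        unifAbs (S z) (√(R ^ 2 + b ^ 2 + 2 * R * b * (2 * u - 1)))) ((cubeMeas m).prod unitMeas) := by
      rw [cubeMeas_eq, unitMeas, Measure.prod_restrict]
      exact hUc.continuousOn.integrableOn_compact (isCompact_Icc.prod isCompact_Icc)
    rw [integral_integral_swap hInt]
    have hAB : |2 * R * b| ≤ R ^ 2 + b ^ 2 + ∑ i, a' i ^ 2 := by
      have : 0 ≤ ∑ i, a' i ^ 2 := by positivity
      rw [abs_le]; constructor <;> nlinarith [sq_nonneg (R + b), sq_nonneg (R - b)]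
    calc _ ≤ ∫ u, √(R ^ 2 + b ^ 2 + ∑ i, a' i ^ 2 + 2 * R * b * (2 * u - 1)) / 2 ∂unitMeas := by
          apply integral_mono_ae hInt.integral_prod_right (integrable_of_continuous_unit (by fun_prop))
          filter_upwards [ae_restrict_mem measurableSet_Icc] with u hu
          simp only [Function.uncurry_apply_pair]
          refine (ih' _).trans_eq ?_
          rw [Real.sq_sqrt (hq u hu)]
          ring_nf
      _ ≤ _ := by
          rw [integral_div]
          have := integral_sqrt_affine_le hAB
          rw [← add_assoc]
          linarith

theorem integral_abs_sum_le {n : ℕ} (a : Fin n → ℝ) :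
    ∫ z, |∑ i, a i * (2 * z i - 1)| ∂cubeMeas n ≤ √(∑ i, a i ^ 2) / 2 := by
  simpa [unifAbs] using integral_unifAbs_sum_le a 0

theorem integral_cubeMeas_coord {n : ℕ} (i : Fin n) : ∫ z, (2 * z i - 1) ∂cubeMeas n = 0 := by
  have := integral_comp_eval (μ := fun _ : Fin n => unitMeas) (i := i) (f := fun u : ℝ => 2 * u - 1)
    (by fun_prop)
  rw [cubeMeas, this, integral_unit_affine]

theorem inner_cubeMap {n : ℕ} (T : EuclideanSpace ℝ (Fin n) ≃ₗᵢ[ℝ] EuclideanSpace ℝ (Fin n))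
    (x₀ v : EuclideanSpace ℝ (Fin n)) (ε : ℝ) (z : Fin n → ℝ) :
    ⟪v, cubeMap T x₀ ε z⟫ = ⟪v, x₀⟫ + ε / 2 * ∑ i, ⟪v, T (EuclideanSpace.single i 1)⟫ * (2 * z i - 1) := by
  have h : WithLp.toLp 2 (ε • (z - fun _ => 1 / 2)) =
      ∑ i, (ε / 2 * (2 * z i - 1)) • (EuclideanSpace.single i (1 : ℝ)) := by
    ext j
    simp [Finset.sum_apply, Pi.single_apply]
    ring
  rw [cubeMap, h, inner_add_right, map_sum, inner_sum, Finset.mul_sum]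
  congr 1
  refine Finset.sum_congr rfl fun i _ => ?_
  rw [map_smul, inner_smul_right]
  ring

theorem average_inner_stdCube {n : ℕ} (T : EuclideanSpace ℝ (Fin n) ≃ₗᵢ[ℝ] EuclideanSpace ℝ (Fin n))
    (x₀ v : EuclideanSpace ℝ (Fin n)) {ε : ℝ} (hε : 0 < ε) :
    ⨍ x in stdCube T x₀ ε, ⟪v, x⟫ = ⟪v, x₀⟫ := by
  rw [average_stdCube T x₀ hε]
  simp only [inner_cubeMap]
  rw [integral_add (integrable_const _) (Continuous.integrable_cubeMeas (by fun_prop)), integral_const_mul,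
    integral_finsetSum _ fun i _ => Continuous.integrable_cubeMeas (by fun_prop)]
  simp only [integral_const_mul, integral_cubeMeas_coord]
  simp

theorem average_abs_inner_stdCube_le {n : ℕ}
    (T : EuclideanSpace ℝ (Fin n) ≃ₗᵢ[ℝ] EuclideanSpace ℝ (Fin n))
    (x₀ v : EuclideanSpace ℝ (Fin n)) {ε : ℝ} (hε : 0 < ε) :
    ⨍ x in stdCube T x₀ ε, |⟪v, x⟫ - ⟪v, x₀⟫| ≤ ε / 4 * ‖v‖ := by
  rw [average_stdCube T x₀ hε]
  simp only [inner_cubeMap, add_sub_cancel_left, abs_mul]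
  rw [integral_const_mul, abs_of_pos (by positivity)]
  have h := integral_abs_sum_le fun i => ⟪v, T (EuclideanSpace.single i 1)⟫
  have h3 := ((EuclideanSpace.basisFun (Fin n) ℝ).map T).sum_sq_norm_inner_right v
  simp only [OrthonormalBasis.map_apply, EuclideanSpace.basisFun_apply, Real.norm_eq_abs, sq_abs] at h3
  simp only [real_inner_comm v] at h3
  have h4 : ∑ i, ⟪v, T (EuclideanSpace.single i 1)⟫ ^ 2 = ‖v‖ ^ 2 := by
    rw [← h3]
  rw [h4, Real.sqrt_sq (norm_nonneg v)] at h
  calc _ ≤ ε / 2 * (‖v‖ / 2) := by gcongr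
    _ = _ := by ring

end

section

/-- The double integral of the oscillation of `h` on `A`. -/
def dblOsc {α : Type*} [MeasureSpace α] (h : α → ℝ) (A : Set α) : ℝ≥0∞ :=
  ∫⁻ p, ‖h p.1 - h p.2‖ₑ ∂((volume.restrict A).prod (volume.restrict A))

theorem lintegral_sub_average_le {α : Type*} [MeasureSpace α] [SFinite (volume : Measure α)] {h : α → ℝ} {A : Set α}
    (hA0 : volume A ≠ 0) (hA : volume A ≠ ⊤) (hh : IntegrableOn h A) :
    ∫⁻ x in A, ‖h x - ⨍ y in A, h y‖ₑ ≤ (volume A)⁻¹ * dblOsc h A := by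
  have : IsFiniteMeasure (volume.restrict A) := ⟨by simpa using hA.lt_top⟩
  have hAr : (volume.real A) ≠ 0 := by simp [Measure.real, ENNReal.toReal_eq_zero_iff, hA0, hA]
  have hm : AEMeasurable (fun p : α × α => ‖h p.1 - h p.2‖ₑ)
      ((volume.restrict A).prod (volume.restrict A)) :=
    (hh.aestronglyMeasurable.comp_fst.sub hh.aestronglyMeasurable.comp_snd).enorm
  rw [dblOsc, lintegral_prod _ hm, ← lintegral_const_mul' _ _ (by simpa using hA0)]
  refine lintegral_mono fun x => ?_
  have e : h x - ⨍ y in A, h y = (volume.real A)⁻¹ • ∫ y in A, (h x - h y) := by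
    rw [integral_sub (integrable_const _) hh, setAverage_eq, integral_const]
    simp only [smul_eq_mul, measureReal_restrict_apply_univ]
    field_simp
  rw [e, enorm_smul]
  gcongr
  · rw [enorm_inv hAr, Measure.real, Real.enorm_eq_ofReal ENNReal.toReal_nonneg, ENNReal.ofReal_toReal hA]
  · exact enorm_integral_le_lintegral_enorm _

theorem ofReal_setAverage_abs {α : Type*} [MeasureSpace α] {h : α → ℝ} {A : Set α}
    (hA0 : volume A ≠ 0) (hA : volume A ≠ ⊤) (hh : IntegrableOn h A) :
    ENNReal.ofReal (⨍ x in A, |h x|) = (volume A)⁻¹ * ∫⁻ x in A, ‖h x‖ₑ := by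
  rw [setAverage_eq, smul_eq_mul, ENNReal.ofReal_mul (by positivity),
    Measure.real, ENNReal.ofReal_inv_of_pos (ENNReal.toReal_pos hA0 hA), ENNReal.ofReal_toReal hA,
    ofReal_integral_eq_lintegral_ofReal hh.abs (ae_of_all _ fun x => abs_nonneg _)]
  simp only [← Real.norm_eq_abs, ofReal_norm]

theorem isOpen_stdCube {n : ℕ} (T : EuclideanSpace ℝ (Fin n) ≃ₗᵢ[ℝ] EuclideanSpace ℝ (Fin n))
    (x₀ : EuclideanSpace ℝ (Fin n)) (ε : ℝ) : IsOpen (stdCube T x₀ ε) := by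
  have h1 : IsOpen {y : EuclideanSpace ℝ (Fin n) | ∀ i, |y i| < ε / 2} := by
    simp only [Set.ofPred_forall]
    exact isOpen_iInter_of_finite fun i => isOpen_lt (by fun_prop) continuous_const
  exact (T.toHomeomorph.trans (Homeomorph.addLeft x₀)).isOpenMap _ h1

theorem stdCube_subset_closedBall {n : ℕ}
    (T : EuclideanSpace ℝ (Fin n) ≃ₗᵢ[ℝ] EuclideanSpace ℝ (Fin n))
    (x₀ : EuclideanSpace ℝ (Fin n)) {ε : ℝ} (hε : 0 < ε) : stdCube T x₀ ε ⊆ closedBall x₀ (n * ε) := by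
  rintro _ ⟨y, hy, rfl⟩
  rw [mem_closedBall, dist_eq_norm, add_sub_cancel_left, LinearIsometryEquiv.norm_map,
    EuclideanSpace.norm_eq]
  apply Real.sqrt_le_iff.2 ⟨by positivity, ?_⟩
  calc ∑ i, ‖y i‖ ^ 2 ≤ ∑ i : Fin n, ε ^ 2 := by
        refine Finset.sum_le_sum fun i _ => ?_
        have := hy i
        rw [Real.norm_eq_abs]
        gcongr
        linarith
    _ = n * ε ^ 2 := by simp
    _ ≤ (n : ℝ) ^ 2 * ε ^ 2 := by
        gcongr
        exact_mod_cast Nat.le_self_pow two_ne_zero n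
    _ = _ := by ring

theorem stdCube_subset_image {n : ℕ}
    (T : EuclideanSpace ℝ (Fin n) ≃ₗᵢ[ℝ] EuclideanSpace ℝ (Fin n))
    (x₀ : EuclideanSpace ℝ (Fin n)) {ε : ℝ} (hε : 0 < ε) :
    stdCube T x₀ ε ⊆ cubeMap T x₀ ε '' Set.Icc 0 1 := by
  rintro _ ⟨y, hy, rfl⟩
  refine ⟨fun i => y i / ε + 1 / 2, ?_, ?_⟩
  · constructor <;> intro i
    · have := (abs_lt.1 (hy i)).1
      have : -(1 / 2) ≤ y i / ε := by rw [le_div_iff₀ hε]; linarith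
      simp only [Pi.zero_apply]; linarith
    · have := (abs_lt.1 (hy i)).2
      have : y i / ε ≤ 1 / 2 := by rw [div_le_iff₀ hε]; linarith
      simp only [Pi.one_apply]; linarith
  · simp only [cubeMap]
    congr 2
    ext i
    simp
    field_simp

theorem image_subset_stdCube {n : ℕ}
    (T : EuclideanSpace ℝ (Fin n) ≃ₗᵢ[ℝ] EuclideanSpace ℝ (Fin n))
    (x₀ : EuclideanSpace ℝ (Fin n)) {ε ε' : ℝ} (hε : 0 < ε') (h : ε' < ε) :
    (cubeMap T x₀ ε') '' Set.Icc 0 1 ⊆ stdCube T x₀ ε := by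
  rintro _ ⟨z, hz, rfl⟩
  refine ⟨WithLp.toLp 2 (ε' • (z - fun _ => 1 / 2)), fun i => ?_, rfl⟩
  simp only [Pi.smul_apply, Pi.sub_apply, smul_eq_mul]
  have h1 := hz.1 i
  have h2 := hz.2 i
  simp only [Pi.zero_apply, Pi.one_apply] at h1 h2
  have h3 : |z i - 1 / 2| ≤ 1 / 2 := abs_le.2 ⟨by linarith, by linarith⟩
  rw [abs_mul, abs_of_pos hε]
  nlinarith

theorem stdCube_mono {n : ℕ}
    (T : EuclideanSpace ℝ (Fin n) ≃ₗᵢ[ℝ] EuclideanSpace ℝ (Fin n))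
    (x₀ : EuclideanSpace ℝ (Fin n)) {ε ε' : ℝ} (h : ε' ≤ ε) : stdCube T x₀ ε' ⊆ stdCube T x₀ ε :=
  Set.image_mono fun _ hy i => (hy i).trans_le (by linarith)

theorem isCompact_cubeMap_image {n : ℕ}
    (T : EuclideanSpace ℝ (Fin n) ≃ₗᵢ[ℝ] EuclideanSpace ℝ (Fin n))
    (x₀ : EuclideanSpace ℝ (Fin n)) (ε : ℝ) : IsCompact (cubeMap T x₀ ε '' Set.Icc 0 1) :=
  isCompact_Icc.image (contDiff_cubeMap T x₀ ε).continuous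

theorem iUnion_stdCube {n : ℕ}
    (T : EuclideanSpace ℝ (Fin n) ≃ₗᵢ[ℝ] EuclideanSpace ℝ (Fin n))
    (x₀ : EuclideanSpace ℝ (Fin n)) {ε : ℝ} {e : ℕ → ℝ} (he : ∀ m, e m ≤ ε)
    (hlim : Tendsto e atTop (𝓝 ε)) : ⋃ m, stdCube T x₀ (e m) = stdCube T x₀ ε := by
  apply Set.Subset.antisymm (Set.iUnion_subset fun m => stdCube_mono T x₀ (he m))
  rintro _ ⟨y, hy, rfl⟩
  have : ∀ᶠ m in atTop, ∀ i, |y i| < e m / 2 :=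
    eventually_all.2 fun i => (hlim.div_const 2).eventually_const_lt (hy i)
  obtain ⟨m, hm⟩ := this.exists
  exact Set.mem_iUnion.2 ⟨m, y, hm, rfl⟩

theorem continuous_gradient {n : ℕ} {w : EuclideanSpace ℝ (Fin n) → ℝ} (hw : ContDiff ℝ 1 w) :
    Continuous (gradient w) :=
  (InnerProductSpace.toDual ℝ (EuclideanSpace ℝ (Fin n))).symm.continuous.comp
    (hw.continuous_fderiv one_ne_zero)

theorem dblOsc_sub_inner_le {n : ℕ}
    (T : EuclideanSpace ℝ (Fin n) ≃ₗᵢ[ℝ] EuclideanSpace ℝ (Fin n))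
    (x₀ c : EuclideanSpace ℝ (Fin n)) {ε : ℝ} (hε : 0 < ε) {w : EuclideanSpace ℝ (Fin n) → ℝ}
    (hw : ContDiff ℝ 1 w) :
    dblOsc (fun x => w x - ⟪c, x⟫) (stdCube T x₀ ε) ≤
      volume (stdCube T x₀ ε) * ENNReal.ofReal (ε / 2) *
        ∫⁻ x in stdCube T x₀ ε, ‖gradient w x - c‖ₑ := by
  obtain ⟨Q, hQ⟩ : ∃ Q, Q = stdCube T x₀ ε := ⟨_, rfl⟩
  have hV : volume Q = ENNReal.ofReal (ε ^ n) := by rw [hQ, volume_stdCube T x₀ hε]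
  have hV0 : volume Q ≠ 0 := by rw [hV, Ne, ENNReal.ofReal_eq_zero, not_le]; positivity
  have hVt : volume Q ≠ ⊤ := by rw [hV]; exact ENNReal.ofReal_ne_top
  have hu : ContDiff ℝ 1 fun x => w x - ⟪c, x⟫ := hw.sub (contDiff_const.inner ℝ contDiff_id)
  have hg : ∀ x, gradient (fun x => w x - ⟪c, x⟫) x = gradient w x - c := by
    intro x
    apply HasGradientAt.gradient
    have h1 := (hw.differentiable one_ne_zero x).hasGradientAt
    have h2 : HasGradientAt (fun x => ⟪c, x⟫) c x := by
      rw [hasGradientAt_iff_hasFDerivAt]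
      exact ((InnerProductSpace.toDual ℝ _) c).hasFDerivAt
    rw [hasGradientAt_iff_hasFDerivAt] at h1 h2 ⊢
    rw [map_sub]
    exact h1.fun_sub h2
  have hp := poincare_stdCube T x₀ hε hu
  rw [← hQ] at hp ⊢
  obtain ⟨u, hu'⟩ : ∃ u, u = fun x => w x - ⟪c, x⟫ := ⟨_, rfl⟩
  simp only [← hu'] at hp hg hu ⊢
  have hus : ∀ x, w x - ⟪c, x⟫ = u x := fun x => by rw [hu']
  simp only [hus] at hp
  have huc := hu.continuous
  have hcont : ∀ {G : EuclideanSpace ℝ (Fin n) → ℝ}, Continuous G → IntegrableOn G Q := fun hG =>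
    (hG.continuousOn.integrableOn_compact (isCompact_closedBall x₀ (n * ε))).mono_set
      (hQ ▸ stdCube_subset_closedBall T x₀ hε)
  have h1 : ENNReal.ofReal (⨍ x in Q, ‖gradient u x‖) =
      (volume Q)⁻¹ * ∫⁻ x in Q, ‖gradient w x - c‖ₑ := by
    have := ofReal_setAverage_abs hV0 hVt (hcont (continuous_gradient hu).norm)
    simpa only [abs_norm, enorm_norm, hg] using this
  have hm : Continuous fun p : EuclideanSpace ℝ (Fin n) × EuclideanSpace ℝ (Fin n) => ‖u p.1 - u p.2‖ₑ := by
    fun_prop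
  have h2 : ENNReal.ofReal (⨍ x in Q, ⨍ y in Q, |u x - u y|) = (volume Q)⁻¹ * ((volume Q)⁻¹ * dblOsc u Q) := by
    have hc2 : Continuous fun x => ⨍ y in Q, |u x - u y| := by
      simp only [hQ, average_stdCube T x₀ hε]
      apply continuous_integral_cubeMeas
      have := (contDiff_cubeMap T x₀ ε).continuous
      unfold Function.uncurry
      fun_prop
    have h3 := ofReal_setAverage_abs hV0 hVt (hcont hc2)
    have h4 : ∀ x, abs (⨍ y in Q, |u x - u y|) = ⨍ y in Q, |u x - u y| := fun x =>
      abs_of_nonneg (integral_nonneg fun y => abs_nonneg _)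
    simp only [h4] at h3
    have h6 : ∀ x, ‖⨍ y in Q, |u x - u y|‖ₑ = (volume Q)⁻¹ * ∫⁻ y in Q, ‖u x - u y‖ₑ := fun x => by
      rw [← ofReal_setAverage_abs hV0 hVt (hcont (by fun_prop)), Real.enorm_eq_ofReal]
      exact integral_nonneg fun y => abs_nonneg _
    rw [h3, dblOsc, lintegral_prod _ hm.aemeasurable]
    simp only [h6]
    rw [lintegral_const_mul' _ _ (by simpa using hV0)]
  have h5 := ENNReal.ofReal_le_ofReal hp
  rw [ENNReal.ofReal_mul (by positivity), h1, h2] at h5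
  calc dblOsc u Q = (volume Q * (volume Q)⁻¹) * (volume Q * (volume Q)⁻¹) * dblOsc u Q := by
        rw [ENNReal.mul_inv_cancel hV0 hVt]; simp
    _ = volume Q * volume Q * ((volume Q)⁻¹ * ((volume Q)⁻¹ * dblOsc u Q)) := by ring
    _ ≤ volume Q * volume Q * (ENNReal.ofReal (ε / 2) * ((volume Q)⁻¹ * ∫⁻ x in Q, ‖gradient w x - c‖ₑ)) := by
        gcongr
    _ = (volume Q * (volume Q)⁻¹) * (volume Q * ENNReal.ofReal (ε / 2) * ∫⁻ x in Q, ‖gradient w x - c‖ₑ) := by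
        ring
    _ = _ := by rw [ENNReal.mul_inv_cancel hV0 hVt, one_mul]

end

section

theorem dblOsc_le_liminf {α : Type*} [MeasureSpace α] [SFinite (volume : Measure α)] {h : α → ℝ} {A : Set α}
    {w : ℕ → α → ℝ} (hw : ∀ k, AEStronglyMeasurable (w k) (volume.restrict A))
    (hlim : ∀ᵐ x ∂volume.restrict A, Tendsto (fun k => w k x) atTop (𝓝 (h x))) :
    dblOsc h A ≤ liminf (fun k => dblOsc (w k) A) atTop := by
  unfold dblOsc
  refine le_trans ?_ (lintegral_liminf_le' fun k => ?_)
  · apply lintegral_mono_ae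
    filter_upwards [Measure.quasiMeasurePreserving_fst.ae hlim,
      Measure.quasiMeasurePreserving_snd.ae hlim] with p h1 h2
    exact (h1.sub h2).enorm.liminf_eq.ge
  · exact ((hw k).comp_fst.sub (hw k).comp_snd).enorm

theorem dblOsc_iUnion {α : Type*} [MeasureSpace α] [SFinite (volume : Measure α)] (h : α → ℝ) {A : ℕ → Set α}
    (hA : Monotone A) : dblOsc h (⋃ m, A m) = ⨆ m, dblOsc h (A m) := by
  unfold dblOsc
  simp only [Measure.prod_restrict]
  have e : (⋃ m, A m) ×ˢ (⋃ m, A m) = ⋃ m, A m ×ˢ A m := by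
    ext p
    simp only [Set.mem_prod, Set.mem_iUnion]
    constructor
    · rintro ⟨⟨i, hi⟩, ⟨j, hj⟩⟩
      exact ⟨max i j, hA (le_max_left i j) hi, hA (le_max_right i j) hj⟩
    · rintro ⟨i, h1, h2⟩
      exact ⟨⟨i, h1⟩, ⟨i, h2⟩⟩
  rw [e]
  refine setLIntegral_iUnion_of_directed _ (Monotone.directed_le fun i j hij => ?_)
  exact Set.prod_mono (hA hij) (hA hij)

theorem sum_liminf_le {ι : Type*} (s : Finset ι) (f : ℕ → ι → ℝ≥0∞) :
    ∑ i ∈ s, liminf (fun k => f k i) atTop ≤ liminf (fun k => ∑ i ∈ s, f k i) atTop := by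
  let : MeasurableSpace ι := ⊤
  have := lintegral_liminf_le (μ := ∑ i ∈ s, Measure.dirac i) (f := f) (u := atTop)
    (fun k => measurable_from_top)
  simpa [lintegral_finsetSum_measure] using this

/-- Oscillation control of finitely many disjoint cubes. -/
theorem sum_dblOsc_le {n : ℕ} {Ω : Set (EuclideanSpace ℝ (Fin n))} {ι : Type*} (s : Finset ι)
    {T : ι → EuclideanSpace ℝ (Fin n) ≃ₗᵢ[ℝ] EuclideanSpace ℝ (Fin n)}
    {x : ι → EuclideanSpace ℝ (Fin n)} {ε ε' : ℝ} (hε' : 0 < ε') (hε : ε' < ε)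
    (hdisj : (s : Set ι).Pairwise fun i j => Disjoint (stdCube (T i) (x i) ε) (stdCube (T j) (x j) ε))
    (hsub : ∀ i ∈ s, stdCube (T i) (x i) ε ⊆ Ω)
    {g : EuclideanSpace ℝ (Fin n) → ℝ} {v : EuclideanSpace ℝ (Fin n) → EuclideanSpace ℝ (Fin n)}
    (hv : Continuous v) {B : ℝ≥0∞}
    (hg : ∀ W, IsCompact W → W ⊆ Ω → ∃ w : ℕ → EuclideanSpace ℝ (Fin n) → ℝ,
      (∀ k, ContDiff ℝ 1 (w k)) ∧
      (∀ᵐ x ∂volume.restrict W, Tendsto (fun k => w k x) atTop (𝓝 (g x))) ∧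
      ∀ᶠ k in atTop, ∫⁻ x in W, ‖gradient (w k) x - v x‖ₑ ≤ B)
    {u : EuclideanSpace ℝ (Fin n) → ℝ≥0∞} (hu : Measurable u)
    (huv : ∀ x y, dist x y ≤ n * ε → ‖v x - v y‖ₑ ≤ u x) :
    ∑ i ∈ s, dblOsc (fun y => g y - ⟪v (x i), y⟫) (stdCube (T i) (x i) ε') ≤
      ENNReal.ofReal (ε ^ n) * ENNReal.ofReal (ε / 2) * (B + ∫⁻ y, u y) := by
  obtain ⟨W, hW⟩ : ∃ W, W = ⋃ i ∈ s, (cubeMap (T i) (x i) ε') '' Set.Icc 0 1 := ⟨_, rfl⟩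
  obtain ⟨w, hw, hwlim, hwB⟩ := hg W
    (hW ▸ s.isCompact_biUnion fun i _ => isCompact_cubeMap_image _ _ _)
    (hW ▸ Set.iUnion₂_subset fun i hi => (image_subset_stdCube _ _ hε' hε).trans (hsub i hi))
  have hQW : ∀ i ∈ s, stdCube (T i) (x i) ε' ⊆ W := fun i hi => by
    rw [hW]
    exact (stdCube_subset_image _ _ hε').trans
      (Set.subset_biUnion_of_mem (u := fun i => (cubeMap (T i) (x i) ε') '' Set.Icc 0 1) hi)
  have h1 : ∀ i ∈ s, dblOsc (fun y => g y - ⟪v (x i), y⟫) (stdCube (T i) (x i) ε') ≤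
      liminf (fun k => dblOsc (fun y => w k y - ⟪v (x i), y⟫) (stdCube (T i) (x i) ε')) atTop := by
    intro i hi
    apply dblOsc_le_liminf
    · intro k
      have := (hw k).continuous
      exact (by fun_prop : Continuous fun y => w k y - ⟪v (x i), y⟫).aestronglyMeasurable
    · filter_upwards [ae_mono (Measure.restrict_mono (hQW i hi) le_rfl) hwlim] with y hy
      exact hy.sub_const _
  have h2 : ∀ᶠ k in atTop, ∑ i ∈ s, dblOsc (fun y => w k y - ⟪v (x i), y⟫) (stdCube (T i) (x i) ε') ≤
      ENNReal.ofReal (ε ^ n) * ENNReal.ofReal (ε / 2) * (B + ∫⁻ y, u y) := by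
    filter_upwards [hwB] with k hk
    have hm : Measurable fun y => ‖gradient (w k) y - v y‖ₑ :=
      ((continuous_gradient (hw k)).sub hv).enorm.measurable
    have hdisj' : (s : Set ι).Pairwise (Function.onFun Disjoint fun i => stdCube (T i) (x i) ε') :=
      fun i hi j hj hij => (hdisj hi hj hij).mono (stdCube_mono _ _ hε.le) (stdCube_mono _ _ hε.le)
    calc _ ≤ ∑ i ∈ s, ENNReal.ofReal (ε ^ n) * ENNReal.ofReal (ε / 2) *
          ∫⁻ y in stdCube (T i) (x i) ε', (‖gradient (w k) y - v y‖ₑ + u y) := by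
          refine Finset.sum_le_sum fun i hi => (dblOsc_sub_inner_le _ _ _ hε' (hw k)).trans ?_
          rw [volume_stdCube _ _ hε']
          refine mul_le_mul' (by gcongr) ?_
          refine setLIntegral_mono (hm.add hu) fun y hy => ?_
          have h3 : dist y (x i) ≤ n * ε :=
            (mem_closedBall.1 (stdCube_subset_closedBall _ _ hε' hy)).trans (by gcongr)
          calc ‖gradient (w k) y - v (x i)‖ₑ = ‖(gradient (w k) y - v y) + (v y - v (x i))‖ₑ := by
                congr 1; abel
            _ ≤ _ := (enorm_add_le _ _).trans (add_le_add le_rfl (huv _ _ h3))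
      _ = ENNReal.ofReal (ε ^ n) * ENNReal.ofReal (ε / 2) *
          ∫⁻ y in ⋃ i ∈ s, stdCube (T i) (x i) ε', (‖gradient (w k) y - v y‖ₑ + u y) := by
          rw [lintegral_biUnion_finset hdisj' fun i _ => (isOpen_stdCube _ _ _).measurableSet, Finset.mul_sum]
      _ ≤ _ := by
          rw [lintegral_add_left hm]
          exact mul_le_mul' le_rfl (add_le_add
            ((lintegral_mono_set (Set.iUnion₂_subset hQW)).trans hk) (setLIntegral_le_lintegral _ _))
  have h3 : ∑ i ∈ s, liminf (fun k => dblOsc (fun y => w k y - ⟪v (x i), y⟫) (stdCube (T i) (x i) ε')) atTop ≤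
      liminf (fun k => ∑ i ∈ s, dblOsc (fun y => w k y - ⟪v (x i), y⟫) (stdCube (T i) (x i) ε')) atTop :=
    sum_liminf_le s _
  refine (Finset.sum_le_sum h1).trans (h3.trans ?_)
  exact liminf_le_of_frequently_le' h2.frequently

theorem ofReal_average_osc_le {n : ℕ}
    (T : EuclideanSpace ℝ (Fin n) ≃ₗᵢ[ℝ] EuclideanSpace ℝ (Fin n))
    (x₀ c : EuclideanSpace ℝ (Fin n)) {ε : ℝ} (hε : 0 < ε) {g : EuclideanSpace ℝ (Fin n) → ℝ}
    (hg : AEStronglyMeasurable g (volume.restrict (stdCube T x₀ ε))) :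
    ENNReal.ofReal (⨍ x in stdCube T x₀ ε, |g x - ⨍ y in stdCube T x₀ ε, g y|) ≤
      (ENNReal.ofReal (ε ^ n))⁻¹ * ((ENNReal.ofReal (ε ^ n))⁻¹ *
        dblOsc (fun y => g y - ⟪c, y⟫) (stdCube T x₀ ε)) + ENNReal.ofReal (ε / 4) * ‖c‖ₑ := by
  have hav := average_abs_inner_stdCube_le T x₀ c hε
  have hav2 := average_inner_stdCube T x₀ c hε
  rw [← volume_stdCube T x₀ hε]
  have hsub := stdCube_subset_closedBall T x₀ hε
  obtain ⟨Q, hQ⟩ : ∃ Q, Q = stdCube T x₀ ε := ⟨_, rfl⟩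
  have hV : volume Q = ENNReal.ofReal (ε ^ n) := by rw [hQ, volume_stdCube T x₀ hε]
  have hV0 : volume Q ≠ 0 := by rw [hV, Ne, ENNReal.ofReal_eq_zero, not_le]; positivity
  have hVt : volume Q ≠ ⊤ := by rw [hV]; exact ENNReal.ofReal_ne_top
  rw [← hQ] at hg hav hav2 hsub ⊢
  clear hQ
  have hfin : IsFiniteMeasure (volume.restrict Q) := ⟨by simpa using hVt.lt_top⟩
  by_cases hi : IntegrableOn g Q
  · have hl : IntegrableOn (fun y => ⟪c, y⟫) Q :=
      (((by fun_prop : Continuous fun y : EuclideanSpace ℝ (Fin n) => ⟪c, y⟫).continuousOn).integrableOn_compact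
        (isCompact_closedBall x₀ (n * ε))).mono_set hsub
    have hh : IntegrableOn (fun y => g y - ⟪c, y⟫) Q := hi.sub hl
    have e1 : ⨍ y in Q, g y = (⨍ y in Q, (g y - ⟪c, y⟫)) + ⟪c, x₀⟫ := by
      rw [← hav2]
      simp only [setAverage_eq, integral_sub hi hl, smul_eq_mul]
      ring
    have hI : IntegrableOn (fun x => g x - ⨍ y in Q, g y) Q := hi.sub (integrable_const _)
    have h1 := lintegral_sub_average_le hV0 hVt hh
    have h2 := ENNReal.ofReal_le_ofReal hav
    have hl2 : IntegrableOn (fun x => ⟪c, x⟫ - ⟪c, x₀⟫) Q := hl.sub (integrable_const _)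
    rw [ofReal_setAverage_abs hV0 hVt hl2, ENNReal.ofReal_mul (by positivity),
      ofReal_norm] at h2
    rw [ofReal_setAverage_abs hV0 hVt hI]
    calc _ ≤ (volume Q)⁻¹ * ∫⁻ x in Q, (‖(g x - ⟪c, x⟫) - ⨍ y in Q, (g y - ⟪c, y⟫)‖ₑ + ‖⟪c, x⟫ - ⟪c, x₀⟫‖ₑ) := by
          gcongr with x
          rw [e1]
          refine le_trans (le_of_eq ?_) (enorm_add_le _ _)
          congr 1; ring
      _ = (volume Q)⁻¹ * (∫⁻ x in Q, ‖(g x - ⟪c, x⟫) - ⨍ y in Q, (g y - ⟪c, y⟫)‖ₑ) +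
          (volume Q)⁻¹ * ∫⁻ x in Q, ‖⟪c, x⟫ - ⟪c, x₀⟫‖ₑ := by
          rw [lintegral_add_right _ (by fun_prop), mul_add]
      _ ≤ _ := by gcongr
  · have h0 : ¬ IntegrableOn (fun x => |g x|) Q := by
      intro h
      exact hi ((integrable_norm_iff hg).1 h)
    have e1 : ⨍ y in Q, g y = 0 := by rw [setAverage_eq, integral_undef hi, smul_zero]
    have e2 : ⨍ y in Q, |g y| = 0 := by rw [setAverage_eq, integral_undef h0, smul_zero]
    simp [e1, e2]

/-- A bound on `κ_ε` over finite families of cubes. -/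
theorem sum_average_osc_le {n : ℕ} (hn : 1 ≤ n) {Ω : Set (EuclideanSpace ℝ (Fin n))} {ι : Type*} (s : Finset ι)
    {T : ι → EuclideanSpace ℝ (Fin n) ≃ₗᵢ[ℝ] EuclideanSpace ℝ (Fin n)}
    {x : ι → EuclideanSpace ℝ (Fin n)} {ε : ℝ} (hε : 0 < ε)
    (hdisj : (s : Set ι).Pairwise fun i j => Disjoint (stdCube (T i) (x i) ε) (stdCube (T j) (x j) ε))
    (hsub : ∀ i ∈ s, stdCube (T i) (x i) ε ⊆ Ω)
    {g : EuclideanSpace ℝ (Fin n) → ℝ} (hgm : AEStronglyMeasurable g (volume.restrict Ω))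
    {v : EuclideanSpace ℝ (Fin n) → EuclideanSpace ℝ (Fin n)}
    (hv : Continuous v) {B : ℝ≥0∞}
    (hg : ∀ W, IsCompact W → W ⊆ Ω → ∃ w : ℕ → EuclideanSpace ℝ (Fin n) → ℝ,
      (∀ k, ContDiff ℝ 1 (w k)) ∧
      (∀ᵐ x ∂volume.restrict W, Tendsto (fun k => w k x) atTop (𝓝 (g x))) ∧
      ∀ᶠ k in atTop, ∫⁻ x in W, ‖gradient (w k) x - v x‖ₑ ≤ B)
    {u : EuclideanSpace ℝ (Fin n) → ℝ≥0∞} (hu : Measurable u)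
    (huv : ∀ x y, dist x y ≤ n * ε → ‖v x - v y‖ₑ ≤ u x) :
    ENNReal.ofReal (ε ^ (n - 1)) * ∑ i ∈ s, ENNReal.ofReal
      (⨍ y in stdCube (T i) (x i) ε, |g y - ⨍ z in stdCube (T i) (x i) ε, g z|) ≤
      (B + ∫⁻ y, u y) / 2 + ((∫⁻ y, ‖v y‖ₑ) + ∫⁻ y, u y) / 4 := by
  have hE0 : ENNReal.ofReal (ε ^ n) ≠ 0 := by rw [Ne, ENNReal.ofReal_eq_zero, not_le]; positivity
  have hEt : ENNReal.ofReal (ε ^ n) ≠ ⊤ := ENNReal.ofReal_ne_top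
  have hpow : ε ^ (n - 1) * ε = ε ^ n := by rw [← pow_succ, Nat.sub_add_cancel hn]
  have h1 : ∑ i ∈ s, dblOsc (fun y => g y - ⟪v (x i), y⟫) (stdCube (T i) (x i) ε) ≤
      ENNReal.ofReal (ε ^ n) * ENNReal.ofReal (ε / 2) * (B + ∫⁻ y, u y) := by
    obtain ⟨e, he⟩ : ∃ e : ℕ → ℝ, e = fun m : ℕ => ε * (1 - 1 / ((m : ℝ) + 2)) := ⟨_, rfl⟩
    have hem : Monotone e := by
      rw [he]; intro i j hij
      have : (i : ℝ) ≤ j := by exact_mod_cast hij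
      dsimp only
      gcongr
    have he1 : ∀ m, e m < ε := fun m => by
      rw [he]
      have : 0 < 1 / ((m : ℝ) + 2) := by positivity
      nlinarith
    have he0 : ∀ m, 0 < e m := fun m => by
      rw [he]
      have : 1 / ((m : ℝ) + 2) < 1 := by rw [div_lt_one (by positivity)]; linarith [(Nat.cast_nonneg m : (0:ℝ) ≤ m)]
      exact mul_pos hε (by linarith)
    have helim : Tendsto e atTop (𝓝 ε) := by
      have h3 : Tendsto (fun m : ℕ => 1 / ((m : ℝ) + 2)) atTop (𝓝 0) := by
        apply Tendsto.div_atTop tendsto_const_nhds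
        exact tendsto_atTop_add_const_right _ _ tendsto_natCast_atTop_atTop
      have := (h3.const_sub 1).const_mul ε
      rw [he]; simpa using this
    have h2 : ∀ i, dblOsc (fun y => g y - ⟪v (x i), y⟫) (stdCube (T i) (x i) ε) =
        ⨆ m, dblOsc (fun y => g y - ⟪v (x i), y⟫) (stdCube (T i) (x i) (e m)) := by
      intro i
      rw [← iUnion_stdCube (T i) (x i) (fun m => (he1 m).le) helim,
        dblOsc_iUnion _ fun a b hab => stdCube_mono _ _ (hem hab)]
    simp only [h2]
    rw [ENNReal.finsetSum_iSup_of_monotone]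
    · exact iSup_le fun m => sum_dblOsc_le s (he0 m) (he1 m) hdisj hsub hv hg hu huv
    · intro i a b hab
      unfold dblOsc
      apply lintegral_mono'
      · exact Measure.prod_mono (Measure.restrict_mono (stdCube_mono _ _ (hem hab)) le_rfl)
          (Measure.restrict_mono (stdCube_mono _ _ (hem hab)) le_rfl)
      · exact le_rfl
  have h4 : ENNReal.ofReal (ε ^ n) * ∑ i ∈ s, ‖v (x i)‖ₑ ≤ (∫⁻ y, ‖v y‖ₑ) + ∫⁻ y, u y := by
    have hdisj' : (s : Set ι).Pairwise (Function.onFun Disjoint fun i => stdCube (T i) (x i) ε) :=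
      fun i hi j hj hij => hdisj hi hj hij
    rw [← lintegral_add_left hv.enorm.measurable, Finset.mul_sum]
    calc _ ≤ ∑ i ∈ s, ∫⁻ y in stdCube (T i) (x i) ε, (‖v y‖ₑ + u y) := by
          refine Finset.sum_le_sum fun i hi => ?_
          rw [← volume_stdCube (T i) (x i) hε, mul_comm, ← setLIntegral_const]
          refine setLIntegral_mono (hv.enorm.measurable.add hu) fun y hy => ?_
          have h3 : dist y (x i) ≤ n * ε := mem_closedBall.1 (stdCube_subset_closedBall _ _ hε hy)
          calc ‖v (x i)‖ₑ = ‖v y + (v (x i) - v y)‖ₑ := by congr 1; abel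
            _ ≤ ‖v y‖ₑ + ‖v (x i) - v y‖ₑ := enorm_add_le _ _
            _ ≤ _ := by rw [enorm_sub_rev]; gcongr; exact huv _ _ h3
      _ = ∫⁻ y in ⋃ i ∈ s, stdCube (T i) (x i) ε, (‖v y‖ₑ + u y) := by
          rw [lintegral_biUnion_finset hdisj' fun i _ => (isOpen_stdCube _ _ _).measurableSet]
      _ ≤ _ := setLIntegral_le_lintegral _ _
  calc _ ≤ ENNReal.ofReal (ε ^ (n - 1)) * ∑ i ∈ s, ((ENNReal.ofReal (ε ^ n))⁻¹ * ((ENNReal.ofReal (ε ^ n))⁻¹ *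
        dblOsc (fun y => g y - ⟪v (x i), y⟫) (stdCube (T i) (x i) ε)) + ENNReal.ofReal (ε / 4) * ‖v (x i)‖ₑ) := by
        gcongr with i hi
        exact ofReal_average_osc_le _ _ _ hε (hgm.mono_measure (Measure.restrict_mono (hsub i hi) le_rfl))
    _ = ENNReal.ofReal (ε ^ (n - 1)) * ((ENNReal.ofReal (ε ^ n))⁻¹ * ((ENNReal.ofReal (ε ^ n))⁻¹ *
        ∑ i ∈ s, dblOsc (fun y => g y - ⟪v (x i), y⟫) (stdCube (T i) (x i) ε))) +
        ENNReal.ofReal (ε ^ (n - 1)) * ENNReal.ofReal (ε / 4) * ∑ i ∈ s, ‖v (x i)‖ₑ := by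
        rw [Finset.sum_add_distrib, mul_add, ← Finset.mul_sum, ← Finset.mul_sum, ← Finset.mul_sum]
        ring
    _ ≤ ENNReal.ofReal (ε ^ (n - 1)) * ((ENNReal.ofReal (ε ^ n))⁻¹ * ((ENNReal.ofReal (ε ^ n))⁻¹ *
        (ENNReal.ofReal (ε ^ n) * ENNReal.ofReal (ε / 2) * (B + ∫⁻ y, u y)))) +
        (ENNReal.ofReal (ε ^ n) * ∑ i ∈ s, ‖v (x i)‖ₑ) / 4 := by
        refine add_le_add (by gcongr) (le_of_eq ?_)
        rw [← ENNReal.ofReal_mul (by positivity), show ε ^ (n - 1) * (ε / 4) = ε ^ n / 4 by rw [← hpow]; ring,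
          ENNReal.ofReal_div_of_pos (by norm_num), ENNReal.ofReal_ofNat, ENNReal.mul_div_right_comm]
    _ = (ENNReal.ofReal (ε ^ n) * (ENNReal.ofReal (ε ^ n))⁻¹) * ((ENNReal.ofReal (ε ^ n))⁻¹ *
        (ENNReal.ofReal (ε ^ (n - 1)) * ENNReal.ofReal (ε / 2)) * (B + ∫⁻ y, u y)) +
        (ENNReal.ofReal (ε ^ n) * ∑ i ∈ s, ‖v (x i)‖ₑ) / 4 := by ring
    _ = (B + ∫⁻ y, u y) / 2 + (ENNReal.ofReal (ε ^ n) * ∑ i ∈ s, ‖v (x i)‖ₑ) / 4 := by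
        rw [← ENNReal.ofReal_mul (by positivity), show ε ^ (n - 1) * (ε / 2) = ε ^ n / 2 by rw [← hpow]; ring,
          ENNReal.ofReal_div_of_pos (by norm_num), ENNReal.ofReal_ofNat, ENNReal.mul_inv_cancel hE0 hEt, one_mul,
          ← mul_div_assoc, ENNReal.inv_mul_cancel hE0 hEt]
        simp only [ENNReal.div_eq_inv_mul, mul_one]
    _ ≤ _ := by gcongr

end

section

theorem kappa_le {n : ℕ} (hn : 1 ≤ n) {Ω : Set (EuclideanSpace ℝ (Fin n))} {ε : ℝ} (hε : 0 < ε)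
    {g : EuclideanSpace ℝ (Fin n) → ℝ} (hgm : AEStronglyMeasurable g (volume.restrict Ω))
    {v : EuclideanSpace ℝ (Fin n) → EuclideanSpace ℝ (Fin n)}
    (hv : Continuous v) {B : ℝ≥0∞}
    (hg : ∀ W, IsCompact W → W ⊆ Ω → ∃ w : ℕ → EuclideanSpace ℝ (Fin n) → ℝ,
      (∀ k, ContDiff ℝ 1 (w k)) ∧
      (∀ᵐ x ∂volume.restrict W, Tendsto (fun k => w k x) atTop (𝓝 (g x))) ∧
      ∀ᶠ k in atTop, ∫⁻ x in W, ‖gradient (w k) x - v x‖ₑ ≤ B)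
    {u : EuclideanSpace ℝ (Fin n) → ℝ≥0∞} (hu : Measurable u)
    (huv : ∀ x y, dist x y ≤ n * ε → ‖v x - v y‖ₑ ≤ u x) :
    kappa n ε g Ω ≤ (B + ∫⁻ y, u y) / 2 + ((∫⁻ y, ‖v y‖ₑ) + ∫⁻ y, u y) / 4 := by
  unfold kappa
  simp only [ENNReal.mul_iSup]
  refine iSup_le fun F => iSup_le fun hF => iSup_le fun hdisj => ?_
  rw [ENNReal.tsum_eq_iSup_sum, ENNReal.mul_iSup]
  refine iSup_le fun s => ?_
  have hc : ∀ Q : F, ∃ (T : EuclideanSpace ℝ (Fin n) ≃ₗᵢ[ℝ] EuclideanSpace ℝ (Fin n))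
      (x : EuclideanSpace ℝ (Fin n)), (Q : Set (EuclideanSpace ℝ (Fin n))) = stdCube T x ε :=
    fun Q => (hF Q Q.2).1
  choose T x hTx using hc
  have := sum_average_osc_le hn s (T := T) (x := x) hε (fun i _ j _ hij => by
      have h : Disjoint (i : Set (EuclideanSpace ℝ (Fin n))) j := hdisj i.2 j.2 fun h => hij (Subtype.ext h)
      rwa [hTx i, hTx j] at h)
    (fun i _ => by rw [← hTx]; exact (hF i i.2).2) hgm hv hg hu huv
  simpa only [← hTx] using this

theorem limsup_kappa_le {n : ℕ} (hn : 1 ≤ n) {Ω : Set (EuclideanSpace ℝ (Fin n))}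
    {g : EuclideanSpace ℝ (Fin n) → ℝ} (hgm : AEStronglyMeasurable g (volume.restrict Ω))
    {v : EuclideanSpace ℝ (Fin n) → EuclideanSpace ℝ (Fin n)}
    (hv : Continuous v) (hvc : HasCompactSupport v) {B : ℝ≥0∞}
    (hg : ∀ W, IsCompact W → W ⊆ Ω → ∃ w : ℕ → EuclideanSpace ℝ (Fin n) → ℝ,
      (∀ k, ContDiff ℝ 1 (w k)) ∧
      (∀ᵐ x ∂volume.restrict W, Tendsto (fun k => w k x) atTop (𝓝 (g x))) ∧
      ∀ᶠ k in atTop, ∫⁻ x in W, ‖gradient (w k) x - v x‖ₑ ≤ B) :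
    limsup (fun ε => kappa n ε g Ω) (𝓝[>] (0:ℝ)) ≤ B / 2 + (∫⁻ y, ‖v y‖ₑ) / 4 := by
  obtain ⟨C, hC⟩ : ∃ C, C = cthickening 1 (tsupport v) := ⟨_, rfl⟩
  have hCc : IsCompact C := hC ▸ hvc.isCompact.cthickening
  have hVt : volume C ≠ ⊤ := hCc.measure_lt_top.ne
  have huc : UniformContinuous v := hvc.uniformContinuous_of_continuous hv
  have h1 : ∀ ω : ℝ, 0 < ω → limsup (fun ε => kappa n ε g Ω) (𝓝[>] (0:ℝ)) ≤
      (B + ENNReal.ofReal ω * volume C) / 2 + ((∫⁻ y, ‖v y‖ₑ) + ENNReal.ofReal ω * volume C) / 4 := by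
    intro ω hω
    obtain ⟨δ, hδ, hvδ⟩ := Metric.uniformContinuous_iff.1 huc ω hω
    refine limsup_le_of_le (by isBoundedDefault) ?_
    have hn0 : (0:ℝ) < n := by exact_mod_cast hn
    have hpos : 0 < min 1 (δ / 2) / n := by positivity
    filter_upwards [Ioo_mem_nhdsGT hpos] with ε hε
    have hε1 : n * ε < min 1 (δ / 2) := by rw [mul_comm]; exact (lt_div_iff₀ hn0).1 hε.2
    have hu : Measurable (C.indicator fun _ => ENNReal.ofReal ω) :=
      measurable_const.indicator hCc.measurableSet
    have := kappa_le hn hε.1 hgm hv hg hu fun x y hxy => by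
      by_cases hx : x ∈ C
      · rw [Set.indicator_of_mem hx, ← ofReal_norm]
        apply ENNReal.ofReal_le_ofReal
        rw [← dist_eq_norm]
        exact (hvδ (hxy.trans_lt (hε1.trans_le ((min_le_right _ _).trans (by linarith))))).le
      · have hx0 : x ∉ tsupport v := fun h => hx (hC ▸ self_subset_cthickening _ h)
        have hy0 : y ∉ tsupport v := fun h => hx (by
          rw [hC]
          exact mem_cthickening_of_dist_le x y 1 _ h (hxy.trans (hε1.le.trans (min_le_left _ _))))
        rw [image_eq_zero_of_notMem_tsupport hx0, image_eq_zero_of_notMem_tsupport hy0]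
        simp
    rwa [lintegral_indicator_const hCc.measurableSet] at this
  have h2 : Tendsto (fun ω : ℝ => ENNReal.ofReal ω * volume C) (𝓝[>] 0) (𝓝 0) := by
    have : Tendsto (fun ω : ℝ => ENNReal.ofReal ω) (𝓝[>] 0) (𝓝 0) := by
      simpa using (ENNReal.continuous_ofReal.tendsto 0).mono_left nhdsWithin_le_nhds
    simpa using ENNReal.Tendsto.mul_const this (Or.inr hVt)
  have h3 : Tendsto (fun ω : ℝ => (B + ENNReal.ofReal ω * volume C) / 2 +
      ((∫⁻ y, ‖v y‖ₑ) + ENNReal.ofReal ω * volume C) / 4) (𝓝[>] 0)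
      (𝓝 (B / 2 + (∫⁻ y, ‖v y‖ₑ) / 4)) := by
    have ha := ENNReal.Tendsto.div_const (h2.const_add B) (b := 2) (Or.inr (by norm_num))
    have hb := ENNReal.Tendsto.div_const (h2.const_add (∫⁻ y, ‖v y‖ₑ)) (b := 4) (Or.inr (by norm_num))
    simpa using ha.add hb
  exact ge_of_tendsto h3 (eventually_mem_nhdsWithin.mono h1)

end

section

/-- A fixed smooth even probability density supported in the unit ball. -/
def mollBump (n : ℕ) : ContDiffBump (0 : EuclideanSpace ℝ (Fin n)) :=
  ⟨1 / 2, 1, by norm_num, by norm_num⟩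

/-- The standard mollifier. -/
def moll (n : ℕ) (z : EuclideanSpace ℝ (Fin n)) : ℝ := (mollBump n).normed volume z

/-- The rescaled mollifier. -/
def mollAt (n : ℕ) (r : ℝ) (z : EuclideanSpace ℝ (Fin n)) : ℝ := (r ^ n)⁻¹ * moll n (r⁻¹ • z)

theorem moll_nonneg (n : ℕ) (z : EuclideanSpace ℝ (Fin n)) : 0 ≤ moll n z :=
  (mollBump n).nonneg_normed z

theorem moll_neg (n : ℕ) (z : EuclideanSpace ℝ (Fin n)) : moll n (-z) = moll n z :=
  (mollBump n).normed_neg z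

theorem support_moll (n : ℕ) : Function.support (moll n) = ball 0 1 :=
  (mollBump n).support_normed_eq

theorem moll_pos {n : ℕ} {z : EuclideanSpace ℝ (Fin n)} (hz : ‖z‖ < 1) : 0 < moll n z := by
  refine (moll_nonneg n z).lt_of_ne' ?_
  have : z ∈ Function.support (moll n) := by rw [support_moll]; simpa using hz
  exact this

theorem moll_eq_zero {n : ℕ} {z : EuclideanSpace ℝ (Fin n)} (hz : 1 ≤ ‖z‖) : moll n z = 0 := by
  by_contra h
  have : z ∈ Function.support (moll n) := h
  rw [support_moll] at this
  exact absurd (by simpa using this) hz.not_gt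

theorem contDiff_moll (n : ℕ) : ContDiff ℝ 1 (moll n) := (mollBump n).contDiff_normed

theorem integral_moll (n : ℕ) : ∫ z, moll n z = 1 := (mollBump n).integral_normed

theorem exists_moll_le (n : ℕ) : ∃ C : ℝ, 0 < C ∧ ∀ z, moll n z ≤ C := by
  have hc : HasCompactSupport (moll n) := (mollBump n).hasCompactSupport_normed
  obtain ⟨C, hC⟩ := hc.exists_bound_of_continuous (contDiff_moll n).continuous
  exact ⟨max C 1, by positivity, fun z => (le_abs_self _).trans ((hC z).trans (le_max_left _ _))⟩

variable {n : ℕ} {r : ℝ}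

theorem mollAt_nonneg (hr : 0 < r) (z : EuclideanSpace ℝ (Fin n)) : 0 ≤ mollAt n r z :=
  mul_nonneg (by positivity) (moll_nonneg _ _)

theorem mollAt_neg (z : EuclideanSpace ℝ (Fin n)) : mollAt n r (-z) = mollAt n r z := by
  simp [mollAt, moll_neg]

theorem mollAt_eq_zero (hr : 0 < r) {z : EuclideanSpace ℝ (Fin n)} (hz : r ≤ ‖z‖) : mollAt n r z = 0 := by
  rw [mollAt, moll_eq_zero, mul_zero]
  rw [norm_smul, norm_inv, Real.norm_of_nonneg hr.le, inv_mul_eq_div, one_le_div hr]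
  exact hz

theorem contDiff_mollAt (n : ℕ) (r : ℝ) : ContDiff ℝ 1 (mollAt n r) :=
  contDiff_const.mul ((contDiff_moll n).comp (contDiff_const_smul _))

theorem continuous_mollAt (n : ℕ) (r : ℝ) : Continuous (mollAt n r) := (contDiff_mollAt n r).continuous

theorem tsupport_mollAt_subset (hr : 0 < r) : tsupport (mollAt n r) ⊆ closedBall 0 r := by
  refine closure_minimal (fun z hz => ?_) isClosed_closedBall
  by_contra h
  exact hz (mollAt_eq_zero hr (by simpa using (not_le.1 (by simpa using h)).le))

theorem hasCompactSupport_mollAt (hr : 0 < r) : HasCompactSupport (mollAt n r) :=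
  (isCompact_closedBall _ _).of_isClosed_subset (isClosed_tsupport _) (tsupport_mollAt_subset hr)

theorem integrable_mollAt (hr : 0 < r) : Integrable (mollAt n r) :=
  (continuous_mollAt n r).integrable_of_hasCompactSupport (hasCompactSupport_mollAt hr)

/-- Rescaling integrals to the unit scale. -/
theorem integral_comp_rescale (hr : 0 < r) (x : EuclideanSpace ℝ (Fin n))
    (F : EuclideanSpace ℝ (Fin n) → ℝ) : (r ^ n)⁻¹ * ∫ z, F z = ∫ y, F (x + r • y) := by
  have h1 := Measure.integral_comp_smul (volume : Measure (EuclideanSpace ℝ (Fin n))) (fun y => F (x + y)) r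
  rw [h1, finrank_euclideanSpace_fin, integral_add_left_eq_self (μ := volume) F x,
    abs_of_pos (by positivity), smul_eq_mul]

theorem integral_mollAt_sub_mul (hr : 0 < r) (x z : EuclideanSpace ℝ (Fin n))
    (F : EuclideanSpace ℝ (Fin n) → ℝ) :
    ∫ y, mollAt n r (x + r • z - y) * F y = ∫ u, moll n (z - u) * F (x + r • u) := by
  have h1 := integral_comp_rescale hr x fun y => moll n (r⁻¹ • (x + r • z - y)) * F y
  rw [← integral_const_mul] at h1
  have e : ∀ u : EuclideanSpace ℝ (Fin n), r⁻¹ • (x + r • z - (x + r • u)) = z - u := fun u => by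
    rw [add_sub_add_left_eq_sub, ← smul_sub, smul_smul, inv_mul_cancel₀ hr.ne', one_smul]
  simp only [e] at h1
  rw [← h1]
  simp only [mollAt, mul_assoc]

theorem integral_mollAt (hr : 0 < r) : ∫ z, mollAt n r z = 1 := by
  have := integral_mollAt_sub_mul hr (0 : EuclideanSpace ℝ (Fin n)) 0 fun _ => 1
  simpa [moll_neg, mollAt_neg, integral_moll] using this

theorem lintegral_mollAt_sub (hr : 0 < r) (x : EuclideanSpace ℝ (Fin n)) :
    ∫⁻ z, ENNReal.ofReal (mollAt n r (z - x)) = 1 := by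
  rw [lintegral_sub_right_eq_self (fun z => ENNReal.ofReal (mollAt n r z)) x,
    ← ofReal_integral_eq_lintegral_ofReal (integrable_mollAt hr) (ae_of_all _ (mollAt_nonneg hr)),
    integral_mollAt hr, ENNReal.ofReal_one]

theorem mollAt_le {C : ℝ} (hC : ∀ z, moll n z ≤ C) (hr : 0 < r) (z : EuclideanSpace ℝ (Fin n)) :
    mollAt n r z ≤ (r ^ n)⁻¹ * C := by
  rw [mollAt]; gcongr; exact hC _

end

section

/-- The mollification of a function at scale `r`. -/
def mollify (n : ℕ) (r : ℝ) (F : EuclideanSpace ℝ (Fin n) → ℝ) (z : EuclideanSpace ℝ (Fin n)) : ℝ :=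
  ∫ y, mollAt n r (z - y) * F y

variable {n : ℕ} {r : ℝ}

theorem mollify_eq_convolution (F : EuclideanSpace ℝ (Fin n) → ℝ) :
    mollify n r F = convolution (mollAt n r) F (ContinuousLinearMap.lsmul ℝ ℝ) volume := by
  ext z
  rw [convolution_lsmul_swap]
  rfl

theorem contDiff_mollify (hr : 0 < r) {F : EuclideanSpace ℝ (Fin n) → ℝ} (hF : LocallyIntegrable F) :
    ContDiff ℝ 1 (mollify n r F) := by
  rw [mollify_eq_convolution]
  exact (hasCompactSupport_mollAt hr).contDiff_convolution_left _ (contDiff_mollAt n r) hF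

theorem fderiv_mollify_apply (hr : 0 < r) {F : EuclideanSpace ℝ (Fin n) → ℝ} (hF : LocallyIntegrable F)
    (z v : EuclideanSpace ℝ (Fin n)) :
    fderiv ℝ (mollify n r F) z v = ∫ y, fderiv ℝ (mollAt n r) (z - y) v * F y := by
  rw [mollify_eq_convolution,
    ((hasCompactSupport_mollAt hr).hasFDerivAt_convolution_left (ContinuousLinearMap.lsmul ℝ ℝ)
      (contDiff_mollAt n r) hF z).fderiv, convolution]
  have hc : ConvolutionExistsAt (fderiv ℝ (mollAt n r)) F z
      ((ContinuousLinearMap.lsmul ℝ ℝ).precompL (EuclideanSpace ℝ (Fin n))) volume :=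
    ((hasCompactSupport_mollAt hr).fderiv ℝ).convolutionExists_left _
      ((contDiff_mollAt n r).continuous_fderiv one_ne_zero) hF z
  rw [ContinuousLinearMap.integral_apply hc]
  simp only [ContinuousLinearMap.precompL_apply, ContinuousLinearMap.lsmul_apply, smul_eq_mul]
  rw [← integral_sub_left_eq_self (fun y => fderiv ℝ (mollAt n r) (z - y) v * F y) volume z]
  simp only [sub_sub_cancel]

theorem vdiv_smul_const {φ : EuclideanSpace ℝ (Fin n) → ℝ} (hφ : Differentiable ℝ φ)
    (v y : EuclideanSpace ℝ (Fin n)) : vdiv n (fun y => φ y • v) y = fderiv ℝ φ y v := by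
  unfold vdiv
  rw [((hφ y).hasFDerivAt.smul_const v).fderiv]
  conv_rhs => rw [← (EuclideanSpace.basisFun (Fin n) ℝ).sum_repr v]
  simp [map_sum, mul_comm]

theorem IsVariationPair.integral_mul_fderiv {f : EuclideanSpace ℝ (Fin n) → ℝ}
    {Ω : Set (EuclideanSpace ℝ (Fin n))} {μ : Measure (EuclideanSpace ℝ (Fin n))}
    {σ : EuclideanSpace ℝ (Fin n) → EuclideanSpace ℝ (Fin n)} (h : IsVariationPair n f Ω μ σ)
    {φ : EuclideanSpace ℝ (Fin n) → ℝ} (hφ : ContDiff ℝ 1 φ) (hc : HasCompactSupport φ)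
    (hs : tsupport φ ⊆ Ω) (v : EuclideanSpace ℝ (Fin n)) :
    ∫ x in Ω, f x * fderiv ℝ φ x v = - ∫ x, φ x * ⟪v, σ x⟫ ∂μ := by
  have h1 := h.2.2.2.2 (fun y => φ y • v) (hφ.smul contDiff_const) hc.smul_right
    ((closure_mono (Function.support_smul_subset_left φ fun _ => v)).trans hs)
  simpa only [vdiv_smul_const (hφ.differentiable one_ne_zero), real_inner_smul_left] using h1

theorem IsVariationPair.integrable_bdd_smul {f : EuclideanSpace ℝ (Fin n) → ℝ}
    {Ω : Set (EuclideanSpace ℝ (Fin n))} {μ : Measure (EuclideanSpace ℝ (Fin n))}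
    {σ : EuclideanSpace ℝ (Fin n) → EuclideanSpace ℝ (Fin n)} (h : IsVariationPair n f Ω μ σ)
    {φ : EuclideanSpace ℝ (Fin n) → ℝ} (hφ : Continuous φ) (hc : HasCompactSupport φ) :
    Integrable (fun y => φ y • σ y) μ := by
  have := h.1
  obtain ⟨C, hC⟩ := hc.exists_bound_of_continuous hφ
  refine Integrable.of_bound (hφ.aestronglyMeasurable.smul h.2.2.1) C ?_
  filter_upwards [h.2.2.2.1] with y hy
  rw [norm_smul, hy, mul_one]
  exact hC y

theorem hasCompactSupport_mollAt_sub (hr : 0 < r) (z : EuclideanSpace ℝ (Fin n)) :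
    HasCompactSupport fun y => mollAt n r (z - y) :=
  (hasCompactSupport_mollAt hr).comp_homeomorph (Homeomorph.subLeft z)

theorem gradient_mollify {f F : EuclideanSpace ℝ (Fin n) → ℝ} {Ω : Set (EuclideanSpace ℝ (Fin n))}
    {μ : Measure (EuclideanSpace ℝ (Fin n))} {σ : EuclideanSpace ℝ (Fin n) → EuclideanSpace ℝ (Fin n)}
    (h : IsVariationPair n f Ω μ σ) (hr : 0 < r) (hF : LocallyIntegrable F)
    {z : EuclideanSpace ℝ (Fin n)} (hz : closedBall z r ⊆ Ω) (hFf : ∀ y ∈ closedBall z r, F y = f y) :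
    gradient (mollify n r F) z = ∫ y, mollAt n r (z - y) • σ y ∂μ := by
  refine ext_inner_left ℝ fun v => ?_
  have hφ : ContDiff ℝ 1 fun y => mollAt n r (z - y) :=
    (contDiff_mollAt n r).comp (contDiff_const.sub contDiff_id)
  have hφc := hasCompactSupport_mollAt_sub hr z
  have hsupp : tsupport (fun y => mollAt n r (z - y)) ⊆ closedBall z r := by
    refine closure_minimal (fun y hy => ?_) isClosed_closedBall
    by_contra hn
    refine hy (mollAt_eq_zero hr ?_)
    rw [mem_closedBall', dist_eq_norm, not_le] at hn
    exact hn.le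
  have hd : ∀ y, fderiv ℝ (fun y => mollAt n r (z - y)) y v = - fderiv ℝ (mollAt n r) (z - y) v := by
    intro y
    have h1 := ((contDiff_mollAt n r).differentiable one_ne_zero (z - y)).hasFDerivAt
    have h2 := HasFDerivAt.comp (g := mollAt n r) (f := fun y => z - y) y h1 ((hasFDerivAt_id y).const_sub z)
    rw [show (fun y => mollAt n r (z - y)) = mollAt n r ∘ fun y => z - y from rfl, h2.fderiv]
    simp
  have h1 := h.integral_mul_fderiv hφ hφc (hsupp.trans hz) v
  have hI := integral_inner (𝕜 := ℝ) (h.integrable_bdd_smul hφ.continuous hφc) v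
  rw [real_inner_comm, gradient, InnerProductSpace.toDual_symm_apply, fderiv_mollify_apply hr hF, ← hI]
  simp only [real_inner_smul_right]
  rw [← neg_eq_iff_eq_neg.2 h1, ← integral_neg]
  have hout : ∀ y, y ∉ closedBall z r → fderiv ℝ (mollAt n r) (z - y) v = 0 := fun y hy => by
    have := hd y
    rw [fderiv_of_notMem_tsupport ℝ fun h => hy (hsupp h)] at this
    simpa using this.symm
  rw [setIntegral_eq_integral_of_forall_compl_eq_zero]
  · refine integral_congr_ae (ae_of_all _ fun y => ?_)
    by_cases hy : y ∈ closedBall z r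
    · simp only [hd, hFf y hy]; ring
    · simp only [hd, hout y hy]; simp
  · intro y hy
    rw [hd, hout y fun h => hy (hz h)]
    simp

end

section

variable {n : ℕ} {r : ℝ}

/-- The function `p` is the `L¹` blow-up limit of `f` at `x`. -/
def HasBlowUp (n : ℕ) (f : EuclideanSpace ℝ (Fin n) → ℝ) (x : EuclideanSpace ℝ (Fin n))
    (p : EuclideanSpace ℝ (Fin n) → ℝ) : Prop :=
  Tendsto (fun r : ℝ => ∫⁻ y in ball 0 2, ‖f (x + r • y) - p y‖ₑ) (𝓝[>] 0) (𝓝 0)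

theorem measurableEmbedding_rescale (hr : 0 < r) (x : EuclideanSpace ℝ (Fin n)) :
    MeasurableEmbedding fun y : EuclideanSpace ℝ (Fin n) => x + r • y :=
  (((Homeomorph.smulOfNeZero r hr.ne').trans (Homeomorph.addLeft x)).measurableEmbedding :)

theorem map_rescale (hr : 0 < r) (x : EuclideanSpace ℝ (Fin n)) :
    Measure.map (fun y : EuclideanSpace ℝ (Fin n) => x + r • y) volume =
      ENNReal.ofReal (r ^ n)⁻¹ • volume := by
  have h1 : Measure.map (fun y : EuclideanSpace ℝ (Fin n) => x + r • y) volume =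
      Measure.map (x + ·) (Measure.map (r • ·) volume) := by
    rw [Measure.map_map (measurable_const_add x) (measurable_const_smul r)]; rfl
  rw [h1, Measure.map_addHaar_smul _ hr.ne', Measure.map_smul, map_add_left_eq_self,
    finrank_euclideanSpace_fin, abs_of_pos (by positivity)]

theorem lintegral_rescale (hr : 0 < r) (x : EuclideanSpace ℝ (Fin n))
    (g : EuclideanSpace ℝ (Fin n) → ℝ≥0∞) :
    ∫⁻ y, g (x + r • y) = ENNReal.ofReal (r ^ n)⁻¹ * ∫⁻ z, g z := by
  rw [← (measurableEmbedding_rescale hr x).lintegral_map, map_rescale hr, lintegral_smul_measure,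
    smul_eq_mul]

theorem setLIntegral_rescale (hr : 0 < r) (x : EuclideanSpace ℝ (Fin n)) (s : ℝ)
    (g : EuclideanSpace ℝ (Fin n) → ℝ≥0∞) :
    ∫⁻ y in ball 0 s, g (x + r • y) = ENNReal.ofReal (r ^ n)⁻¹ * ∫⁻ z in ball x (r * s), g z := by
  rw [← lintegral_indicator measurableSet_ball, ← lintegral_indicator measurableSet_ball,
    ← lintegral_rescale hr x]
  congr 1; ext y
  have : y ∈ ball (0 : EuclideanSpace ℝ (Fin n)) s ↔ x + r • y ∈ ball x (r * s) := by
    rw [mem_ball_zero_iff, mem_ball, dist_eq_norm, add_sub_cancel_left, norm_smul,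
      Real.norm_of_nonneg hr.le, mul_lt_mul_iff_right₀ hr]
  by_cases hy : y ∈ ball (0 : EuclideanSpace ℝ (Fin n)) s
  · rw [Set.indicator_of_mem hy, Set.indicator_of_mem (this.1 hy)]
  · rw [Set.indicator_of_notMem hy, Set.indicator_of_notMem (fun h => hy (this.2 h))]

theorem quasiMeasurePreserving_rescale (hr : 0 < r) (x : EuclideanSpace ℝ (Fin n)) :
    Measure.QuasiMeasurePreserving (fun y : EuclideanSpace ℝ (Fin n) => x + r • y) volume volume :=
  ⟨(measurableEmbedding_rescale hr x).measurable, by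
    rw [map_rescale hr x]; exact Measure.smul_absolutelyContinuous⟩

theorem locallyIntegrable_rescale (hr : 0 < r) (x : EuclideanSpace ℝ (Fin n))
    {F : EuclideanSpace ℝ (Fin n) → ℝ} (hF : LocallyIntegrable F) :
    LocallyIntegrable fun y => F (x + r • y) := by
  rw [locallyIntegrable_iff]
  intro K hK
  obtain ⟨s, hs⟩ := hK.isBounded.subset_ball 0
  refine IntegrableOn.mono_set ?_ hs
  refine ⟨(hF.aestronglyMeasurable.comp_quasiMeasurePreserving
    (quasiMeasurePreserving_rescale hr x)).restrict, ?_⟩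
  rw [hasFiniteIntegral_iff_enorm, setLIntegral_rescale hr x s fun z => ‖F z‖ₑ]
  refine ENNReal.mul_lt_top ENNReal.ofReal_lt_top ?_
  have := (hF.integrableOn_isCompact (isCompact_closedBall x (r * s))).mono_set ball_subset_closedBall
  exact this.2

theorem mollify_rescale (hr : 0 < r) (F : EuclideanSpace ℝ (Fin n) → ℝ) (x z : EuclideanSpace ℝ (Fin n)) :
    mollify n r F (x + r • z) = mollify n 1 (fun u => F (x + r • u)) z := by
  unfold mollify
  rw [integral_mollAt_sub_mul hr]
  simp [mollAt]

theorem integrable_mollAt_mul (hr : 0 < r) {F : EuclideanSpace ℝ (Fin n) → ℝ} (hF : LocallyIntegrable F)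
    (z : EuclideanSpace ℝ (Fin n)) : Integrable fun y => mollAt n r (z - y) * F y :=
  hF.integrable_smul_left_of_hasCompactSupport
    ((continuous_mollAt n r).comp (continuous_const.sub continuous_id)) (hasCompactSupport_mollAt_sub hr z)

theorem enorm_mollify_sub_le {C : ℝ} (hC : ∀ z, moll n z ≤ C) {F p : EuclideanSpace ℝ (Fin n) → ℝ}
    (hF : LocallyIntegrable F) (hp : LocallyIntegrable p) {z : EuclideanSpace ℝ (Fin n)} (hz : ‖z‖ ≤ 1) :
    ‖mollify n 1 F z - mollify n 1 p z‖ₑ ≤ ENNReal.ofReal C * ∫⁻ u in ball 0 2, ‖F u - p u‖ₑ := by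
  unfold mollify
  rw [← integral_sub (integrable_mollAt_mul one_pos hF z) (integrable_mollAt_mul one_pos hp z)]
  refine (enorm_integral_le_lintegral_enorm _).trans ?_
  rw [← lintegral_const_mul' _ _ ENNReal.ofReal_ne_top, ← lintegral_indicator measurableSet_ball]
  refine lintegral_mono fun u => ?_
  by_cases hu : u ∈ ball (0 : EuclideanSpace ℝ (Fin n)) 2
  · rw [Set.indicator_of_mem hu, ← mul_sub, enorm_mul]
    gcongr
    rw [Real.enorm_of_nonneg (mollAt_nonneg one_pos _)]
    apply ENNReal.ofReal_le_ofReal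
    simpa using mollAt_le hC one_pos (z - u)
  · rw [Set.indicator_of_notMem hu, mollAt_eq_zero one_pos]
    · simp
    · have h1 : 2 ≤ ‖u‖ := by simpa using hu
      have h2 := norm_sub_norm_le u z
      rw [norm_sub_rev] at h2
      linarith

theorem mollify_const (hr : 0 < r) (c : ℝ) (z : EuclideanSpace ℝ (Fin n)) :
    mollify n r (fun _ => c) z = c := by
  unfold mollify
  rw [integral_mul_const, integral_sub_left_eq_self (fun y => mollAt n r y) volume z, integral_mollAt hr,
    one_mul]

/-- Mollifications at scale `r` converge to the mollified profile, uniformly on balls of radius `r`. -/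
theorem HasBlowUp.mollify_tendsto {F p : EuclideanSpace ℝ (Fin n) → ℝ} {x : EuclideanSpace ℝ (Fin n)}
    (h : HasBlowUp n F x p) (hF : LocallyIntegrable F) (hp : LocallyIntegrable p)
    {z : EuclideanSpace ℝ (Fin n)} (hz : ‖z‖ ≤ 1) :
    Tendsto (fun r => mollify n r F (x + r • z)) (𝓝[>] 0) (𝓝 (mollify n 1 p z)) := by
  obtain ⟨C, hC0, hC⟩ := exists_moll_le n
  rw [tendsto_iff_edist_tendsto_0]
  have h1 := ENNReal.Tendsto.const_mul (a := ENNReal.ofReal C) h (Or.inr ENNReal.ofReal_ne_top)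
  rw [mul_zero] at h1
  refine tendsto_of_tendsto_of_tendsto_of_le_of_le' tendsto_const_nhds h1
    (Eventually.of_forall fun _ => zero_le) ?_
  filter_upwards [self_mem_nhdsWithin] with r hr
  rw [mollify_rescale hr, edist_eq_enorm_sub]
  exact enorm_mollify_sub_le hC (locallyIntegrable_rescale hr x hF) hp hz

theorem ae_hasBlowUp {F : EuclideanSpace ℝ (Fin n) → ℝ} (hF : LocallyIntegrable F) :
    ∀ᵐ x, HasBlowUp n F x fun _ => F x := by
  filter_upwards [(Besicovitch.vitaliFamily volume).ae_tendsto_lintegral_enorm_sub_div hF] with x hx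
  have h1 := hx.comp (Besicovitch.tendsto_filterAt volume x)
  have h2 : Tendsto (fun r : ℝ => r * 2) (𝓝[>] 0) (𝓝[>] 0) := by
    refine tendsto_nhdsWithin_iff.2 ⟨?_, ?_⟩
    · have : Tendsto (fun r : ℝ => r * 2) (𝓝 0) (𝓝 (0 * 2)) := tendsto_id.mul_const 2
      rw [zero_mul] at this
      exact this.mono_left nhdsWithin_le_nhds
    · filter_upwards [self_mem_nhdsWithin] with r hr
      exact mul_pos (Set.mem_Ioi.1 hr) (by norm_num : (0:ℝ) < 2)
  have h3 := ENNReal.Tendsto.const_mul (a := volume (closedBall (0 : EuclideanSpace ℝ (Fin n)) 2))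
    (h1.comp h2) (Or.inr measure_closedBall_lt_top.ne)
  rw [mul_zero] at h3
  refine tendsto_of_tendsto_of_tendsto_of_le_of_le' tendsto_const_nhds h3
    (Eventually.of_forall fun _ => zero_le) ?_
  filter_upwards [self_mem_nhdsWithin] with r (hr : 0 < r)
  rw [setLIntegral_rescale hr x 2 fun z => ‖F z - F x‖ₑ]
  have hv : volume (closedBall x (r * 2)) =
      ENNReal.ofReal (r ^ n) * volume (closedBall (0 : EuclideanSpace ℝ (Fin n)) 2) := by
    rw [Measure.addHaar_closedBall_mul _ _ hr.le zero_le_two]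
    simp
  have hv0 : volume (closedBall (0 : EuclideanSpace ℝ (Fin n)) 2) ≠ 0 :=
    (measure_closedBall_pos _ _ two_pos).ne'
  have hvt : volume (closedBall (0 : EuclideanSpace ℝ (Fin n)) 2) ≠ ⊤ := measure_closedBall_lt_top.ne
  simp only [Function.comp_apply]
  rw [hv, ENNReal.div_eq_inv_mul, ENNReal.mul_inv (Or.inr hvt) (Or.inr hv0), mul_comm (_)⁻¹ (_)⁻¹,
    mul_assoc, ← mul_assoc, ENNReal.mul_inv_cancel hv0 hvt, one_mul, ENNReal.ofReal_inv_of_pos (by positivity)]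
  gcongr
  exact ball_subset_closedBall

end

section

variable {n : ℕ} {r : ℝ}

theorem measurable_ofReal_moll (n : ℕ) : Measurable fun y => ENNReal.ofReal (moll n y) :=
  (contDiff_moll n).continuous.measurable.ennreal_ofReal

theorem lintegral_moll (n : ℕ) : ∫⁻ y, ENNReal.ofReal (moll n y) = 1 := by
  have := lintegral_mollAt_sub one_pos (0 : EuclideanSpace ℝ (Fin n))
  simpa [mollAt] using this

theorem lintegral_mollAt_mul (hr : 0 < r) (x : EuclideanSpace ℝ (Fin n))
    (H : EuclideanSpace ℝ (Fin n) → ℝ≥0∞) :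
    ∫⁻ z, ENNReal.ofReal (mollAt n r (z - x)) * H z =
      ∫⁻ y, ENNReal.ofReal (moll n y) * H (x + r • y) := by
  have h1 := lintegral_rescale hr x fun z => ENNReal.ofReal (moll n (r⁻¹ • (z - x))) * H z
  simp only [add_sub_cancel_left, smul_smul, inv_mul_cancel₀ hr.ne', one_smul] at h1
  rw [h1, ← lintegral_const_mul' _ _ ENNReal.ofReal_ne_top]
  congr 1; ext z
  rw [mollAt, ENNReal.ofReal_mul (by positivity), mul_assoc]

theorem lintegral_moll_comp_le {C : ℝ} (hC : ∀ z, moll n z ≤ C) {F p : EuclideanSpace ℝ (Fin n) → ℝ}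
    (hF : LocallyIntegrable F) (hp : LocallyIntegrable p) {L : NNReal} {a : ℝ → ℝ} (ha : LipschitzWith L a) :
    ∫⁻ y, ENNReal.ofReal (moll n y) * ENNReal.ofReal (a (F y - mollify n 1 F y)) ≤
      (∫⁻ y, ENNReal.ofReal (moll n y) * ENNReal.ofReal (a (p y - mollify n 1 p y))) +
        L * (2 * ENNReal.ofReal C) * ∫⁻ u in ball 0 2, ‖F u - p u‖ₑ := by
  obtain ⟨e, he⟩ : ∃ e, e = ∫⁻ u in ball 0 2, ‖F u - p u‖ₑ := ⟨_, rfl⟩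
  have hm := measurable_ofReal_moll n
  have hFm := hF.aestronglyMeasurable
  have hpm := hp.aestronglyMeasurable
  have hmF : Continuous (mollify n 1 F) := (contDiff_mollify one_pos hF).continuous
  have hmp : Continuous (mollify n 1 p) := (contDiff_mollify one_pos hp).continuous
  have hae : AEMeasurable (fun y => ‖F y - p y‖ₑ) := (hFm.sub hpm).enorm
  have key : ∀ y, ENNReal.ofReal (moll n y) * ENNReal.ofReal (a (F y - mollify n 1 F y)) ≤
      ENNReal.ofReal (moll n y) * ENNReal.ofReal (a (p y - mollify n 1 p y)) +
        L * (ENNReal.ofReal (moll n y) * ‖F y - p y‖ₑ +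
          ENNReal.ofReal (moll n y) * (ENNReal.ofReal C * e)) := by
    intro y
    rcases lt_or_ge ‖y‖ 1 with hy | hy
    · have h1 : ENNReal.ofReal (a (F y - mollify n 1 F y)) ≤
          ENNReal.ofReal (a (p y - mollify n 1 p y)) + L * (‖F y - p y‖ₑ + ENNReal.ofReal C * e) := by
        have h2 := ha (F y - mollify n 1 F y) (p y - mollify n 1 p y)
        have h3 : edist (F y - mollify n 1 F y) (p y - mollify n 1 p y) ≤
            ‖F y - p y‖ₑ + ENNReal.ofReal C * e := by
          rw [edist_eq_enorm_sub]
          calc ‖F y - mollify n 1 F y - (p y - mollify n 1 p y)‖ₑ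
              = ‖(F y - p y) - (mollify n 1 F y - mollify n 1 p y)‖ₑ := by congr 1; ring
            _ ≤ ‖F y - p y‖ₑ + ‖mollify n 1 F y - mollify n 1 p y‖ₑ := enorm_sub_le
            _ ≤ _ := by
              gcongr
              rw [he]
              exact enorm_mollify_sub_le hC hF hp hy.le
        rw [edist_eq_enorm_sub] at h2
        calc _ = ENNReal.ofReal (a (p y - mollify n 1 p y) +
              (a (F y - mollify n 1 F y) - a (p y - mollify n 1 p y))) := by congr 1; ring
          _ ≤ ENNReal.ofReal (a (p y - mollify n 1 p y)) + ENNReal.ofReal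
              (a (F y - mollify n 1 F y) - a (p y - mollify n 1 p y)) := ENNReal.ofReal_add_le
          _ ≤ _ := by
            gcongr
            refine le_trans ?_ (h2.trans (by gcongr))
            exact Real.ofReal_le_enorm _
      calc _ ≤ ENNReal.ofReal (moll n y) * (ENNReal.ofReal (a (p y - mollify n 1 p y)) +
            L * (‖F y - p y‖ₑ + ENNReal.ofReal C * e)) := by gcongr
        _ = _ := by ring
    · simp [moll_eq_zero hy]
  have hac : Continuous a := ha.continuous
  have hap : AEMeasurable (fun y => ENNReal.ofReal (a (p y - mollify n 1 p y))) :=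
    (hac.comp_aestronglyMeasurable (hpm.sub hmp.aestronglyMeasurable)).aemeasurable.ennreal_ofReal
  have hap2 : AEMeasurable fun y => ENNReal.ofReal (moll n y) * ENNReal.ofReal (a (p y - mollify n 1 p y)) :=
    hm.aemeasurable.mul hap
  have hae2 : AEMeasurable fun y => ENNReal.ofReal (moll n y) * ‖F y - p y‖ₑ := hm.aemeasurable.mul hae
  calc _ ≤ _ := lintegral_mono key
    _ = (∫⁻ y, ENNReal.ofReal (moll n y) * ENNReal.ofReal (a (p y - mollify n 1 p y))) +
        L * ((∫⁻ y, ENNReal.ofReal (moll n y) * ‖F y - p y‖ₑ) + ENNReal.ofReal C * e) := by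
        rw [lintegral_add_left' hap2, lintegral_const_mul' _ _ ENNReal.coe_ne_top,
          lintegral_add_left' hae2, lintegral_mul_const _ hm, lintegral_moll, one_mul]
    _ ≤ (∫⁻ y, ENNReal.ofReal (moll n y) * ENNReal.ofReal (a (p y - mollify n 1 p y))) +
        L * (ENNReal.ofReal C * e + ENNReal.ofReal C * e) := by
        gcongr
        rw [he, ← lintegral_const_mul' _ _ ENNReal.ofReal_ne_top, ← lintegral_indicator measurableSet_ball]
        refine lintegral_mono fun u => ?_
        by_cases hu : u ∈ ball (0 : EuclideanSpace ℝ (Fin n)) 2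
        · rw [Set.indicator_of_mem hu]
          gcongr
          exact hC u
        · rw [Set.indicator_of_notMem hu, moll_eq_zero]
          · simp
          · have h1 : 2 ≤ ‖u‖ := by simpa using hu
            linarith
    _ = _ := by rw [← he]; ring

theorem HasBlowUp.tendsto_lintegral {F p : EuclideanSpace ℝ (Fin n) → ℝ} {x : EuclideanSpace ℝ (Fin n)}
    (h : HasBlowUp n F x p) (hF : LocallyIntegrable F) (hp : LocallyIntegrable p)
    {L : NNReal} {a : ℝ → ℝ} (ha : LipschitzWith L a) (ha1 : ∀ s, a s ≤ 1) :
    Tendsto (fun r => ∫⁻ z, ENNReal.ofReal (mollAt n r (z - x)) *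
        ENNReal.ofReal (a (F z - mollify n r F z))) (𝓝[>] 0)
      (𝓝 (∫⁻ y, ENNReal.ofReal (moll n y) * ENNReal.ofReal (a (p y - mollify n 1 p y)))) := by
  obtain ⟨C, hC0, hC⟩ := exists_moll_le n
  obtain ⟨θ, hθ⟩ : ∃ θ, θ = ∫⁻ y, ENNReal.ofReal (moll n y) *
    ENNReal.ofReal (a (p y - mollify n 1 p y)) := ⟨_, rfl⟩
  have hθ1 : θ ≤ 1 := by
    rw [hθ, ← lintegral_moll n]
    refine lintegral_mono fun y => ?_
    calc _ ≤ ENNReal.ofReal (moll n y) * 1 := by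
          gcongr
          simpa using ENNReal.ofReal_le_ofReal (ha1 (p y - mollify n 1 p y))
      _ = _ := mul_one _
  have hE : Tendsto (fun r : ℝ => (L * (2 * ENNReal.ofReal C)) *
      ∫⁻ u in ball 0 2, ‖F (x + r • u) - p u‖ₑ) (𝓝[>] 0) (𝓝 0) := by
    have := ENNReal.Tendsto.const_mul (a := L * (2 * ENNReal.ofReal C)) h
      (Or.inr (ENNReal.mul_ne_top ENNReal.coe_ne_top
        (ENNReal.mul_ne_top (by norm_num) ENNReal.ofReal_ne_top)))
    simpa using this
  have h1 := hE.const_add θ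
  have h2 := ENNReal.Tendsto.sub (tendsto_const_nhds (x := θ)) hE (Or.inl (ne_top_of_le_ne_top (by simp) hθ1))
  rw [add_zero] at h1
  rw [tsub_zero] at h2
  rw [← hθ]
  refine tendsto_of_tendsto_of_tendsto_of_le_of_le' h2 h1 ?_ ?_
  · filter_upwards [self_mem_nhdsWithin] with r (hr : 0 < r)
    rw [lintegral_mollAt_mul hr, tsub_le_iff_right, hθ]
    simp only [mollify_rescale hr]
    have := lintegral_moll_comp_le hC hp (locallyIntegrable_rescale hr x hF) ha
    simpa only [enorm_sub_rev (p _)] using this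
  · filter_upwards [self_mem_nhdsWithin] with r (hr : 0 < r)
    rw [lintegral_mollAt_mul hr, hθ]
    simp only [mollify_rescale hr]
    exact lintegral_moll_comp_le hC (locallyIntegrable_rescale hr x hF) hp ha

end

section

variable {n : ℕ} {r : ℝ}

/-- The two-valued profile jumping across the hyperplane orthogonal to `ν`. -/
def stepFun (n : ℕ) (ν : EuclideanSpace ℝ (Fin n)) (a b : ℝ) (y : EuclideanSpace ℝ (Fin n)) : ℝ :=
  if 0 < ⟪y, ν⟫ then a else b

theorem measurableSet_halfSpace (ν : EuclideanSpace ℝ (Fin n)) : MeasurableSet {y | 0 < ⟪y, ν⟫} :=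
  (isOpen_lt continuous_const (continuous_id.inner continuous_const)).measurableSet

theorem measurable_stepFun (ν : EuclideanSpace ℝ (Fin n)) (a b : ℝ) : Measurable (stepFun n ν a b) :=
  Measurable.ite (measurableSet_halfSpace ν) measurable_const measurable_const

theorem locallyIntegrable_stepFun (ν : EuclideanSpace ℝ (Fin n)) (a b : ℝ) :
    LocallyIntegrable (stepFun n ν a b) := by
  refine (locallyIntegrable_const (max |a| |b|)).mono (measurable_stepFun ν a b).aestronglyMeasurable
    (ae_of_all _ fun y => ?_)
  have h0 : 0 ≤ max |a| |b| := le_max_of_le_left (abs_nonneg a)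
  rw [Real.norm_of_nonneg h0, Real.norm_eq_abs]
  unfold stepFun
  split_ifs
  · exact le_max_left _ _
  · exact le_max_right _ _

theorem stepFun_self (ν : EuclideanSpace ℝ (Fin n)) (a : ℝ) : stepFun n ν a a = fun _ => a := by
  ext y; simp [stepFun]

theorem stepFun_sub_mollify_ne {ν : EuclideanSpace ℝ (Fin n)} (hν : ‖ν‖ = 1) {a b : ℝ} (hab : a ≠ b)
    {y : EuclideanSpace ℝ (Fin n)} (hy : ‖y‖ < 1) :
    stepFun n ν a b y - mollify n 1 (stepFun n ν a b) y ≠ 0 := by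
  have hνν : ⟪ν, ν⟫ = 1 := by rw [real_inner_self_eq_norm_sq, hν, one_pow]
  have hyν : |⟪y, ν⟫| < 1 := by
    have := abs_real_inner_le_norm y ν
    rw [hν, mul_one] at this
    exact this.trans_lt hy
  obtain ⟨hy1, hy2⟩ := abs_lt.1 hyν
  obtain ⟨q, hq⟩ : ∃ q, q = mollify n 1 (fun u => stepFun n ν a b y - stepFun n ν a b u) y := ⟨_, rfl⟩
  have hLI := locallyIntegrable_stepFun ν a b
  have e1 : stepFun n ν a b y - mollify n 1 (stepFun n ν a b) y = q := by
    rw [hq]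
    conv_lhs => rw [← mollify_const one_pos (stepFun n ν a b y) y]
    unfold mollify
    rw [← integral_sub (integrable_mollAt_mul one_pos (locallyIntegrable_const _) y)
      (integrable_mollAt_mul one_pos hLI y)]
    simp only [mul_sub]
  have key : ∀ (A : Set (EuclideanSpace ℝ (Fin n))) (d : ℝ), MeasurableSet A → d ≠ 0 →
      (∀ u, stepFun n ν a b y - stepFun n ν a b u = d * A.indicator (fun _ => (1:ℝ)) u) →
      (∃ O ⊆ A, IsOpen O ∧ ∃ t : ℝ, |t| < 1 ∧ y + t • ν ∈ O) → q ≠ 0 := by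
    rintro A d hA hd hAd ⟨O, hOA, hO, t, ht, htO⟩
    have e2 : q = d * ∫ u, mollAt n 1 (y - u) * A.indicator (fun _ => (1:ℝ)) u := by
      rw [hq, ← integral_const_mul]
      unfold mollify
      congr 1; ext u
      show _ * (stepFun n ν a b y - stepFun n ν a b u) = _
      rw [hAd]; ring
    rw [e2]
    refine mul_ne_zero hd (ne_of_gt ?_)
    rw [integral_pos_iff_support_of_nonneg]
    · have hO2 : IsOpen (O ∩ ball y 1) := hO.inter isOpen_ball
      refine lt_of_lt_of_le (hO2.measure_pos volume ⟨y + t • ν, htO, ?_⟩) (measure_mono ?_)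
      · rw [mem_ball, dist_eq_norm, add_sub_cancel_left, norm_smul, hν, mul_one]
        exact ht
      · rintro u ⟨hu, hu2⟩
        rw [Function.mem_support, Set.indicator_of_mem (hOA hu), mul_one]
        have : 0 < moll n (y - u) := moll_pos (by rwa [← dist_eq_norm, dist_comm])
        simpa [mollAt] using this.ne'
    · intro u
      exact mul_nonneg (mollAt_nonneg one_pos _) (Set.indicator_nonneg (fun _ _ => zero_le_one) _)
    · refine integrable_mollAt_mul one_pos ?_ y
      exact (locallyIntegrable_const (1:ℝ)).indicator hA
  rw [e1]
  have hin : ∀ t : ℝ, ⟪y + t • ν, ν⟫ = ⟪y, ν⟫ + t := fun t => by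
    rw [inner_add_left, real_inner_smul_left, hνν, mul_one]
  rcases lt_or_ge 0 ⟪y, ν⟫ with h | h
  · refine key {u | 0 < ⟪u, ν⟫}ᶜ (a - b) (measurableSet_halfSpace ν).compl (sub_ne_zero.2 hab) (fun u => ?_)
      ⟨{u | ⟪u, ν⟫ < 0}, fun u hu (hu' : 0 < ⟪u, ν⟫) => lt_asymm hu hu',
        isOpen_lt (continuous_id.inner continuous_const) continuous_const,
        -((1 + ⟪y, ν⟫) / 2), ?_, ?_⟩
    · by_cases hu : 0 < ⟪u, ν⟫
      · rw [Set.indicator_of_notMem (s := {u | 0 < ⟪u, ν⟫}ᶜ) (fun h' => h' hu)]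
        simp [stepFun, hu, h]
      · rw [Set.indicator_of_mem (s := {u | 0 < ⟪u, ν⟫}ᶜ) hu]
        simp [stepFun, hu, h]
    · rw [abs_lt]; constructor <;> linarith
    · show ⟪y + _ • ν, ν⟫ < 0
      rw [hin]; linarith
  · refine key {u | 0 < ⟪u, ν⟫} (b - a) (measurableSet_halfSpace ν) (sub_ne_zero.2 hab.symm) (fun u => ?_)
      ⟨{u | 0 < ⟪u, ν⟫}, le_rfl,
        isOpen_lt continuous_const (continuous_id.inner continuous_const),
        (1 - ⟪y, ν⟫) / 2, ?_, ?_⟩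
    · by_cases hu : 0 < ⟪u, ν⟫
      · rw [Set.indicator_of_mem (s := {u | 0 < ⟪u, ν⟫}) hu]
        simp [stepFun, hu, h.not_gt]
      · rw [Set.indicator_of_notMem (s := {u | 0 < ⟪u, ν⟫}) hu]
        simp [stepFun, hu, h.not_gt]
    · rw [abs_lt]; constructor <;> linarith
    · show 0 < ⟪y + _ • ν, ν⟫
      rw [hin]; linarith

/-- The truncation profile. -/
def truncFun (δ s : ℝ) : ℝ := δ * Real.arctan (s / δ)

/-- The derivative of the truncation profile. -/
def truncDeriv (δ s : ℝ) : ℝ := 1 / (1 + (s / δ) ^ 2)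

theorem truncDeriv_nonneg (δ s : ℝ) : 0 ≤ truncDeriv δ s := by unfold truncDeriv; positivity

theorem truncDeriv_le_one (δ s : ℝ) : truncDeriv δ s ≤ 1 := by
  unfold truncDeriv
  rw [div_le_one (by positivity)]
  linarith [sq_nonneg (s / δ)]

theorem truncDeriv_lt_one {δ s : ℝ} (hδ : δ ≠ 0) (hs : s ≠ 0) : truncDeriv δ s < 1 := by
  unfold truncDeriv
  rw [div_lt_one (by positivity)]
  have : 0 < (s / δ) ^ 2 := by positivity
  linarith

theorem truncDeriv_zero (δ : ℝ) : truncDeriv δ 0 = 1 := by simp [truncDeriv]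

theorem hasDerivAt_truncFun {δ : ℝ} (hδ : δ ≠ 0) (s : ℝ) :
    HasDerivAt (truncFun δ) (truncDeriv δ s) s := by
  have h1 := ((hasDerivAt_id' s).div_const δ).arctan.const_mul δ
  refine h1.congr_deriv ?_
  unfold truncDeriv
  field_simp

theorem contDiff_truncFun (δ : ℝ) : ContDiff ℝ 1 (truncFun δ) :=
  contDiff_const.mul (Real.contDiff_arctan.comp (contDiff_id.div_const δ))

theorem abs_truncFun_le {δ : ℝ} (hδ : 0 < δ) (s : ℝ) : |truncFun δ s| ≤ δ * 2 := by
  unfold truncFun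
  rw [abs_mul, abs_of_pos hδ]
  gcongr
  rw [abs_le]
  have h1 := Real.arctan_lt_pi_div_two (s / δ)
  have h2 := Real.neg_pi_div_two_lt_arctan (s / δ)
  have := Real.pi_lt_four
  constructor <;> linarith

theorem truncFun_zero (δ : ℝ) : truncFun δ 0 = 0 := by simp [truncFun]

theorem lipschitzWith_truncDeriv {δ : ℝ} (hδ : 0 < δ) : LipschitzWith (Real.toNNReal (1 / δ)) (truncDeriv δ) := by
  refine LipschitzWith.of_dist_le_mul fun s t => ?_
  rw [Real.coe_toNNReal _ (by positivity), Real.dist_eq, Real.dist_eq]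
  obtain ⟨u, hu⟩ : ∃ u, u = s / δ := ⟨_, rfl⟩
  obtain ⟨v, hv⟩ : ∃ v, v = t / δ := ⟨_, rfl⟩
  have e : 1 / δ * |s - t| = |u - v| := by
    rw [hu, hv, ← sub_div, abs_div, abs_of_pos hδ]; ring
  rw [e]
  unfold truncDeriv
  rw [← hu, ← hv]
  have e2 : 1 / (1 + u ^ 2) - 1 / (1 + v ^ 2) = (u - v) * (-(u + v) / ((1 + u ^ 2) * (1 + v ^ 2))) := by
    field_simp; ring
  rw [e2, abs_mul]
  refine mul_le_of_le_one_right (abs_nonneg _) ?_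
  rw [abs_div, abs_of_pos (by positivity : 0 < (1 + u ^ 2) * (1 + v ^ 2)), div_le_one (by positivity),
    abs_le]
  constructor <;> nlinarith [sq_nonneg (u - 1), sq_nonneg (v - 1), sq_nonneg (u + 1), sq_nonneg (v + 1),
    mul_nonneg (sq_nonneg u) (sq_nonneg v)]

theorem lipschitzWith_one_sub_truncDeriv {δ : ℝ} (hδ : 0 < δ) :
    LipschitzWith (Real.toNNReal (1 / δ)) fun s => 1 - truncDeriv δ s := by
  refine LipschitzWith.of_dist_le_mul fun s t => ?_
  have := (lipschitzWith_truncDeriv hδ).dist_le_mul s t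
  rwa [dist_sub_left]

theorem tendsto_truncDeriv {s : ℝ} (hs : s ≠ 0) : Tendsto (fun δ => truncDeriv δ s) (𝓝[>] 0) (𝓝 0) := by
  have h1 : Tendsto (fun δ : ℝ => δ ^ 2 / (δ ^ 2 + s ^ 2)) (𝓝[>] 0) (𝓝 (0 ^ 2 / (0 ^ 2 + s ^ 2))) := by
    refine Tendsto.mono_left (ContinuousAt.tendsto ?_) nhdsWithin_le_nhds
    fun_prop (disch := positivity)
  simp only [ne_eq, OfNat.ofNat_ne_zero, not_false_eq_true, zero_pow, zero_div] at h1
  refine h1.congr' ?_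
  filter_upwards [self_mem_nhdsWithin] with δ (hδ : 0 < δ)
  unfold truncDeriv
  field_simp

/-- The oscillation defect of a jump profile vanishes as the truncation level goes to zero. -/
theorem tendsto_stepFun_defect {ν : EuclideanSpace ℝ (Fin n)} (hν : ‖ν‖ = 1) {a b : ℝ} (hab : a ≠ b) :
    Tendsto (fun δ => ∫⁻ y, ENNReal.ofReal (moll n y) * ENNReal.ofReal
      (truncDeriv δ (stepFun n ν a b y - mollify n 1 (stepFun n ν a b) y))) (𝓝[>] 0) (𝓝 0) := by
  have hLI := locallyIntegrable_stepFun ν a b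
  have hmp : Continuous (mollify n 1 (stepFun n ν a b)) := (contDiff_mollify one_pos hLI).continuous
  have h0 : (0:ℝ≥0∞) = ∫⁻ y : EuclideanSpace ℝ (Fin n), 0 := by simp
  rw [h0]
  refine tendsto_lintegral_filter_of_dominated_convergence (fun y => ENNReal.ofReal (moll n y)) ?_ ?_ ?_ ?_
  · filter_upwards [self_mem_nhdsWithin] with δ hδ
    refine (measurable_ofReal_moll n).mul (Measurable.ennreal_ofReal ?_)
    exact (lipschitzWith_truncDeriv hδ).continuous.measurable.comp
      ((measurable_stepFun ν a b).sub hmp.measurable)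
  · refine Eventually.of_forall fun δ => ae_of_all _ fun y => ?_
    calc _ ≤ ENNReal.ofReal (moll n y) * 1 := by
          gcongr
          simpa using ENNReal.ofReal_le_ofReal (truncDeriv_le_one δ _)
      _ = _ := mul_one _
  · rw [lintegral_moll]; simp
  · refine ae_of_all _ fun y => ?_
    rcases lt_or_ge ‖y‖ 1 with hy | hy
    · have h1 := tendsto_truncDeriv (stepFun_sub_mollify_ne hν hab hy)
      have h2 := ENNReal.tendsto_ofReal h1
      have h3 := ENNReal.Tendsto.const_mul (a := ENNReal.ofReal (moll n y)) h2 (Or.inr ENNReal.ofReal_ne_top)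
      simpa using h3
    · simp [moll_eq_zero hy]

theorem stepFun_defect_ne_zero {ν : EuclideanSpace ℝ (Fin n)} (hν : ‖ν‖ = 1) {a b : ℝ} (hab : a ≠ b) :
    ∫⁻ y, ENNReal.ofReal (moll n y) * ENNReal.ofReal
      (1 - truncDeriv 1 (stepFun n ν a b y - mollify n 1 (stepFun n ν a b) y)) ≠ 0 := by
  have hLI := locallyIntegrable_stepFun ν a b
  have hmp : Continuous (mollify n 1 (stepFun n ν a b)) := (contDiff_mollify one_pos hLI).continuous
  intro h0
  rw [lintegral_eq_zero_iff] at h0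
  · have h1 : ∀ᵐ y : EuclideanSpace ℝ (Fin n), y ∉ ball (0 : EuclideanSpace ℝ (Fin n)) 1 := by
      filter_upwards [h0] with y hy hyb
      have hyb : ‖y‖ < 1 := by simpa using hyb
      simp only [Pi.zero_apply, mul_eq_zero, ENNReal.ofReal_eq_zero] at hy
      have h2 := moll_pos hyb
      have h3 := truncDeriv_lt_one one_ne_zero (stepFun_sub_mollify_ne hν hab hyb)
      rcases hy with hy | hy <;> linarith
    have h2 : volume (ball (0 : EuclideanSpace ℝ (Fin n)) 1) = 0 := by
      rw [ae_iff] at h1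
      simp only [not_not] at h1
      exact h1
    exact (measure_ball_pos volume (0 : EuclideanSpace ℝ (Fin n)) one_pos).ne' h2
  · refine (measurable_ofReal_moll n).mul (Measurable.ennreal_ofReal (measurable_const.sub ?_))
    exact (lipschitzWith_truncDeriv one_pos).continuous.measurable.comp
      ((measurable_stepFun ν a b).sub hmp.measurable)

end

section

variable {n : ℕ} {r : ℝ}

/-- The mollified density of a measure at scale `r`. -/
def mollDensity (n : ℕ) (r : ℝ) (μ : Measure (EuclideanSpace ℝ (Fin n)))
    (z : EuclideanSpace ℝ (Fin n)) : ℝ≥0∞ :=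
  ∫⁻ y, ENNReal.ofReal (mollAt n r (z - y)) ∂μ

/-- The mollification at scale `r` of the vector measure `σ μ`. -/
def mollField (n : ℕ) (r : ℝ) (μ : Measure (EuclideanSpace ℝ (Fin n)))
    (σ : EuclideanSpace ℝ (Fin n) → EuclideanSpace ℝ (Fin n))
    (z : EuclideanSpace ℝ (Fin n)) : EuclideanSpace ℝ (Fin n) :=
  ∫ y, mollAt n r (z - y) • σ y ∂μ

theorem measurable_ofReal_mollAt_sub (n : ℕ) (r : ℝ) :
    Measurable fun p : EuclideanSpace ℝ (Fin n) × EuclideanSpace ℝ (Fin n) =>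
      ENNReal.ofReal (mollAt n r (p.1 - p.2)) :=
  (((continuous_mollAt n r).comp (continuous_fst.sub continuous_snd)).measurable).ennreal_ofReal

theorem measurable_mollDensity (n : ℕ) (r : ℝ) (μ : Measure (EuclideanSpace ℝ (Fin n))) [SFinite μ] :
    Measurable (mollDensity n r μ) :=
  (measurable_ofReal_mollAt_sub n r).lintegral_prod_right'

theorem lintegral_mul_mollDensity {μ : Measure (EuclideanSpace ℝ (Fin n))} [SFinite μ]
    {Φ : EuclideanSpace ℝ (Fin n) → ℝ≥0∞} (hΦ : Measurable Φ) :
    ∫⁻ z, Φ z * mollDensity n r μ z =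
      ∫⁻ y, ∫⁻ z, ENNReal.ofReal (mollAt n r (z - y)) * Φ z ∂volume ∂μ := by
  have h1 : ∀ z, Φ z * mollDensity n r μ z = ∫⁻ y, ENNReal.ofReal (mollAt n r (z - y)) * Φ z ∂μ := by
    intro z
    have hm : Measurable fun y => ENNReal.ofReal (mollAt n r (z - y)) :=
      (((continuous_mollAt n r).comp (continuous_const.sub continuous_id)).measurable).ennreal_ofReal
    rw [lintegral_mul_const _ hm, mul_comm]
    rfl
  have h2 : Measurable fun p : EuclideanSpace ℝ (Fin n) × EuclideanSpace ℝ (Fin n) =>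
      ENNReal.ofReal (mollAt n r (p.1 - p.2)) * Φ p.1 :=
    (measurable_ofReal_mollAt_sub n r).mul (hΦ.comp measurable_fst)
  simp only [h1]
  exact lintegral_lintegral_swap (f := fun z y => ENNReal.ofReal (mollAt n r (z - y)) * Φ z)
    h2.aemeasurable

theorem lintegral_mollDensity (hr : 0 < r) (μ : Measure (EuclideanSpace ℝ (Fin n))) [SFinite μ] :
    ∫⁻ z, mollDensity n r μ z = μ Set.univ := by
  have h := lintegral_mul_mollDensity (r := r) (μ := μ) (Φ := fun _ => 1) measurable_const
  simpa [lintegral_mollAt_sub hr] using h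

theorem mollDensity_lt_top (hr : 0 < r) (μ : Measure (EuclideanSpace ℝ (Fin n))) [IsFiniteMeasure μ]
    (z : EuclideanSpace ℝ (Fin n)) : mollDensity n r μ z < ⊤ := by
  obtain ⟨C, hC⟩ := (hasCompactSupport_mollAt hr).exists_bound_of_continuous (continuous_mollAt n r)
  calc mollDensity n r μ z ≤ ∫⁻ _, ENNReal.ofReal C ∂μ :=
        lintegral_mono fun y => ENNReal.ofReal_le_ofReal ((le_abs_self _).trans (hC _))
    _ = ENNReal.ofReal C * μ Set.univ := lintegral_const _
    _ < ⊤ := ENNReal.mul_lt_top ENNReal.ofReal_lt_top (measure_lt_top _ _)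

theorem enorm_mollField_le (hr : 0 < r) {μ : Measure (EuclideanSpace ℝ (Fin n))}
    {σ : EuclideanSpace ℝ (Fin n) → EuclideanSpace ℝ (Fin n)} (hσ : ∀ᵐ x ∂μ, ‖σ x‖ = 1)
    (z : EuclideanSpace ℝ (Fin n)) : ‖mollField n r μ σ z‖ₑ ≤ mollDensity n r μ z := by
  refine (enorm_integral_le_lintegral_enorm _).trans (lintegral_mono_ae ?_)
  filter_upwards [hσ] with y hy
  rw [enorm_smul, ← ofReal_norm (σ y), hy, ENNReal.ofReal_one, mul_one,
    Real.enorm_eq_ofReal (mollAt_nonneg hr _)]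

theorem integrable_mollAt_smul (hr : 0 < r) {μ : Measure (EuclideanSpace ℝ (Fin n))} [IsFiniteMeasure μ]
    {σ : EuclideanSpace ℝ (Fin n) → EuclideanSpace ℝ (Fin n)} (hσm : AEStronglyMeasurable σ μ)
    (hσ : ∀ᵐ x ∂μ, ‖σ x‖ = 1) (z : EuclideanSpace ℝ (Fin n)) :
    Integrable (fun y => mollAt n r (z - y) • σ y) μ := by
  obtain ⟨C, hC⟩ := (hasCompactSupport_mollAt hr).exists_bound_of_continuous (continuous_mollAt n r)
  refine Integrable.of_bound ((((continuous_mollAt n r).comp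
    (continuous_const.sub continuous_id)).aestronglyMeasurable).smul hσm) C ?_
  filter_upwards [hσ] with y hy
  rw [norm_smul, hy, mul_one]
  exact hC _

theorem continuous_mollField (hr : 0 < r) {μ : Measure (EuclideanSpace ℝ (Fin n))} [IsFiniteMeasure μ]
    {σ : EuclideanSpace ℝ (Fin n) → EuclideanSpace ℝ (Fin n)} (hσm : AEStronglyMeasurable σ μ)
    (hσ : ∀ᵐ x ∂μ, ‖σ x‖ = 1) : Continuous (mollField n r μ σ) := by
  obtain ⟨C, hC⟩ := (hasCompactSupport_mollAt hr).exists_bound_of_continuous (continuous_mollAt n r)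
  refine continuous_of_dominated (bound := fun _ => C)
    (fun z => (integrable_mollAt_smul hr hσm hσ z).aestronglyMeasurable) (fun z => ?_)
    (integrable_const C) (ae_of_all _ fun y => ?_)
  · filter_upwards [hσ] with y hy
    rw [norm_smul, hy, mul_one]
    exact hC _
  · exact ((continuous_mollAt n r).comp (continuous_id.sub continuous_const)).smul continuous_const

theorem mollField_restrict_add_compl (hr : 0 < r) {μ : Measure (EuclideanSpace ℝ (Fin n))} [IsFiniteMeasure μ]
    {σ : EuclideanSpace ℝ (Fin n) → EuclideanSpace ℝ (Fin n)} (hσm : AEStronglyMeasurable σ μ)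
    (hσ : ∀ᵐ x ∂μ, ‖σ x‖ = 1) {G : Set (EuclideanSpace ℝ (Fin n))} (hG : MeasurableSet G)
    (z : EuclideanSpace ℝ (Fin n)) :
    mollField n r (μ.restrict G) σ z + mollField n r (μ.restrict Gᶜ) σ z = mollField n r μ σ z :=
  integral_add_compl hG (integrable_mollAt_smul hr hσm hσ z)

theorem HasBlowUp.congr_ae {f F : EuclideanSpace ℝ (Fin n) → ℝ} {x : EuclideanSpace ℝ (Fin n)}
    {p : EuclideanSpace ℝ (Fin n) → ℝ} (h : HasBlowUp n f x p) {ρ : ℝ} (hρ : 0 < ρ)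
    (hF : ∀ᵐ y, y ∈ ball x ρ → F y = f y) : HasBlowUp n F x p := by
  refine Tendsto.congr' ?_ h
  have h2 : ∀ᶠ r : ℝ in 𝓝[>] 0, r < ρ / 2 :=
    nhdsWithin_le_nhds (gt_mem_nhds (by positivity : (0:ℝ) < ρ / 2))
  filter_upwards [self_mem_nhdsWithin, h2] with r (hr : 0 < r) hr2
  refine setLIntegral_congr_fun_ae measurableSet_ball ?_
  filter_upwards [(quasiMeasurePreserving_rescale hr x).ae hF] with y hy hyb
  rw [hy]
  rw [mem_ball, dist_eq_norm, add_sub_cancel_left, norm_smul, Real.norm_of_nonneg hr.le]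
  rw [mem_ball_zero_iff] at hyb
  nlinarith

theorem HasBlowUp.tendsto_mollify_const {F : EuclideanSpace ℝ (Fin n) → ℝ} {x : EuclideanSpace ℝ (Fin n)}
    {c : ℝ} (h : HasBlowUp n F x fun _ => c) (hF : LocallyIntegrable F) {z : EuclideanSpace ℝ (Fin n)}
    (hz : ‖z‖ ≤ 1) : Tendsto (fun r => mollify n r F (x + r • z)) (𝓝[>] 0) (𝓝 c) := by
  have h1 := h.mollify_tendsto hF (locallyIntegrable_const c) hz
  rwa [mollify_const one_pos] at h1

theorem ae_tendsto_mollify {F : EuclideanSpace ℝ (Fin n) → ℝ} (hF : LocallyIntegrable F) :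
    ∀ᵐ x, Tendsto (fun r => mollify n r F x) (𝓝[>] 0) (𝓝 (F x)) := by
  filter_upwards [ae_hasBlowUp hF] with x hx
  simpa using hx.tendsto_mollify_const hF (z := 0) (by simp)

end

section

variable {n : ℕ} {r : ℝ}

/-- The function `a` corrected towards `b` where the cutoff `ψ` lives, moving by at most `2δ`. -/
def corrected (n : ℕ) (δ : ℝ) (ψ a b : EuclideanSpace ℝ (Fin n) → ℝ) (z : EuclideanSpace ℝ (Fin n)) : ℝ :=
  a z - ψ z * truncFun δ (a z - b z)

theorem contDiff_corrected {δ : ℝ} {ψ a b : EuclideanSpace ℝ (Fin n) → ℝ}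
    (hψ : ContDiff ℝ 1 ψ) (ha : ContDiff ℝ 1 a) (hb : ContDiff ℝ 1 b) :
    ContDiff ℝ 1 (corrected n δ ψ a b) :=
  ha.sub (hψ.mul ((contDiff_truncFun δ).comp (ha.sub hb)))

theorem gradient_corrected {δ : ℝ} (hδ : 0 < δ) {ψ a b : EuclideanSpace ℝ (Fin n) → ℝ}
    (hψ : ContDiff ℝ 1 ψ) (ha : ContDiff ℝ 1 a) (hb : ContDiff ℝ 1 b) (z : EuclideanSpace ℝ (Fin n)) :
    gradient (corrected n δ ψ a b) z = (1 - ψ z * truncDeriv δ (a z - b z)) • gradient a z +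
      (ψ z * truncDeriv δ (a z - b z)) • gradient b z - truncFun δ (a z - b z) • gradient ψ z := by
  have ha' := (ha.differentiable one_ne_zero z).hasFDerivAt
  have hb' := (hb.differentiable one_ne_zero z).hasFDerivAt
  have hψ' := (hψ.differentiable one_ne_zero z).hasFDerivAt
  have hT := (hasDerivAt_truncFun hδ.ne' (a z - b z)).comp_hasFDerivAt z (ha'.sub hb')
  have h := ha'.sub (hψ'.mul hT)
  have h' : fderiv ℝ (corrected n δ ψ a b) z = _ := h.fderiv
  refine ext_inner_right ℝ fun v => ?_
  rw [inner_sub_left, inner_add_left]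
  simp only [real_inner_smul_left, gradient, InnerProductSpace.toDual_symm_apply, h']
  simp
  ring

theorem enorm_gradient_corrected_sub_le {δ : ℝ} (hδ : 0 < δ) {ψ a b : EuclideanSpace ℝ (Fin n) → ℝ}
    (hψ : ContDiff ℝ 1 ψ) (ha : ContDiff ℝ 1 a) (hb : ContDiff ℝ 1 b) {z : EuclideanSpace ℝ (Fin n)}
    (hψ0 : 0 ≤ ψ z) (hψ1 : ψ z ≤ 1) {p q s t : EuclideanSpace ℝ (Fin n)}
    (hga : gradient a z = p + q) (hgb : ψ z ≠ 0 → gradient b z = s + t) :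
    ‖gradient (corrected n δ ψ a b) z - ψ z • s‖ₑ ≤
      ENNReal.ofReal (1 - ψ z * truncDeriv δ (a z - b z)) * ‖p‖ₑ + ‖q‖ₑ +
        (ENNReal.ofReal (ψ z * truncDeriv δ (a z - b z)) * ‖t‖ₑ +
          ENNReal.ofReal (ψ z * (1 - truncDeriv δ (a z - b z))) * ‖s‖ₑ +
          ENNReal.ofReal |truncFun δ (a z - b z)| * ‖gradient ψ z‖ₑ) := by
  obtain ⟨τ, hτ⟩ : ∃ τ, τ = truncDeriv δ (a z - b z) := ⟨_, rfl⟩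
  have h0 : 0 ≤ τ := hτ ▸ truncDeriv_nonneg _ _
  have h1 : τ ≤ 1 := hτ ▸ truncDeriv_le_one _ _
  have hb' : (ψ z * τ) • gradient b z = (ψ z * τ) • (s + t) := by
    by_cases h : ψ z = 0
    · simp [h]
    · rw [hgb h]
  rw [gradient_corrected hδ hψ ha hb, hga, ← hτ, hb']
  have e : (1 - ψ z * τ) • (p + q) + (ψ z * τ) • (s + t) - truncFun δ (a z - b z) • gradient ψ z - ψ z • s =
      ((1 - ψ z * τ) • p + (1 - ψ z * τ) • q) + ((ψ z * τ) • t - (ψ z * (1 - τ)) • s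
        - truncFun δ (a z - b z) • gradient ψ z) := by
    module
  rw [e]
  have hx : ψ z * τ ≤ 1 := mul_le_one₀ hψ1 h0 h1
  refine (enorm_add_le _ _).trans (add_le_add ((enorm_add_le _ _).trans (add_le_add ?_ ?_))
    ((enorm_sub_le).trans (add_le_add (enorm_sub_le.trans (add_le_add ?_ ?_)) ?_)))
  · rw [enorm_smul, Real.enorm_eq_ofReal (by linarith)]
  · rw [enorm_smul, Real.enorm_eq_ofReal (by linarith)]
    calc _ ≤ ENNReal.ofReal 1 * ‖q‖ₑ := by
          gcongr
          have := mul_nonneg hψ0 h0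
          linarith
      _ = _ := by simp
  · rw [enorm_smul, Real.enorm_eq_ofReal (by positivity)]
  · rw [enorm_smul, Real.enorm_eq_ofReal (mul_nonneg hψ0 (by linarith))]
  · rw [enorm_smul, Real.enorm_eq_ofReal_abs]

end

section

variable {n : ℕ} {r : ℝ}

theorem tendsto_one_div_succ_nhdsGT : Tendsto (fun k : ℕ => 1 / ((k : ℝ) + 1)) atTop (𝓝[>] 0) :=
  tendsto_nhdsWithin_iff.2 ⟨tendsto_one_div_add_atTop_nhds_zero_nat,
    Eventually.of_forall fun _ => Set.mem_Ioi.2 Nat.one_div_pos_of_nat⟩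

/-- Dominated convergence along a countably generated filter, with a.e. measurability. -/
theorem tendsto_lintegral_of_dominated_ae {α ι : Type*} [MeasurableSpace α] {μ : Measure α}
    {l : Filter ι} [l.IsCountablyGenerated] {f : ι → α → ℝ≥0∞} {g : α → ℝ≥0∞} (bound : α → ℝ≥0∞)
    (hf : ∀ᶠ i in l, AEMeasurable (f i) μ) (hb : ∀ᶠ i in l, f i ≤ᵐ[μ] bound)
    (hfin : ∫⁻ a, bound a ∂μ ≠ ⊤) (hlim : ∀ᵐ a ∂μ, Tendsto (fun i => f i a) l (𝓝 (g a))) :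
    Tendsto (fun i => ∫⁻ a, f i a ∂μ) l (𝓝 (∫⁻ a, g a ∂μ)) := by
  refine tendsto_of_seq_tendsto fun x hx => ?_
  obtain ⟨k, hk⟩ := eventually_atTop.1 (hx.eventually (hf.and hb))
  rw [← tendsto_add_atTop_iff_nat k]
  refine tendsto_lintegral_of_dominated_convergence' bound
    (fun m => (hk (m + k) (Nat.le_add_left k m)).1) (fun m => (hk (m + k) (Nat.le_add_left k m)).2) hfin ?_
  filter_upwards [hlim] with a ha
  exact (ha.comp hx).comp (tendsto_add_atTop_nat k)

theorem continuous_truncDeriv {δ : ℝ} (hδ : 0 < δ) : Continuous (truncDeriv δ) :=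
  (lipschitzWith_truncDeriv hδ).continuous

theorem lintegral_mollAt_mul_le_one (hr : 0 < r) (x : EuclideanSpace ℝ (Fin n))
    {Φ : EuclideanSpace ℝ (Fin n) → ℝ≥0∞} (hΦ : ∀ z, Φ z ≤ 1) :
    ∫⁻ z, ENNReal.ofReal (mollAt n r (z - x)) * Φ z ≤ 1 :=
  calc _ ≤ ∫⁻ z, ENNReal.ofReal (mollAt n r (z - x)) :=
        lintegral_mono fun z => mul_le_of_le_one_right' (hΦ z)
    _ = 1 := lintegral_mollAt_sub hr x

theorem tendsto_lintegral_one_sub {μ : Measure (EuclideanSpace ℝ (Fin n))} [IsFiniteMeasure μ]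
    {F ψ b c : EuclideanSpace ℝ (Fin n) → ℝ} (hF : LocallyIntegrable F) {δ : ℝ} (hδ : 0 < δ)
    (hψ : Continuous ψ) (hψ0 : ∀ z, 0 ≤ ψ z) (hb : Continuous b)
    (hc : ∀ᵐ y ∂μ, HasBlowUp n F y fun _ => c y) :
    Tendsto (fun r => ∫⁻ z, ENNReal.ofReal (1 - ψ z * truncDeriv δ (mollify n r F z - b z)) *
      mollDensity n r μ z) (𝓝[>] 0)
      (𝓝 (∫⁻ y, ENNReal.ofReal (1 - ψ y * truncDeriv δ (c y - b y)) ∂μ)) := by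
  have hτ := continuous_truncDeriv hδ
  have hle : ∀ r z, ENNReal.ofReal (1 - ψ z * truncDeriv δ (mollify n r F z - b z)) ≤ 1 := fun r z => by
    rw [ENNReal.ofReal_le_one]
    have := mul_nonneg (hψ0 z) (truncDeriv_nonneg δ (mollify n r F z - b z))
    linarith
  have hm : ∀ r, 0 < r → Measurable fun z =>
      ENNReal.ofReal (1 - ψ z * truncDeriv δ (mollify n r F z - b z)) := fun r hr =>
    ((continuous_const.sub (hψ.mul (hτ.comp
      ((contDiff_mollify hr hF).continuous.sub hb)))).measurable).ennreal_ofReal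
  have key : Tendsto (fun r => ∫⁻ y, ∫⁻ z, ENNReal.ofReal (mollAt n r (z - y)) *
      ENNReal.ofReal (1 - ψ z * truncDeriv δ (mollify n r F z - b z)) ∂volume ∂μ) (𝓝[>] 0)
      (𝓝 (∫⁻ y, ENNReal.ofReal (1 - ψ y * truncDeriv δ (c y - b y)) ∂μ)) := by
    refine tendsto_lintegral_of_dominated_ae (fun _ => 1) ?_ ?_ ?_ ?_
    · filter_upwards [self_mem_nhdsWithin] with r (hr : 0 < r)
      have h2 : Measurable fun p : EuclideanSpace ℝ (Fin n) × EuclideanSpace ℝ (Fin n) =>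
          ENNReal.ofReal (mollAt n r (p.1 - p.2)) *
            ENNReal.ofReal (1 - ψ p.1 * truncDeriv δ (mollify n r F p.1 - b p.1)) :=
        (measurable_ofReal_mollAt_sub n r).mul ((hm r hr).comp measurable_fst)
      have h3 : Measurable fun y => ∫⁻ z, ENNReal.ofReal (mollAt n r (z - y)) *
          ENNReal.ofReal (1 - ψ z * truncDeriv δ (mollify n r F z - b z)) := h2.lintegral_prod_left'
      exact h3.aemeasurable
    · filter_upwards [self_mem_nhdsWithin] with r (hr : 0 < r)
      exact ae_of_all _ fun y => lintegral_mollAt_mul_le_one hr y (hle r)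
    · simp
    · filter_upwards [hc] with y hy
      have h1 : Tendsto (fun r : ℝ => ∫⁻ u, ENNReal.ofReal (moll n u) * ENNReal.ofReal
          (1 - ψ (y + r • u) * truncDeriv δ (mollify n r F (y + r • u) - b (y + r • u)))) (𝓝[>] 0)
          (𝓝 (∫⁻ u, ENNReal.ofReal (moll n u) * ENNReal.ofReal (1 - ψ y * truncDeriv δ (c y - b y)))) := by
        refine tendsto_lintegral_of_dominated_ae (fun u => ENNReal.ofReal (moll n u))
          ?_ ?_ ?_ ?_
        · filter_upwards [self_mem_nhdsWithin] with r (hr : 0 < r)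
          have h3 : Measurable fun u : EuclideanSpace ℝ (Fin n) => ENNReal.ofReal
              (1 - ψ (y + r • u) * truncDeriv δ (mollify n r F (y + r • u) - b (y + r • u))) :=
            (hm r hr).comp (measurableEmbedding_rescale hr y).measurable
          exact (measurable_ofReal_moll n).aemeasurable.mul h3.aemeasurable
        · exact Eventually.of_forall fun r => ae_of_all _ fun u => mul_le_of_le_one_right' (hle r _)
        · rw [lintegral_moll]; simp
        · refine ae_of_all _ fun u => ?_
          rcases lt_or_ge ‖u‖ 1 with hu | hu
          · have h4 := hy.tendsto_mollify_const hF hu.le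
            have h5 : Tendsto (fun r : ℝ => y + r • u) (𝓝[>] 0) (𝓝 y) := by
              have : Tendsto (fun r : ℝ => y + r • u) (𝓝 0) (𝓝 (y + (0:ℝ) • u)) :=
                (continuous_const.add (continuous_id.smul continuous_const)).tendsto 0
              rw [zero_smul, add_zero] at this
              exact this.mono_left nhdsWithin_le_nhds
            have h6 : Tendsto (fun r : ℝ => 1 - ψ (y + r • u) *
                truncDeriv δ (mollify n r F (y + r • u) - b (y + r • u))) (𝓝[>] 0)
                (𝓝 (1 - ψ y * truncDeriv δ (c y - b y))) :=
              tendsto_const_nhds.sub (((hψ.tendsto y).comp h5).mul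
                ((hτ.tendsto _).comp (h4.sub ((hb.tendsto y).comp h5))))
            exact ENNReal.Tendsto.const_mul (ENNReal.tendsto_ofReal h6) (Or.inr ENNReal.ofReal_ne_top)
          · simp [moll_eq_zero hu]
      rw [lintegral_mul_const _ (measurable_ofReal_moll n), lintegral_moll, one_mul] at h1
      refine h1.congr' ?_
      filter_upwards [self_mem_nhdsWithin] with r (hr : 0 < r)
      rw [lintegral_mollAt_mul hr]
  refine key.congr' ?_
  filter_upwards [self_mem_nhdsWithin] with r (hr : 0 < r)
  rw [lintegral_mul_mollDensity (hm r hr)]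

theorem tendsto_lintegral_one_sub_mollify {μ : Measure (EuclideanSpace ℝ (Fin n))} [IsFiniteMeasure μ]
    {F ψ c : EuclideanSpace ℝ (Fin n) → ℝ} (hF : LocallyIntegrable F) {δ : ℝ} (hδ : 0 < δ)
    (hψ : ∀ᵐ y ∂μ, ψ y = 1) (hc : ∀ᵐ y ∂μ, HasBlowUp n F y fun _ => c y) :
    Tendsto (fun r => ∫⁻ y, ENNReal.ofReal (1 - ψ y * truncDeriv δ (c y - mollify n r F y)) ∂μ)
      (𝓝[>] 0) (𝓝 0) := by
  have hτ := continuous_truncDeriv hδ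
  have hlim : ∀ᵐ y ∂μ, Tendsto (fun r => mollify n r F y) (𝓝[>] 0) (𝓝 (c y)) := by
    filter_upwards [hc] with y hy
    simpa using hy.tendsto_mollify_const hF (z := 0) (by simp)
  have hcm : AEMeasurable c μ := by
    refine aemeasurable_of_tendsto_metrizable_ae atTop
      (f := fun (k : ℕ) y => mollify n (1 / ((k : ℝ) + 1)) F y) (fun k =>
        (contDiff_mollify Nat.one_div_pos_of_nat hF).continuous.aemeasurable) ?_
    filter_upwards [hlim] with y hy
    exact hy.comp tendsto_one_div_succ_nhdsGT
  have h0 : ∫⁻ _, (0 : ℝ≥0∞) ∂μ = 0 := lintegral_zero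
  have hcongr : ∀ r, ∫⁻ y, ENNReal.ofReal (1 - ψ y * truncDeriv δ (c y - mollify n r F y)) ∂μ =
      ∫⁻ y, ENNReal.ofReal (1 - truncDeriv δ (c y - mollify n r F y)) ∂μ := fun r => by
    refine lintegral_congr_ae ?_
    filter_upwards [hψ] with y hy
    simp [hy]
  simp only [hcongr]
  rw [← h0]
  refine tendsto_lintegral_of_dominated_ae (fun _ => 1) ?_ ?_ ?_ ?_
  · filter_upwards [self_mem_nhdsWithin] with r (hr : 0 < r)
    exact (aemeasurable_const.sub (hτ.measurable.comp_aemeasurable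
      (hcm.sub (contDiff_mollify hr hF).continuous.aemeasurable))).ennreal_ofReal
  · refine Eventually.of_forall fun r => ae_of_all _ fun y => ?_
    rw [ENNReal.ofReal_le_one]
    linarith [truncDeriv_nonneg δ (c y - mollify n r F y)]
  · simp
  · filter_upwards [hlim] with y hy
    have h1 : Tendsto (fun r => 1 - truncDeriv δ (c y - mollify n r F y)) (𝓝[>] 0)
        (𝓝 (1 - truncDeriv δ (c y - c y))) :=
      tendsto_const_nhds.sub ((hτ.tendsto _).comp (tendsto_const_nhds.sub hy))
    rw [sub_self, truncDeriv_zero, sub_self] at h1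
    simpa using ENNReal.tendsto_ofReal h1

/-- The asymptotic value of the defect integral at a point with blow-up `p`. -/
def blowUpDefect (n : ℕ) (a : ℝ → ℝ) (p : EuclideanSpace ℝ (Fin n) → ℝ) : ℝ≥0∞ :=
  ∫⁻ y, ENNReal.ofReal (moll n y) * ENNReal.ofReal (a (p y - mollify n 1 p y))

/-- The defect integral at scale `r` centred at `x`. -/
def defectAt (n : ℕ) (a : ℝ → ℝ) (F : EuclideanSpace ℝ (Fin n) → ℝ) (r : ℝ)
    (x : EuclideanSpace ℝ (Fin n)) : ℝ≥0∞ :=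
  ∫⁻ z, ENNReal.ofReal (mollAt n r (z - x)) * ENNReal.ofReal (a (F z - mollify n r F z))

theorem measurable_defectAt {a : ℝ → ℝ} (ha : Continuous a) {F : EuclideanSpace ℝ (Fin n) → ℝ}
    (hFm : Measurable F) (hF : LocallyIntegrable F) (hr : 0 < r) : Measurable (defectAt n a F r) := by
  have hm : Measurable fun z => ENNReal.ofReal (a (F z - mollify n r F z)) :=
    (ha.measurable.comp (hFm.sub (contDiff_mollify hr hF).continuous.measurable)).ennreal_ofReal
  have h2 : Measurable fun p : EuclideanSpace ℝ (Fin n) × EuclideanSpace ℝ (Fin n) =>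
      ENNReal.ofReal (mollAt n r (p.1 - p.2)) * ENNReal.ofReal (a (F p.1 - mollify n r F p.1)) :=
    (measurable_ofReal_mollAt_sub n r).mul (hm.comp measurable_fst)
  exact h2.lintegral_prod_left'

theorem tendsto_lintegral_defect {μ : Measure (EuclideanSpace ℝ (Fin n))} [IsFiniteMeasure μ]
    {F : EuclideanSpace ℝ (Fin n) → ℝ} (hFm : Measurable F) (hF : LocallyIntegrable F)
    {p : EuclideanSpace ℝ (Fin n) → EuclideanSpace ℝ (Fin n) → ℝ}
    (hp : ∀ᵐ y ∂μ, HasBlowUp n F y (p y)) (hpl : ∀ᵐ y ∂μ, LocallyIntegrable (p y))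
    {L : NNReal} {a : ℝ → ℝ} (ha : LipschitzWith L a) (ha1 : ∀ s, a s ≤ 1) :
    AEMeasurable (fun y => blowUpDefect n a (p y)) μ ∧
    Tendsto (fun r => ∫⁻ z, ENNReal.ofReal (a (F z - mollify n r F z)) * mollDensity n r μ z) (𝓝[>] 0)
      (𝓝 (∫⁻ y, blowUpDefect n a (p y) ∂μ)) := by
  have hlim : ∀ᵐ y ∂μ, Tendsto (fun r => defectAt n a F r y) (𝓝[>] 0) (𝓝 (blowUpDefect n a (p y))) := by
    filter_upwards [hp, hpl] with y hy hyl
    exact hy.tendsto_lintegral hF hyl ha ha1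
  refine ⟨?_, ?_⟩
  · refine aemeasurable_of_tendsto_metrizable_ae atTop
      (f := fun (k : ℕ) y => defectAt n a F (1 / ((k : ℝ) + 1)) y) (fun k =>
        (measurable_defectAt ha.continuous hFm hF Nat.one_div_pos_of_nat).aemeasurable) ?_
    filter_upwards [hlim] with y hy
    exact hy.comp tendsto_one_div_succ_nhdsGT
  · have h1 : Tendsto (fun r => ∫⁻ y, defectAt n a F r y ∂μ) (𝓝[>] 0)
        (𝓝 (∫⁻ y, blowUpDefect n a (p y) ∂μ)) := by
      refine tendsto_lintegral_of_dominated_ae (fun _ => 1) ?_ ?_ ?_ hlim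
      · filter_upwards [self_mem_nhdsWithin] with r (hr : 0 < r)
        exact (measurable_defectAt ha.continuous hFm hF hr).aemeasurable
      · filter_upwards [self_mem_nhdsWithin] with r (hr : 0 < r)
        refine ae_of_all _ fun y => lintegral_mollAt_mul_le_one hr y fun z => ?_
        rw [ENNReal.ofReal_le_one]
        exact ha1 _
      · simp
    refine h1.congr' ?_
    filter_upwards [self_mem_nhdsWithin] with r (hr : 0 < r)
    rw [lintegral_mul_mollDensity]
    · rfl
    · exact (ha.continuous.measurable.comp
        (hFm.sub (contDiff_mollify hr hF).continuous.measurable)).ennreal_ofReal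

end

section

variable {n : ℕ} {r : ℝ}

theorem gradient_mollify_eq_mollField {f F : EuclideanSpace ℝ (Fin n) → ℝ}
    {Ω K : Set (EuclideanSpace ℝ (Fin n))} {μ : Measure (EuclideanSpace ℝ (Fin n))}
    {σ : EuclideanSpace ℝ (Fin n) → EuclideanSpace ℝ (Fin n)}
    (h : IsVariationPair n f Ω μ σ) (hr : 0 < r) (hF : LocallyIntegrable F)
    {z : EuclideanSpace ℝ (Fin n)} (hz : closedBall z r ⊆ K) (hK : K ⊆ Ω)
    (hFf : ∀ᵐ y, y ∈ K → F y = f y) :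
    gradient (mollify n r F) z = mollField n r μ σ z := by
  obtain ⟨F', hF'⟩ : ∃ F' : EuclideanSpace ℝ (Fin n) → ℝ, F' = fun y => if y ∈ K then f y else F y :=
    ⟨_, rfl⟩
  have hae : F =ᵐ[volume] F' := by
    filter_upwards [hFf] with y hy
    rw [hF']
    by_cases hyK : y ∈ K
    · simp [hyK, hy hyK]
    · simp [hyK]
  have hm : mollify n r F = mollify n r F' := by
    ext z
    refine integral_congr_ae ?_
    filter_upwards [hae] with y hy
    rw [hy]
  rw [hm]
  refine gradient_mollify h hr (hF.congr hae) (hz.trans hK) fun y hy => ?_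
  rw [hF']
  simp [hz hy]

/-- The part of the gradient error that converges by dominated convergence. -/
def corrError (n : ℕ) (δ ρ : ℝ) (μ ν : Measure (EuclideanSpace ℝ (Fin n)))
    (ψ a b : EuclideanSpace ℝ (Fin n) → ℝ) (z : EuclideanSpace ℝ (Fin n)) : ℝ≥0∞ :=
  ENNReal.ofReal (ψ z * truncDeriv δ (a z - b z)) * mollDensity n ρ ν z +
    ENNReal.ofReal (ψ z * (1 - truncDeriv δ (a z - b z))) * mollDensity n ρ μ z +
    ENNReal.ofReal |truncFun δ (a z - b z)| * ‖gradient ψ z‖ₑ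

theorem lintegral_enorm_gradient_lt_top {ψ : EuclideanSpace ℝ (Fin n) → ℝ} (hψ : ContDiff ℝ 1 ψ)
    (hψc : HasCompactSupport ψ) : ∫⁻ z, ‖gradient ψ z‖ₑ < ⊤ := by
  refine (Continuous.integrable_of_hasCompactSupport (continuous_gradient hψ) ?_).2
  exact (hψc.fderiv ℝ).comp_left (map_zero _)

theorem aemeasurable_corrError {δ ρ : ℝ} (hδ : 0 < δ) {μ ν : Measure (EuclideanSpace ℝ (Fin n))}
    [SFinite μ] [SFinite ν] {ψ a b : EuclideanSpace ℝ (Fin n) → ℝ}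
    (hψ : ContDiff ℝ 1 ψ) (ha : Measurable a) (hb : Measurable b) :
    Measurable (corrError n δ ρ μ ν ψ a b) := by
  have hτ := (continuous_truncDeriv hδ).measurable.comp (ha.sub hb)
  have hT := (contDiff_truncFun δ).continuous.measurable.comp (ha.sub hb)
  have h1 : Measurable fun z => ENNReal.ofReal (ψ z * truncDeriv δ (a z - b z)) :=
    (hψ.continuous.measurable.mul hτ).ennreal_ofReal
  have h2 : Measurable fun z => ENNReal.ofReal (ψ z * (1 - truncDeriv δ (a z - b z))) :=
    (hψ.continuous.measurable.mul (measurable_const.sub hτ)).ennreal_ofReal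
  have h3 : Measurable fun z => ENNReal.ofReal |truncFun δ (a z - b z)| :=
    (continuous_abs.measurable.comp hT).ennreal_ofReal
  exact ((h1.mul (measurable_mollDensity n ρ ν)).add (h2.mul (measurable_mollDensity n ρ μ))).add
    (h3.mul (continuous_gradient hψ).measurable.enorm)

theorem tendsto_lintegral_corrError {δ ρ : ℝ} (hδ : 0 < δ) (hρ : 0 < ρ)
    {μ ν : Measure (EuclideanSpace ℝ (Fin n))}
    [IsFiniteMeasure μ] [IsFiniteMeasure ν] {ψ F b : EuclideanSpace ℝ (Fin n) → ℝ}
    (hψ : ContDiff ℝ 1 ψ) (hψc : HasCompactSupport ψ) (hψ1 : ∀ z, ψ z ≤ 1)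
    (hF : LocallyIntegrable F) (hb : Measurable b) :
    Tendsto (fun r => ∫⁻ z, corrError n δ ρ μ ν ψ (mollify n r F) b z) (𝓝[>] 0)
      (𝓝 (∫⁻ z, corrError n δ ρ μ ν ψ F b z)) := by
  have hτ := continuous_truncDeriv hδ
  have hT := (contDiff_truncFun δ).continuous
  refine tendsto_lintegral_of_dominated_ae (fun z => mollDensity n ρ ν z + mollDensity n ρ μ z +
    ENNReal.ofReal (δ * 2) * ‖gradient ψ z‖ₑ) ?_ ?_ ?_ ?_
  · filter_upwards [self_mem_nhdsWithin] with r (hr : 0 < r)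
    exact (aemeasurable_corrError hδ hψ (contDiff_mollify hr hF).continuous.measurable hb).aemeasurable
  · refine Eventually.of_forall fun r => ae_of_all _ fun z => ?_
    obtain ⟨s, hs⟩ : ∃ s, s = mollify n r F z - b z := ⟨_, rfl⟩
    have h0 := truncDeriv_nonneg δ s
    have h1 := truncDeriv_le_one δ s
    simp only [corrError, ← hs]
    refine add_le_add (add_le_add (mul_le_of_le_one_left' ?_) (mul_le_of_le_one_left' ?_)) ?_
    · exact ENNReal.ofReal_le_one.2 (mul_le_one₀ (hψ1 z) h0 h1)
    · exact ENNReal.ofReal_le_one.2 (mul_le_one₀ (hψ1 z) (by linarith) (by linarith))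
    · gcongr
      exact abs_truncFun_le hδ s
  · have hm : Measurable fun z => mollDensity n ρ ν z + mollDensity n ρ μ z :=
      (measurable_mollDensity n ρ ν).add (measurable_mollDensity n ρ μ)
    rw [lintegral_add_left hm, lintegral_add_left (measurable_mollDensity n ρ ν),
      lintegral_const_mul' _ _ ENNReal.ofReal_ne_top, lintegral_mollDensity hρ, lintegral_mollDensity hρ]
    exact ENNReal.add_ne_top.2 ⟨ENNReal.add_ne_top.2 ⟨measure_ne_top _ _, measure_ne_top _ _⟩,
      ENNReal.mul_ne_top ENNReal.ofReal_ne_top (lintegral_enorm_gradient_lt_top hψ hψc).ne⟩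
  · filter_upwards [ae_tendsto_mollify hF] with z hz
    have h1 : Tendsto (fun r => mollify n r F z - b z) (𝓝[>] 0) (𝓝 (F z - b z)) :=
      hz.sub tendsto_const_nhds
    have h2 := (hτ.tendsto _).comp h1
    have h3 := (hT.abs.tendsto _).comp h1
    refine Tendsto.add (Tendsto.add ?_ ?_) ?_
    · exact ENNReal.Tendsto.mul_const (ENNReal.tendsto_ofReal (tendsto_const_nhds.mul h2))
        (Or.inr (mollDensity_lt_top hρ _ _).ne)
    · exact ENNReal.Tendsto.mul_const
        (ENNReal.tendsto_ofReal (tendsto_const_nhds.mul (tendsto_const_nhds.sub h2)))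
        (Or.inr (mollDensity_lt_top hρ _ _).ne)
    · exact ENNReal.Tendsto.mul_const (ENNReal.tendsto_ofReal h3) (Or.inr enorm_ne_top)

theorem eventually_lintegral_gradient_le {f F FW ψ c : EuclideanSpace ℝ (Fin n) → ℝ}
    {Ω K KW W G : Set (EuclideanSpace ℝ (Fin n))} {μ : Measure (EuclideanSpace ℝ (Fin n))}
    {σ : EuclideanSpace ℝ (Fin n) → EuclideanSpace ℝ (Fin n)}
    (h : IsVariationPair n f Ω μ σ) {δ ρ κ : ℝ} (hδ : 0 < δ) (hρ : 0 < ρ) (hκ : 0 < κ)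
    (hF : LocallyIntegrable F) (hFW : LocallyIntegrable FW)
    (hFf : ∀ᵐ y, y ∈ K → F y = f y) (hFWf : ∀ᵐ y, y ∈ KW → FW y = f y)
    (hψ : ContDiff ℝ 1 ψ) (hψc : HasCompactSupport ψ) (hψ0 : ∀ z, 0 ≤ ψ z) (hψ1 : ∀ z, ψ z ≤ 1)
    (hψK : ∀ z, ψ z ≠ 0 → closedBall z ρ ⊆ K) (hK : K ⊆ KW) (hKW : KW ⊆ Ω)
    (hW : MeasurableSet W) (hWK : ∀ z ∈ W, closedBall z κ ⊆ KW) (hG : MeasurableSet G)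
    (hc : ∀ᵐ y ∂μ.restrict G, HasBlowUp n FW y fun _ => c y) {B : ℝ≥0∞}
    (hB : ∫⁻ y in G, ENNReal.ofReal (1 - ψ y * truncDeriv δ (c y - mollify n ρ F y)) ∂μ + μ Gᶜ +
      ∫⁻ z, corrError n δ ρ (μ.restrict G) (μ.restrict Gᶜ) ψ F (mollify n ρ F) z < B) :
    ∀ᶠ r in 𝓝[>] 0, ∫⁻ z in W, ‖gradient (corrected n δ ψ (mollify n r FW) (mollify n ρ F)) z -
      ψ z • mollField n ρ (μ.restrict G) σ z‖ₑ ≤ B := by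
  have := h.1
  have hσm := h.2.2.1
  have hσ := h.2.2.2.1
  have hb := contDiff_mollify hρ hF
  have hE : ∫⁻ z, corrError n δ ρ (μ.restrict G) (μ.restrict Gᶜ) ψ FW (mollify n ρ F) z =
      ∫⁻ z, corrError n δ ρ (μ.restrict G) (μ.restrict Gᶜ) ψ F (mollify n ρ F) z := by
    have hg0 : ∀ z, z ∉ K → ψ =ᶠ[𝓝 z] 0 → gradient ψ z = 0 := fun z _ hz => by
      rw [gradient, hz.fderiv_eq]; simp
    have hKt : tsupport ψ ⊆ closure K := closure_mono fun z hz => hψK z hz (mem_closedBall_self hρ.le)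
    have hgz : ∀ z, z ∉ K → gradient ψ z = 0 := fun z hz => by
      by_contra hne
      have hzt : z ∈ tsupport ψ := by
        by_contra hzt
        exact hne (hg0 z hz (notMem_tsupport_iff_eventuallyEq.1 hzt))
      obtain ⟨w, hw, hwz⟩ := Metric.mem_closure_iff.1 hzt ρ hρ
      exact hz (hψK w hw (by rw [mem_closedBall]; exact hwz.le))
    refine lintegral_congr_ae ?_
    filter_upwards [hFf, hFWf] with z hz hzW
    by_cases hzK : z ∈ K
    · simp only [corrError, hz hzK, hzW (hK hzK)]
    · have : ψ z = 0 := by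
        by_contra hne
        exact hzK (hψK z hne (mem_closedBall_self hρ.le))
      simp [corrError, this, hgz z hzK]
  have hlim := ((tendsto_lintegral_one_sub (μ := μ.restrict G) hFW hδ hψ.continuous hψ0 hb.continuous hc).add
    (tendsto_const_nhds (x := μ Gᶜ))).add (tendsto_lintegral_corrError (μ := μ.restrict G)
      (ν := μ.restrict Gᶜ) hδ hρ hψ hψc hψ1 hFW hb.continuous.measurable)
  rw [hE] at hlim
  have hκ' : ∀ᶠ r : ℝ in 𝓝[>] 0, r < κ := nhdsWithin_le_nhds (gt_mem_nhds hκ)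
  filter_upwards [hlim.eventually (gt_mem_nhds hB), self_mem_nhdsWithin, hκ'] with r hrB (hr : 0 < r) hrκ
  refine le_trans ?_ hrB.le
  have ha := contDiff_mollify hr hFW
  have hm1 : Measurable fun z => ENNReal.ofReal (1 - ψ z * truncDeriv δ (mollify n r FW z - mollify n ρ F z)) *
      mollDensity n r (μ.restrict G) z :=
    Measurable.mul ((measurable_const.sub (hψ.continuous.measurable.mul
      ((continuous_truncDeriv hδ).measurable.comp
        (ha.continuous.measurable.sub hb.continuous.measurable)))).ennreal_ofReal)
      (measurable_mollDensity n r _)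
  have hm2 : Measurable fun z => ENNReal.ofReal (1 - ψ z * truncDeriv δ (mollify n r FW z - mollify n ρ F z)) *
      mollDensity n r (μ.restrict G) z + mollDensity n r (μ.restrict Gᶜ) z :=
    hm1.add (measurable_mollDensity n r _)
  have hR : μ Gᶜ = ∫⁻ z, mollDensity n r (μ.restrict Gᶜ) z := by
    rw [lintegral_mollDensity hr, Measure.restrict_apply_univ]
  rw [hR, ← lintegral_add_left hm1, ← lintegral_add_left hm2]
  refine (setLIntegral_mono' hW fun z hz => ?_).trans (setLIntegral_le_lintegral W _)
  have hga : gradient (mollify n r FW) z =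
      mollField n r (μ.restrict G) σ z + mollField n r (μ.restrict Gᶜ) σ z := by
    rw [mollField_restrict_add_compl hr hσm hσ hG]
    exact gradient_mollify_eq_mollField h hr hFW
      ((closedBall_subset_closedBall hrκ.le).trans (hWK z hz)) hKW hFWf
  have hgb : ψ z ≠ 0 → gradient (mollify n ρ F) z =
      mollField n ρ (μ.restrict G) σ z + mollField n ρ (μ.restrict Gᶜ) σ z := fun hne => by
    rw [mollField_restrict_add_compl hρ hσm hσ hG]
    exact gradient_mollify_eq_mollField h hρ hF (hψK z hne) (hK.trans hKW) hFf
  refine (enorm_gradient_corrected_sub_le hδ hψ ha hb (hψ0 z) (hψ1 z) hga hgb).trans ?_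
  have hσG := ae_restrict_of_ae (s := G) hσ
  have hσR := ae_restrict_of_ae (s := Gᶜ) hσ
  unfold corrError
  gcongr
  · exact enorm_mollField_le hr hσG z
  · exact enorm_mollField_le hr hσR z
  · exact enorm_mollField_le hρ hσR z
  · exact enorm_mollField_le hρ hσG z

end

section

variable {n : ℕ} {r : ℝ}

theorem HasBlowUp.congr_of_mem_interior {f F : EuclideanSpace ℝ (Fin n) → ℝ} {x : EuclideanSpace ℝ (Fin n)}
    {p : EuclideanSpace ℝ (Fin n) → ℝ} (h : HasBlowUp n f x p) {K : Set (EuclideanSpace ℝ (Fin n))}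
    (hx : x ∈ interior K) (hF : ∀ᵐ y, y ∈ K → F y = f y) : HasBlowUp n F x p := by
  obtain ⟨ρ, hρ, hρK⟩ := Metric.mem_nhds_iff.1 (mem_interior_iff_mem_nhds.1 hx)
  exact h.congr_ae hρ (hF.mono fun y hy hyb => hy (hρK hyb))

theorem limsup_kappa_corrected_le (hn : 1 ≤ n) {Ω : Set (EuclideanSpace ℝ (Fin n))} (hΩ : IsOpen Ω)
    {f F ψ c : EuclideanSpace ℝ (Fin n) → ℝ} (hf : LocallyIntegrableOn f Ω volume)
    {K G : Set (EuclideanSpace ℝ (Fin n))} {μ : Measure (EuclideanSpace ℝ (Fin n))}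
    {σ : EuclideanSpace ℝ (Fin n) → EuclideanSpace ℝ (Fin n)}
    (h : IsVariationPair n f Ω μ σ) {δ ρ : ℝ} (hδ : 0 < δ) (hρ : 0 < ρ)
    (hF : LocallyIntegrable F) (hFf : ∀ᵐ y, y ∈ K → F y = f y)
    (hψ : ContDiff ℝ 1 ψ) (hψc : HasCompactSupport ψ) (hψ0 : ∀ z, 0 ≤ ψ z) (hψ1 : ∀ z, ψ z ≤ 1)
    (hψK : ∀ z, ψ z ≠ 0 → closedBall z ρ ⊆ K) (hK : IsCompact K) (hKΩ : K ⊆ Ω)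
    (hG : MeasurableSet G) (hGK : G ⊆ interior K)
    (hc : ∀ᵐ y ∂μ.restrict G, HasBlowUp n f y fun _ => c y) {B : ℝ≥0∞}
    (hB : ∫⁻ y in G, ENNReal.ofReal (1 - ψ y * truncDeriv δ (c y - mollify n ρ F y)) ∂μ + μ Gᶜ +
      ∫⁻ z, corrError n δ ρ (μ.restrict G) (μ.restrict Gᶜ) ψ F (mollify n ρ F) z < B) :
    limsup (fun ε => kappa n ε (fun z => f z - ψ z * truncFun δ (F z - mollify n ρ F z)) Ω) (𝓝[>] 0)
      ≤ B / 2 + μ G / 4 := by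
  have := h.1
  have hσG := ae_restrict_of_ae (s := G) h.2.2.2.1
  have hσm : AEStronglyMeasurable σ (μ.restrict G) := h.2.2.1.restrict
  have hb := contDiff_mollify hρ hF
  have hv : Continuous fun z => ψ z • mollField n ρ (μ.restrict G) σ z :=
    hψ.continuous.smul (continuous_mollField hρ hσm hσG)
  have hvi : ∫⁻ z, ‖ψ z • mollField n ρ (μ.restrict G) σ z‖ₑ ≤ μ G := by
    rw [← Measure.restrict_apply_univ, ← lintegral_mollDensity hρ]
    refine lintegral_mono fun z => ?_
    rw [enorm_smul, Real.enorm_eq_ofReal (hψ0 z)]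
    calc _ ≤ ENNReal.ofReal 1 * mollDensity n ρ (μ.restrict G) z := by
          gcongr
          · exact hψ1 z
          · exact enorm_mollField_le hρ hσG z
      _ = _ := by simp
  have hgm : AEStronglyMeasurable (fun z => f z - ψ z * truncFun δ (F z - mollify n ρ F z))
      (volume.restrict Ω) := by
    have h1 : AEStronglyMeasurable (fun z => F z - mollify n ρ F z) volume :=
      hF.aestronglyMeasurable.sub hb.continuous.aestronglyMeasurable
    exact hf.aestronglyMeasurable.sub ((hψ.continuous.aestronglyMeasurable.mul
      ((contDiff_truncFun δ).continuous.comp_aestronglyMeasurable h1)).restrict)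
  refine (limsup_kappa_le hn hgm hv hψc.smul_right (B := B) fun W hW hWΩ => ?_).trans ?_
  · obtain ⟨κ, hκ, hκΩ⟩ := (hW.union hK).exists_cthickening_subset_open hΩ (Set.union_subset hWΩ hKΩ)
    obtain ⟨KW, hKW⟩ : ∃ KW, KW = cthickening κ (W ∪ K) := ⟨_, rfl⟩
    have hKWc : IsCompact KW := hKW ▸ (hW.union hK).cthickening
    have hsub : W ∪ K ⊆ KW := hKW ▸ self_subset_cthickening _
    have hFW : LocallyIntegrable (KW.indicator f) :=
      ((integrable_indicator_iff hKWc.measurableSet).2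
        (hf.integrableOn_compact_subset (hKW ▸ hκΩ) hKWc)).locallyIntegrable
    have hFWf : ∀ y, y ∈ KW → KW.indicator f y = f y := fun y hy => Set.indicator_of_mem hy f
    have hKKW : K ⊆ KW := Set.subset_union_right.trans hsub
    have hev := eventually_lintegral_gradient_le (W := W) (c := c) h hδ hρ hκ hF hFW hFf
      (ae_of_all _ hFWf) hψ hψc hψ0 hψ1 hψK hKKW (hKW ▸ hκΩ) hW.measurableSet
      (fun z hz => by
        rw [hKW]; exact closedBall_subset_cthickening (Set.mem_union_left K hz) κ) hG (by
        filter_upwards [hc, ae_restrict_mem hG] with y hy hyG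
        exact hy.congr_of_mem_interior (interior_mono hKKW (hGK hyG)) (ae_of_all _ hFWf)) hB
    refine ⟨fun k : ℕ => corrected n δ ψ (mollify n (1 / ((k : ℝ) + 1)) (KW.indicator f)) (mollify n ρ F),
      fun k => contDiff_corrected hψ (contDiff_mollify Nat.one_div_pos_of_nat hFW) hb, ?_,
      tendsto_one_div_succ_nhdsGT.eventually hev⟩
    filter_upwards [ae_restrict_mem hW.measurableSet, ae_restrict_of_ae hFf,
      ae_restrict_of_ae (ae_tendsto_mollify hFW)] with z hzW hzF hz
    have hzk := hz.comp tendsto_one_div_succ_nhdsGT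
    have h1 := hzk.sub ((tendsto_const_nhds (x := ψ z)).mul
      (((contDiff_truncFun δ).continuous.tendsto _).comp (hzk.sub (tendsto_const_nhds (x := mollify n ρ F z)))))
    rw [hFWf z (hsub (Or.inl hzW))] at h1
    have h2 : f z - ψ z * truncFun δ (F z - mollify n ρ F z) =
        f z - ψ z * truncFun δ (f z - mollify n ρ F z) := by
      by_cases hψz : ψ z = 0
      · simp [hψz]
      · rw [hzF (hψK z hψz (mem_closedBall_self hρ.le))]
    rw [h2]
    exact h1
  · gcongr

end

section

open scoped ENNReal RealInnerProductSpace Classical Manifold ContDiff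

variable {n : ℕ} {r : ℝ}

theorem exists_contDiff_cutoff {K : Set (EuclideanSpace ℝ (Fin n))} (hK : IsCompact K) {κ : ℝ} (hκ : 0 < κ) :
    ∃ ψ : EuclideanSpace ℝ (Fin n) → ℝ, ContDiff ℝ 1 ψ ∧ HasCompactSupport ψ ∧ (∀ z, 0 ≤ ψ z) ∧
      (∀ z, ψ z ≤ 1) ∧ (∀ z ∈ K, ψ z = 1) ∧ ∀ z, ψ z ≠ 0 → z ∈ thickening κ K := by
  obtain ⟨ψ, h1, h2, h3, h4⟩ := exists_contMDiff_zero_iff_one_iff_of_isClosed (n := 1)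
    𝓘(ℝ, EuclideanSpace ℝ (Fin n)) (s := (thickening κ K)ᶜ) (t := K)
    isOpen_thickening.isClosed_compl hK.isClosed
    (Set.disjoint_compl_left_iff_subset.2 (self_subset_thickening hκ K))
  have hs : ∀ z, ψ z ≠ 0 → z ∈ thickening κ K := fun z hz => by
    by_contra hn
    exact hz ((h3 z).1 hn)
  refine ⟨ψ, h1.contDiff, ?_, fun z => (h2 ⟨z, rfl⟩).1, fun z => (h2 ⟨z, rfl⟩).2,
    fun z hz => (h4 z).1 hz, hs⟩
  exact HasCompactSupport.intro (hK.cthickening (r := κ)) fun z hz => by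
    by_contra hne
    exact hz (thickening_subset_cthickening κ K (hs z hne))

theorem mollDensity_restrict_compl_le {μ : Measure (EuclideanSpace ℝ (Fin n))}
    {K G : Set (EuclideanSpace ℝ (Fin n))} (z : EuclideanSpace ℝ (Fin n)) :
    mollDensity n r (μ.restrict Gᶜ) z ≤
      mollDensity n r (μ.restrict (K \ G)) z + mollDensity n r (μ.restrict Kᶜ) z := by
  unfold mollDensity
  rw [← lintegral_add_measure]
  refine lintegral_mono' ?_ le_rfl
  refine (Measure.restrict_mono (fun x hx => ?_) le_rfl).trans (Measure.restrict_union_le (K \ G) Kᶜ)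
  by_cases hxK : x ∈ K
  · exact Or.inl ⟨hxK, hx⟩
  · exact Or.inr hxK

theorem tendsto_corrError {μ : Measure (EuclideanSpace ℝ (Fin n))} [IsFiniteMeasure μ]
    {K G : Set (EuclideanSpace ℝ (Fin n))} {ψ F : EuclideanSpace ℝ (Fin n) → ℝ}
    (hFm : Measurable F) (hF : LocallyIntegrable F) {δ : ℝ} (hδ : 0 < δ)
    (hψ : ContDiff ℝ 1 ψ) (hψc : HasCompactSupport ψ) (hψ1 : ∀ z, ψ z ≤ 1)
    {c : EuclideanSpace ℝ (Fin n) → ℝ} {p : EuclideanSpace ℝ (Fin n) → EuclideanSpace ℝ (Fin n) → ℝ}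
    (hc : ∀ᵐ y ∂μ.restrict G, HasBlowUp n F y fun _ => c y)
    (hp : ∀ᵐ y ∂μ.restrict (K \ G), HasBlowUp n F y (p y))
    (hpl : ∀ᵐ y ∂μ.restrict (K \ G), LocallyIntegrable (p y)) {A : ℝ≥0∞}
    (hA : ∫⁻ y in K \ G, blowUpDefect n (truncDeriv δ) (p y) ∂μ + μ Kᶜ < A) :
    ∀ᶠ ρ in 𝓝[>] 0, ∫⁻ z, corrError n δ ρ (μ.restrict G) (μ.restrict Gᶜ) ψ F (mollify n ρ F) z < A := by
  have hτ := continuous_truncDeriv hδ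
  have hT := (contDiff_truncFun δ).continuous
  have l1 := (tendsto_lintegral_defect (μ := μ.restrict (K \ G)) hFm hF hp hpl
    (lipschitzWith_truncDeriv hδ) (truncDeriv_le_one δ)).2
  have l2 := (tendsto_lintegral_defect (μ := μ.restrict G) hFm hF hc
    (ae_of_all _ fun y => locallyIntegrable_const (c y))
    (lipschitzWith_one_sub_truncDeriv hδ) (fun s => by linarith [truncDeriv_nonneg δ s])).2
  have z2 : ∀ y, blowUpDefect n (fun s => 1 - truncDeriv δ s) (fun _ => c y) = 0 := fun y => by
    simp [blowUpDefect, mollify_const one_pos, truncDeriv_zero]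
  simp only [z2, lintegral_zero] at l2
  have l3 : Tendsto (fun ρ => ∫⁻ z, ENNReal.ofReal |truncFun δ (F z - mollify n ρ F z)| * ‖gradient ψ z‖ₑ)
      (𝓝[>] 0) (𝓝 (∫⁻ _ : EuclideanSpace ℝ (Fin n), 0)) := by
    refine tendsto_lintegral_of_dominated_ae (fun z => ENNReal.ofReal (δ * 2) * ‖gradient ψ z‖ₑ) ?_ ?_ ?_ ?_
    · filter_upwards [self_mem_nhdsWithin] with ρ (hρ : 0 < ρ)
      have h3 : Measurable fun z => ENNReal.ofReal |truncFun δ (F z - mollify n ρ F z)| :=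
        (continuous_abs.measurable.comp (hT.measurable.comp
          (hFm.sub (contDiff_mollify hρ hF).continuous.measurable))).ennreal_ofReal
      exact h3.aemeasurable.mul (continuous_gradient hψ).measurable.enorm.aemeasurable
    · refine Eventually.of_forall fun ρ => ae_of_all _ fun z => ?_
      have h3 : ENNReal.ofReal |truncFun δ (F z - mollify n ρ F z)| ≤ ENNReal.ofReal (δ * 2) :=
        ENNReal.ofReal_le_ofReal (abs_truncFun_le hδ _)
      exact mul_le_mul_left h3 _
    · rw [lintegral_const_mul' _ _ ENNReal.ofReal_ne_top]
      exact ENNReal.mul_ne_top ENNReal.ofReal_ne_top (lintegral_enorm_gradient_lt_top hψ hψc).ne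
    · filter_upwards [ae_tendsto_mollify hF] with z hz
      have h1 : Tendsto (fun ρ => F z - mollify n ρ F z) (𝓝[>] 0) (𝓝 (F z - F z)) :=
        tendsto_const_nhds.sub hz
      have h3 := (hT.abs.tendsto _).comp h1
      rw [sub_self, truncFun_zero, abs_zero] at h3
      have h4 := ENNReal.Tendsto.mul_const (b := ‖gradient ψ z‖ₑ) (ENNReal.tendsto_ofReal h3)
        (Or.inr enorm_ne_top)
      simpa using h4
  rw [lintegral_zero] at l3
  have lim := ((l1.add (tendsto_const_nhds (x := μ Kᶜ))).add l2).add l3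
  rw [add_zero, add_zero] at lim
  filter_upwards [lim.eventually (gt_mem_nhds hA), self_mem_nhdsWithin] with ρ hρA (hρ : 0 < ρ)
  refine lt_of_le_of_lt ?_ hρA
  have hs : Measurable fun z => F z - mollify n ρ F z :=
    hFm.sub (contDiff_mollify hρ hF).continuous.measurable
  have m1 : Measurable fun z => ENNReal.ofReal (truncDeriv δ (F z - mollify n ρ F z)) *
      mollDensity n ρ (μ.restrict (K \ G)) z :=
    Measurable.mul (hτ.measurable.comp hs).ennreal_ofReal (measurable_mollDensity n ρ _)
  have m2 : Measurable fun z => ENNReal.ofReal (1 - truncDeriv δ (F z - mollify n ρ F z)) *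
      mollDensity n ρ (μ.restrict G) z :=
    Measurable.mul (measurable_const.sub (hτ.measurable.comp hs)).ennreal_ofReal (measurable_mollDensity n ρ _)
  have m3 := measurable_mollDensity n ρ (μ.restrict Kᶜ)
  have m13 : Measurable fun z => ENNReal.ofReal (truncDeriv δ (F z - mollify n ρ F z)) *
      mollDensity n ρ (μ.restrict (K \ G)) z + mollDensity n ρ (μ.restrict Kᶜ) z := m1.add m3
  have m132 : Measurable fun z => ENNReal.ofReal (truncDeriv δ (F z - mollify n ρ F z)) *
      mollDensity n ρ (μ.restrict (K \ G)) z + mollDensity n ρ (μ.restrict Kᶜ) z +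
      ENNReal.ofReal (1 - truncDeriv δ (F z - mollify n ρ F z)) *
      mollDensity n ρ (μ.restrict G) z := m13.add m2
  have hKc : μ Kᶜ = ∫⁻ z, mollDensity n ρ (μ.restrict Kᶜ) z := by
    rw [lintegral_mollDensity hρ, Measure.restrict_apply_univ]
  rw [hKc, ← lintegral_add_left m1, ← lintegral_add_left m13, ← lintegral_add_left m132]
  refine lintegral_mono fun z => ?_
  obtain ⟨s, hs⟩ : ∃ s, s = F z - mollify n ρ F z := ⟨_, rfl⟩
  have h0 := truncDeriv_nonneg δ s
  have h1 := truncDeriv_le_one δ s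
  simp only [corrError, ← hs]
  refine add_le_add (add_le_add ?_ ?_) le_rfl
  · refine (mul_le_mul_right (mollDensity_restrict_compl_le (K := K) z) _).trans ?_
    rw [mul_add]
    refine add_le_add ?_ (mul_le_of_le_one_left' ?_)
    · gcongr
      exact mul_le_of_le_one_left h0 (hψ1 z)
    · exact ENNReal.ofReal_le_one.2 (mul_le_one₀ (hψ1 z) h0 h1)
  · gcongr
    exact mul_le_of_le_one_left (by linarith) (hψ1 z)

end

section

variable {n : ℕ} {r : ℝ}

theorem exists_recovery (hn : 1 ≤ n) {Ω : Set (EuclideanSpace ℝ (Fin n))} (hΩ : IsOpen Ω)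
    {f : EuclideanSpace ℝ (Fin n) → ℝ} (hf : LocallyIntegrableOn f Ω)
    {μ : Measure (EuclideanSpace ℝ (Fin n))} {σ : EuclideanSpace ℝ (Fin n) → EuclideanSpace ℝ (Fin n)}
    (h : IsVariationPair n f Ω μ σ)
    (hS : ∀ᵐ x ∂μ, ∃ ν : EuclideanSpace ℝ (Fin n), ‖ν‖ = 1 ∧ ∃ a b : ℝ, HasBlowUp n f x (stepFun n ν a b))
    {δ₀ : ℝ} (hδ₀ : 0 < δ₀) {η : ℝ≥0∞} (hη : η ≠ 0) :
    ∃ g : EuclideanSpace ℝ (Fin n) → ℝ, AEStronglyMeasurable g (volume.restrict Ω) ∧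
      (∀ x, |g x - f x| ≤ δ₀) ∧
      limsup (fun ε => kappa n ε g Ω) (𝓝[>] 0) ≤
        μ {x | ∃ c : ℝ, HasBlowUp n f x fun _ => c} / 4 +
          μ {x | ∃ c : ℝ, HasBlowUp n f x fun _ => c}ᶜ / 2 + η := by
  have := h.1
  obtain ⟨C, hC⟩ : ∃ C, C = {x | ∃ c : ℝ, HasBlowUp n f x fun _ => c} := ⟨_, rfl⟩
  rw [← hC]
  have hη4 : η / 4 ≠ 0 := (ENNReal.div_pos hη (by simp)).ne'
  obtain ⟨K, hKΩ, hK, hKμ⟩ := hΩ.measurableSet.exists_isCompact_sdiff_lt (measure_ne_top μ Ω) hη4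
  have hKc : μ Kᶜ < η / 4 := by
    refine lt_of_le_of_lt ?_ hKμ
    calc μ Kᶜ ≤ μ (Ωᶜ ∪ Ω \ K) := measure_mono fun x hx => by
          by_cases hxΩ : x ∈ Ω
          · exact Or.inr ⟨hxΩ, hx⟩
          · exact Or.inl hxΩ
      _ ≤ μ Ωᶜ + μ (Ω \ K) := measure_union_le _ _
      _ = μ (Ω \ K) := by rw [h.2.1, zero_add]
  obtain ⟨κ, hκ, hκΩ⟩ := hK.exists_cthickening_subset_open hΩ hKΩ
  obtain ⟨K₁, hK₁⟩ : ∃ K₁, K₁ = cthickening κ K := ⟨_, rfl⟩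
  have hK₁c : IsCompact K₁ := hK₁ ▸ hK.cthickening
  have hKint : K ⊆ interior K₁ := by
    rw [hK₁]
    exact (self_subset_thickening hκ K).trans (thickening_subset_interior_cthickening κ K)
  obtain ⟨ψ, hψ, hψc, hψ0, hψ1, hψK, hψs⟩ := exists_contDiff_cutoff hK (half_pos hκ)
  have hFi : Integrable (K₁.indicator f) :=
    (integrable_indicator_iff hK₁c.measurableSet).2
      (hf.integrableOn_compact_subset (hK₁ ▸ hκΩ) hK₁c)
  obtain ⟨F, hFm, hFae⟩ := hFi.aestronglyMeasurable
  have hFm := hFm.measurable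
  have hF : LocallyIntegrable F := (hFi.congr hFae).locallyIntegrable
  have hFf : ∀ᵐ y, y ∈ K₁ → F y = f y := by
    filter_upwards [hFae] with y hy hyK
    rw [← hy, Set.indicator_of_mem hyK]
  have hFblow : ∀ x ∈ K, ∀ p, HasBlowUp n f x p → HasBlowUp n F x p := fun x hx p hp =>
    hp.congr_of_mem_interior (hKint hx) hFf
  have hτ1 := lipschitzWith_one_sub_truncDeriv one_pos
  have hlim : ∀ x ∈ K, ∀ p, LocallyIntegrable p → HasBlowUp n f x p →
      Tendsto (fun k : ℕ => defectAt n (fun s => 1 - truncDeriv 1 s) F (1 / ((k : ℝ) + 1)) x) atTop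
        (𝓝 (blowUpDefect n (fun s => 1 - truncDeriv 1 s) p)) := fun x hx p hpl hp =>
    ((hFblow x hx p hp).tendsto_lintegral hF hpl hτ1
      (fun s => by linarith [truncDeriv_nonneg 1 s])).comp tendsto_one_div_succ_nhdsGT
  have z2 : ∀ c : ℝ, blowUpDefect n (fun s => 1 - truncDeriv 1 s) (fun _ => c) = 0 := fun y => by
    simp [blowUpDefect, mollify_const one_pos, truncDeriv_zero]
  obtain ⟨G, hG⟩ : ∃ G, G = K ∩ {x | Tendsto (fun k : ℕ =>
    defectAt n (fun s => 1 - truncDeriv 1 s) F (1 / ((k : ℝ) + 1)) x) atTop (𝓝 0)} := ⟨_, rfl⟩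
  have hGm : MeasurableSet G := by
    rw [hG]
    exact hK.measurableSet.inter (measurableSet_tendsto _ fun k =>
      measurable_defectAt hτ1.continuous hFm hF Nat.one_div_pos_of_nat)
  have hKC : ∀ x ∈ K, x ∈ C → x ∈ G := fun x hx hxC => by
    rw [hC] at hxC
    obtain ⟨c, hc⟩ := hxC
    rw [hG]
    exact ⟨hx, z2 c ▸ hlim x hx _ (locallyIntegrable_const c) hc⟩
  obtain ⟨ν, hν⟩ := skolem.1 hS
  obtain ⟨a, ha⟩ : ∃ a : EuclideanSpace ℝ (Fin n) → ℝ, ∀ᵐ x ∂μ, ‖ν x‖ = 1 ∧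
      ∃ b : ℝ, HasBlowUp n f x (stepFun n (ν x) (a x) b) := by
    have : ∀ᵐ x ∂μ, ∃ a : ℝ, ‖ν x‖ = 1 ∧ ∃ b : ℝ, HasBlowUp n f x (stepFun n (ν x) a b) := by
      filter_upwards [hν] with x ⟨h1, a, b, h2⟩
      exact ⟨a, h1, b, h2⟩
    exact skolem.1 this
  obtain ⟨b, hb⟩ : ∃ b : EuclideanSpace ℝ (Fin n) → ℝ, ∀ᵐ x ∂μ, ‖ν x‖ = 1 ∧
      HasBlowUp n f x (stepFun n (ν x) (a x) (b x)) := by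
    have : ∀ᵐ x ∂μ, ∃ b : ℝ, ‖ν x‖ = 1 ∧ HasBlowUp n f x (stepFun n (ν x) (a x) b) := by
      filter_upwards [ha] with x ⟨h1, b, h2⟩
      exact ⟨b, h1, h2⟩
    exact skolem.1 this
  have hGc : ∀ᵐ y ∂μ.restrict G, HasBlowUp n f y fun _ => a y := by
    filter_upwards [ae_restrict_of_ae hb, ae_restrict_mem hGm] with y ⟨h1, h2⟩ hyG
    rw [hG] at hyG
    by_cases hab : a y = b y
    · rw [← hab, stepFun_self] at h2
      exact h2
    · exact absurd (tendsto_nhds_unique (hlim y hyG.1 _ (locallyIntegrable_stepFun _ _ _) h2) hyG.2)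
        (stepFun_defect_ne_zero h1 hab)
  have hGK : G ⊆ K := hG ▸ Set.inter_subset_left
  have hpK : ∀ᵐ y ∂μ.restrict (K \ G), ‖ν y‖ = 1 ∧ a y ≠ b y ∧
      HasBlowUp n F y (stepFun n (ν y) (a y) (b y)) := by
    filter_upwards [ae_restrict_of_ae hb, ae_restrict_mem (hK.measurableSet.diff hGm)] with y ⟨h1, h2⟩ hyK
    refine ⟨h1, fun hab => hyK.2 (hKC y hyK.1 ?_), hFblow y hyK.1 _ h2⟩
    rw [← hab, stepFun_self] at h2
    rw [hC]
    exact ⟨_, h2⟩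
  have hcF : ∀ᵐ y ∂μ.restrict G, HasBlowUp n F y fun _ => a y := by
    filter_upwards [hGc, ae_restrict_mem hGm] with y hy hyG
    exact hFblow y (hGK hyG) _ hy
  have hpF : ∀ᵐ y ∂μ.restrict (K \ G), HasBlowUp n F y (stepFun n (ν y) (a y) (b y)) :=
    hpK.mono fun y hy => hy.2.2
  have hpl : ∀ᵐ y ∂μ.restrict (K \ G), LocallyIntegrable (stepFun n (ν y) (a y) (b y)) :=
    ae_of_all _ fun y => locallyIntegrable_stepFun _ _ _
  have hδlim : Tendsto (fun δ => ∫⁻ y in K \ G, blowUpDefect n (truncDeriv δ)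
      (stepFun n (ν y) (a y) (b y)) ∂μ) (𝓝[>] 0) (𝓝 (∫⁻ _ in K \ G, 0 ∂μ)) := by
    refine tendsto_lintegral_of_dominated_ae (fun _ => 1) ?_ ?_ ?_ ?_
    · filter_upwards [self_mem_nhdsWithin] with δ (hδ : 0 < δ)
      exact (tendsto_lintegral_defect hFm hF hpF hpl (lipschitzWith_truncDeriv hδ) (truncDeriv_le_one δ)).1
    · refine Eventually.of_forall fun δ => ae_of_all _ fun y => ?_
      calc _ ≤ ∫⁻ y, ENNReal.ofReal (moll n y) := lintegral_mono fun z =>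
            mul_le_of_le_one_right' (ENNReal.ofReal_le_one.2 (truncDeriv_le_one _ _))
        _ = 1 := lintegral_moll n
    · simp
    · filter_upwards [hpK] with y hy
      exact tendsto_stepFun_defect hy.1 hy.2.1
  rw [lintegral_zero] at hδlim
  obtain ⟨δ, hδA, hδ, hδ2⟩ := ((hδlim.eventually (gt_mem_nhds hη4.bot_lt)).and
    (Ioo_mem_nhdsGT (half_pos hδ₀))).exists
  have hA : ∫⁻ y in K \ G, blowUpDefect n (truncDeriv δ) (stepFun n (ν y) (a y) (b y)) ∂μ + μ Kᶜ < η / 2 := by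
    refine (ENNReal.add_lt_add hδA hKc).trans_le (le_of_eq ?_)
    rw [← ENNReal.add_div, ← two_mul, ENNReal.div_eq_inv_mul, ENNReal.div_eq_inv_mul, ← mul_assoc]
    congr 1
    rw [show (4:ℝ≥0∞) = 2 * 2 by norm_num, ENNReal.mul_inv (by simp) (by simp), mul_assoc,
      ENNReal.inv_mul_cancel (by simp) (by simp), mul_one]
  have e1 := tendsto_corrError (ψ := ψ) hFm hF hδ hψ hψc hψ1 hcF hpF hpl hA
  have e2 := (tendsto_lintegral_one_sub_mollify (ψ := ψ) hF hδ (by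
    filter_upwards [ae_restrict_mem hGm] with y hy
    exact hψK y (hGK hy)) hcF).eventually (gt_mem_nhds hη4.bot_lt)
  obtain ⟨ρ, ⟨hρ1, hρ2⟩, hρ, hρκ⟩ := ((e1.and e2).and (Ioo_mem_nhdsGT (half_pos hκ))).exists
  have hψK₁ : ∀ z, ψ z ≠ 0 → closedBall z ρ ⊆ K₁ := fun z hz => by
    rw [hK₁]
    refine (closedBall_subset_cthickening (hψs z hz) ρ).trans ?_
    refine (cthickening_thickening_subset hρ.le _ _).trans (cthickening_mono (by linarith) _)
  have hGcK : μ Gᶜ ≤ μ Cᶜ + η / 4 := by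
    calc μ Gᶜ ≤ μ (Cᶜ ∪ Kᶜ) := measure_mono fun x hx => by
          by_cases hxK : x ∈ K
          · exact Or.inl fun hxC => hx (hKC x hxK hxC)
          · exact Or.inr hxK
      _ ≤ μ Cᶜ + μ Kᶜ := measure_union_le _ _
      _ ≤ _ := by gcongr
  have hGC : μ G ≤ μ C := by
    refine measure_mono_ae ((ae_restrict_iff' hGm).1 (hGc.mono fun y hy => ?_))
    rw [hC]
    exact ⟨_, hy⟩
  refine ⟨fun z => f z - ψ z * truncFun δ (F z - mollify n ρ F z), ?_, fun x => ?_, ?_⟩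
  · have hb := contDiff_mollify hρ hF
    have h1 : AEStronglyMeasurable (fun z => F z - mollify n ρ F z) volume :=
      hF.aestronglyMeasurable.sub hb.continuous.aestronglyMeasurable
    exact hf.aestronglyMeasurable.sub ((hψ.continuous.aestronglyMeasurable.mul
      ((contDiff_truncFun δ).continuous.comp_aestronglyMeasurable h1)).restrict)
  · rw [sub_sub_cancel_left, abs_neg, abs_mul, abs_of_nonneg (hψ0 x)]
    calc _ ≤ 1 * (δ * 2) := mul_le_mul (hψ1 x) (abs_truncFun_le hδ _) (abs_nonneg _) zero_le_one
      _ ≤ δ₀ := by linarith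
  · refine (limsup_kappa_corrected_le (B := μ Gᶜ + η) hn hΩ hf h hδ hρ hF hFf hψ hψc hψ0 hψ1 hψK₁ hK₁c
      (hK₁ ▸ hκΩ) hGm (hGK.trans hKint) hGc ?_).trans ?_
    · have h3 : ∫⁻ y in G, ENNReal.ofReal (1 - ψ y * truncDeriv δ (a y - mollify n ρ F y)) ∂μ +
          ∫⁻ z, corrError n δ ρ (μ.restrict G) (μ.restrict Gᶜ) ψ F (mollify n ρ F) z < η / 4 + η / 2 :=
        ENNReal.add_lt_add hρ2 hρ1
      have h4 : η / 4 + η / 2 ≤ η :=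
        calc η / 4 + η / 2 ≤ η / 2 + η / 2 :=
              add_le_add (ENNReal.div_le_div_left (by norm_num) η) le_rfl
          _ = η := ENNReal.add_halves η
      rw [add_right_comm, add_comm (μ Gᶜ)]
      exact ENNReal.add_lt_add_right (measure_ne_top _ _) (h3.trans_le h4)
    · calc (μ Gᶜ + η) / 2 + μ G / 4 ≤ (μ Cᶜ + η + η) / 2 + μ C / 4 := by
            gcongr
            refine hGcK.trans ?_
            gcongr
            exact ENNReal.div_le_of_le_mul (le_mul_of_one_le_right' (by norm_num))
        _ = μ C / 4 + μ Cᶜ / 2 + η := by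
            rw [add_assoc, ENNReal.add_div, ENNReal.add_div, ENNReal.add_halves]
            ring

end

section

variable {n : ℕ} {r : ℝ}

theorem setLIntegral_rescale_set (hr : 0 < r) (x : EuclideanSpace ℝ (Fin n))
    {U : Set (EuclideanSpace ℝ (Fin n))} (hU : MeasurableSet U) (g : EuclideanSpace ℝ (Fin n) → ℝ≥0∞) :
    ∫⁻ z in {z | r⁻¹ • (z - x) ∈ U}, g z = ENNReal.ofReal (r ^ n) * ∫⁻ y in U, g (x + r • y) := by
  have hm : MeasurableSet {z | r⁻¹ • (z - x) ∈ U} :=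
    hU.preimage ((measurable_id.sub_const x).const_smul r⁻¹)
  have h1 := lintegral_rescale hr x (Set.indicator {z | r⁻¹ • (z - x) ∈ U} g)
  rw [lintegral_indicator hm] at h1
  have h2 : ∀ y, Set.indicator {z | r⁻¹ • (z - x) ∈ U} g (x + r • y) =
      U.indicator (fun y => g (x + r • y)) y := fun y => by
    simp only [Set.indicator, Set.mem_ofPred_eq, add_sub_cancel_left, smul_smul,
      inv_mul_cancel₀ hr.ne', one_smul]
  simp only [h2] at h1
  rw [← lintegral_indicator hU, h1, ← mul_assoc, ← ENNReal.ofReal_mul (by positivity),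
    mul_inv_cancel₀ (by positivity), ENNReal.ofReal_one, one_mul]

theorem HasBlowUp.tendsto_setAverage {f p : EuclideanSpace ℝ (Fin n) → ℝ} {x : EuclideanSpace ℝ (Fin n)}
    (h : HasBlowUp n f x p) {U : Set (EuclideanSpace ℝ (Fin n))} (hU : MeasurableSet U)
    (hU2 : U ⊆ ball 0 2) (hU0 : volume U ≠ 0) {a : ℝ} (hp : ∀ y ∈ U, p y = a) :
    Tendsto (fun r : ℝ => ⨍ z in {z | r⁻¹ • (z - x) ∈ U}, |f z - a|) (𝓝[>] 0) (𝓝 0) := by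
  have hUt : volume U ≠ ⊤ := ((measure_mono hU2).trans_lt measure_ball_lt_top).ne
  have hUr : 0 < (volume U).toReal := ENNReal.toReal_pos hU0 hUt
  rw [tendsto_iff_enorm_sub_tendsto_zero]
  simp only [sub_zero]
  have h0 := ENNReal.Tendsto.const_mul (a := ENNReal.ofReal (volume U).toReal⁻¹) h
    (Or.inr ENNReal.ofReal_ne_top)
  rw [mul_zero] at h0
  refine tendsto_of_tendsto_of_tendsto_of_le_of_le' tendsto_const_nhds h0
    (Eventually.of_forall fun _ => zero_le) ?_
  filter_upwards [self_mem_nhdsWithin] with r (hr : 0 < r)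
  have hv : (volume {z | r⁻¹ • (z - x) ∈ U}).toReal = r ^ n * (volume U).toReal := by
    have := setLIntegral_rescale_set hr x hU fun _ => 1
    rw [setLIntegral_one, setLIntegral_one] at this
    rw [this, ENNReal.toReal_mul, ENNReal.toReal_ofReal (by positivity)]
  rw [setAverage_eq, Measure.real, hv, enorm_smul, Real.enorm_eq_ofReal (by positivity)]
  calc _ ≤ ENNReal.ofReal (r ^ n * (volume U).toReal)⁻¹ *
        ∫⁻ z in {z | r⁻¹ • (z - x) ∈ U}, ‖f z - a‖ₑ := by
        gcongr
        refine (enorm_integral_le_lintegral_enorm _).trans (le_of_eq ?_)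
        simp
    _ = ENNReal.ofReal (volume U).toReal⁻¹ * ∫⁻ y in U, ‖f (x + r • y) - p y‖ₑ := by
        rw [setLIntegral_rescale_set hr x hU, ← mul_assoc, ← ENNReal.ofReal_mul (by positivity)]
        congr 1
        · congr 1; field_simp
        · exact setLIntegral_congr_fun hU fun y hy => by rw [hp y hy]
    _ ≤ _ := by gcongr

theorem mem_ball_iff_rescale (hr : 0 < r) (x z : EuclideanSpace ℝ (Fin n)) :
    r⁻¹ • (z - x) ∈ ball (0 : EuclideanSpace ℝ (Fin n)) 1 ↔ z ∈ ball x r := by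
  rw [mem_ball_zero_iff, norm_smul, norm_inv, Real.norm_of_nonneg hr.le, mem_ball_iff_norm,
    inv_mul_lt_one₀ hr]

theorem HasBlowUp.notMem_approxDiscontSet {f : EuclideanSpace ℝ (Fin n) → ℝ} {x : EuclideanSpace ℝ (Fin n)}
    {c : ℝ} (h : HasBlowUp n f x fun _ => c) : x ∉ approxDiscontSet n f := by
  intro hx
  refine hx ⟨c, (h.tendsto_setAverage measurableSet_ball (ball_subset_ball one_le_two)
    (measure_ball_pos volume 0 one_pos).ne' fun _ _ => rfl).congr' ?_⟩
  filter_upwards [self_mem_nhdsWithin] with r (hr : 0 < r)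
  simp only [mem_ball_iff_rescale hr]
  rfl

theorem HasBlowUp.mem_jumpSet {f : EuclideanSpace ℝ (Fin n) → ℝ} {x ν : EuclideanSpace ℝ (Fin n)}
    {a b : ℝ} (hν : ‖ν‖ = 1) (hab : a ≠ b) (h : HasBlowUp n f x (stepFun n ν a b)) : x ∈ jumpSet n f := by
  have hinner : ∀ s : ℝ, ⟪s • ν, ν⟫ = s := fun s => by
    rw [real_inner_smul_left, real_inner_self_eq_norm_sq, hν]; norm_num
  have hc : Continuous fun y : EuclideanSpace ℝ (Fin n) => ⟪y, ν⟫ := continuous_id.inner continuous_const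
  have hneg : ∀ s {r : ℝ}, 0 < r → (r⁻¹ * s < 0 ↔ s < 0) := fun s r hr => by
    rw [← div_eq_inv_mul, div_neg_iff]
    simp [hr, hr.not_gt]
  refine ⟨ν, hν, a, b, hab, ?_, ?_⟩
  · have ho : IsOpen (ball (0 : EuclideanSpace ℝ (Fin n)) 1 ∩ {y | 0 < ⟪y, ν⟫}) :=
      isOpen_ball.inter (isOpen_lt continuous_const hc)
    refine (h.tendsto_setAverage ho.measurableSet
      (Set.inter_subset_left.trans (ball_subset_ball (by norm_num)))
      (ho.measure_pos volume ⟨(1 / 2 : ℝ) • ν, ?_, ?_⟩).ne' fun y hy => if_pos hy.2).congr' ?_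
    · simp [norm_smul, hν]; norm_num
    · rw [Set.mem_ofPred_eq, hinner]; norm_num
    · filter_upwards [self_mem_nhdsWithin] with r (hr : 0 < r)
      simp only [Set.mem_inter_iff, mem_ball_iff_rescale hr, Set.mem_ofPred_eq, real_inner_smul_left,
        mul_pos_iff_of_pos_left (inv_pos.2 hr)]
  · have ho : IsOpen (ball (0 : EuclideanSpace ℝ (Fin n)) 1 ∩ {y | ⟪y, ν⟫ < 0}) :=
      isOpen_ball.inter (isOpen_lt hc continuous_const)
    refine (h.tendsto_setAverage ho.measurableSet
      (Set.inter_subset_left.trans (ball_subset_ball (by norm_num)))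
      (ho.measure_pos volume ⟨(-1 / 2 : ℝ) • ν, ?_, ?_⟩).ne' fun y hy => if_neg hy.2.not_gt).congr' ?_
    · simp [norm_smul, hν]; norm_num
    · rw [Set.mem_ofPred_eq, hinner]; norm_num
    · filter_upwards [self_mem_nhdsWithin] with r (hr : 0 < r)
      simp only [Set.mem_inter_iff, mem_ball_iff_rescale hr, Set.mem_ofPred_eq, real_inner_smul_left,
        hneg _ hr]

theorem volume_diff_hasBlowUp_const {Ω : Set (EuclideanSpace ℝ (Fin n))} (hΩ : IsOpen Ω)
    {f : EuclideanSpace ℝ (Fin n) → ℝ} (hf : LocallyIntegrableOn f Ω) :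
    volume (Ω \ {x | ∃ c : ℝ, HasBlowUp n f x fun _ => c}) = 0 := by
  refine measure_null_of_locally_null _ fun x hx => ?_
  obtain ⟨s, hs, hsΩ⟩ := nhds_basis_closedBall.mem_iff.1 (hΩ.mem_nhds hx.1)
  have hK := isCompact_closedBall x s
  have hF : LocallyIntegrable ((closedBall x s).indicator f) :=
    ((integrable_indicator_iff hK.measurableSet).2
      (hf.integrableOn_compact_subset hsΩ hK)).locallyIntegrable
  refine ⟨ball x s ∩ (Ω \ {x | ∃ c : ℝ, HasBlowUp n f x fun _ => c}),
    Filter.inter_mem (mem_nhdsWithin_of_mem_nhds (isOpen_ball.mem_nhds (mem_ball_self hs)))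
      self_mem_nhdsWithin, ?_⟩
  refine measure_mono_null (fun y hy => ?_) (ae_iff.1 (ae_hasBlowUp hF))
  refine fun hy2 => hy.2.2 ⟨_, hy2.congr_of_mem_interior (K := closedBall x s)
    (ball_subset_interior_closedBall hy.1) (ae_of_all _ fun z hz => (Set.indicator_of_mem hz f).symm)⟩

theorem measure_hasBlowUp_const_le {Ω : Set (EuclideanSpace ℝ (Fin n))} (hΩ : IsOpen Ω)
    {f : EuclideanSpace ℝ (Fin n) → ℝ} (hf : LocallyIntegrableOn f Ω)
    {μ : Measure (EuclideanSpace ℝ (Fin n))} [IsFiniteMeasure μ] (hμ : μ Ωᶜ = 0)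
    (hS : ∀ᵐ x ∂μ, ∃ ν : EuclideanSpace ℝ (Fin n), ‖ν‖ = 1 ∧ ∃ a b : ℝ, HasBlowUp n f x (stepFun n ν a b)) :
    μ {x | ∃ c : ℝ, HasBlowUp n f x fun _ => c} / 4 +
      μ {x | ∃ c : ℝ, HasBlowUp n f x fun _ => c}ᶜ / 2 ≤
    volume.withDensity (μ.rnDeriv volume) Ω / 4 + μ.singularPart volume (Ω \ approxDiscontSet n f) / 4 +
      μ.singularPart volume (jumpSet n f ∩ Ω) / 2 := by
  obtain ⟨C, hC⟩ : ∃ C, C = {x | ∃ c : ℝ, HasBlowUp n f x fun _ => c} := ⟨_, rfl⟩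
  obtain ⟨s, hs⟩ : ∃ s, s = μ.singularPart volume := ⟨_, rfl⟩
  obtain ⟨a, ha⟩ : ∃ a, a = volume.withDensity (μ.rnDeriv volume) := ⟨_, rfl⟩
  have hvol := volume_diff_hasBlowUp_const hΩ hf
  rw [← hC, ← hs, ← ha]
  rw [← hC] at hvol
  have hμe : μ = s + a := by rw [hs, ha]; exact Measure.haveLebesgueDecomposition_add μ volume
  have hsμ : s ≤ μ := hs ▸ Measure.singularPart_le μ volume
  have haμ : a ≤ μ := ha ▸ Measure.withDensity_rnDeriv_le μ volume
  have hsΩ : ∀ᵐ x ∂s, x ∈ Ω := mem_ae_iff.2 (le_antisymm ((hsμ _).trans hμ.le) zero_le)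
  have haΩ : ∀ᵐ x ∂a, x ∈ Ω := mem_ae_iff.2 (le_antisymm ((haμ _).trans hμ.le) zero_le)
  have hsS := hS.filter_mono (ae_mono hsμ)
  have haC : a Cᶜ = 0 := by
    have h1 : a (Ω \ C) = 0 := by rw [ha]; exact withDensity_absolutelyContinuous _ _ hvol
    refine le_antisymm (le_trans (measure_mono_ae ?_) h1.le) zero_le
    filter_upwards [haΩ] with x hx hxC
    exact ⟨hx, hxC⟩
  have haC' : a C ≤ a Ω := by
    refine measure_mono_ae ?_
    filter_upwards [haΩ] with x hx _
    exact hx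
  have hsC : s C ≤ s (Ω \ approxDiscontSet n f) := by
    refine measure_mono_ae ?_
    filter_upwards [hsΩ] with x hx (hxC : x ∈ C)
    rw [hC] at hxC
    obtain ⟨c, hc⟩ := hxC
    exact ⟨hx, hc.notMem_approxDiscontSet⟩
  have hsJ : s Cᶜ ≤ s (jumpSet n f ∩ Ω) := by
    refine measure_mono_ae ?_
    filter_upwards [hsΩ, hsS] with x hx ⟨ν, hν, a, b, hab⟩ (hxC : x ∉ C)
    refine ⟨hab.mem_jumpSet hν ?_, hx⟩
    rintro rfl
    rw [stepFun_self] at hab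
    rw [hC] at hxC
    exact hxC ⟨_, hab⟩
  calc μ C / 4 + μ Cᶜ / 2 = (s C + a C) / 4 + (s Cᶜ + a Cᶜ) / 2 := by
        conv_lhs => rw [hμe]
        rfl
    _ ≤ (s (Ω \ approxDiscontSet n f) + a Ω) / 4 + (s (jumpSet n f ∩ Ω) + 0) / 2 := by
        rw [haC]
        gcongr
    _ = _ := by rw [add_zero, ENNReal.add_div]; ring

end

section

variable {n : ℕ} {r : ℝ}

/-- Diagonal selection of an index along `𝓝[>] 0`. -/
theorem exists_diagonal {P : ℕ → ℝ → Prop} (hP : ∀ m, ∀ᶠ ε in 𝓝[>] (0:ℝ), P m ε) :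
    ∃ m : ℝ → ℕ, Tendsto m (𝓝[>] 0) atTop ∧ ∀ᶠ ε in 𝓝[>] (0:ℝ), P (m ε) ε := by
  have key : ∀ M : ℕ, ∀ᶠ ε in 𝓝[>] (0:ℝ), M ≤ Nat.findGreatest (fun m => P m ε) ⌈1 / ε⌉₊ ∧
      P (Nat.findGreatest (fun m => P m ε) ⌈1 / ε⌉₊) ε := fun M => by
    filter_upwards [hP M, Ioo_mem_nhdsGT (by positivity : (0:ℝ) < 1 / (M + 1))] with ε hε hεM
    have h1 : M ≤ ⌈1 / ε⌉₊ := by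
      have h2 : (M : ℝ) + 1 < 1 / ε := by
        rw [lt_one_div (by positivity) hεM.1]; exact hεM.2
      have h3 := Nat.le_ceil (1 / ε)
      exact_mod_cast (by linarith : (M : ℝ) ≤ ⌈1 / ε⌉₊)
    exact ⟨Nat.le_findGreatest h1 hε, Nat.findGreatest_spec (P := fun m => P m ε) h1 hε⟩
  exact ⟨fun ε => Nat.findGreatest (fun m => P m ε) ⌈1 / ε⌉₊,
    tendsto_atTop.2 fun M => (key M).mono fun _ h => h.1, (key 0).mono fun _ h => h.2⟩

theorem locallyIntegrableOn_of_abs_sub_le {Ω : Set (EuclideanSpace ℝ (Fin n))}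
    {f g : EuclideanSpace ℝ (Fin n) → ℝ} (hf : LocallyIntegrableOn f Ω)
    (hg : AEStronglyMeasurable g (volume.restrict Ω)) {δ : ℝ} (h : ∀ x, |g x - f x| ≤ δ) :
    LocallyIntegrableOn g Ω := by
  intro x hx
  obtain ⟨s, hs, hfs⟩ := hf x hx
  obtain ⟨t, ht, hct⟩ := (locallyIntegrable_const (μ := volume) δ).locallyIntegrableOn Ω x hx
  refine ⟨s ∩ t ∩ Ω, inter_mem (inter_mem hs ht) self_mem_nhdsWithin, ?_⟩
  have h1 : IntegrableOn f (s ∩ t ∩ Ω) := hfs.mono_set fun y hy => hy.1.1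
  have h2 : IntegrableOn (fun x => g x - f x) (s ∩ t ∩ Ω) :=
    Integrable.mono' (hct.mono_set fun y hy => hy.1.2)
      ((hg.sub hf.aestronglyMeasurable).mono_set fun y hy => hy.2) (ae_of_all _ h)
  exact (h1.add h2).congr (ae_of_all _ fun y => by simp)

theorem eLpNorm_top_le_of_abs_le {μ : Measure (EuclideanSpace ℝ (Fin n))}
    {f : EuclideanSpace ℝ (Fin n) → ℝ} {δ : ℝ} (h : ∀ x, |f x| ≤ δ) :
    eLpNorm f ⊤ μ ≤ ENNReal.ofReal δ := by
  rw [eLpNorm_exponent_top]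
  exact eLpNormEssSup_le_of_ae_bound (ae_of_all _ h)

theorem exists_family_of_forall_approx {Ω : Set (EuclideanSpace ℝ (Fin n))}
    {f : EuclideanSpace ℝ (Fin n) → ℝ} (hf : LocallyIntegrableOn f Ω) {R : ℝ≥0∞}
    (H : ∀ δ₀ : ℝ, 0 < δ₀ → ∀ η : ℝ≥0∞, η ≠ 0 → ∃ g : EuclideanSpace ℝ (Fin n) → ℝ,
      AEStronglyMeasurable g (volume.restrict Ω) ∧ (∀ x, |g x - f x| ≤ δ₀) ∧
      limsup (fun ε => kappa n ε g Ω) (𝓝[>] 0) ≤ R + η) :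
    ∃ F : ℝ → EuclideanSpace ℝ (Fin n) → ℝ,
      (∀ ε, 0 < ε → LocallyIntegrableOn (F ε) Ω volume) ∧
      (∀ ε, 0 < ε → ∀ K, IsCompact K → K ⊆ Ω →
        eLpNorm (fun x => F ε x - f x) ⊤ (volume.restrict K) < ⊤) ∧
      (∀ K, IsCompact K → K ⊆ Ω →
        Tendsto (fun ε => eLpNorm (fun x => F ε x - f x) ⊤ (volume.restrict K))
          (𝓝[>] (0:ℝ)) (𝓝 0)) ∧
      limsup (fun ε => kappa n ε (F ε) Ω) (𝓝[>] (0:ℝ)) ≤ R := by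
  obtain rfl | hR := eq_or_ne R ⊤
  · refine ⟨fun _ => f, fun _ _ => hf, fun _ _ _ _ _ => ?_, fun _ _ _ => ?_, le_top⟩
    · simp only [sub_self, eLpNorm_zero', ENNReal.zero_lt_top]
    · simp only [sub_self, eLpNorm_zero', tendsto_const_nhds_iff]
  have hη : ∀ m : ℕ, ENNReal.ofReal (1 / ((m : ℝ) + 1)) ≠ 0 := fun m =>
    (ENNReal.ofReal_pos.2 Nat.one_div_pos_of_nat).ne'
  choose g hgm hgf hgκ using fun m : ℕ => H (1 / ((m : ℝ) + 1)) Nat.one_div_pos_of_nat _ (hη m)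
  have hlim : Tendsto (fun m : ℕ => ENNReal.ofReal (1 / ((m : ℝ) + 1))) atTop (𝓝 0) := by
    simpa using ENNReal.tendsto_ofReal (tendsto_one_div_add_atTop_nhds_zero_nat (𝕜 := ℝ))
  obtain ⟨m, hm, hmP⟩ := exists_diagonal (P := fun m ε => kappa n ε (g m) Ω <
      R + ENNReal.ofReal (1 / ((m : ℝ) + 1)) + ENNReal.ofReal (1 / ((m : ℝ) + 1))) fun m =>
    eventually_lt_of_limsup_lt ((hgκ m).trans_lt (ENNReal.lt_add_right
      (ENNReal.add_ne_top.2 ⟨hR, ENNReal.ofReal_ne_top⟩) (hη m)))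
  have hle : ∀ ε K, eLpNorm (fun x => g (m ε) x - f x) ⊤ (volume.restrict K) ≤
      ENNReal.ofReal (1 / ((m ε : ℝ) + 1)) := fun ε K => eLpNorm_top_le_of_abs_le (hgf _)
  refine ⟨fun ε => g (m ε), fun ε _ => locallyIntegrableOn_of_abs_sub_le hf (hgm _) (hgf _),
    fun ε _ K _ _ => (hle ε K).trans_lt ENNReal.ofReal_lt_top, fun K _ _ =>
      tendsto_of_tendsto_of_tendsto_of_le_of_le tendsto_const_nhds (hlim.comp hm)
        (fun _ => zero_le) fun ε => hle ε K, ?_⟩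
  have h2 : Tendsto (fun ε => R + ENNReal.ofReal (1 / ((m ε : ℝ) + 1)) +
      ENNReal.ofReal (1 / ((m ε : ℝ) + 1))) (𝓝[>] (0:ℝ)) (𝓝 (R + 0 + 0)) :=
    (tendsto_const_nhds.add (hlim.comp hm)).add (hlim.comp hm)
  rw [add_zero, add_zero] at h2
  rw [← h2.limsup_eq]
  exact limsup_le_limsup (hmP.mono fun _ h => h.le)

end

section

variable {n : ℕ} {r : ℝ}

theorem enorm_inner_mollField_le (hr : 0 < r) {μ : Measure (EuclideanSpace ℝ (Fin n))} [IsFiniteMeasure μ]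
    {σ : EuclideanSpace ℝ (Fin n) → EuclideanSpace ℝ (Fin n)} (hσm : AEStronglyMeasurable σ μ)
    (hσ : ∀ᵐ x ∂μ, ‖σ x‖ = 1) (τ : EuclideanSpace ℝ (Fin n)) {V : Set (EuclideanSpace ℝ (Fin n))}
    {z : EuclideanSpace ℝ (Fin n)} (hz : closedBall z r ⊆ V) :
    ‖⟪τ, mollField n r μ σ z⟫‖ₑ ≤
      ∫⁻ y in V, ENNReal.ofReal (mollAt n r (z - y)) * ‖⟪τ, σ y⟫‖ₑ ∂μ := by
  have h1 : ⟪τ, mollField n r μ σ z⟫ = ∫ y, mollAt n r (z - y) * ⟪τ, σ y⟫ ∂μ := by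
    rw [mollField, ← integral_inner (integrable_mollAt_smul hr hσm hσ z)]
    simp only [real_inner_smul_right]
  have h2 : ∀ y, ‖mollAt n r (z - y) * ⟪τ, σ y⟫‖ₑ =
      ENNReal.ofReal (mollAt n r (z - y)) * ‖⟪τ, σ y⟫‖ₑ := fun y => by
    rw [enorm_mul, Real.enorm_eq_ofReal (mollAt_nonneg hr _)]
  rw [h1]
  refine (enorm_integral_le_lintegral_enorm _).trans ?_
  simp only [h2]
  rw [setLIntegral_eq_of_support_subset]
  intro y hy
  apply hz
  rw [mem_closedBall, dist_comm, dist_eq_norm]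
  by_contra hc
  push Not at hc
  exact hy (by simp [mollAt_eq_zero hr hc.le])

theorem lintegral_inner_mollField_le (hr : 0 < r) {μ : Measure (EuclideanSpace ℝ (Fin n))} [IsFiniteMeasure μ]
    {σ : EuclideanSpace ℝ (Fin n) → EuclideanSpace ℝ (Fin n)} (hσm : AEStronglyMeasurable σ μ)
    (hσ : ∀ᵐ x ∂μ, ‖σ x‖ = 1) (τ v : EuclideanSpace ℝ (Fin n)) {V W : Set (EuclideanSpace ℝ (Fin n))}
    (hW : MeasurableSet W) (hz : ∀ z ∈ W, closedBall (z + v) r ⊆ V) :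
    ∫⁻ z in W, ‖⟪τ, mollField n r μ σ (z + v)⟫‖ₑ ≤ ∫⁻ y in V, ‖⟪τ, σ y⟫‖ₑ ∂μ := by
  have hg : AEMeasurable (fun y => ‖⟪τ, σ y⟫‖ₑ) (μ.restrict V) :=
    ((aestronglyMeasurable_const.inner hσm).enorm).restrict
  have hm : Measurable fun p : EuclideanSpace ℝ (Fin n) × EuclideanSpace ℝ (Fin n) =>
      ENNReal.ofReal (mollAt n r (p.1 + v - p.2)) :=
    (((continuous_mollAt n r).comp ((continuous_fst.add continuous_const).sub
      continuous_snd)).measurable).ennreal_ofReal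
  have hmul : AEMeasurable (fun p : EuclideanSpace ℝ (Fin n) × EuclideanSpace ℝ (Fin n) =>
      ENNReal.ofReal (mollAt n r (p.1 + v - p.2)) * ‖⟪τ, σ p.2⟫‖ₑ)
      ((volume : Measure (EuclideanSpace ℝ (Fin n))).prod (μ.restrict V)) :=
    hm.aemeasurable.mul hg.comp_snd
  calc ∫⁻ z in W, ‖⟪τ, mollField n r μ σ (z + v)⟫‖ₑ
      ≤ ∫⁻ z in W, ∫⁻ y in V, ENNReal.ofReal (mollAt n r (z + v - y)) * ‖⟪τ, σ y⟫‖ₑ ∂μ :=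
        setLIntegral_mono' hW fun z hzW => enorm_inner_mollField_le hr hσm hσ τ (hz z hzW)
    _ ≤ ∫⁻ z, ∫⁻ y in V, ENNReal.ofReal (mollAt n r (z + v - y)) * ‖⟪τ, σ y⟫‖ₑ ∂μ :=
        setLIntegral_le_lintegral _ _
    _ = ∫⁻ y in V, ∫⁻ z, ENNReal.ofReal (mollAt n r (z + v - y)) * ‖⟪τ, σ y⟫‖ₑ ∂volume ∂μ :=
        lintegral_lintegral_swap
          (f := fun z y => ENNReal.ofReal (mollAt n r (z + v - y)) * ‖⟪τ, σ y⟫‖ₑ)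
          hmul
    _ = ∫⁻ y in V, ‖⟪τ, σ y⟫‖ₑ ∂μ := by
        congr 1
        ext y
        have hy : Measurable fun z => ENNReal.ofReal (mollAt n r (z + v - y)) :=
          (((continuous_mollAt n r).comp ((continuous_id.add continuous_const).sub
            continuous_const)).measurable).ennreal_ofReal
        rw [lintegral_mul_const _ hy]
        have : ∫⁻ z, ENNReal.ofReal (mollAt n r (z + v - y)) = 1 := by
          rw [← lintegral_mollAt_sub hr (y - v)]
          congr 1
          ext z
          rw [sub_sub_eq_add_sub]
        rw [this, one_mul]

theorem enorm_sub_le_lintegral_gradient {g : EuclideanSpace ℝ (Fin n) → ℝ} (hg : ContDiff ℝ 1 g)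
    (z τ : EuclideanSpace ℝ (Fin n)) :
    ‖g (z + τ) - g z‖ₑ ≤ ∫⁻ t in Set.Ioc (0 : ℝ) 1, ‖⟪τ, gradient g (z + t • τ)⟫‖ₑ := by
  have hd : ∀ t : ℝ, HasDerivAt (fun t : ℝ => g (z + t • τ)) ⟪τ, gradient g (z + t • τ)⟫ t := by
    intro t
    have h1 : HasFDerivAt g (fderiv ℝ g (z + t • τ)) (z + t • τ) :=
      (hg.differentiable one_ne_zero _).hasFDerivAt
    have h2 : HasDerivAt (fun t : ℝ => z + t • τ) τ t := by
      simpa using ((hasDerivAt_id t).smul_const τ).const_add z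
    have h3 := h1.comp_hasDerivAt t h2
    have h4 : ⟪τ, gradient g (z + t • τ)⟫ = fderiv ℝ g (z + t • τ) τ := by
      rw [real_inner_comm, gradient, InnerProductSpace.toDual_symm_apply]
    rw [h4]
    exact h3
  have hc : Continuous fun t : ℝ => ⟪τ, gradient g (z + t • τ)⟫ :=
    continuous_const.inner ((continuous_gradient hg).comp (by fun_prop))
  have h := intervalIntegral.integral_eq_sub_of_hasDerivAt (a := 0) (b := 1) (fun t _ => hd t)
    (hc.intervalIntegrable 0 1)
  rw [intervalIntegral.integral_of_le zero_le_one] at h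
  simp only [one_smul, zero_smul, add_zero] at h
  rw [← h]
  exact enorm_integral_le_lintegral_enorm _

/-- The translation estimate for functions of bounded variation. -/
theorem lintegral_translate_sub_le {f F : EuclideanSpace ℝ (Fin n) → ℝ}
    {Ω K : Set (EuclideanSpace ℝ (Fin n))} {μ : Measure (EuclideanSpace ℝ (Fin n))}
    {σ : EuclideanSpace ℝ (Fin n) → EuclideanSpace ℝ (Fin n)}
    (h : IsVariationPair n f Ω μ σ) (hF : LocallyIntegrable F) (hK : K ⊆ Ω)
    (hFf : ∀ᵐ y, y ∈ K → F y = f y) {V W : Set (EuclideanSpace ℝ (Fin n))} (hW : MeasurableSet W)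
    (τ : EuclideanSpace ℝ (Fin n)) {ρ : ℝ} (hρ : 0 < ρ)
    (hV : ∀ z ∈ W, ∀ t ∈ Set.Ioc (0 : ℝ) 1, closedBall (z + t • τ) ρ ⊆ V) (hVK : V ⊆ K) :
    ∫⁻ z in W, ‖F (z + τ) - F z‖ₑ ≤ ∫⁻ y in V, ‖⟪τ, σ y⟫‖ₑ ∂μ := by
  have hμ : IsFiniteMeasure μ := h.1
  have hσm := h.2.2.1
  have hσ := h.2.2.2.1
  have hmol : ∀ r : ℝ, 0 < r → r < ρ →
      ∫⁻ z in W, ‖mollify n r F (z + τ) - mollify n r F z‖ₑ ≤ ∫⁻ y in V, ‖⟪τ, σ y⟫‖ₑ ∂μ := by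
    intro r hr hrρ
    have hcont : Continuous fun p : EuclideanSpace ℝ (Fin n) × ℝ =>
        ⟪τ, mollField n r μ σ (p.1 + p.2 • τ)⟫ :=
      continuous_const.inner ((continuous_mollField hr hσm hσ).comp (by fun_prop))
    have hsub : ∀ z ∈ W, ∀ t ∈ Set.Ioc (0 : ℝ) 1, closedBall (z + t • τ) r ⊆ V := fun z hz t ht =>
      (closedBall_subset_closedBall hrρ.le).trans (hV z hz t ht)
    calc ∫⁻ z in W, ‖mollify n r F (z + τ) - mollify n r F z‖ₑ
        ≤ ∫⁻ z in W, ∫⁻ t in Set.Ioc (0 : ℝ) 1, ‖⟪τ, mollField n r μ σ (z + t • τ)⟫‖ₑ := by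
          refine setLIntegral_mono' hW fun z hz => ?_
          refine (enorm_sub_le_lintegral_gradient (contDiff_mollify hr hF) z τ).trans ?_
          refine setLIntegral_mono' measurableSet_Ioc fun t ht => ?_
          rw [gradient_mollify_eq_mollField h hr hF ((hsub z hz t ht).trans hVK) hK hFf]
      _ = ∫⁻ t in Set.Ioc (0 : ℝ) 1, ∫⁻ z in W, ‖⟪τ, mollField n r μ σ (z + t • τ)⟫‖ₑ :=
          lintegral_lintegral_swap (f := fun z t => ‖⟪τ, mollField n r μ σ (z + t • τ)⟫‖ₑ)
            hcont.measurable.enorm.aemeasurable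
      _ ≤ ∫⁻ _ in Set.Ioc (0 : ℝ) 1, ∫⁻ y in V, ‖⟪τ, σ y⟫‖ₑ ∂μ :=
          setLIntegral_mono' measurableSet_Ioc fun t ht =>
            lintegral_inner_mollField_le hr hσm hσ τ (t • τ) hW fun z hz => hsub z hz t ht
      _ = ∫⁻ y in V, ‖⟪τ, σ y⟫‖ₑ ∂μ := by simp
  obtain ⟨u, hu0, hu⟩ : ∃ u : ℕ → ℝ, (∀ k, 0 < u k ∧ u k < ρ) ∧ Tendsto u atTop (𝓝[>] 0) := by
    obtain ⟨u, -, h2, h3⟩ := exists_seq_strictAnti_tendsto' hρ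
    exact ⟨u, h2, tendsto_nhdsWithin_iff.2 ⟨h3, Eventually.of_forall fun k => (h2 k).1⟩⟩
  have hlim : ∀ᵐ z ∂(volume.restrict W), Tendsto
      (fun k => ‖mollify n (u k) F (z + τ) - mollify n (u k) F z‖ₑ) atTop
      (𝓝 ‖F (z + τ) - F z‖ₑ) := by
    refine ae_restrict_of_ae ?_
    have ht := (quasiMeasurePreserving_add_right volume τ).ae (ae_tendsto_mollify hF)
    filter_upwards [ae_tendsto_mollify hF, ht] with z h1 h2
    exact ((h2.comp hu).sub (h1.comp hu)).enorm
  calc ∫⁻ z in W, ‖F (z + τ) - F z‖ₑ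
      = ∫⁻ z in W, liminf (fun k => ‖mollify n (u k) F (z + τ) - mollify n (u k) F z‖ₑ) atTop :=
        lintegral_congr_ae (hlim.mono fun z hz => hz.liminf_eq.symm)
    _ ≤ liminf (fun k => ∫⁻ z in W, ‖mollify n (u k) F (z + τ) - mollify n (u k) F z‖ₑ) atTop := by
        refine lintegral_liminf_le fun k => ?_
        have hc := (contDiff_mollify (hu0 k).1 hF).continuous
        exact ((hc.comp (continuous_id.add continuous_const)).sub hc).measurable.enorm
    _ ≤ ∫⁻ y in V, ‖⟪τ, σ y⟫‖ₑ ∂μ :=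
        liminf_le_of_frequently_le' (Frequently.of_forall fun k => hmol _ (hu0 k).1 (hu0 k).2)

end

section

open scoped Manifold ContDiff

variable {m : ℕ}

/-- The point of `ℝ^(m+1)` with `i`-th coordinate `s` and remaining coordinates `y`. -/
def insertCoord (i : Fin (m + 1)) (p : ℝ × (Fin m → ℝ)) : EuclideanSpace ℝ (Fin (m + 1)) :=
  WithLp.toLp 2 (i.insertNth p.1 p.2)

/-- The projection of `ℝ^(m+1)` that forgets the `i`-th coordinate. -/
def dropCoord (i : Fin (m + 1)) (z : EuclideanSpace ℝ (Fin (m + 1))) : Fin m → ℝ :=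
  fun j => z (i.succAbove j)

theorem insertCoord_apply_same (i : Fin (m + 1)) (p : ℝ × (Fin m → ℝ)) : insertCoord i p i = p.1 := by
  simp [insertCoord]

theorem dropCoord_insertCoord (i : Fin (m + 1)) (p : ℝ × (Fin m → ℝ)) :
    dropCoord i (insertCoord i p) = p.2 := by
  ext j
  simp [insertCoord, dropCoord]

theorem insertCoord_dropCoord (i : Fin (m + 1)) (z : EuclideanSpace ℝ (Fin (m + 1))) :
    insertCoord i (z i, dropCoord i z) = z := by
  ext j
  refine Fin.succAboveCases i ?_ (fun k => ?_) j
  · simp [insertCoord]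
  · simp [insertCoord, dropCoord]

theorem insertCoord_add (i : Fin (m + 1)) (p q : ℝ × (Fin m → ℝ)) :
    insertCoord i (p + q) = insertCoord i p + insertCoord i q := by
  ext j
  refine Fin.succAboveCases i ?_ (fun k => ?_) j <;> simp [insertCoord]

theorem insertCoord_smul (i : Fin (m + 1)) (t : ℝ) (p : ℝ × (Fin m → ℝ)) :
    insertCoord i (t • p) = t • insertCoord i p := by
  ext j
  refine Fin.succAboveCases i ?_ (fun k => ?_) j <;> simp [insertCoord]

theorem dropCoord_add (i : Fin (m + 1)) (z w : EuclideanSpace ℝ (Fin (m + 1))) :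
    dropCoord i (z + w) = dropCoord i z + dropCoord i w := rfl

theorem dropCoord_smul (i : Fin (m + 1)) (t : ℝ) (z : EuclideanSpace ℝ (Fin (m + 1))) :
    dropCoord i (t • z) = t • dropCoord i z := rfl

theorem contDiff_dropCoord (i : Fin (m + 1)) {k : WithTop ℕ∞} : ContDiff ℝ k (dropCoord i) :=
  contDiff_pi.2 fun j => (EuclideanSpace.proj (𝕜 := ℝ) (i.succAbove j)).contDiff

theorem norm_dropCoord_le (i : Fin (m + 1)) (z : EuclideanSpace ℝ (Fin (m + 1))) :
    ‖dropCoord i z‖ ≤ ‖z‖ :=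
  (pi_norm_le_iff_of_nonneg (norm_nonneg z)).2 fun j => PiLp.norm_apply_le z (i.succAbove j)

theorem measurePreserving_insertCoord (i : Fin (m + 1)) :
    MeasurePreserving (insertCoord (m := m) i) volume volume :=
  (PiLp.volume_preserving_toLp (Fin (m + 1))).comp
    (volume_preserving_piFinSuccAbove (fun _ => ℝ) i).symm

theorem quasiMeasurePreserving_dropCoord (i : Fin (m + 1)) :
    Measure.QuasiMeasurePreserving (dropCoord (m := m) i) volume volume := by
  have h1 : Measure.QuasiMeasurePreserving (Prod.snd : ℝ × (Fin m → ℝ) → Fin m → ℝ) volume volume :=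
    Measure.quasiMeasurePreserving_snd
  exact h1.comp ((volume_preserving_piFinSuccAbove (fun _ => ℝ) i).comp
    (PiLp.volume_preserving_ofLp (Fin (m + 1)))).quasiMeasurePreserving

theorem exists_contDiff_approx_indicator {K : Set (Fin m → ℝ)} (hK : IsCompact K) :
    ∃ a : ℕ → (Fin m → ℝ) → ℝ, (∀ k, ContDiff ℝ 1 (a k)) ∧ (∀ k y, |a k y| ≤ 1) ∧
      ∀ y, Tendsto (fun k => a k y) atTop (𝓝 (K.indicator 1 y)) := by
  have hex : ∀ k : ℕ, ∃ a : (Fin m → ℝ) → ℝ, ContDiff ℝ 1 a ∧ (∀ y, |a y| ≤ 1) ∧ (∀ y ∈ K, a y = 1) ∧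
      ∀ y ∉ thickening (1 / ((k : ℝ) + 1)) K, a y = 0 := by
    intro k
    obtain ⟨ψ, h1, h2, h3, h4⟩ := exists_contMDiff_zero_iff_one_iff_of_isClosed (n := 1)
      𝓘(ℝ, Fin m → ℝ) (s := (thickening (1 / ((k : ℝ) + 1)) K)ᶜ) (t := K)
      isOpen_thickening.isClosed_compl hK.isClosed
      (Set.disjoint_compl_left_iff_subset.2 (self_subset_thickening (by positivity) K))
    refine ⟨ψ, h1.contDiff, fun y => ?_, fun y hy => (h4 y).1 hy, fun y hy => (h3 y).1 hy⟩
    have := h2 ⟨y, rfl⟩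
    rw [abs_of_nonneg this.1]
    exact this.2
  choose a h1 h2 h3 h4 using hex
  refine ⟨a, h1, h2, fun y => ?_⟩
  by_cases hy : y ∈ K
  · simp only [Set.indicator_of_mem hy, Pi.one_apply, h3 _ y hy]
    exact tendsto_const_nhds
  · rw [Set.indicator_of_notMem hy]
    refine tendsto_const_nhds.congr' ?_
    obtain ⟨ε, hε, hd⟩ : ∃ ε > 0, y ∉ thickening ε K := by
      rw [← hK.isClosed.closure_eq, closure_eq_iInter_thickening] at hy
      simpa using hy
    filter_upwards [tendsto_one_div_add_atTop_nhds_zero_nat.eventually (gt_mem_nhds hε)] with k hk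
    exact (h4 k y fun hc => hd (thickening_mono hk.le _ hc)).symm

theorem integrableOn_mul_fderiv {n : ℕ} {f φ : EuclideanSpace ℝ (Fin n) → ℝ}
    {Ω : Set (EuclideanSpace ℝ (Fin n))} (hf : LocallyIntegrableOn f Ω) (hφ : ContDiff ℝ 1 φ)
    (hc : HasCompactSupport φ) (hs : tsupport φ ⊆ Ω) (v : EuclideanSpace ℝ (Fin n)) :
    IntegrableOn (fun x => f x * fderiv ℝ φ x v) Ω := by
  have hcont : Continuous fun x => fderiv ℝ φ x v :=
    (hφ.continuous_fderiv one_ne_zero).clm_apply continuous_const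
  have h1 : IntegrableOn f (tsupport φ) := hf.integrableOn_compact_subset hs hc
  have h2 : IntegrableOn (fun x => f x * fderiv ℝ φ x v) (tsupport φ) :=
    h1.mul_continuousOn hcont.continuousOn hc
  refine (IntegrableOn.integrable_of_forall_notMem_eq_zero h2 fun x hx => ?_).integrableOn
  have : fderiv ℝ φ x = 0 := by
    by_contra hne
    exact hx (tsupport_fderiv_subset ℝ (subset_tsupport _ hne))
  simp [this]

theorem integral_indicator_dropCoord_eq_zero {f : EuclideanSpace ℝ (Fin (m + 1)) → ℝ}
    {Ω : Set (EuclideanSpace ℝ (Fin (m + 1)))} {μ : Measure (EuclideanSpace ℝ (Fin (m + 1)))}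
    {σ : EuclideanSpace ℝ (Fin (m + 1)) → EuclideanSpace ℝ (Fin (m + 1))}
    (hf : LocallyIntegrableOn f Ω) (h : IsVariationPair (m + 1) f Ω μ σ) (i : Fin (m + 1))
    {K : Set (Fin m → ℝ)} (hK : IsCompact K) (hK0 : volume K = 0)
    {φ : EuclideanSpace ℝ (Fin (m + 1)) → ℝ} (hφ : ContDiff ℝ 1 φ) (hc : HasCompactSupport φ)
    (hs : tsupport φ ⊆ Ω) :
    ∫ x, φ x * (K.indicator 1 (dropCoord i x) * σ x i) ∂μ = 0 := by
  have hμ : IsFiniteMeasure μ := h.1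
  obtain ⟨a, ha, ha1, hlim⟩ := exists_contDiff_approx_indicator hK
  obtain ⟨v, hv⟩ : ∃ v : EuclideanSpace ℝ (Fin (m + 1)), v = EuclideanSpace.single i 1 := ⟨_, rfl⟩
  have hvσ : ∀ x, ⟪v, σ x⟫ = σ x i := fun x => by
    rw [hv, EuclideanSpace.inner_single_left]
    simp
  have hdv : ∀ z : EuclideanSpace ℝ (Fin (m + 1)), ∀ t : ℝ, dropCoord i (z + t • v) = dropCoord i z := by
    intro z t
    ext j
    simp [hv, dropCoord, Fin.succAbove_ne]
  have hder : ∀ k x, fderiv ℝ (fun z => φ z * a k (dropCoord i z)) x v =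
      fderiv ℝ φ x v * a k (dropCoord i x) := by
    intro k x
    have hb : DifferentiableAt ℝ (fun z => a k (dropCoord i z)) x :=
      ((ha k).comp (contDiff_dropCoord i)).differentiable one_ne_zero x
    have hb0 : fderiv ℝ (fun z => a k (dropCoord i z)) x v = 0 := by
      rw [← hb.lineDeriv_eq_fderiv]
      simp [lineDeriv, hdv]
    rw [fderiv_fun_mul (hφ.differentiable one_ne_zero x) hb]
    simp [hb0, mul_comm]
  have hid : ∀ k, ∫ x in Ω, f x * fderiv ℝ φ x v * a k (dropCoord i x) =
      - ∫ x, φ x * (a k (dropCoord i x) * σ x i) ∂μ := by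
    intro k
    have h1 := h.integral_mul_fderiv (φ := fun z => φ z * a k (dropCoord i z))
      (hφ.mul ((ha k).comp (contDiff_dropCoord i))) hc.mul_right
      ((closure_mono (Function.support_mul_subset_left φ _)).trans hs) v
    simp only [hder, hvσ, ← mul_assoc] at h1 ⊢
    exact h1
  have hcd : Continuous (dropCoord (m := m) i) := (contDiff_dropCoord i (k := 1)).continuous
  have hL : Tendsto (fun k => ∫ x in Ω, f x * fderiv ℝ φ x v * a k (dropCoord i x)) atTop
      (𝓝 (∫ x in Ω, f x * fderiv ℝ φ x v * K.indicator 1 (dropCoord i x))) := by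
    have hInt := integrableOn_mul_fderiv hf hφ hc hs v
    refine tendsto_integral_of_dominated_convergence (fun x => ‖f x * fderiv ℝ φ x v‖)
      (fun k => hInt.aestronglyMeasurable.mul ((ha k).continuous.comp hcd).aestronglyMeasurable)
      hInt.norm (fun k => ae_of_all _ fun x => ?_) (ae_of_all _ fun x => ?_)
    · rw [norm_mul]
      exact mul_le_of_le_one_right (norm_nonneg _) (ha1 k _)
    · exact (hlim (dropCoord i x)).const_mul _
  have hL0 : ∫ x in Ω, f x * fderiv ℝ φ x v * K.indicator 1 (dropCoord i x) = 0 := by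
    refine integral_eq_zero_of_ae (ae_restrict_of_ae ?_)
    have hK' : ∀ᵐ y : Fin m → ℝ, y ∉ K := measure_eq_zero_iff_ae_notMem.1 hK0
    filter_upwards [(quasiMeasurePreserving_dropCoord i).ae hK'] with x hx
    simp [Set.indicator_of_notMem hx]
  have hR : Tendsto (fun k => ∫ x, φ x * (a k (dropCoord i x) * σ x i) ∂μ) atTop
      (𝓝 (∫ x, φ x * (K.indicator 1 (dropCoord i x) * σ x i) ∂μ)) := by
    obtain ⟨C, hC⟩ := hc.exists_bound_of_continuous hφ.continuous
    have hσi : AEStronglyMeasurable (fun x => σ x i) μ :=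
      (EuclideanSpace.proj (𝕜 := ℝ) i).continuous.comp_aestronglyMeasurable h.2.2.1
    refine tendsto_integral_of_dominated_convergence (fun _ => C)
      (fun k => hφ.continuous.aestronglyMeasurable.mul
        (((ha k).continuous.comp hcd).aestronglyMeasurable.mul hσi))
      (integrable_const C) (fun k => ?_) (ae_of_all _ fun x => ?_)
    · filter_upwards [h.2.2.2.1] with x hx
      have h1 : ‖σ x i‖ ≤ 1 := (PiLp.norm_apply_le (σ x) i).trans hx.le
      rw [norm_mul, norm_mul]
      have h2 : ‖a k (dropCoord i x)‖ * ‖σ x i‖ ≤ 1 :=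
        mul_le_one₀ (ha1 k _) (norm_nonneg _) h1
      exact (mul_le_of_le_one_right (norm_nonneg _) h2).trans (hC x)
    · exact ((hlim (dropCoord i x)).mul_const _).const_mul _
  simp only [hid, hL0] at hL
  have := tendsto_nhds_unique hL hR.neg
  linarith

theorem ae_apply_eq_zero_of_isCompact {f : EuclideanSpace ℝ (Fin (m + 1)) → ℝ}
    {Ω : Set (EuclideanSpace ℝ (Fin (m + 1)))} {μ : Measure (EuclideanSpace ℝ (Fin (m + 1)))}
    {σ : EuclideanSpace ℝ (Fin (m + 1)) → EuclideanSpace ℝ (Fin (m + 1))} (hΩ : IsOpen Ω)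
    (hf : LocallyIntegrableOn f Ω) (h : IsVariationPair (m + 1) f Ω μ σ) (i : Fin (m + 1))
    {K : Set (Fin m → ℝ)} (hK : IsCompact K) (hK0 : volume K = 0) :
    ∀ᵐ x ∂μ, dropCoord i x ∈ K → σ x i = 0 := by
  have hμ : IsFiniteMeasure μ := h.1
  have hcd : Continuous (dropCoord (m := m) i) := (contDiff_dropCoord i (k := 1)).continuous
  have hσi : AEStronglyMeasurable (fun x => σ x i) μ :=
    (EuclideanSpace.proj (𝕜 := ℝ) i).continuous.comp_aestronglyMeasurable h.2.2.1
  have hind : Measurable fun x : EuclideanSpace ℝ (Fin (m + 1)) => K.indicator (1 : (Fin m → ℝ) → ℝ) (dropCoord i x) :=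
    (measurable_one.indicator hK.measurableSet).comp hcd.measurable
  have hInt : Integrable (fun x => K.indicator (1 : (Fin m → ℝ) → ℝ) (dropCoord i x) * σ x i) μ := by
    refine Integrable.of_bound (hind.aestronglyMeasurable.mul hσi) 1 ?_
    filter_upwards [h.2.2.2.1] with x hx
    rw [norm_mul]
    refine mul_le_one₀ ?_ (norm_nonneg _) ((PiLp.norm_apply_le (σ x) i).trans hx.le)
    by_cases hxK : dropCoord i x ∈ K <;> simp [hxK]
  have h0 := hΩ.ae_eq_zero_of_integral_contDiff_smul_eq_zero
    (hInt.locallyIntegrable.locallyIntegrableOn Ω) fun g hg hgc hgs =>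
      integral_indicator_dropCoord_eq_zero hf h i hK hK0 (hg.of_le (by simp)) hgc hgs
  have hΩμ : ∀ᵐ x ∂μ, x ∈ Ω := by
    rw [ae_iff]
    exact h.2.1
  filter_upwards [h0, hΩμ] with x hx hxΩ hxK
  simpa [hxK] using hx hxΩ

/-- The `i`-th component of the gradient measure vanishes on cylinders in direction `i` over null sets. -/
theorem ae_apply_eq_zero_of_measure_eq_zero {f : EuclideanSpace ℝ (Fin (m + 1)) → ℝ}
    {Ω : Set (EuclideanSpace ℝ (Fin (m + 1)))} {μ : Measure (EuclideanSpace ℝ (Fin (m + 1)))}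
    {σ : EuclideanSpace ℝ (Fin (m + 1)) → EuclideanSpace ℝ (Fin (m + 1))} (hΩ : IsOpen Ω)
    (hf : LocallyIntegrableOn f Ω) (h : IsVariationPair (m + 1) f Ω μ σ) (i : Fin (m + 1))
    {N : Set (Fin m → ℝ)} (hN : volume N = 0) : ∀ᵐ x ∂μ, dropCoord i x ∈ N → σ x i = 0 := by
  have hμ : IsFiniteMeasure μ := h.1
  have hcd : Continuous (dropCoord (m := m) i) := (contDiff_dropCoord i (k := 1)).continuous
  have hσi : AEMeasurable (fun x => ‖σ x i‖ₑ) μ :=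
    ((EuclideanSpace.proj (𝕜 := ℝ) i).continuous.comp_aestronglyMeasurable
      h.2.2.1).enorm
  obtain ⟨lam, hlam⟩ : ∃ lam : Measure (EuclideanSpace ℝ (Fin (m + 1))),
      lam = μ.withDensity fun x => ‖σ x i‖ₑ := ⟨_, rfl⟩
  have hfin : IsFiniteMeasure lam := by
    rw [hlam]
    refine isFiniteMeasure_withDensity (ne_top_of_le_ne_top (measure_ne_top μ Set.univ) ?_)
    calc ∫⁻ x, ‖σ x i‖ₑ ∂μ ≤ ∫⁻ _, 1 ∂μ := by
          refine lintegral_mono_ae ?_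
          filter_upwards [h.2.2.2.1] with x hx
          rw [← ofReal_norm, ← ENNReal.ofReal_one]
          exact ENNReal.ofReal_le_ofReal ((PiLp.norm_apply_le (σ x) i).trans hx.le)
      _ = μ Set.univ := by simp
  have hset : ∀ B : Set (Fin m → ℝ), MeasurableSet B → lam.map (dropCoord i) B =
      ∫⁻ x in dropCoord i ⁻¹' B, ‖σ x i‖ₑ ∂μ := by
    intro B hB
    rw [Measure.map_apply hcd.measurable hB, hlam, withDensity_apply _ (hcd.measurable hB)]
  have hzero : lam.map (dropCoord i) (toMeasurable volume N) = 0 := by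
    by_contra hne
    obtain ⟨K, hKN, hK, hpos⟩ := (measurableSet_toMeasurable volume N).exists_lt_isCompact
      (pos_iff_ne_zero.2 hne)
    have hK0 : volume K = 0 := measure_mono_null hKN (by rw [measure_toMeasurable, hN])
    refine hpos.ne' ?_
    rw [hset K hK.measurableSet, lintegral_eq_zero_iff' hσi.restrict, EventuallyEq,
      ae_restrict_iff' (hcd.measurable hK.measurableSet)]
    filter_upwards [ae_apply_eq_zero_of_isCompact hΩ hf h i hK hK0] with x hx hxK
    simp [hx hxK]
  rw [hset _ (measurableSet_toMeasurable _ _), lintegral_eq_zero_iff' hσi.restrict, EventuallyEq,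
    ae_restrict_iff' (hcd.measurable (measurableSet_toMeasurable _ _))] at hzero
  filter_upwards [hzero] with x hx hxN
  simpa using hx (subset_toMeasurable _ _ hxN)

end

section

variable {m : ℕ}

theorem ae_exists_measure_closedBall_le (κ : Measure (Fin m → ℝ)) [IsFiniteMeasure κ] :
    ∀ᵐ y : Fin m → ℝ, ∃ M : ℝ≥0∞, M ≠ ⊤ ∧ ∃ R₀ > 0, ∀ R : ℝ, 0 < R → R < R₀ →
      κ (closedBall y R) ≤ M * ENNReal.ofReal ((2 * R) ^ m) := by
  filter_upwards [Besicovitch.ae_tendsto_rnDeriv κ volume, κ.rnDeriv_lt_top volume] with y hy hlt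
  have h1 : ∀ᶠ R in 𝓝[>] (0 : ℝ), κ (closedBall y R) / volume (closedBall y R) <
      κ.rnDeriv volume y + 1 :=
    hy.eventually (gt_mem_nhds (ENNReal.lt_add_right hlt.ne one_ne_zero))
  obtain ⟨R₀, hR₀, h2⟩ := mem_nhdsGT_iff_exists_Ioo_subset.1 h1
  refine ⟨κ.rnDeriv volume y + 1, ENNReal.add_ne_top.2 ⟨hlt.ne, ENNReal.one_ne_top⟩, R₀, hR₀,
    fun R hR hRR => ?_⟩
  have h3 : κ (closedBall y R) / volume (closedBall y R) < κ.rnDeriv volume y + 1 := h2 ⟨hR, hRR⟩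
  rw [Real.volume_pi_closedBall y hR.le, Fintype.card_fin] at h3
  exact (ENNReal.div_le_iff (by simp [hR]) ENNReal.ofReal_ne_top).1 h3.le

end

section

variable {m : ℕ}

/-- A point of a ball whose average distance to the ball is controlled by translation differences. -/
theorem exists_setLIntegral_le_of_translate {d : (Fin m → ℝ) → (Fin m → ℝ) → ℝ≥0∞}
    (hd : Measurable (Function.uncurry d)) (hsymm : ∀ y y', d y y' = d y' y) {y₀ : Fin m → ℝ} {R : ℝ}
    (hR : 0 < R) {T : ℝ≥0∞}
    (h : ∀ h : Fin m → ℝ, ‖h‖ ≤ 2 * R → ∫⁻ y in ball y₀ R, d (y + h) y ≤ T) :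
    ∃ y' ∈ ball y₀ R, ∫⁻ y in ball y₀ R, d y y' ≤ 2 ^ m * T := by
  have hvol : ∀ ρ : ℝ, 0 < ρ → ∀ y : Fin m → ℝ, volume (ball y ρ) = ENNReal.ofReal ((2 * ρ) ^ m) := by
    intro ρ hρ y
    rw [Real.volume_pi_ball y hρ, Fintype.card_fin]
  have hv0 : volume (ball y₀ R) ≠ 0 := by simp [hvol R hR, hR]
  have hvt : volume (ball y₀ R) ≠ ⊤ := measure_ball_lt_top.ne
  have hsw : Measurable (Function.uncurry fun y' y => d y y') := hd.comp measurable_swap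
  have hsh : Measurable fun p : (Fin m → ℝ) × (Fin m → ℝ) => d (p.1 + p.2) p.1 := by
    have h1 : Measurable fun p : (Fin m → ℝ) × (Fin m → ℝ) => (p.1 + p.2, p.1) := by fun_prop
    exact hd.comp h1
  have hm1 : Measurable fun y' => ∫⁻ y in ball y₀ R, d y y' := hsw.lintegral_prod_right'
  obtain ⟨y', hy', hle⟩ := exists_le_setLAverage (μ := volume) hv0 hvt hm1.aemeasurable
  refine ⟨y', hy', hle.trans ?_⟩
  rw [setLAverage_eq]
  refine ENNReal.div_le_of_le_mul ?_
  calc ∫⁻ y' in ball y₀ R, ∫⁻ y in ball y₀ R, d y y'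
      = ∫⁻ y in ball y₀ R, ∫⁻ y' in ball y₀ R, d y y' :=
        lintegral_lintegral_swap (f := fun y' y => d y y') hsw.aemeasurable
    _ ≤ ∫⁻ y in ball y₀ R, ∫⁻ h in ball (0 : Fin m → ℝ) (2 * R), d (y + h) y := by
        refine setLIntegral_mono' measurableSet_ball fun y hy => ?_
        have e : ∫⁻ y' in ball y₀ R, d y y' =
            ∫⁻ h, (ball y₀ R).indicator (fun y' => d y y') (y + h) := by
          rw [lintegral_add_left_eq_self, lintegral_indicator measurableSet_ball]
        rw [e, ← lintegral_indicator measurableSet_ball]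
        refine lintegral_mono fun h => ?_
        by_cases hh : y + h ∈ ball y₀ R
        · have h2 : h ∈ ball (0 : Fin m → ℝ) (2 * R) := by
            rw [mem_ball_zero_iff]
            rw [mem_ball] at hh hy
            calc ‖h‖ = dist (y + h) y := by simp [dist_eq_norm]
              _ ≤ dist (y + h) y₀ + dist y y₀ := dist_triangle_right _ _ _
              _ < 2 * R := by linarith
          rw [Set.indicator_of_mem hh, Set.indicator_of_mem h2, hsymm]
        · rw [Set.indicator_of_notMem hh]
          exact bot_le
    _ = ∫⁻ h in ball (0 : Fin m → ℝ) (2 * R), ∫⁻ y in ball y₀ R, d (y + h) y :=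
        lintegral_lintegral_swap (f := fun y h => d (y + h) y) hsh.aemeasurable
    _ ≤ ∫⁻ _ in ball (0 : Fin m → ℝ) (2 * R), T :=
        setLIntegral_mono' measurableSet_ball fun h' hh' => h h' (mem_ball_zero_iff.1 hh').le
    _ = T * volume (ball (0 : Fin m → ℝ) (2 * R)) := setLIntegral_const _ _
    _ = 2 ^ m * T * volume (ball y₀ R) := by
        rw [hvol _ (by positivity), hvol R hR, mul_pow, ENNReal.ofReal_mul (by positivity),
          ENNReal.ofReal_pow (by norm_num)]
        simp only [ENNReal.ofReal_ofNat]
        ring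

theorem lintegral_enorm_sub_le_add {α : Type*} [MeasurableSpace α] {μ : Measure α} {a b c : α → ℝ}
    (ha : AEMeasurable a μ) (hb : AEMeasurable b μ) :
    ∫⁻ s, ‖a s - c s‖ₑ ∂μ ≤ (∫⁻ s, ‖a s - b s‖ₑ ∂μ) + ∫⁻ s, ‖b s - c s‖ₑ ∂μ := by
  have hab : AEMeasurable (fun s => ‖a s - b s‖ₑ) μ := (ha.sub hb).enorm
  rw [← lintegral_add_left' hab]
  refine lintegral_mono fun s => ?_
  refine le_trans (le_of_eq ?_) (enorm_add_le _ _)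
  congr 1
  ring

/-- A sequence with geometrically decaying `L¹` increments converges at the same rate. -/
theorem exists_limit_of_lintegral_sub_le {α : Type*} [MeasurableSpace α] {μ : Measure α} {g : ℕ → α → ℝ}
    (hg : ∀ k, Measurable (g k)) {C : ℝ≥0∞} (hC : C ≠ ⊤)
    (h : ∀ k, ∫⁻ s, ‖g (k + 1) s - g k s‖ₑ ∂μ ≤ C * 2⁻¹ ^ k) :
    ∃ G : α → ℝ, Measurable G ∧ ∀ k, ∫⁻ s, ‖g k s - G s‖ₑ ∂μ ≤ 2 * C * 2⁻¹ ^ k := by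
  have hmeas : ∀ k, Measurable fun s => ‖g (k + 1) s - g k s‖ₑ := fun k => ((hg (k + 1)).sub (hg k)).enorm
  have hsum : ∀ k, ∫⁻ s, ∑' j, ‖g (k + j + 1) s - g (k + j) s‖ₑ ∂μ ≤ 2 * C * 2⁻¹ ^ k := by
    intro k
    rw [lintegral_tsum fun j => (hmeas (k + j)).aemeasurable]
    calc ∑' j, ∫⁻ s, ‖g (k + j + 1) s - g (k + j) s‖ₑ ∂μ ≤ ∑' j, C * 2⁻¹ ^ k * 2⁻¹ ^ j :=
          ENNReal.tsum_le_tsum fun j => (h (k + j)).trans_eq (by rw [pow_add, mul_assoc])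
      _ = 2 * C * 2⁻¹ ^ k := by
          rw [ENNReal.tsum_mul_left, ENNReal.tsum_geometric, ENNReal.one_sub_inv_two, inv_inv]
          ring
  have hfin : ∀ᵐ s ∂μ, ∑' j, ‖g (j + 1) s - g j s‖ₑ < ⊤ := by
    refine ae_lt_top (Measurable.tsum hmeas) ?_
    have h0 := hsum 0
    simp only [zero_add, pow_zero, mul_one] at h0
    exact ne_top_of_le_ne_top (ENNReal.mul_ne_top (by simp) hC) h0
  have hed : ∀ s k, edist (g k s) (g (k + 1) s) ≤ ‖g (k + 1) s - g k s‖ₑ := fun s k => by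
    rw [edist_comm, edist_eq_enorm_sub]
  obtain ⟨G, hG, hlim⟩ := measurable_limit_of_tendsto_metrizable_ae (μ := μ) (f := g) (L := atTop)
    (fun k => (hg k).aemeasurable) (hfin.mono fun s hs =>
      cauchySeq_tendsto_of_complete (cauchySeq_of_edist_le_of_tsum_ne_top _ (hed s) hs.ne))
  refine ⟨G, hG, fun k => (lintegral_mono_ae ?_).trans (hsum k)⟩
  filter_upwards [hlim] with s hs
  have := edist_le_tsum_of_edist_le_of_tendsto _ (hed s) hs k
  rwa [edist_eq_enorm_sub] at this

/-- Under a translation estimate the slices of `u` near `y₀` are close to a single function. -/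
theorem exists_slice_limit {u : ℝ → (Fin m → ℝ) → ℝ} (hu : Measurable (Function.uncurry u))
    {S : Set ℝ} {y₀ : Fin m → ℝ} {M : ℝ≥0∞} (hM : M ≠ ⊤) {R₀ : ℝ} (hR₀ : 0 < R₀)
    (H : ∀ R, 0 < R → R < R₀ → ∀ h : Fin m → ℝ, ‖h‖ ≤ 2 * R →
      ∫⁻ y in ball y₀ R, ∫⁻ s in S, ‖u s (y + h) - u s y‖ₑ ≤
        M * ENNReal.ofReal R * ENNReal.ofReal ((2 * R) ^ m)) :
    ∃ G : ℝ → ℝ, Measurable G ∧ ∃ C : ℝ≥0∞, C ≠ ⊤ ∧ ∃ R₁ > 0, ∀ R, 0 < R → R < R₁ →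
      ∫⁻ y in ball y₀ R, ∫⁻ s in S, ‖u s y - G s‖ₑ ≤
        C * ENNReal.ofReal R * ENNReal.ofReal ((2 * R) ^ m) := by
  obtain ⟨R₁, hR₁, hR₁₀⟩ : ∃ R₁ > 0, R₁ < R₀ := ⟨R₀ / 2, by positivity, by linarith⟩
  obtain ⟨ρ, hρ⟩ : ∃ ρ : ℕ → ℝ, ρ = fun k => R₁ * 2⁻¹ ^ k := ⟨_, rfl⟩
  have hρ0 : ∀ k, 0 < ρ k := fun k => by rw [hρ]; positivity
  have hρR : ∀ k, ρ k < R₀ := fun k => by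
    rw [hρ]
    exact (mul_le_of_le_one_right hR₁.le (pow_le_one₀ (by norm_num) (by norm_num))).trans_lt hR₁₀
  have hρs : ∀ k, ρ k = 2 * ρ (k + 1) := fun k => by
    simp only [hρ, pow_succ]
    ring
  have hρe : ∀ k, ENNReal.ofReal (ρ k) = ENNReal.ofReal R₁ * 2⁻¹ ^ k := fun k => by
    rw [hρ, ENNReal.ofReal_mul hR₁.le, ENNReal.ofReal_pow (by norm_num),
      ENNReal.ofReal_inv_of_pos (by norm_num)]
    simp
  have hvol : ∀ ρ : ℝ, 0 < ρ → volume (ball y₀ ρ) = ENNReal.ofReal ((2 * ρ) ^ m) := by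
    intro ρ hρ
    rw [Real.volume_pi_ball y₀ hρ, Fintype.card_fin]
  obtain ⟨d, hd⟩ : ∃ d : (Fin m → ℝ) → (Fin m → ℝ) → ℝ≥0∞,
      d = fun y y' => ∫⁻ s in S, ‖u s y - u s y'‖ₑ := ⟨_, rfl⟩
  have hdm : Measurable (Function.uncurry d) := by
    rw [hd]
    have h1 : Measurable fun q : ((Fin m → ℝ) × (Fin m → ℝ)) × ℝ => u q.2 q.1.1 :=
      hu.comp (measurable_snd.prodMk (measurable_fst.comp measurable_fst))
    have h2 : Measurable fun q : ((Fin m → ℝ) × (Fin m → ℝ)) × ℝ => u q.2 q.1.2 :=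
      hu.comp (measurable_snd.prodMk (measurable_snd.comp measurable_fst))
    exact (h1.sub h2).enorm.lintegral_prod_right'
  have hsl : ∀ y, Measurable fun s => u s y := fun y => hu.comp (measurable_id.prodMk measurable_const)
  have hdsymm : ∀ y y', d y y' = d y' y := fun y y' => by
    rw [hd]
    exact lintegral_congr fun s => enorm_sub_rev _ _
  have hex : ∀ k, ∃ y', ∫⁻ y in ball y₀ (ρ k), d y y' ≤
      2 ^ m * (M * ENNReal.ofReal (ρ k) * ENNReal.ofReal ((2 * ρ k) ^ m)) := by
    intro k
    obtain ⟨y', -, h⟩ := exists_setLIntegral_le_of_translate hdm hdsymm (hρ0 k) (y₀ := y₀)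
      (T := M * ENNReal.ofReal (ρ k) * ENNReal.ofReal ((2 * ρ k) ^ m)) fun h hh => by
        rw [hd]
        exact H _ (hρ0 k) (hρR k) h hh
    exact ⟨y', h⟩
  choose y hy using hex
  obtain ⟨C, hC⟩ : ∃ C : ℝ≥0∞, C = 2 * 4 ^ m * M * ENNReal.ofReal R₁ := ⟨_, rfl⟩
  have hCt : C ≠ ⊤ := by
    rw [hC]
    exact ENNReal.mul_ne_top (ENNReal.mul_ne_top (ENNReal.mul_ne_top (by simp) (by simp)) hM)
      ENNReal.ofReal_ne_top
  have hpow : ∀ k, ENNReal.ofReal ((2 * ρ k) ^ m) = 2 ^ m * ENNReal.ofReal ((2 * ρ (k + 1)) ^ m) := by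
    intro k
    rw [hρs k, mul_pow 2 (2 * ρ (k + 1)), ENNReal.ofReal_mul (by positivity), ENNReal.ofReal_pow (by norm_num)]
    simp
  have hstep : ∀ k, ∫⁻ s in S, ‖u s (y (k + 1)) - u s (y k)‖ₑ ≤ C * 2⁻¹ ^ k := by
    intro k
    have hv0 : ENNReal.ofReal ((2 * ρ (k + 1)) ^ m) ≠ 0 := by
      have := hρ0 (k + 1)
      simp [this]
    have h1 : d (y (k + 1)) (y k) * ENNReal.ofReal ((2 * ρ (k + 1)) ^ m) ≤
        C * 2⁻¹ ^ k * ENNReal.ofReal ((2 * ρ (k + 1)) ^ m) := by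
      rw [← hvol _ (hρ0 (k + 1)), ← setLIntegral_const]
      calc ∫⁻ _ in ball y₀ (ρ (k + 1)), d (y (k + 1)) (y k)
          ≤ ∫⁻ x in ball y₀ (ρ (k + 1)), (d x (y (k + 1)) + d x (y k)) := by
            refine lintegral_mono fun x => ?_
            rw [hdsymm x, hd]
            dsimp only
            exact lintegral_enorm_sub_le_add (hsl _).aemeasurable (hsl _).aemeasurable
        _ = (∫⁻ x in ball y₀ (ρ (k + 1)), d x (y (k + 1))) + ∫⁻ x in ball y₀ (ρ (k + 1)), d x (y k) :=
            lintegral_add_left (hdm.comp (measurable_id.prodMk measurable_const)) _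
        _ ≤ 2 ^ m * (M * ENNReal.ofReal (ρ k) * ENNReal.ofReal ((2 * ρ k) ^ m)) +
            2 ^ m * (M * ENNReal.ofReal (ρ k) * ENNReal.ofReal ((2 * ρ k) ^ m)) := by
            have hle : ρ (k + 1) ≤ ρ k := by
              have := hρ0 (k + 1)
              rw [hρs k]
              linarith
            refine add_le_add ((hy (k + 1)).trans ?_)
              ((lintegral_mono_set (ball_subset_ball hle)).trans (hy k))
            have := (hρ0 (k + 1)).le
            gcongr
        _ = C * 2⁻¹ ^ k * volume (ball y₀ (ρ (k + 1))) := by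
            have h4 : (4 : ℝ≥0∞) ^ m = 2 ^ m * 2 ^ m := by
              rw [← mul_pow]
              norm_num
            rw [hvol _ (hρ0 (k + 1)), hpow k, hρe k, hC, h4]
            ring
    have := (ENNReal.mul_le_mul_iff_left hv0 ENNReal.ofReal_ne_top).1 h1
    rwa [hd] at this
  obtain ⟨G, hG, hGk⟩ := exists_limit_of_lintegral_sub_le (μ := volume.restrict S)
    (g := fun k s => u s (y k)) (fun k => hsl _) hCt hstep
  obtain ⟨D, hD⟩ : ∃ D : ℝ≥0∞, D = 2 ^ m * M + 4 * 4 ^ m * M := ⟨_, rfl⟩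
  have hDt : D ≠ ⊤ := by
    rw [hD]
    exact ENNReal.add_ne_top.2 ⟨ENNReal.mul_ne_top (by simp) hM,
      ENNReal.mul_ne_top (ENNReal.mul_ne_top (by simp) (by simp)) hM⟩
  refine ⟨G, hG, 2 * 2 ^ m * D, ENNReal.mul_ne_top (ENNReal.mul_ne_top (by simp) (by simp)) hDt, R₁, hR₁, fun R hR hRR => ?_⟩
  obtain ⟨k, hk1, hk2⟩ := exists_nat_pow_near_of_lt_one (div_pos hR hR₁) ((div_le_one hR₁).2 hRR.le)
    (by norm_num : (0 : ℝ) < 2⁻¹) (by norm_num)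
  have hk1' : ρ (k + 1) < R := by
    rw [lt_div_iff₀ hR₁, mul_comm] at hk1
    rwa [hρ]
  have hk2' : R ≤ ρ k := by
    rw [div_le_iff₀ hR₁, mul_comm] at hk2
    rwa [hρ]
  have hk3 : ρ k ≤ 2 * R := by
    rw [hρs k]
    linarith
  have hmz : Measurable fun z => d z (y k) := hdm.comp (measurable_id.prodMk measurable_const)
  calc ∫⁻ z in ball y₀ R, ∫⁻ s in S, ‖u s z - G s‖ₑ
      ≤ ∫⁻ z in ball y₀ (ρ k), ∫⁻ s in S, ‖u s z - G s‖ₑ := lintegral_mono_set (ball_subset_ball hk2')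
    _ ≤ ∫⁻ z in ball y₀ (ρ k), (d z (y k) + 2 * C * 2⁻¹ ^ k) := by
        refine lintegral_mono fun z => ?_
        refine le_trans ?_ (add_le_add_right (hGk k) _)
        rw [hd]
        dsimp only
        exact lintegral_enorm_sub_le_add (hsl _).aemeasurable (hsl _).aemeasurable
    _ = (∫⁻ z in ball y₀ (ρ k), d z (y k)) + 2 * C * 2⁻¹ ^ k * ENNReal.ofReal ((2 * ρ k) ^ m) := by
        rw [lintegral_add_left hmz, setLIntegral_const, hvol _ (hρ0 k)]
    _ ≤ 2 ^ m * (M * ENNReal.ofReal (ρ k) * ENNReal.ofReal ((2 * ρ k) ^ m)) +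
        2 * C * 2⁻¹ ^ k * ENNReal.ofReal ((2 * ρ k) ^ m) := add_le_add_left (hy k) _
    _ = D * ENNReal.ofReal (ρ k) * ENNReal.ofReal ((2 * ρ k) ^ m) := by
        rw [hρe k, hC, hD]
        ring
    _ ≤ D * ENNReal.ofReal (2 * R) * ENNReal.ofReal ((2 * (2 * R)) ^ m) := by
        have := (hρ0 k).le
        gcongr
    _ = 2 * 2 ^ m * D * ENNReal.ofReal R * ENNReal.ofReal ((2 * R) ^ m) := by
        rw [mul_pow 2 (2 * R), ENNReal.ofReal_mul (by positivity), ENNReal.ofReal_mul (by positivity),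
          ENNReal.ofReal_pow (by norm_num)]
        simp only [ENNReal.ofReal_ofNat]
        ring

end

section

variable {m : ℕ}

theorem slice_limit_translate {u : ℝ → (Fin m → ℝ) → ℝ} (hu : Measurable (Function.uncurry u))
    {G : ℝ → ℝ} (hG : Measurable G) {S S' : Set ℝ} (hS : MeasurableSet S) (hS' : MeasurableSet S')
    (hSS : S' ⊆ S) {t : ℝ} (hSt : ∀ s ∈ S', s + t ∈ S) {y₀ : Fin m → ℝ} {T C : ℝ≥0∞} (hC : C ≠ ⊤)
    {R₁ : ℝ} (hR₁ : 0 < R₁)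
    (h1 : ∀ R, 0 < R → R < R₁ → ∫⁻ y in ball y₀ R, ∫⁻ s in S, ‖u s y - G s‖ₑ ≤
      C * ENNReal.ofReal R * ENNReal.ofReal ((2 * R) ^ m))
    (h2 : ∀ R, 0 < R → R < R₁ → ∫⁻ y in ball y₀ R, ∫⁻ s in S', ‖u (s + t) y - u s y‖ₑ ≤
      T * ENNReal.ofReal ((2 * R) ^ m)) :
    ∫⁻ s in S', ‖G (s + t) - G s‖ₑ ≤ T := by
  have hsl : ∀ y, Measurable fun s => u s y := fun y => hu.comp (measurable_id.prodMk measurable_const)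
  have hslt : ∀ y, Measurable fun s => u (s + t) y := fun y => (hsl y).comp (measurable_add_const t)
  have hGt : Measurable fun s => G (s + t) := hG.comp (measurable_add_const t)
  have hpt : ∀ y, ∫⁻ s in S', ‖G (s + t) - G s‖ₑ ≤
      (∫⁻ s in S, ‖u s y - G s‖ₑ) + ((∫⁻ s in S', ‖u (s + t) y - u s y‖ₑ) +
        ∫⁻ s in S, ‖u s y - G s‖ₑ) := by
    intro y
    have e1 : ∫⁻ s in S', ‖G (s + t) - u (s + t) y‖ₑ ≤ ∫⁻ s in S, ‖u s y - G s‖ₑ := by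
      rw [← lintegral_indicator hS', ← lintegral_indicator hS,
        ← lintegral_add_right_eq_self (S.indicator fun s => ‖u s y - G s‖ₑ) t]
      refine lintegral_mono fun s => ?_
      by_cases hs : s ∈ S'
      · rw [Set.indicator_of_mem hs, Set.indicator_of_mem (hSt s hs), enorm_sub_rev]
      · rw [Set.indicator_of_notMem hs]
        exact bot_le
    calc ∫⁻ s in S', ‖G (s + t) - G s‖ₑ
        ≤ (∫⁻ s in S', ‖G (s + t) - u (s + t) y‖ₑ) + ∫⁻ s in S', ‖u (s + t) y - G s‖ₑ :=
          lintegral_enorm_sub_le_add hGt.aemeasurable (hslt y).aemeasurable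
      _ ≤ _ := add_le_add e1 ((lintegral_enorm_sub_le_add (hslt y).aemeasurable
          (hsl y).aemeasurable).trans (add_le_add_right (lintegral_mono_set hSS) _))
  have hm1 : Measurable fun y => ∫⁻ s in S, ‖u s y - G s‖ₑ := by
    have : Measurable fun q : (Fin m → ℝ) × ℝ => u q.2 q.1 := hu.comp measurable_swap
    exact (this.sub (hG.comp measurable_snd)).enorm.lintegral_prod_right'
  have hm2 : Measurable fun y => ∫⁻ s in S', ‖u (s + t) y - u s y‖ₑ := by
    have e1 : Measurable fun q : (Fin m → ℝ) × ℝ => u q.2 q.1 := hu.comp measurable_swap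
    have e2 : Measurable fun q : (Fin m → ℝ) × ℝ => u (q.2 + t) q.1 :=
      hu.comp (((measurable_add_const t).comp measurable_snd).prodMk measurable_fst)
    exact (e2.sub e1).enorm.lintegral_prod_right'
  have hR : ∀ R, 0 < R → R < R₁ → ∫⁻ s in S', ‖G (s + t) - G s‖ₑ ≤ T + 2 * C * ENNReal.ofReal R := by
    intro R hR hRR
    have hv : volume (ball y₀ R) = ENNReal.ofReal ((2 * R) ^ m) := by
      rw [Real.volume_pi_ball y₀ hR, Fintype.card_fin]
    have hv0 : volume (ball y₀ R) ≠ 0 := by simp [hv, hR]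
    refine (ENNReal.mul_le_mul_iff_left hv0 measure_ball_lt_top.ne).1 ?_
    rw [← setLIntegral_const]
    calc ∫⁻ _ in ball y₀ R, ∫⁻ s in S', ‖G (s + t) - G s‖ₑ
        ≤ ∫⁻ y in ball y₀ R, ((∫⁻ s in S, ‖u s y - G s‖ₑ) + ((∫⁻ s in S', ‖u (s + t) y - u s y‖ₑ) +
            ∫⁻ s in S, ‖u s y - G s‖ₑ)) := lintegral_mono hpt
      _ = (∫⁻ y in ball y₀ R, ∫⁻ s in S, ‖u s y - G s‖ₑ) +
          ((∫⁻ y in ball y₀ R, ∫⁻ s in S', ‖u (s + t) y - u s y‖ₑ) +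
            ∫⁻ y in ball y₀ R, ∫⁻ s in S, ‖u s y - G s‖ₑ) := by
          rw [lintegral_add_left hm1, lintegral_add_left hm2]
      _ ≤ C * ENNReal.ofReal R * ENNReal.ofReal ((2 * R) ^ m) + (T * ENNReal.ofReal ((2 * R) ^ m) +
          C * ENNReal.ofReal R * ENNReal.ofReal ((2 * R) ^ m)) :=
          add_le_add (h1 R hR hRR) (add_le_add (h2 R hR hRR) (h1 R hR hRR))
      _ = (T + 2 * C * ENNReal.ofReal R) * volume (ball y₀ R) := by
          rw [hv]
          ring
  have hlim : Tendsto (fun R : ℝ => T + 2 * C * ENNReal.ofReal R) (𝓝[>] 0) (𝓝 (T + 2 * C * ENNReal.ofReal 0)) :=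
    ((ENNReal.Tendsto.const_mul (ENNReal.continuous_ofReal.tendsto 0)
      (Or.inr (ENNReal.mul_ne_top (by simp) hC))).const_add T).mono_left nhdsWithin_le_nhds
  rw [ENNReal.ofReal_zero, mul_zero, add_zero] at hlim
  refine ge_of_tendsto hlim ?_
  have hR1 : ∀ᶠ R : ℝ in 𝓝[>] 0, R < R₁ := nhdsWithin_le_nhds (gt_mem_nhds hR₁)
  filter_upwards [self_mem_nhdsWithin, hR1] with R h0 h3 using hR R h0 h3

theorem eVariationOn_le_setLIntegral {g : ℝ → ℝ} {q : ℝ → ℝ≥0∞} {L I : Set ℝ} (hI : I.OrdConnected)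
    (hL : L ⊆ I) (h : ∀ x ∈ L, ∀ y ∈ L, x ≤ y → edist (g x) (g y) ≤ ∫⁻ s in Set.Ioc x y, q s) :
    eVariationOn g L ≤ ∫⁻ s in I, q s := by
  refine iSup_le fun p => ?_
  obtain ⟨k, u, hu, huL⟩ := p
  have hind : ∀ k : ℕ, ∑ i ∈ Finset.range k, ∫⁻ s in Set.Ioc (u i) (u (i + 1)), q s ≤
      ∫⁻ s in Set.Ioc (u 0) (u k), q s := by
    intro k
    induction k with
    | zero => simp
    | succ k ih =>
      rw [Finset.sum_range_succ]
      refine (add_le_add_left ih _).trans ?_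
      rw [← lintegral_union measurableSet_Ioc (Set.Ioc_disjoint_Ioc_of_le le_rfl),
        Set.Ioc_union_Ioc_eq_Ioc (hu (Nat.zero_le k)) (hu (Nat.le_succ k))]
  calc ∑ i ∈ Finset.range k, edist (g (u (i + 1))) (g (u i))
      ≤ ∑ i ∈ Finset.range k, ∫⁻ s in Set.Ioc (u i) (u (i + 1)), q s :=
        Finset.sum_le_sum fun i _ => by
          rw [edist_comm]
          exact h _ (huL i) _ (huL (i + 1)) (hu (Nat.le_succ i))
    _ ≤ ∫⁻ s in Set.Ioc (u 0) (u k), q s := hind k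
    _ ≤ ∫⁻ s in I, q s := lintegral_mono_set
        (Set.Ioc_subset_Icc_self.trans (hI.out (hL (huL 0)) (hL (huL k))))

theorem eVariationOn_le_of_translate {G : ℝ → ℝ} (hG : Integrable G) {I L : Set ℝ} (hI : I.OrdConnected)
    (hL : L ⊆ I) (hder : ∀ x ∈ L, HasDerivAt (fun x => ∫ t in (0 : ℝ)..x, G t) (G x) x)
    {t₀ : ℝ} (ht₀ : 0 < t₀) {C : ℝ≥0∞}
    (h : ∀ t, 0 < t → t < t₀ → ∫⁻ s in I, ‖G (s + t) - G s‖ₑ ≤ C * ENNReal.ofReal t) :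
    eVariationOn G L ≤ C := by
  obtain ⟨P, hP⟩ : ∃ P : ℝ → ℝ, P = fun x => ∫ t in (0 : ℝ)..x, G t := ⟨_, rfl⟩
  rw [← hP] at hder
  have hlim : ∀ x ∈ L, Tendsto (fun r : ℝ => r⁻¹ • (P (x + r) - P x)) (𝓝[>] 0) (𝓝 (G x)) :=
    fun x hx => (hder x hx).tendsto_slope_zero_right
  have hii : ∀ a b, IntervalIntegrable G volume a b := fun a b => hG.intervalIntegrable
  have hbound : ∀ r : ℝ, 0 < r → r < t₀ → eVariationOn (fun x => r⁻¹ • (P (x + r) - P x)) L ≤ C := by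
    intro r hr hrt
    have hGr : Integrable fun s => G (s + r) := hG.comp_add_right r
    have hr0 : ENNReal.ofReal r ≠ 0 := by simp [hr]
    calc eVariationOn (fun x => r⁻¹ • (P (x + r) - P x)) L
        ≤ ∫⁻ s in I, (ENNReal.ofReal r)⁻¹ * ‖G (s + r) - G s‖ₑ := by
          refine eVariationOn_le_setLIntegral hI hL fun x _ y _ hxy => ?_
          have e1 : (r⁻¹ • (P (y + r) - P y)) - (r⁻¹ • (P (x + r) - P x)) =
              r⁻¹ * ∫ s in x..y, (G (s + r) - G s) := by
            rw [intervalIntegral.integral_sub hGr.intervalIntegrable (hii _ _),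
              intervalIntegral.integral_comp_add_right (f := G),
              ← intervalIntegral.integral_interval_sub_left (hii 0 (y + r)) (hii 0 (x + r)),
              ← intervalIntegral.integral_interval_sub_left (hii 0 y) (hii 0 x), hP]
            simp only [smul_eq_mul]
            ring
          rw [edist_comm, edist_eq_enorm_sub, e1, enorm_mul, Real.enorm_eq_ofReal (inv_nonneg.2 hr.le),
            ENNReal.ofReal_inv_of_pos hr, intervalIntegral.integral_of_le hxy,
            lintegral_const_mul' _ _ (ENNReal.inv_ne_top.2 hr0)]
          gcongr
          exact enorm_integral_le_lintegral_enorm _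
      _ = (ENNReal.ofReal r)⁻¹ * ∫⁻ s in I, ‖G (s + r) - G s‖ₑ :=
          lintegral_const_mul' _ _ (ENNReal.inv_ne_top.2 hr0)
      _ ≤ (ENNReal.ofReal r)⁻¹ * (C * ENNReal.ofReal r) := by
          gcongr
          exact h r hr hrt
      _ = C := by
          rw [mul_comm, mul_assoc, ENNReal.mul_inv_cancel hr0 ENNReal.ofReal_ne_top, mul_one]
  by_contra hlt
  push Not at hlt
  have hev := eVariationOn.lowerSemicontinuous_aux hlim hlt
  have h2 : ∀ᶠ r : ℝ in 𝓝[>] 0, r < t₀ := nhdsWithin_le_nhds (gt_mem_nhds ht₀)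
  obtain ⟨r, ⟨hr1, hr2⟩, hr3⟩ := ((hev.and h2).and self_mem_nhdsWithin).exists
  exact absurd (hbound r hr3 hr2) (not_le.2 hr1)

/-- An integrable function with linear `L¹` modulus of continuity near a point has one-sided
averaged limits there. -/
theorem exists_one_sided_limits {G : ℝ → ℝ} (hG : Integrable G) {s₀ c t₀ : ℝ} (hc : 0 < c) (ht₀ : 0 < t₀)
    {C : ℝ≥0∞} (hC : C ≠ ⊤)
    (h : ∀ t, 0 < t → t < t₀ → ∫⁻ s in ball s₀ c, ‖G (s + t) - G s‖ₑ ≤ C * ENNReal.ofReal t) :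
    ∃ a b : ℝ, ∀ ε : ℝ≥0∞, ε ≠ 0 → ∃ δ > 0, ∀ r : ℝ, 0 < r → r < δ →
      ∫⁻ s in ball s₀ r, ‖G s - (if s₀ < s then a else b)‖ₑ ≤ ε * ENNReal.ofReal r := by
  obtain ⟨L, hLdef⟩ : ∃ L : Set ℝ, L =
      {x | HasDerivAt (fun x => ∫ t in (0 : ℝ)..x, G t) (G x) x} ∩ ball s₀ c := ⟨_, rfl⟩
  have hae : ∀ᵐ x, x ∈ ball s₀ c → x ∈ L := by
    filter_upwards [_root_.LocallyIntegrable.ae_hasDerivAt_integral hG.locallyIntegrable] with x hx hxb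
    rw [hLdef]
    exact ⟨hx 0, hxb⟩
  have hbv : BoundedVariationOn G L := by
    refine ne_top_of_le_ne_top hC (eVariationOn_le_of_translate hG (I := ball s₀ c) ?_ ?_ ?_ ht₀ h)
    · rw [Real.ball_eq_Ioo]
      exact Set.ordConnected_Ioo
    · rw [hLdef]
      exact Set.inter_subset_right
    · rw [hLdef]
      exact fun x hx => hx.1
  obtain ⟨a, ha⟩ := hbv.exists_tendsto_right s₀
  obtain ⟨b, hb⟩ := hbv.exists_tendsto_left s₀
  refine ⟨a, b, fun ε hε => ?_⟩
  have hε2 : ε / 2 ≠ 0 := by simpa using hε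
  have ha' := EMetric.tendsto_nhds.1 ha (ε / 2) (pos_iff_ne_zero.2 hε2)
  have hb' := EMetric.tendsto_nhds.1 hb (ε / 2) (pos_iff_ne_zero.2 hε2)
  obtain ⟨δ₁, hδ₁, h1⟩ := Metric.mem_nhdsWithin_iff.1 ha'
  obtain ⟨δ₂, hδ₂, h2⟩ := Metric.mem_nhdsWithin_iff.1 hb'
  refine ⟨min c (min δ₁ δ₂), by positivity, fun r hr hrm => ?_⟩
  have hrc : r < c := hrm.trans_le (min_le_left _ _)
  have hr1 : r < δ₁ := hrm.trans_le ((min_le_right _ _).trans (min_le_left _ _))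
  have hr2 : r < δ₂ := hrm.trans_le ((min_le_right _ _).trans (min_le_right _ _))
  have hne : ∀ᵐ x : ℝ, x ≠ s₀ := by simp [ae_iff]
  calc ∫⁻ s in ball s₀ r, ‖G s - (if s₀ < s then a else b)‖ₑ ≤ ∫⁻ _ in ball s₀ r, ε / 2 := by
        refine lintegral_mono_ae ((ae_restrict_iff' measurableSet_ball).2 ?_)
        filter_upwards [hae, hne] with s hs hs0 hsb
        have hsL := hs (ball_subset_ball hrc.le hsb)
        rw [← edist_eq_enorm_sub]
        split_ifs with hlt
        · exact le_of_lt (h1 ⟨ball_subset_ball hr1.le hsb, hsL, hlt⟩)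
        · exact le_of_lt (h2 ⟨ball_subset_ball hr2.le hsb, hsL, lt_of_le_of_ne (not_lt.1 hlt) hs0⟩)
    _ = ε * ENNReal.ofReal r := by
        rw [setLIntegral_const, Real.volume_ball, ENNReal.ofReal_mul (by norm_num), ENNReal.ofReal_ofNat,
          ← mul_assoc, ENNReal.div_mul_cancel (by simp) (by simp)]

end

section

variable {m : ℕ}

theorem exists_norm_insertCoord_le (i : Fin (m + 1)) :
    ∃ A : ℝ, 1 ≤ A ∧ ∀ p, ‖insertCoord i p‖ ≤ A * ‖p‖ := by
  let L : (ℝ × (Fin m → ℝ)) →ₗ[ℝ] EuclideanSpace ℝ (Fin (m + 1)) :=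
    { toFun := insertCoord i
      map_add' := insertCoord_add i
      map_smul' := insertCoord_smul i }
  refine ⟨‖LinearMap.toContinuousLinearMap L‖ + 1, by simp, fun p => ?_⟩
  have h1 : ‖insertCoord i p‖ ≤ ‖LinearMap.toContinuousLinearMap L‖ * ‖p‖ :=
    (LinearMap.toContinuousLinearMap L).le_opNorm p
  nlinarith [norm_nonneg p]

/-- The set of points whose `i`-th coordinate lies in `S` and whose remaining coordinates lie
in `B`. -/
def coordCylinder (i : Fin (m + 1)) (S : Set ℝ) (B : Set (Fin m → ℝ)) : Set (EuclideanSpace ℝ (Fin (m + 1))) :=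
  {z | z i ∈ S ∧ dropCoord i z ∈ B}

theorem measurableSet_coordCylinder (i : Fin (m + 1)) {S : Set ℝ} {B : Set (Fin m → ℝ)} (hS : MeasurableSet S)
    (hB : MeasurableSet B) : MeasurableSet (coordCylinder i S B) := by
  have h1 : Measurable fun z : EuclideanSpace ℝ (Fin (m + 1)) => z i :=
    (EuclideanSpace.proj (𝕜 := ℝ) i).continuous.measurable
  exact (h1 hS).inter ((contDiff_dropCoord (k := 0) i).continuous.measurable hB)

theorem lintegral_coordCylinder (i : Fin (m + 1)) {S : Set ℝ} {B : Set (Fin m → ℝ)} (hS : MeasurableSet S)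
    (hB : MeasurableSet B) {g : EuclideanSpace ℝ (Fin (m + 1)) → ℝ≥0∞} (hg : Measurable g) :
    ∫⁻ z in coordCylinder i S B, g z = ∫⁻ y in B, ∫⁻ s in S, g (insertCoord i (s, y)) := by
  have hpre : insertCoord i ⁻¹' coordCylinder i S B = S ×ˢ B := by
    ext p
    simp [coordCylinder, insertCoord_apply_same, dropCoord_insertCoord]
  have hgm : Measurable fun p : ℝ × (Fin m → ℝ) => g (insertCoord i p) :=
    hg.comp (measurePreserving_insertCoord i).measurable
  rw [← (measurePreserving_insertCoord i).setLIntegral_comp_preimage (measurableSet_coordCylinder i hS hB) hg,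
    hpre, Measure.volume_eq_prod, ← Measure.prod_restrict, lintegral_prod_symm _ hgm.aemeasurable]

theorem norm_sub_le_of_coord_le {i : Fin (m + 1)} {A : ℝ} (hA : ∀ p, ‖insertCoord i p‖ ≤ A * ‖p‖)
    (hA1 : 1 ≤ A) (z x : EuclideanSpace ℝ (Fin (m + 1))) {a : ℝ} (h1 : |z i - x i| ≤ a)
    (h2 : ‖dropCoord i z - dropCoord i x‖ ≤ a) : ‖z - x‖ ≤ A * a := by
  have h3 : z - x = insertCoord i (z i - x i, dropCoord i z - dropCoord i x) :=
    (insertCoord_dropCoord i (z - x)).symm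
  rw [h3]
  refine (hA _).trans (mul_le_mul_of_nonneg_left ?_ (by linarith))
  exact max_le h1 h2

/-- Translation estimate on a cylinder over a point where the projected variation measure has
bounded density. -/
theorem setLIntegral_cylinder_translate_le {f F : EuclideanSpace ℝ (Fin (m + 1)) → ℝ}
    {Ω : Set (EuclideanSpace ℝ (Fin (m + 1)))} {μ : Measure (EuclideanSpace ℝ (Fin (m + 1)))}
    {σ : EuclideanSpace ℝ (Fin (m + 1)) → EuclideanSpace ℝ (Fin (m + 1))}
    (h : IsVariationPair (m + 1) f Ω μ σ) (hF : LocallyIntegrable F) {i : Fin (m + 1)} {A : ℝ} (hA1 : 1 ≤ A)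
    (hA : ∀ p, ‖insertCoord i p‖ ≤ A * ‖p‖) {x : EuclideanSpace ℝ (Fin (m + 1))} {c : ℝ} (hc : 0 < c)
    (hK : closedBall x (8 * A * c) ⊆ Ω) (hFf : ∀ᵐ y, y ∈ closedBall x (8 * A * c) → F y = f y)
    {M : ℝ≥0∞} {R : ℝ} (hR : 0 < R) (hRc : R ≤ c)
    (hM : μ (dropCoord i ⁻¹' closedBall (dropCoord i x) (4 * R)) ≤ M)
    {t : ℝ} {y : Fin m → ℝ} (ht : |t| ≤ c) (hy : ‖y‖ ≤ 2 * R) {S : Set ℝ} (hSm : MeasurableSet S)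
    (hS : S ⊆ ball (x i) (2 * c)) :
    ∫⁻ z in coordCylinder i S (ball (dropCoord i x) R), ‖F (z + insertCoord i (t, y)) - F z‖ₑ ≤
      ENNReal.ofReal (A * ‖(t, y)‖) * M := by
  have hσ := h.2.2.2.1
  have hV : ∀ z ∈ coordCylinder i S (ball (dropCoord i x) R), ∀ q ∈ Set.Ioc (0 : ℝ) 1,
      closedBall (z + q • insertCoord i (t, y)) R ⊆
        closedBall x (8 * A * c) ∩ dropCoord i ⁻¹' closedBall (dropCoord i x) (4 * R) := by
    intro z hz q hq w hw
    have hz1 : |z i - x i| < 2 * c := hS hz.1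
    have hz2 : ‖dropCoord i z - dropCoord i x‖ < R := by
      rw [← dist_eq_norm]
      exact hz.2
    rw [mem_closedBall, dist_eq_norm] at hw
    have hqt : |q * t| ≤ c := by
      rw [abs_mul, abs_of_pos hq.1]
      nlinarith [abs_nonneg t, hq.1, hq.2]
    have hqy : ‖q • y‖ ≤ 2 * R := by
      rw [norm_smul, Real.norm_eq_abs, abs_of_pos hq.1]
      nlinarith [norm_nonneg y, hq.1, hq.2]
    have hd : dropCoord i (z + q • insertCoord i (t, y)) - dropCoord i x =
        (dropCoord i z - dropCoord i x) + q • y := by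
      rw [dropCoord_add, dropCoord_smul, dropCoord_insertCoord]
      abel
    have hd' : ‖dropCoord i (z + q • insertCoord i (t, y)) - dropCoord i x‖ ≤ 3 * R := by
      rw [hd]
      linarith [norm_add_le (dropCoord i z - dropCoord i x) (q • y)]
    have hi : (z + q • insertCoord i (t, y)) i - x i = (z i - x i) + q * t := by
      simp only [PiLp.add_apply, PiLp.smul_apply, insertCoord_apply_same, smul_eq_mul]
      ring
    have hi' : |(z + q • insertCoord i (t, y)) i - x i| ≤ 3 * c := by
      rw [hi]
      linarith [abs_add_le (z i - x i) (q * t)]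
    constructor
    · have h3 := norm_sub_le_of_coord_le hA hA1 (z + q • insertCoord i (t, y)) x hi'
        (hd'.trans (by linarith))
      rw [mem_closedBall, dist_eq_norm]
      have h4 := norm_sub_le_norm_sub_add_norm_sub w (z + q • insertCoord i (t, y)) x
      nlinarith
    · rw [Set.mem_preimage, mem_closedBall, dist_eq_norm]
      have h3 : ‖dropCoord i w - dropCoord i (z + q • insertCoord i (t, y))‖ ≤ R :=
        (norm_dropCoord_le i (w - (z + q • insertCoord i (t, y)))).trans hw
      have h4 := norm_sub_le_norm_sub_add_norm_sub (dropCoord i w)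
        (dropCoord i (z + q • insertCoord i (t, y))) (dropCoord i x)
      linarith
  calc ∫⁻ z in coordCylinder i S (ball (dropCoord i x) R), ‖F (z + insertCoord i (t, y)) - F z‖ₑ
      ≤ ∫⁻ w in closedBall x (8 * A * c) ∩ dropCoord i ⁻¹' closedBall (dropCoord i x) (4 * R),
          ‖⟪insertCoord i (t, y), σ w⟫‖ₑ ∂μ :=
        lintegral_translate_sub_le h hF hK hFf (measurableSet_coordCylinder i hSm measurableSet_ball) _ hR hV
          Set.inter_subset_left
    _ ≤ ∫⁻ w in dropCoord i ⁻¹' closedBall (dropCoord i x) (4 * R), ‖⟪insertCoord i (t, y), σ w⟫‖ₑ ∂μ :=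
        lintegral_mono_set Set.inter_subset_right
    _ ≤ ∫⁻ _ in dropCoord i ⁻¹' closedBall (dropCoord i x) (4 * R), ENNReal.ofReal (A * ‖(t, y)‖) ∂μ := by
        refine lintegral_mono_ae (ae_restrict_of_ae ?_)
        filter_upwards [hσ] with w hw
        rw [← ofReal_norm]
        refine ENNReal.ofReal_le_ofReal ((norm_inner_le_norm _ _).trans ?_)
        rw [hw, mul_one]
        exact hA _
    _ ≤ ENNReal.ofReal (A * ‖(t, y)‖) * M := by
        rw [setLIntegral_const]
        gcongr

/-- Over a point where the projected variation measure has bounded density, a function of bounded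
variation is close to a two-valued function of the remaining coordinate. -/
theorem exists_step_approx_cylinder {f F : EuclideanSpace ℝ (Fin (m + 1)) → ℝ}
    {Ω : Set (EuclideanSpace ℝ (Fin (m + 1)))} {μ : Measure (EuclideanSpace ℝ (Fin (m + 1)))}
    {σ : EuclideanSpace ℝ (Fin (m + 1)) → EuclideanSpace ℝ (Fin (m + 1))}
    (h : IsVariationPair (m + 1) f Ω μ σ) (hFm : Measurable F) (hF : Integrable F) (i : Fin (m + 1))
    {x : EuclideanSpace ℝ (Fin (m + 1))} {ρ₀ : ℝ} (hρ₀ : 0 < ρ₀) (hK : closedBall x ρ₀ ⊆ Ω)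
    (hFf : ∀ᵐ y, y ∈ closedBall x ρ₀ → F y = f y) {M : ℝ≥0∞} (hM : M ≠ ⊤) {R₀ : ℝ} (hR₀ : 0 < R₀)
    (hκ : ∀ R, 0 < R → R < R₀ →
      μ (dropCoord i ⁻¹' closedBall (dropCoord i x) R) ≤ M * ENNReal.ofReal ((2 * R) ^ m)) :
    ∃ a b : ℝ, ∃ C : ℝ≥0∞, C ≠ ⊤ ∧ ∀ ε : ℝ≥0∞, ε ≠ 0 → ∃ δ > 0, ∀ r R : ℝ, 0 < r → r < δ → 0 < R → R < δ →
      ∫⁻ z in coordCylinder i (ball (x i) r) (ball (dropCoord i x) R), ‖F z - (if x i < z i then a else b)‖ₑ ≤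
        (C * ENNReal.ofReal R + ε * ENNReal.ofReal r) * ENNReal.ofReal ((2 * R) ^ m) := by
  obtain ⟨A, hA1, hA⟩ := exists_norm_insertCoord_le i
  have hA0 : 0 < A := by linarith
  obtain ⟨c, hcdef⟩ : ∃ c, c = ρ₀ / (8 * A) := ⟨_, rfl⟩
  have hc : 0 < c := by rw [hcdef]; positivity
  have hcρ : 8 * A * c = ρ₀ := by rw [hcdef]; field_simp
  rw [← hcρ] at hK hFf
  obtain ⟨y₀, hy₀⟩ : ∃ y₀, y₀ = dropCoord i x := ⟨_, rfl⟩
  obtain ⟨N, hN⟩ : ∃ N, N = M * ENNReal.ofReal (4 ^ m) := ⟨_, rfl⟩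
  have hNtop : N ≠ ⊤ := by rw [hN]; exact ENNReal.mul_ne_top hM ENNReal.ofReal_ne_top
  obtain ⟨u, hu⟩ : ∃ u : ℝ → (Fin m → ℝ) → ℝ, u = fun s y => F (insertCoord i (s, y)) := ⟨_, rfl⟩
  have humeas : Measurable (Function.uncurry u) := by
    rw [hu]
    exact hFm.comp (measurePreserving_insertCoord i).measurable
  obtain ⟨Rm, hRm⟩ : ∃ Rm, Rm = min (R₀ / 4) c := ⟨_, rfl⟩
  have hRm0 : 0 < Rm := by rw [hRm]; positivity
  have key : ∀ R, 0 < R → R < Rm → ∀ (t : ℝ) (k : Fin m → ℝ), |t| ≤ c → ‖k‖ ≤ 2 * R →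
      ∀ S, MeasurableSet S → S ⊆ ball (x i) (2 * c) →
      ∫⁻ y in ball y₀ R, ∫⁻ s in S, ‖u (s + t) (y + k) - u s y‖ₑ ≤
        ENNReal.ofReal (A * ‖(t, k)‖) * N * ENNReal.ofReal ((2 * R) ^ m) := by
    intro R hR hRR t k ht hk S hSm hS
    have hR4 : 4 * R < R₀ := by
      have := hRR.trans_le (hRm.le.trans (min_le_left _ _))
      linarith
    have hRc : R ≤ c := (hRR.trans_le (hRm.le.trans (min_le_right _ _))).le
    have hMM : M * ENNReal.ofReal ((2 * (4 * R)) ^ m) = N * ENNReal.ofReal ((2 * R) ^ m) := by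
      rw [hN, mul_assoc, ← ENNReal.ofReal_mul (by positivity), ← mul_pow]
      ring_nf
    have e1 := setLIntegral_cylinder_translate_le h hF.locallyIntegrable hA1 hA hc hK hFf hR hRc
      ((hκ (4 * R) (by positivity) hR4).trans hMM.le) ht hk hSm hS
    have e2 : Measurable fun z => ‖F (z + insertCoord i (t, k)) - F z‖ₑ :=
      ((hFm.comp (measurable_add_const _)).sub hFm).enorm
    rw [lintegral_coordCylinder i hSm measurableSet_ball e2] at e1
    rw [mul_assoc, hu, hy₀]
    simpa only [← insertCoord_add, Prod.mk_add_mk] using e1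
  have H1 : ∀ R, 0 < R → R < Rm → ∀ k, ‖k‖ ≤ 2 * R →
      ∫⁻ y in ball y₀ R, ∫⁻ s in ball (x i) (2 * c), ‖u s (y + k) - u s y‖ₑ ≤
        ENNReal.ofReal (2 * A) * N * ENNReal.ofReal R * ENNReal.ofReal ((2 * R) ^ m) := by
    intro R hR hRR k hk
    have e1 := key R hR hRR 0 k (by simpa using hc.le) hk _ measurableSet_ball subset_rfl
    simp only [add_zero] at e1
    refine e1.trans ?_
    have e2 : ‖((0 : ℝ), k)‖ ≤ 2 * R := by
      rw [Prod.norm_def]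
      exact max_le (by simp [hR.le]) hk
    have e3 : ENNReal.ofReal (A * ‖((0 : ℝ), k)‖) ≤ ENNReal.ofReal (2 * A) * ENNReal.ofReal R := by
      rw [← ENNReal.ofReal_mul (by positivity)]
      refine ENNReal.ofReal_le_ofReal ?_
      nlinarith
    calc _ ≤ ENNReal.ofReal (2 * A) * ENNReal.ofReal R * N * ENNReal.ofReal ((2 * R) ^ m) := by gcongr
      _ = _ := by ring
  obtain ⟨G, hG, C, hC, R₁, hR₁, hrate⟩ := exists_slice_limit humeas
    (ENNReal.mul_ne_top ENNReal.ofReal_ne_top hNtop) hRm0 H1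
  obtain ⟨R₂, hR₂⟩ : ∃ R₂, R₂ = min R₁ Rm := ⟨_, rfl⟩
  have hR₂0 : 0 < R₂ := by rw [hR₂]; positivity
  have hR21 : R₂ ≤ R₁ := hR₂.le.trans (min_le_left _ _)
  have hR2m : R₂ ≤ Rm := hR₂.le.trans (min_le_right _ _)
  have htr : ∀ t, 0 < t → t < c → ∫⁻ s in ball (x i) c, ‖G (s + t) - G s‖ₑ ≤
      ENNReal.ofReal A * N * ENNReal.ofReal t := by
    intro t ht htc
    refine slice_limit_translate humeas hG (S := ball (x i) (2 * c)) measurableSet_ball measurableSet_ball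
      (ball_subset_ball (by linarith)) (fun s hs => ?_) hC hR₂0
      (fun R hR hRR => hrate R hR (hRR.trans_le hR21)) fun R hR hRR => ?_
    · rw [mem_ball, Real.dist_eq] at hs ⊢
      have : s + t - x i = (s - x i) + t := by ring
      rw [this]
      have := abs_add_le (s - x i) t
      rw [abs_of_pos ht] at this
      linarith
    · have e1 := key R hR (hRR.trans_le hR2m) t 0 (by rw [abs_of_pos ht]; exact htc.le)
        (by simpa using hR.le) (ball (x i) c) measurableSet_ball (ball_subset_ball (by linarith))
      simp only [add_zero] at e1
      refine e1.trans (le_of_eq ?_)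
      have e2 : ‖(t, (0 : Fin m → ℝ))‖ = t := by
        rw [Prod.norm_def]
        simp [abs_of_pos ht, ht.le]
      rw [e2, ENNReal.ofReal_mul hA0.le]
      ring
  have hGint : IntegrableOn G (ball (x i) (2 * c)) := by
    refine ⟨hG.aestronglyMeasurable, ?_⟩
    obtain ⟨R, hR⟩ : ∃ R, R = R₂ / 2 := ⟨_, rfl⟩
    have hR0 : 0 < R := by rw [hR]; positivity
    have hRR : R < R₁ := by linarith
    have hsl : ∀ y, Measurable fun s => u s y := fun y =>
      humeas.comp (measurable_id.prodMk measurable_const)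
    have hm1 : Measurable fun y => ∫⁻ s in ball (x i) (2 * c), ‖u s y - G s‖ₑ := by
      have : Measurable fun q : (Fin m → ℝ) × ℝ => u q.2 q.1 := humeas.comp measurable_swap
      exact (this.sub (hG.comp measurable_snd)).enorm.lintegral_prod_right'
    have e1 : ∫⁻ y in ball y₀ R, ∫⁻ s in ball (x i) (2 * c), ‖u s y‖ₑ < ⊤ := by
      rw [hu, ← lintegral_coordCylinder i measurableSet_ball measurableSet_ball (g := fun z => ‖F z‖ₑ) hFm.enorm]
      exact (setLIntegral_le_lintegral _ _).trans_lt hF.2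
    have e2 : (∫⁻ s in ball (x i) (2 * c), ‖G s‖ₑ) * volume (ball y₀ R) < ⊤ := by
      rw [← setLIntegral_const]
      calc ∫⁻ _ in ball y₀ R, ∫⁻ s in ball (x i) (2 * c), ‖G s‖ₑ
          ≤ ∫⁻ y in ball y₀ R, ((∫⁻ s in ball (x i) (2 * c), ‖u s y - G s‖ₑ) +
              ∫⁻ s in ball (x i) (2 * c), ‖u s y‖ₑ) := by
            refine lintegral_mono fun y => ?_
            have e3 := lintegral_enorm_sub_le_add (μ := volume.restrict (ball (x i) (2 * c)))
              (c := fun _ => (0 : ℝ)) hG.aemeasurable (hsl y).aemeasurable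
            simpa only [sub_zero, enorm_sub_rev (G _)] using e3
        _ = (∫⁻ y in ball y₀ R, ∫⁻ s in ball (x i) (2 * c), ‖u s y - G s‖ₑ) +
              ∫⁻ y in ball y₀ R, ∫⁻ s in ball (x i) (2 * c), ‖u s y‖ₑ := lintegral_add_left hm1 _
        _ < ⊤ := ENNReal.add_lt_top.2 ⟨(hrate R hR0 hRR).trans_lt (ENNReal.mul_lt_top
            (ENNReal.mul_lt_top hC.lt_top ENNReal.ofReal_lt_top) ENNReal.ofReal_lt_top), e1⟩
    have hv0 : volume (ball y₀ R) ≠ 0 := (measure_ball_pos _ _ hR0).ne'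
    by_contra hc
    have hc' : (∫⁻ s in ball (x i) (2 * c), ‖G s‖ₑ) = ⊤ := not_lt_top_iff.1 hc
    rw [hc', ENNReal.top_mul hv0] at e2
    exact lt_irrefl _ e2
  have htr' : ∀ t, 0 < t → t < c → ∫⁻ s in ball (x i) c,
      ‖(ball (x i) (2 * c)).indicator G (s + t) - (ball (x i) (2 * c)).indicator G s‖ₑ ≤
      ENNReal.ofReal A * N * ENNReal.ofReal t := by
    intro t ht htc
    refine le_trans (le_of_eq ?_) (htr t ht htc)
    refine setLIntegral_congr_fun measurableSet_ball fun s hs => ?_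
    have h1 : s ∈ ball (x i) (2 * c) := ball_subset_ball (by linarith) hs
    have h2 : s + t ∈ ball (x i) (2 * c) := by
      rw [mem_ball, Real.dist_eq] at hs ⊢
      have : s + t - x i = (s - x i) + t := by ring
      rw [this]
      have := abs_add_le (s - x i) t
      rw [abs_of_pos ht] at this
      linarith
    simp only [Set.indicator_of_mem h1, Set.indicator_of_mem h2]
  obtain ⟨a, b, hab⟩ := exists_one_sided_limits ((integrable_indicator_iff measurableSet_ball).2 hGint) hc hc
    (ENNReal.mul_ne_top ENNReal.ofReal_ne_top hNtop) htr'
  refine ⟨a, b, C, hC, fun ε hε => ?_⟩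
  obtain ⟨δ, hδ, hδr⟩ := hab ε hε
  refine ⟨min (min δ R₂) c, by positivity, fun r R hr hrδ hR hRδ => ?_⟩
  have hr1 : r < δ := hrδ.trans_le ((min_le_left _ _).trans (min_le_left _ _))
  have hrc : r < c := hrδ.trans_le (min_le_right _ _)
  have hR1 : R < R₁ := (hRδ.trans_le ((min_le_left _ _).trans (min_le_right _ _))).trans_le hR21
  have hstep : Measurable fun s : ℝ => if x i < s then a else b :=
    Measurable.ite measurableSet_Ioi measurable_const measurable_const
  have hstepz : Measurable fun z : EuclideanSpace ℝ (Fin (m + 1)) => if x i < z i then a else b :=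
    hstep.comp (EuclideanSpace.proj (𝕜 := ℝ) i).continuous.measurable
  have hsub : ball (x i) r ⊆ ball (x i) (2 * c) := ball_subset_ball (by linarith)
  have e1 : ∫⁻ s in ball (x i) r, ‖G s - (if x i < s then a else b)‖ₑ ≤ ε * ENNReal.ofReal r := by
    refine le_trans (le_of_eq ?_) (hδr r hr hr1)
    refine setLIntegral_congr_fun measurableSet_ball fun s hs => ?_
    simp only [Set.indicator_of_mem (hsub hs)]
  have hFs : Measurable fun z => ‖F z - (if x i < z i then a else b)‖ₑ := (hFm.sub hstepz).enorm
  rw [lintegral_coordCylinder i measurableSet_ball measurableSet_ball hFs, ← hy₀]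
  simp only [insertCoord_apply_same]
  have hsl : ∀ y, Measurable fun s => u s y := fun y =>
    humeas.comp (measurable_id.prodMk measurable_const)
  have hv : volume (ball y₀ R) = ENNReal.ofReal ((2 * R) ^ m) := by
    rw [Real.volume_pi_ball y₀ hR, Fintype.card_fin]
  calc ∫⁻ y in ball y₀ R, ∫⁻ s in ball (x i) r, ‖F (insertCoord i (s, y)) - (if x i < s then a else b)‖ₑ
      ≤ ∫⁻ y in ball y₀ R, ((∫⁻ s in ball (x i) (2 * c), ‖u s y - G s‖ₑ) + ε * ENNReal.ofReal r) := by
        refine lintegral_mono fun y => ?_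
        have e2 := lintegral_enorm_sub_le_add (μ := volume.restrict (ball (x i) r))
          (c := fun s => if x i < s then a else b) (hsl y).aemeasurable hG.aemeasurable
        rw [hu] at e2 ⊢
        exact e2.trans (add_le_add (lintegral_mono_set hsub) e1)
    _ = (∫⁻ y in ball y₀ R, ∫⁻ s in ball (x i) (2 * c), ‖u s y - G s‖ₑ) +
          ε * ENNReal.ofReal r * ENNReal.ofReal ((2 * R) ^ m) := by
        rw [lintegral_add_right _ measurable_const, setLIntegral_const, hv]
    _ ≤ C * ENNReal.ofReal R * ENNReal.ofReal ((2 * R) ^ m) +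
          ε * ENNReal.ofReal r * ENNReal.ofReal ((2 * R) ^ m) := add_le_add (hrate R hR hR1) le_rfl
    _ = _ := by ring

end

section

variable {m : ℕ}

theorem lintegral_sub_mul_le_of_shear {i : Fin (m + 1)} {Φ p : EuclideanSpace ℝ (Fin (m + 1)) → ℝ}
    (hΦ : Measurable Φ) (hp : Measurable p) {e : (Fin m → ℝ) → EuclideanSpace ℝ (Fin (m + 1))}
    (he : Measurable e) (hed : ∀ k, dropCoord i (e k) = k) {T : ℝ} (heT : ∀ k, ‖k‖ < 3 → |e k i| ≤ T)
    (hinv : ∀ k w, p (w - e k) = p w) {ρ : ℝ} (hρ : 0 < ρ) (hρ1 : ρ ≤ 1) :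
    (∫⁻ w in ball 0 2, ‖Φ w - p w‖ₑ) * ENNReal.ofReal ((2 * ρ) ^ m) ≤
      (∫⁻ k in ball 0 3, ∫⁻ w in ball 0 2, ‖Φ w - Φ (w - e k)‖ₑ) +
        ENNReal.ofReal (6 ^ m) * ∫⁻ w in coordCylinder i (ball 0 (2 + T)) (ball 0 ρ), ‖Φ w - p w‖ₑ := by
  obtain ⟨q, hq⟩ : ∃ q, q = (coordCylinder i (ball 0 (2 + T)) (ball 0 ρ)).indicator
      fun w => ‖Φ w - p w‖ₑ := ⟨_, rfl⟩
  have hZ : MeasurableSet (coordCylinder i (ball 0 (2 + T)) (ball 0 ρ)) :=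
    measurableSet_coordCylinder i measurableSet_ball measurableSet_ball
  have hqm : Measurable q := by
    rw [hq]
    exact (hΦ.sub hp).enorm.indicator hZ
  have hpt : ∀ w ∈ ball (0 : EuclideanSpace ℝ (Fin (m + 1))) 2,
      ‖Φ w - p w‖ₑ * ENNReal.ofReal ((2 * ρ) ^ m) ≤
        ∫⁻ k in ball 0 3, (‖Φ w - Φ (w - e k)‖ₑ + q (w - e k)) := by
    intro w hw
    have hw2 : ‖w‖ < 2 := by simpa using hw
    have hv : volume (ball (dropCoord i w) ρ) = ENNReal.ofReal ((2 * ρ) ^ m) := by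
      rw [Real.volume_pi_ball _ hρ, Fintype.card_fin]
    have hsub : ball (dropCoord i w) ρ ⊆ ball 0 3 := by
      refine ball_subset_ball' ?_
      rw [dist_zero_right]
      linarith [norm_dropCoord_le i w]
    rw [← hv, ← setLIntegral_const]
    refine le_trans (setLIntegral_mono' measurableSet_ball fun k hk => ?_) (lintegral_mono_set hsub)
    have hk3 : ‖k‖ < 3 := by simpa using hsub hk
    have hmem : w - e k ∈ coordCylinder i (ball 0 (2 + T)) (ball 0 ρ) := by
      constructor
      · rw [mem_ball_zero_iff, Real.norm_eq_abs, PiLp.sub_apply]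
        have h1 : |w i| ≤ ‖w‖ := PiLp.norm_apply_le w i
        linarith [abs_sub (w i) (e k i), heT k hk3]
      · have h1 : dropCoord i (w - e k) = dropCoord i w - dropCoord i (e k) := rfl
        rw [h1, hed, mem_ball_zero_iff, ← dist_eq_norm, dist_comm]
        exact hk
    rw [hq, Set.indicator_of_mem hmem, hinv, ← edist_eq_enorm_sub, ← edist_eq_enorm_sub,
      ← edist_eq_enorm_sub]
    exact edist_triangle _ _ _
  have hsubm : Measurable fun z : EuclideanSpace ℝ (Fin (m + 1)) × (Fin m → ℝ) => z.1 - e z.2 :=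
    measurable_fst.sub (he.comp measurable_snd)
  have h1 : Measurable fun z : EuclideanSpace ℝ (Fin (m + 1)) × (Fin m → ℝ) =>
      ‖Φ z.1 - Φ (z.1 - e z.2)‖ₑ := ((hΦ.comp measurable_fst).sub (hΦ.comp hsubm)).enorm
  have h2 : Measurable fun z : EuclideanSpace ℝ (Fin (m + 1)) × (Fin m → ℝ) => q (z.1 - e z.2) :=
    hqm.comp hsubm
  have h1k : Measurable fun k => ∫⁻ w in ball 0 2, ‖Φ w - Φ (w - e k)‖ₑ := by
    have := h1.comp measurable_swap
    exact this.lintegral_prod_right'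
  have h1w : ∀ k, Measurable fun w => ‖Φ w - Φ (w - e k)‖ₑ := fun k =>
    h1.comp (measurable_id.prodMk measurable_const)
  have h12 : AEMeasurable (fun z : EuclideanSpace ℝ (Fin (m + 1)) × (Fin m → ℝ) =>
      ‖Φ z.1 - Φ (z.1 - e z.2)‖ₑ + q (z.1 - e z.2))
      ((volume.restrict (ball 0 2)).prod (volume.restrict (ball 0 3))) := (h1.add h2).aemeasurable
  have hInt : ∫⁻ w, q w = ∫⁻ w in coordCylinder i (ball 0 (2 + T)) (ball 0 ρ), ‖Φ w - p w‖ₑ := by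
    rw [hq, lintegral_indicator hZ]
  calc (∫⁻ w in ball 0 2, ‖Φ w - p w‖ₑ) * ENNReal.ofReal ((2 * ρ) ^ m)
      = ∫⁻ w in ball 0 2, ‖Φ w - p w‖ₑ * ENNReal.ofReal ((2 * ρ) ^ m) :=
        (lintegral_mul_const' _ _ ENNReal.ofReal_ne_top).symm
    _ ≤ ∫⁻ w in ball 0 2, ∫⁻ k in ball 0 3, (‖Φ w - Φ (w - e k)‖ₑ + q (w - e k)) :=
        setLIntegral_mono' measurableSet_ball hpt
    _ = ∫⁻ k in ball 0 3, ∫⁻ w in ball 0 2, (‖Φ w - Φ (w - e k)‖ₑ + q (w - e k)) :=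
        lintegral_lintegral_swap h12
    _ ≤ ∫⁻ k in ball 0 3, ((∫⁻ w in ball 0 2, ‖Φ w - Φ (w - e k)‖ₑ) + ∫⁻ w, q w) := by
        refine lintegral_mono fun k => ?_
        rw [lintegral_add_left (h1w k)]
        refine add_le_add le_rfl ((setLIntegral_le_lintegral _ _).trans (le_of_eq ?_))
        exact lintegral_sub_right_eq_self q (e k)
    _ = _ := by
        rw [lintegral_add_left h1k, setLIntegral_const, Real.volume_pi_ball _ (by norm_num),
          Fintype.card_fin, hInt, mul_comm (ENNReal.ofReal _)]
        norm_num

theorem volume_coordCylinder (i : Fin (m + 1)) {S : Set ℝ} {B : Set (Fin m → ℝ)} (hS : MeasurableSet S)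
    (hB : MeasurableSet B) : volume (coordCylinder i S B) = volume S * volume B := by
  have h := lintegral_coordCylinder i hS hB (g := fun _ => 1) measurable_const
  simpa only [setLIntegral_const, one_mul] using h

theorem inner_insertCoord (i : Fin (m + 1)) (s : ℝ) (k : Fin m → ℝ) (ν : EuclideanSpace ℝ (Fin (m + 1))) :
    ⟪insertCoord i (s, k), ν⟫ = s * ν i + ⟪insertCoord i (0, k), ν⟫ := by
  have h1 : insertCoord i (s, k) = s • EuclideanSpace.single i (1 : ℝ) + insertCoord i (0, k) := by
    ext j
    refine Fin.succAboveCases i ?_ (fun l => ?_) j <;> simp [insertCoord]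
  rw [h1, inner_add_left, real_inner_smul_left, EuclideanSpace.inner_single_left]
  simp

end

section

variable {m : ℕ}

/-- The point of the hyperplane orthogonal to `ν` lying over `k`. -/
def shear (i : Fin (m + 1)) (ν : EuclideanSpace ℝ (Fin (m + 1))) (k : Fin m → ℝ) :
    EuclideanSpace ℝ (Fin (m + 1)) :=
  insertCoord i (-(⟪insertCoord i (0, k), ν⟫ / ν i), k)

theorem measurable_shear (i : Fin (m + 1)) (ν : EuclideanSpace ℝ (Fin (m + 1))) : Measurable (shear i ν) := by
  have h0 : Measurable (insertCoord (m := m) i) := (measurePreserving_insertCoord i).measurable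
  have h1 : Measurable fun k : Fin m → ℝ => insertCoord i (0, k) :=
    h0.comp (measurable_const.prodMk measurable_id)
  have h2 : Measurable fun k : Fin m → ℝ => -(⟪insertCoord i (0, k), ν⟫ / ν i) :=
    ((h1.inner measurable_const).div_const _).neg
  exact h0.comp (h2.prodMk measurable_id)

theorem dropCoord_shear (i : Fin (m + 1)) (ν : EuclideanSpace ℝ (Fin (m + 1))) (k : Fin m → ℝ) :
    dropCoord i (shear i ν k) = k := dropCoord_insertCoord i _

theorem inner_eq_mul_sub_shear {i : Fin (m + 1)} {ν : EuclideanSpace ℝ (Fin (m + 1))} (hi : ν i ≠ 0)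
    (w : EuclideanSpace ℝ (Fin (m + 1))) : ⟪w, ν⟫ = ν i * (w i - shear i ν (dropCoord i w) i) := by
  conv_lhs => rw [← insertCoord_dropCoord i w, inner_insertCoord]
  rw [shear, insertCoord_apply_same]
  field_simp
  ring

theorem inner_shear {i : Fin (m + 1)} {ν : EuclideanSpace ℝ (Fin (m + 1))} (hi : ν i ≠ 0) (k : Fin m → ℝ) :
    ⟪shear i ν k, ν⟫ = 0 := by
  rw [inner_eq_mul_sub_shear hi, dropCoord_shear, sub_self, mul_zero]

theorem exists_norm_shear_le {i : Fin (m + 1)} {ν : EuclideanSpace ℝ (Fin (m + 1))} (hν : ‖ν‖ = 1)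
    (hi : 0 < ν i) : ∃ E : ℝ, 0 < E ∧ ∀ k, ‖shear i ν k‖ ≤ E * ‖k‖ := by
  obtain ⟨A, hA1, hA⟩ := exists_norm_insertCoord_le i
  refine ⟨A * (A / ν i + 1), by positivity, fun k => (hA _).trans ?_⟩
  rw [mul_assoc]
  refine mul_le_mul_of_nonneg_left ?_ (by linarith)
  rw [Prod.norm_def]
  have h1 : ‖insertCoord i (0, k)‖ ≤ A * ‖k‖ := by
    refine (hA _).trans (le_of_eq ?_)
    rw [Prod.norm_def]
    simp
  have h2 : |⟪insertCoord i (0, k), ν⟫| ≤ A * ‖k‖ := by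
    refine (abs_real_inner_le_norm _ _).trans ?_
    rwa [hν, mul_one]
  have h3 : 0 ≤ A / ν i * ‖k‖ := by positivity
  refine max_le ?_ (by nlinarith)
  rw [norm_neg, Real.norm_eq_abs, abs_div, abs_of_pos hi]
  have h4 : |⟪insertCoord i (0, k), ν⟫| / ν i ≤ A * ‖k‖ / ν i := by gcongr
  calc _ ≤ A * ‖k‖ / ν i := h4
    _ ≤ (A / ν i + 1) * ‖k‖ := by
      rw [add_mul, one_mul, mul_div_right_comm]
      linarith [norm_nonneg k]

theorem stepFun_eq_ite {i : Fin (m + 1)} {ν : EuclideanSpace ℝ (Fin (m + 1))} (hi : 0 < ν i) {E : ℝ} (hE : 0 < E)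
    (hEk : ∀ k, ‖shear i ν k‖ ≤ E * ‖k‖) (a b : ℝ) {ρ : ℝ} {w : EuclideanSpace ℝ (Fin (m + 1))}
    (hw : ‖dropCoord i w‖ < ρ) (hwi : E * ρ ≤ |w i|) :
    stepFun (m + 1) ν a b w = if 0 < w i then a else b := by
  have h1 : |shear i ν (dropCoord i w) i| < |w i| :=
    calc |shear i ν (dropCoord i w) i| ≤ ‖shear i ν (dropCoord i w)‖ := PiLp.norm_apply_le (shear i ν (dropCoord i w)) i
      _ ≤ E * ‖dropCoord i w‖ := hEk _
      _ < E * ρ := mul_lt_mul_of_pos_left hw hE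
      _ ≤ |w i| := hwi
  have h2 : 0 < ⟪w, ν⟫ ↔ 0 < w i := by
    rw [inner_eq_mul_sub_shear hi.ne', mul_pos_iff_of_pos_left hi]
    rcases abs_lt.1 h1 with ⟨h3, h4⟩
    constructor
    · intro h5
      by_contra h6
      rw [abs_of_nonpos (not_lt.1 h6)] at h3
      linarith
    · intro h5
      rw [abs_of_pos h5] at h4
      linarith
  simp only [stepFun, h2]

theorem stepFun_sub_shear {i : Fin (m + 1)} {ν : EuclideanSpace ℝ (Fin (m + 1))} (hi : ν i ≠ 0) (a b : ℝ)
    (k : Fin m → ℝ) (w : EuclideanSpace ℝ (Fin (m + 1))) :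
    stepFun (m + 1) ν a b (w - shear i ν k) = stepFun (m + 1) ν a b w := by
  simp only [stepFun, inner_sub_left, inner_shear hi, sub_zero]

theorem measurable_ite_coord (i : Fin (m + 1)) (s a b : ℝ) :
    Measurable fun w : EuclideanSpace ℝ (Fin (m + 1)) => if s < w i then a else b := by
  have h1 : Measurable fun z : EuclideanSpace ℝ (Fin (m + 1)) => z i :=
    (EuclideanSpace.proj (𝕜 := ℝ) i).continuous.measurable
  exact Measurable.ite (h1 measurableSet_Ioi) measurable_const measurable_const

theorem setLIntegral_sub_stepFun_le {i : Fin (m + 1)} {ν : EuclideanSpace ℝ (Fin (m + 1))} (hi : 0 < ν i)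
    {E : ℝ} (hE : 0 < E) (hEk : ∀ k, ‖shear i ν k‖ ≤ E * ‖k‖) (a b : ℝ) {Φ : EuclideanSpace ℝ (Fin (m + 1)) → ℝ}
    (hΦ : Measurable Φ) {L ρ : ℝ} (hρ : 0 < ρ) :
    ∫⁻ w in coordCylinder i (ball 0 L) (ball 0 ρ), ‖Φ w - stepFun (m + 1) ν a b w‖ₑ ≤
      (∫⁻ w in coordCylinder i (ball 0 L) (ball 0 ρ), ‖Φ w - (if 0 < w i then a else b)‖ₑ) +
        ‖a - b‖ₑ * ENNReal.ofReal (2 * E) * ENNReal.ofReal ρ * ENNReal.ofReal ((2 * ρ) ^ m) := by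
  have hst := measurable_ite_coord i 0 a b
  refine (lintegral_enorm_sub_le_add hΦ.aemeasurable hst.aemeasurable).trans (add_le_add le_rfl ?_)
  have hZ : MeasurableSet (coordCylinder i (ball 0 L) (ball 0 ρ)) :=
    measurableSet_coordCylinder i measurableSet_ball measurableSet_ball
  have hZ' : MeasurableSet (coordCylinder i (ball 0 (E * ρ)) (ball 0 ρ)) :=
    measurableSet_coordCylinder i measurableSet_ball measurableSet_ball
  calc ∫⁻ w in coordCylinder i (ball 0 L) (ball 0 ρ), ‖(if 0 < w i then a else b) - stepFun (m + 1) ν a b w‖ₑ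
      ≤ ∫⁻ w in coordCylinder i (ball 0 L) (ball 0 ρ),
          (coordCylinder i (ball 0 (E * ρ)) (ball 0 ρ)).indicator (fun _ => ‖a - b‖ₑ) w := by
        refine setLIntegral_mono' hZ fun w hw => ?_
        by_cases hwi : |w i| < E * ρ
        · have hmem : w ∈ coordCylinder i (ball 0 (E * ρ)) (ball 0 ρ) := ⟨by simpa using hwi, hw.2⟩
          rw [Set.indicator_of_mem hmem, stepFun]
          split_ifs
          · simp
          · rfl
          · rw [enorm_sub_rev]
          · simp
        · rw [stepFun_eq_ite hi hE hEk a b (by simpa using hw.2) (not_lt.1 hwi), sub_self, enorm_zero]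
          exact bot_le
    _ ≤ ∫⁻ w, (coordCylinder i (ball 0 (E * ρ)) (ball 0 ρ)).indicator (fun _ => ‖a - b‖ₑ) w :=
        setLIntegral_le_lintegral _ _
    _ = _ := by
        rw [lintegral_indicator hZ', setLIntegral_const,
          volume_coordCylinder i measurableSet_ball measurableSet_ball, Real.volume_pi_ball _ hρ,
          Real.volume_ball, Fintype.card_fin, ← mul_assoc (2 : ℝ), ENNReal.ofReal_mul (by positivity)]
        ring

theorem ofReal_inv_pow_succ_mul {r : ℝ} (hr : 0 < r) :
    ENNReal.ofReal (r ^ (m + 1))⁻¹ * (ENNReal.ofReal r * ENNReal.ofReal (r ^ m)) = 1 := by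
  rw [← ENNReal.ofReal_mul hr.le, ← ENNReal.ofReal_mul (by positivity)]
  rw [← pow_succ', inv_mul_cancel₀ (by positivity), ENNReal.ofReal_one]

theorem setLIntegral_coordCylinder_rescale {r : ℝ} (hr : 0 < r) (i : Fin (m + 1))
    (x : EuclideanSpace ℝ (Fin (m + 1))) (L ρ : ℝ) (g : EuclideanSpace ℝ (Fin (m + 1)) → ℝ≥0∞) :
    ∫⁻ w in coordCylinder i (ball 0 L) (ball 0 ρ), g (x + r • w) = ENNReal.ofReal (r ^ (m + 1))⁻¹ *
      ∫⁻ z in coordCylinder i (ball (x i) (r * L)) (ball (dropCoord i x) (r * ρ)), g z := by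
  rw [← lintegral_indicator (measurableSet_coordCylinder i measurableSet_ball measurableSet_ball),
    ← lintegral_indicator (measurableSet_coordCylinder i measurableSet_ball measurableSet_ball),
    ← lintegral_rescale hr x]
  congr 1
  ext w
  have h1 : w ∈ coordCylinder i (ball 0 L) (ball 0 ρ) ↔
      x + r • w ∈ coordCylinder i (ball (x i) (r * L)) (ball (dropCoord i x) (r * ρ)) := by
    have e1 : (x + r • w) i = x i + r * w i := rfl
    simp only [coordCylinder, Set.mem_ofPred_eq, dropCoord_add, dropCoord_smul, e1, mem_ball, dist_eq_norm,
      add_sub_cancel_left, norm_smul, norm_mul, Real.norm_of_nonneg hr.le, sub_zero,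
      mul_lt_mul_iff_right₀ hr]
  by_cases hw : w ∈ coordCylinder i (ball 0 L) (ball 0 ρ)
  · rw [Set.indicator_of_mem hw, Set.indicator_of_mem (h1.1 hw)]
  · rw [Set.indicator_of_notMem hw, Set.indicator_of_notMem (fun h2 => hw (h1.2 h2))]

end

section

variable {m : ℕ}

/-- Near a point of approximate continuity of the polar density, a function of bounded variation is
almost invariant under translations orthogonal to the density. -/
theorem setLIntegral_rescale_translate_le {f F : EuclideanSpace ℝ (Fin (m + 1)) → ℝ}
    {Ω : Set (EuclideanSpace ℝ (Fin (m + 1)))} {μ : Measure (EuclideanSpace ℝ (Fin (m + 1)))}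
    {σ : EuclideanSpace ℝ (Fin (m + 1)) → EuclideanSpace ℝ (Fin (m + 1))}
    (h : IsVariationPair (m + 1) f Ω μ σ) (hF : LocallyIntegrable F)
    {x : EuclideanSpace ℝ (Fin (m + 1))} {ρ₀ : ℝ} (hK : closedBall x ρ₀ ⊆ Ω)
    (hFf : ∀ᵐ y, y ∈ closedBall x ρ₀ → F y = f y) {τ : EuclideanSpace ℝ (Fin (m + 1))} {T : ℝ} (hT : ‖τ‖ ≤ T)
    (hτ : ⟪τ, σ x⟫ = 0) {r : ℝ} (hr : 0 < r) (hrT : r * (3 + T) ≤ ρ₀) {ε : ℝ≥0∞}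
    (hε : ∫⁻ y in closedBall x (r * (3 + T)), ‖σ y - σ x‖ₑ ∂μ ≤
      ε * ENNReal.ofReal ((r * (3 + T)) ^ m)) :
    ∫⁻ w in ball 0 2, ‖F (x + r • w) - F (x + r • (w - τ))‖ₑ ≤
      ENNReal.ofReal (T * (3 + T) ^ m) * ε := by
  have hT0 : 0 ≤ T := (norm_nonneg τ).trans hT
  have hV : ∀ z ∈ ball x (r * 2), ∀ t ∈ Set.Ioc (0 : ℝ) 1,
      closedBall (z + t • (-(r • τ))) r ⊆ closedBall x (r * (3 + T)) := by
    intro z hz t ht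
    refine closedBall_subset_closedBall' ?_
    rw [mem_ball, dist_eq_norm] at hz
    have e1 : z + t • (-(r • τ)) - x = (z - x) - t • (r • τ) := by
      rw [smul_neg]
      abel
    rw [dist_eq_norm, e1]
    have e2 : ‖t • (r • τ)‖ ≤ r * T := by
      rw [norm_smul, norm_smul, Real.norm_of_nonneg ht.1.le, Real.norm_of_nonneg hr.le]
      have e3 : r * ‖τ‖ ≤ r * T := by gcongr
      have e4 : 0 ≤ r * ‖τ‖ := by positivity
      nlinarith [ht.1, ht.2]
    linarith [norm_sub_le (z - x) (t • (r • τ))]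
  have e5 : ∀ w, x + r • (w - τ) = x + r • w + -(r • τ) := fun w => by
    rw [smul_sub]
    abel
  simp only [e5, enorm_sub_rev (F (x + r • _)) (F (_ + _))]
  rw [setLIntegral_rescale hr x 2 fun z => ‖F (z + -(r • τ)) - F z‖ₑ]
  have e6 : ∫⁻ z in ball x (r * 2), ‖F (z + -(r • τ)) - F z‖ₑ ≤
      ENNReal.ofReal (r * T) * (ε * ENNReal.ofReal ((r * (3 + T)) ^ m)) :=
    calc ∫⁻ z in ball x (r * 2), ‖F (z + -(r • τ)) - F z‖ₑ
        ≤ ∫⁻ y in closedBall x (r * (3 + T)), ‖⟪-(r • τ), σ y⟫‖ₑ ∂μ :=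
          lintegral_translate_sub_le h hF hK hFf measurableSet_ball _ hr hV
            (closedBall_subset_closedBall hrT)
      _ ≤ ∫⁻ y in closedBall x (r * (3 + T)), ENNReal.ofReal (r * T) * ‖σ y - σ x‖ₑ ∂μ := by
          refine lintegral_mono fun y => ?_
          have e7 : ⟪-(r • τ), σ y⟫ = ⟪-(r • τ), σ y - σ x⟫ := by
            rw [inner_sub_right, inner_neg_left _ (σ x), real_inner_smul_left, hτ, mul_zero, neg_zero, sub_zero]
          rw [e7, ← ofReal_norm, ← ofReal_norm, ← ENNReal.ofReal_mul (by positivity)]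
          refine ENNReal.ofReal_le_ofReal ((norm_inner_le_norm _ _).trans ?_)
          rw [norm_neg, norm_smul, Real.norm_of_nonneg hr.le]
          gcongr
      _ = ENNReal.ofReal (r * T) * ∫⁻ y in closedBall x (r * (3 + T)), ‖σ y - σ x‖ₑ ∂μ :=
          lintegral_const_mul' _ _ ENNReal.ofReal_ne_top
      _ ≤ _ := by gcongr
  calc _ ≤ ENNReal.ofReal (r ^ (m + 1))⁻¹ *
        (ENNReal.ofReal (r * T) * (ε * ENNReal.ofReal ((r * (3 + T)) ^ m))) := by gcongr
    _ = (ENNReal.ofReal (r ^ (m + 1))⁻¹ * (ENNReal.ofReal r * ENNReal.ofReal (r ^ m))) *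
        (ENNReal.ofReal (T * (3 + T) ^ m) * ε) := by
      rw [ENNReal.ofReal_mul hr.le, ENNReal.ofReal_mul hT0, mul_pow, ENNReal.ofReal_mul (by positivity)]
      ring
    _ = _ := by rw [ofReal_inv_pow_succ_mul hr, one_mul]

theorem hasBlowUp_stepFun {f F : EuclideanSpace ℝ (Fin (m + 1)) → ℝ}
    {Ω : Set (EuclideanSpace ℝ (Fin (m + 1)))} {μ : Measure (EuclideanSpace ℝ (Fin (m + 1)))}
    {σ : EuclideanSpace ℝ (Fin (m + 1)) → EuclideanSpace ℝ (Fin (m + 1))}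
    (h : IsVariationPair (m + 1) f Ω μ σ) (hFm : Measurable F) (hF : LocallyIntegrable F)
    {x : EuclideanSpace ℝ (Fin (m + 1))} {ρ₀ : ℝ} (hρ₀ : 0 < ρ₀) (hK : closedBall x ρ₀ ⊆ Ω)
    (hFf : ∀ᵐ y, y ∈ closedBall x ρ₀ → F y = f y) {i : Fin (m + 1)} {ν : EuclideanSpace ℝ (Fin (m + 1))}
    (hν : ‖ν‖ = 1) (hi : 0 < ν i) (hνσ : ∀ τ, ⟪τ, ν⟫ = 0 → ⟪τ, σ x⟫ = 0)
    (hσ : ∀ ε : ℝ≥0∞, ε ≠ 0 → ∃ δ > 0, ∀ r : ℝ, 0 < r → r < δ →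
      ∫⁻ y in closedBall x r, ‖σ y - σ x‖ₑ ∂μ ≤ ε * ENNReal.ofReal (r ^ m))
    {a b : ℝ} {C : ℝ≥0∞} (hC : C ≠ ⊤)
    (hcyl : ∀ ε : ℝ≥0∞, ε ≠ 0 → ∃ δ > 0, ∀ r R : ℝ, 0 < r → r < δ → 0 < R → R < δ →
      ∫⁻ z in coordCylinder i (ball (x i) r) (ball (dropCoord i x) R), ‖F z - (if x i < z i then a else b)‖ₑ ≤
        (C * ENNReal.ofReal R + ε * ENNReal.ofReal r) * ENNReal.ofReal ((2 * R) ^ m)) :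
    HasBlowUp (m + 1) F x (stepFun (m + 1) ν a b) := by
  obtain ⟨E, hE, hEk⟩ := exists_norm_shear_le hν hi
  obtain ⟨T, hT⟩ : ∃ T, T = 3 * E := ⟨_, rfl⟩
  have hT0 : 0 < T := by rw [hT]; positivity
  have hTk : ∀ k, ‖k‖ < 3 → ‖shear i ν k‖ ≤ T := fun k hk => (hEk k).trans (by nlinarith)
  refine ENNReal.tendsto_nhds_zero.2 fun η hη => ?_
  have hη3 : η / 3 ≠ 0 := (ENNReal.div_pos hη.ne' (by simp)).ne'
  -- the width of the cylinder
  obtain ⟨P, hP⟩ : ∃ P, P = ENNReal.ofReal (6 ^ m) * (C + ‖a - b‖ₑ * ENNReal.ofReal (2 * E)) := ⟨_, rfl⟩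
  have hPtop : P ≠ ⊤ := by
    rw [hP]
    exact ENNReal.mul_ne_top ENNReal.ofReal_ne_top
      (ENNReal.add_ne_top.2 ⟨hC, ENNReal.mul_ne_top enorm_ne_top ENNReal.ofReal_ne_top⟩)
  obtain ⟨ρ, hρ, hρ1, hρP⟩ : ∃ ρ : ℝ, 0 < ρ ∧ ρ ≤ 1 ∧ ENNReal.ofReal ρ * P ≤ η / 3 := by
    obtain ⟨q, hq, hqP⟩ := ENNReal.exists_nnreal_pos_mul_lt hPtop hη3
    refine ⟨min q 1, lt_min (by exact_mod_cast hq) one_pos, min_le_right _ _, le_trans ?_ hqP.le⟩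
    gcongr
    rw [← ENNReal.ofReal_coe_nnreal]
    exact ENNReal.ofReal_le_ofReal (min_le_left _ _)
  obtain ⟨v, hv⟩ : ∃ v, v = ENNReal.ofReal ((2 * ρ) ^ m) := ⟨_, rfl⟩
  have hv0 : v ≠ 0 := by
    rw [hv]
    simp [hρ]
  have hvtop : v ≠ ⊤ := by rw [hv]; exact ENNReal.ofReal_ne_top
  -- the two errors
  obtain ⟨ε₁, hε₁, hε₁'⟩ := ENNReal.exists_nnreal_pos_mul_lt
    (a := ENNReal.ofReal (6 ^ m) * ENNReal.ofReal (T * (3 + T) ^ m))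
    (ENNReal.mul_ne_top ENNReal.ofReal_ne_top ENNReal.ofReal_ne_top) (mul_ne_zero hη3 hv0)
  obtain ⟨ε₂, hε₂, hε₂'⟩ := ENNReal.exists_nnreal_pos_mul_lt
    (a := ENNReal.ofReal (6 ^ m) * ENNReal.ofReal (2 + T))
    (ENNReal.mul_ne_top ENNReal.ofReal_ne_top ENNReal.ofReal_ne_top) hη3
  obtain ⟨δ₁, hδ₁, h1⟩ := hσ ε₁ (by exact_mod_cast hε₁.ne')
  obtain ⟨δ₂, hδ₂, h2⟩ := hcyl ε₂ (by exact_mod_cast hε₂.ne')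
  have hev : ∀ c : ℝ, 0 < c → ∀ d : ℝ, 0 < d → ∀ᶠ r : ℝ in 𝓝[>] 0, r * c < d := by
    intro c hc d hd
    have e1 : ∀ᶠ r : ℝ in 𝓝[>] 0, r < d / c := nhdsWithin_le_nhds (gt_mem_nhds (by positivity))
    filter_upwards [e1] with r hr using (lt_div_iff₀ hc).1 hr
  filter_upwards [self_mem_nhdsWithin, hev (3 + T) (by positivity) δ₁ hδ₁, hev (3 + T) (by positivity) ρ₀ hρ₀,
    hev (2 + T) (by positivity) δ₂ hδ₂, hev ρ hρ δ₂ hδ₂] with r (hr : 0 < r) hr1 hr2 hr3 hr4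
  have hΦ : Measurable fun w => F (x + r • w) := hFm.comp (measurableEmbedding_rescale hr x).measurable
  have hp := measurable_stepFun ν a b
  have key := lintegral_sub_mul_le_of_shear hΦ hp (measurable_shear i ν) (dropCoord_shear i ν)
    (fun k hk => (PiLp.norm_apply_le (shear i ν k) i).trans (hTk k hk)) (stepFun_sub_shear hi.ne' a b) hρ hρ1
  have i1 : ∫⁻ k in ball 0 3, ∫⁻ w in ball 0 2, ‖F (x + r • w) - F (x + r • (w - shear i ν k))‖ₑ ≤
      η / 3 * v := by
    calc _ ≤ ∫⁻ _ in ball (0 : Fin m → ℝ) 3, ENNReal.ofReal (T * (3 + T) ^ m) * ε₁ := by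
          refine setLIntegral_mono' measurableSet_ball fun k hk => ?_
          have hk3 : ‖k‖ < 3 := by simpa using hk
          exact setLIntegral_rescale_translate_le h hF hK hFf (hTk k hk3) (hνσ _ (inner_shear hi.ne' k)) hr
            hr2.le (h1 _ (by positivity) hr1)
      _ = ε₁ * (ENNReal.ofReal (6 ^ m) * ENNReal.ofReal (T * (3 + T) ^ m)) := by
          rw [setLIntegral_const, Real.volume_pi_ball _ (by norm_num), Fintype.card_fin]
          norm_num
          ring
      _ ≤ η / 3 * v := hε₁'.le
  have i2 : ∫⁻ w in coordCylinder i (ball 0 (2 + T)) (ball 0 ρ),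
      ‖F (x + r • w) - (if 0 < w i then a else b)‖ₑ ≤
      (C * ENNReal.ofReal ρ + ε₂ * ENNReal.ofReal (2 + T)) * v := by
    have e1 : ∀ w : EuclideanSpace ℝ (Fin (m + 1)), (0 < w i) = (x i < (x + r • w) i) := fun w => by
      have e2 : (x + r • w) i = x i + r * w i := rfl
      rw [e2, eq_iff_iff]
      constructor
      · intro h3
        nlinarith
      · intro h3
        by_contra h4
        nlinarith
    simp only [e1]
    rw [setLIntegral_coordCylinder_rescale hr i x (2 + T) ρ
      fun z => ‖F z - (if x i < z i then a else b)‖ₑ]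
    calc _ ≤ ENNReal.ofReal (r ^ (m + 1))⁻¹ * ((C * ENNReal.ofReal (r * ρ) +
          ε₂ * ENNReal.ofReal (r * (2 + T))) * ENNReal.ofReal ((2 * (r * ρ)) ^ m)) := by
          gcongr
          exact h2 _ _ (by positivity) hr3 (by positivity) hr4
      _ = (ENNReal.ofReal (r ^ (m + 1))⁻¹ * (ENNReal.ofReal r * ENNReal.ofReal (r ^ m))) *
          ((C * ENNReal.ofReal ρ + ε₂ * ENNReal.ofReal (2 + T)) * v) := by
          rw [hv, mul_left_comm (2 : ℝ) r ρ, mul_pow r, ENNReal.ofReal_mul hr.le, ENNReal.ofReal_mul hr.le,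
            ENNReal.ofReal_mul (by positivity)]
          ring
      _ = _ := by rw [ofReal_inv_pow_succ_mul hr, one_mul]
  have i3 := setLIntegral_sub_stepFun_le hi hE hEk a b hΦ (L := 2 + T) hρ
  rw [← hv] at key i3
  refine (ENNReal.mul_le_mul_iff_left hv0 hvtop).1 ?_
  calc (∫⁻ y in ball 0 2, ‖F (x + r • y) - stepFun (m + 1) ν a b y‖ₑ) * v
      ≤ η / 3 * v + ENNReal.ofReal (6 ^ m) * ((C * ENNReal.ofReal ρ + ε₂ * ENNReal.ofReal (2 + T)) * v +
          ‖a - b‖ₑ * ENNReal.ofReal (2 * E) * ENNReal.ofReal ρ * v) :=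
        key.trans (add_le_add i1 (mul_le_mul_right (i3.trans (add_le_add i2 le_rfl)) _))
    _ = (η / 3 + (ENNReal.ofReal ρ * P + ε₂ * (ENNReal.ofReal (6 ^ m) * ENNReal.ofReal (2 + T)))) * v := by
        rw [hP]
        ring
    _ ≤ (η / 3 + (η / 3 + η / 3)) * v := by gcongr
    _ = η * v := by rw [← add_assoc, ENNReal.add_thirds]

end

section

variable {m : ℕ}

/-- The polar density oscillates little around points where the measure has finite codimension one
density. -/
theorem exists_setLIntegral_closedBall_le {E F : Type*} [PseudoMetricSpace E] [MeasurableSpace E]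
    [NormedAddCommGroup F] {μ : Measure E} [IsFiniteMeasure μ] {σ : E → F} {x : E}
    (hx : Tendsto (fun r : ℝ => (∫⁻ y in closedBall x r, ‖σ y - σ x‖ₑ ∂μ) / μ (closedBall x r))
      (𝓝[>] 0) (𝓝 0))
    {M : ℝ≥0∞} (hM : M ≠ ⊤) {R₀ : ℝ} (hR₀ : 0 < R₀)
    (hμ : ∀ r : ℝ, 0 < r → r < R₀ → μ (closedBall x r) ≤ M * ENNReal.ofReal ((2 * r) ^ m))
    {ε : ℝ≥0∞} (hε : ε ≠ 0) :
    ∃ δ > 0, ∀ r : ℝ, 0 < r → r < δ →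
      ∫⁻ y in closedBall x r, ‖σ y - σ x‖ₑ ∂μ ≤ ε * ENNReal.ofReal (r ^ m) := by
  obtain ⟨q, hq, hqM⟩ := ENNReal.exists_nnreal_pos_mul_lt
    (ENNReal.mul_ne_top hM (ENNReal.ofReal_ne_top (r := 2 ^ m))) hε
  have h1 := ENNReal.tendsto_nhds_zero.1 hx q (by exact_mod_cast hq)
  obtain ⟨δ, hδ, hδ'⟩ := mem_nhdsGT_iff_exists_Ioo_subset.1 h1
  refine ⟨min δ R₀, lt_min hδ hR₀, fun r hr hrδ => ?_⟩
  have h2 : (∫⁻ y in closedBall x r, ‖σ y - σ x‖ₑ ∂μ) / μ (closedBall x r) ≤ q :=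
    hδ' ⟨hr, hrδ.trans_le (min_le_left _ _)⟩
  have h3 : ∫⁻ y in closedBall x r, ‖σ y - σ x‖ₑ ∂μ ≤ q * μ (closedBall x r) := by
    obtain h0 | h0 := eq_or_ne (μ (closedBall x r)) 0
    · rw [setLIntegral_measure_zero _ _ h0]; exact zero_le
    · exact (ENNReal.div_le_iff h0 (measure_ne_top _ _)).1 h2
  calc ∫⁻ y in closedBall x r, ‖σ y - σ x‖ₑ ∂μ ≤ q * (M * ENNReal.ofReal ((2 * r) ^ m)) :=
        h3.trans (by gcongr; exact hμ r hr (hrδ.trans_le (min_le_right _ _)))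
    _ = (q * (M * ENNReal.ofReal (2 ^ m))) * ENNReal.ofReal (r ^ m) := by
        rw [mul_pow, ENNReal.ofReal_mul (by positivity)]; ring
    _ ≤ ε * ENNReal.ofReal (r ^ m) := by gcongr

/-- Almost every point with respect to the variation measure has a blow-up which is a step
function. -/
theorem ae_exists_hasBlowUp_stepFun {n : ℕ} (hn : 1 ≤ n) {Ω : Set (EuclideanSpace ℝ (Fin n))}
    (hΩ : IsOpen Ω) {f : EuclideanSpace ℝ (Fin n) → ℝ} (hf : LocallyIntegrableOn f Ω)
    {μ : Measure (EuclideanSpace ℝ (Fin n))} {σ : EuclideanSpace ℝ (Fin n) → EuclideanSpace ℝ (Fin n)}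
    (h : IsVariationPair n f Ω μ σ) :
    ∀ᵐ x ∂μ, ∃ ν : EuclideanSpace ℝ (Fin n), ‖ν‖ = 1 ∧ ∃ a b : ℝ, HasBlowUp n f x (stepFun n ν a b) := by
  obtain ⟨m, rfl⟩ : ∃ m, n = m + 1 := ⟨n - 1, by omega⟩
  have hfin : IsFiniteMeasure μ := h.1
  have hσint : Integrable σ μ :=
    Integrable.of_bound h.2.2.1 1 (h.2.2.2.1.mono fun x hx => hx.le)
  have hΩae : ∀ᵐ x ∂μ, x ∈ Ω := h.2.1
  have hbad : ∀ i : Fin (m + 1), ∀ᵐ x ∂μ, σ x i ≠ 0 → ∃ M : ℝ≥0∞, M ≠ ⊤ ∧ ∃ R₀ > 0, ∀ R : ℝ, 0 < R → R < R₀ →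
      μ.map (dropCoord i) (closedBall (dropCoord i x) R) ≤ M * ENNReal.ofReal ((2 * R) ^ m) := by
    intro i
    filter_upwards [ae_apply_eq_zero_of_measure_eq_zero hΩ hf h i
      (ae_iff.1 (ae_exists_measure_closedBall_le (μ.map (dropCoord i))))] with x hx hne
    by_contra hcon
    exact hne (hx hcon)
  filter_upwards [hΩae, h.2.2.2.1, ae_all_iff.2 hbad,
    (Besicovitch.vitaliFamily μ).ae_tendsto_lintegral_enorm_sub_div_of_integrable hσint]
    with x hxΩ hσx hgood hleb
  obtain ⟨i, hi⟩ : ∃ i, σ x i ≠ 0 := by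
    by_contra! hcon
    have : σ x = 0 := by ext i; simpa using hcon i
    rw [this] at hσx
    simp at hσx
  obtain ⟨M, hM, R₀, hR₀, hκ⟩ := hgood i hi
  have hmeas : Measurable (dropCoord (m := m) i) :=
    (contDiff_dropCoord i (k := 0)).continuous.measurable
  have hκ' : ∀ R, 0 < R → R < R₀ →
      μ (dropCoord i ⁻¹' closedBall (dropCoord i x) R) ≤ M * ENNReal.ofReal ((2 * R) ^ m) := by
    intro R hR hRR
    rw [← Measure.map_apply hmeas measurableSet_closedBall]
    exact hκ R hR hRR
  have hball : ∀ r : ℝ, 0 < r → r < R₀ → μ (closedBall x r) ≤ M * ENNReal.ofReal ((2 * r) ^ m) := by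
    intro r hr hrR
    refine (measure_mono fun y hy => ?_).trans (hκ' r hr hrR)
    rw [Set.mem_preimage, mem_closedBall, dist_eq_norm]
    rw [mem_closedBall, dist_eq_norm] at hy
    exact (norm_dropCoord_le i (y - x)).trans hy
  obtain ⟨ν, hν, hνi, hνσ⟩ : ∃ ν : EuclideanSpace ℝ (Fin (m + 1)), ‖ν‖ = 1 ∧ 0 < ν i ∧
      ∀ τ, ⟪τ, ν⟫ = 0 → ⟪τ, σ x⟫ = 0 := by
    obtain hneg | hpos := lt_or_gt_of_ne hi
    · exact ⟨-σ x, by rwa [norm_neg], by simpa using hneg, fun τ hτ => by simpa using hτ⟩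
    · exact ⟨σ x, hσx, hpos, fun τ hτ => hτ⟩
  obtain ⟨ρ₀, hρ₀, hK⟩ := nhds_basis_closedBall.mem_iff.1 (hΩ.mem_nhds hxΩ)
  have hfK : IntegrableOn f (closedBall x ρ₀) :=
    hf.integrableOn_compact_subset hK (isCompact_closedBall x ρ₀)
  obtain ⟨F, hF⟩ : ∃ F, F = (closedBall x ρ₀).indicator (hfK.1.mk f) := ⟨_, rfl⟩
  have hFm : Measurable F := by
    rw [hF]
    exact hfK.1.stronglyMeasurable_mk.measurable.indicator measurableSet_closedBall
  have hFi : Integrable F := by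
    rw [hF, integrable_indicator_iff measurableSet_closedBall]
    exact hfK.congr hfK.1.ae_eq_mk
  have hFf : ∀ᵐ y, y ∈ closedBall x ρ₀ → F y = f y := by
    filter_upwards [(ae_restrict_iff' measurableSet_closedBall).1 hfK.1.ae_eq_mk] with y hy hyK
    rw [hF, Set.indicator_of_mem hyK, hy hyK]
  obtain ⟨a, b, C, hC, hcyl⟩ := exists_step_approx_cylinder h hFm hFi i hρ₀ hK hFf hM hR₀ hκ'
  refine ⟨ν, hν, a, b, HasBlowUp.congr_ae (hasBlowUp_stepFun h hFm hFi.locallyIntegrable hρ₀ hK hFf hν hνi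
    hνσ (fun ε hε => exists_setLIntegral_closedBall_le ?_ hM hR₀ hball hε) hC hcyl) hρ₀ ?_⟩
  · exact hleb.comp (Besicovitch.tendsto_filterAt μ x)
  · filter_upwards [hFf] with y hy hyb
    exact (hy (ball_subset_closedBall hyb)).symm

end

/-- Upper bound for the `Γ_∞`-limit: there is a recovery
family `f_ε` with `f_ε − f → 0` in `L^∞_loc(Ω)` and
`limsup_{ε→0} κ_ε(f_ε, Ω) ≤ (1/4)|D^a f|(Ω) + (1/4)|D^c f|(Ω) + (1/2)|D^j f|(Ω)`. -/
theorem gammaInfty_upper_bound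
    (n : ℕ) (hn : 1 ≤ n)
    (Ω : Set (EuclideanSpace ℝ (Fin n))) (hΩ : IsOpen Ω)
    (f : EuclideanSpace ℝ (Fin n) → ℝ) (hf : LocallyIntegrableOn f Ω volume) :
    ∃ F : ℝ → EuclideanSpace ℝ (Fin n) → ℝ,
      (∀ ε, 0 < ε → LocallyIntegrableOn (F ε) Ω volume) ∧
      (∀ ε, 0 < ε → ∀ K, IsCompact K → K ⊆ Ω →
        eLpNorm (fun x => F ε x - f x) ⊤ (volume.restrict K) < ⊤) ∧
      (∀ K, IsCompact K → K ⊆ Ω →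
        Tendsto (fun ε => eLpNorm (fun x => F ε x - f x) ⊤ (volume.restrict K))
          (𝓝[>] (0:ℝ)) (𝓝 0)) ∧
      limsup (fun ε => kappa n ε (F ε) Ω) (𝓝[>] (0:ℝ)) ≤
        absVar n f Ω / 4 + cantorVar n f Ω / 4 + jumpVar n f Ω / 2 := by
  refine exists_family_of_forall_approx hf fun δ₀ hδ₀ η hη => ?_
  by_cases h : ∃ p : Measure (EuclideanSpace ℝ (Fin n)) ×
      (EuclideanSpace ℝ (Fin n) → EuclideanSpace ℝ (Fin n)), IsVariationPair n f Ω p.1 p.2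
  · have hpair := h.choose_spec
    have := hpair.1
    have hS := ae_exists_hasBlowUp_stepFun hn hΩ hf hpair
    obtain ⟨g, hg, hgf, hlim⟩ := exists_recovery hn hΩ hf hpair hS hδ₀ hη
    refine ⟨g, hg, hgf, hlim.trans ?_⟩
    rw [absVar, cantorVar, jumpVar, dif_pos h, dif_pos h, dif_pos h]
    gcongr ?_ + η
    exact measure_hasBlowUp_const_le hΩ hf hpair.2.1 hS
  · refine ⟨f, hf.aestronglyMeasurable, fun x => by simpa using hδ₀.le, le_top.trans ?_⟩
    rw [absVar, dif_neg h, ENNReal.top_div_of_ne_top (by simp), top_add, top_add, top_add]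

end
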